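/- Let f, g : (ℝⁿ,0) → (ℝᵐ,0) be Nash map germs. If f and g are formally R-L equivalent, then f and g are Nash R-L equivalent. -/

import Mathlib

open scoped Topology

/-- A Nash map germ `f : (ℝⁿ,0) → (ℝᵐ,0)`: real analytic at `0`, `f 0 = 0`, and each
component satisfies a nontrivial polynomial equation near `0`. -/
def NashGerm {n m : ℕ} (f : (Fin n → ℝ) → (Fin m → ℝ)) : Prop :=
  AnalyticAt ℝ f 0 ∧ f 0 = 0 ∧
    ∀ j : Fin m, ∃ P : MvPolynomial (Fin (n + 1)) ℝ, P ≠ 0 ∧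
      ∀ᶠ x : Fin n → ℝ in 𝓝 0, MvPolynomial.eval (Fin.snoc x (f x j)) P = 0

/-- A Nash diffeomorphism germ of `(ℝⁿ,0)`: a Nash map germ whose derivative at `0` is a
linear isomorphism. -/
def NashDiffeoGerm {n : ℕ} (τ : (Fin n → ℝ) → (Fin n → ℝ)) : Prop :=
  NashGerm τ ∧ ∃ D : (Fin n → ℝ) ≃L[ℝ] (Fin n → ℝ),
    HasFDerivAt τ (D : (Fin n → ℝ) →L[ℝ] (Fin n → ℝ)) 0

section

open MvPolynomial

/-- Infinitesimal lifting property of the `R`-algebra `A` on the locus where `a` is invertible,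
relative to test algebras killed by `𝔞`. -/
def LiftsMod (R : Type) [CommRing R] (𝔞 : Ideal R) (A : Type) [CommRing A] [Algebra R A]
    (a : A) : Prop :=
  ∀ (T : Type) [CommRing T] [Algebra R T] (J : Ideal T), 𝔞 ≤ RingHom.ker (algebraMap R T) →
    J ^ 2 = ⊥ → ∀ f : A →ₐ[R] T ⧸ J, IsUnit (f a) →
      ∃ g : A →ₐ[R] T, (Ideal.Quotient.mkₐ R J).comp g = f

/-- Infinitesimal lifting property of the `R`-algebra `A` where `a` is invertible. -/
def LiftsAt (R : Type) [CommRing R] (A : Type) [CommRing A] [Algebra R A] (a : A) : Prop :=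
  LiftsMod R ⊥ A a

section Lifts

variable {R : Type} [CommRing R]

theorem isUnit_of_isUnit_mk {T : Type} [CommRing T] {J : Ideal T} (hJ : J ^ 2 = ⊥) {t : T}
    (h : IsUnit (Ideal.Quotient.mk J t)) : IsUnit t := by
  obtain ⟨u, hu⟩ := h.exists_right_inv
  obtain ⟨u, rfl⟩ := Ideal.Quotient.mk_surjective u
  rw [← map_mul, ← map_one (Ideal.Quotient.mk J), Ideal.Quotient.eq] at hu
  have h2 : (t * u - 1) ^ 2 = 0 := by
    have := Ideal.pow_mem_pow hu 2
    rwa [hJ] at this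
  exact IsUnit.of_mul_eq_one (u * (2 - t * u)) (by linear_combination -h2)

theorem mul_eq_zero_of_mem_of_sq {T : Type} [CommRing T] {J : Ideal T} (hJ : J ^ 2 = ⊥) {a b : T}
    (ha : a ∈ J) (hb : b ∈ J) : a * b = 0 := by
  have : a * b ∈ J ^ 2 := by rw [pow_two]; exact Ideal.mul_mem_mul ha hb
  rwa [hJ] at this

theorem LiftsMod.mul_right {𝔞 : Ideal R} {A : Type} [CommRing A] [Algebra R A] {a : A}
    (h : LiftsMod R 𝔞 A a) (b : A) : LiftsMod R 𝔞 A (a * b) := by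
  intro T _ _ J h𝔞 hJ f hf
  rw [map_mul] at hf
  exact h T J h𝔞 hJ f (isUnit_of_mul_isUnit_left hf)

theorem LiftsMod.comp {𝔞 : Ideal R} {A B : Type} [CommRing A] [Algebra R A] [CommRing B]
    [Algebra R B] [Algebra A B] [IsScalarTower R A B] {a : A} {b : B}
    (ha : LiftsMod R 𝔞 A a) (hb : LiftsAt A B b) : LiftsMod R 𝔞 B (algebraMap A B a * b) := by
  intro T _ _ J h𝔞 hJ f hf
  rw [map_mul] at hf
  obtain ⟨g, hg⟩ := ha T J h𝔞 hJ (f.comp (IsScalarTower.toAlgHom R A B))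
    (isUnit_of_mul_isUnit_left hf)
  let _ : Algebra A T := g.toRingHom.toAlgebra
  have : IsScalarTower R A T := IsScalarTower.of_algebraMap_eq fun r => (g.commutes r).symm
  let f' : B →ₐ[A] T ⧸ J :=
    { f.toRingHom with
      commutes' := fun x => by
        have := DFunLike.congr_fun hg x
        exact this.symm }
  obtain ⟨k, hk⟩ := hb T J bot_le hJ f' (isUnit_of_mul_isUnit_right hf)
  refine ⟨k.restrictScalars R, ?_⟩
  ext x
  exact DFunLike.congr_fun hk x

theorem liftsMod_mvPolynomial (𝔞 : Ideal R) (σ : Type) : LiftsMod R 𝔞 (MvPolynomial σ R) 1 := by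
  intro T _ _ J _ _ f _
  choose x hx using fun i => Ideal.Quotient.mk_surjective (f (X i))
  refine ⟨aeval x, ?_⟩
  ext i
  simp [hx]

end Lifts

section Taylor

variable {R σ : Type} [CommRing R] [Fintype σ]

theorem aeval_add_taylor {T : Type} [CommRing T] [Algebra R T] (p : MvPolynomial σ R)
    (x h : σ → T) : ∃ r : σ → σ → T, aeval (x + h) p =
      aeval x p + ∑ j, aeval x (pderiv j p) * h j + ∑ j, ∑ k, r j k * (h j * h k) := by
  classical
  induction p using MvPolynomial.induction_on with
  | C a => exact ⟨0, by simp⟩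
  | add p q hp hq =>
    obtain ⟨r, hr⟩ := hp
    obtain ⟨s, hs⟩ := hq
    refine ⟨r + s, ?_⟩
    simp only [map_add, hr, hs, add_mul, Finset.sum_add_distrib, Pi.add_apply]
    ring
  | mul_X p i hp =>
    obtain ⟨r, hr⟩ := hp
    refine ⟨fun j k => r j k * (x i + h i) + (if k = i then aeval x (pderiv j p) else 0), ?_⟩
    have e1 : ∀ j, aeval x (pderiv j (p * X i)) * h j =
        (aeval x (pderiv j p) * h j) * x i + (if j = i then aeval x p * h i else 0) := by
      intro j
      rw [Derivation.leibniz, pderiv_X]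
      by_cases hji : j = i
      · subst hji; simp; ring
      · simp [hji, Ne.symm hji]; ring
    have e2 : ∀ j k, (r j k * (x i + h i) + (if k = i then aeval x (pderiv j p) else 0)) *
        (h j * h k) = (r j k * (h j * h k)) * (x i + h i) +
          (if k = i then (aeval x (pderiv j p) * h j) * h i else 0) := by
      intro j k
      by_cases hki : k = i
      · subst hki; simp; ring
      · simp [hki]; ring
    simp only [e1, e2, Finset.sum_add_distrib, Finset.sum_ite_eq', Finset.mem_univ, if_true,
      ← Finset.sum_mul, map_mul, aeval_X, Pi.add_apply, hr]
    ring

theorem aeval_add_of_sq_zero {T : Type} [CommRing T] [Algebra R T] {J : Ideal T} (hJ : J ^ 2 = ⊥)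
    (p : MvPolynomial σ R) (x h : σ → T) (hh : ∀ j, h j ∈ J) : aeval (x + h) p =
      aeval x p + ∑ j, aeval x (pderiv j p) * h j := by
  obtain ⟨r, hr⟩ := aeval_add_taylor p x h
  rw [hr, add_eq_left]
  refine Finset.sum_eq_zero fun j _ => Finset.sum_eq_zero fun k _ => ?_
  rw [mul_eq_zero_of_mem_of_sq hJ (hh j) (hh k), mul_zero]

end Taylor

section Newton

variable {R σ ι : Type} [CommRing R] [Fintype σ] [Fintype ι]

/-- The Jacobian matrix of a polynomial system. -/
noncomputable def jac (F : ι → MvPolynomial σ R) : Matrix ι σ (MvPolynomial σ R) :=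
  Matrix.of fun i j => pderiv j (F i)

/-- `c` is a Newton element for the system `F` modulo `ϖ`: multiplication by `c` on the conormal
module factors through the differentials. -/
def Newton (F : ι → MvPolynomial σ R) (c : MvPolynomial σ R) (ϖ : R) : Prop :=
  ∃ (S : Matrix σ ι (MvPolynomial σ R)) (q : ι → ι → ι → MvPolynomial σ R)
    (r : ι → MvPolynomial σ R), ∀ i, ∑ k, (jac F * S) i k * F k =
      c * F i + ∑ k, ∑ l, q i k l * (F k * F l) + C ϖ * r i

theorem mem_span_range_sq {P : Type} [CommRing P] (F : ι → P) {x : P}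
    (hx : x ∈ Ideal.span (Set.range F) ^ 2) : ∃ q : ι → ι → P,
      x = ∑ k, ∑ l, q k l * (F k * F l) := by
  rw [pow_two, Ideal.span_mul_span', ← Set.image2_mul, Set.image2_range] at hx
  obtain ⟨c, hc⟩ := Ideal.mem_span_range_iff_exists_fun.1 hx
  refine ⟨fun k l => c (k, l), ?_⟩
  rw [← hc, Fintype.sum_prod_type]

theorem newton_of_mem {F : ι → MvPolynomial σ R} {c : MvPolynomial σ R} {ϖ : R}
    (S : Matrix σ ι (MvPolynomial σ R))
    (h : ∀ i, ∑ k, (jac F * S) i k * F k - c * F i ∈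
      Ideal.span (Set.range F) ^ 2 ⊔ Ideal.span {C ϖ}) : Newton F c ϖ := by
  have : ∀ i, ∃ (q : ι → ι → MvPolynomial σ R) (r : MvPolynomial σ R),
      ∑ k, (jac F * S) i k * F k = c * F i + ∑ k, ∑ l, q k l * (F k * F l) + C ϖ * r := by
    intro i
    obtain ⟨y, hy, z, hz, hyz⟩ := Submodule.mem_sup.1 (h i)
    obtain ⟨q, rfl⟩ := mem_span_range_sq F hy
    obtain ⟨r, rfl⟩ := Ideal.mem_span_singleton'.1 hz
    exact ⟨q, r, by linear_combination -hyz⟩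
  choose q r hqr using this
  exact ⟨S, q, r, hqr⟩

theorem Newton.add {F : ι → MvPolynomial σ R} {c d : MvPolynomial σ R} {ϖ : R}
    (hc : Newton F c ϖ) (hd : Newton F d ϖ) : Newton F (c + d) ϖ := by
  obtain ⟨S, q, r, h⟩ := hc
  obtain ⟨S', q', r', h'⟩ := hd
  refine ⟨S + S', q + q', r + r', fun i => ?_⟩
  simp only [Matrix.mul_add, Matrix.add_apply, add_mul, Finset.sum_add_distrib, Pi.add_apply,
    h i, h' i]
  ring

theorem Newton.mul_left {F : ι → MvPolynomial σ R} {c : MvPolynomial σ R} {ϖ : R}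
    (hc : Newton F c ϖ) (d : MvPolynomial σ R) : Newton F (d * c) ϖ := by
  obtain ⟨S, q, r, h⟩ := hc
  refine ⟨d • S, fun i k l => d * q i k l, fun i => d * r i, fun i => ?_⟩
  have e1 : ∀ k, (jac F * d • S) i k * F k = d * ((jac F * S) i k * F k) := fun k => by
    rw [Matrix.mul_smul, Matrix.smul_apply, smul_eq_mul, mul_assoc]
  have e2 : ∀ k l, d * q i k l * (F k * F l) = d * (q i k l * (F k * F l)) := fun k l => by ring
  simp_rw [e1, e2, ← Finset.mul_sum, h i]
  ring

theorem newton_of_mem_span {F : ι → MvPolynomial σ R} {c : MvPolynomial σ R} {ϖ : R}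
    (hc : c ∈ Ideal.span (Set.range F)) : Newton F c ϖ := by
  refine newton_of_mem 0 fun i => Ideal.mem_sup_left ?_
  simp only [Matrix.mul_zero, Matrix.zero_apply, zero_mul, Finset.sum_const_zero, zero_sub,
    neg_mem_iff, pow_two]
  exact Ideal.mul_mem_mul hc (Ideal.subset_span ⟨i, rfl⟩)

theorem newton_of_mem_span_image {F : ι → MvPolynomial σ R} {ϖ : R} {s : Set (MvPolynomial σ R)}
    (hs : ∀ c ∈ s, Newton F c ϖ) {d : MvPolynomial σ R}
    (hd : d ∈ Ideal.span s ⊔ Ideal.span (Set.range F)) : Newton F d ϖ := by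
  obtain ⟨y, hy, z, hz, rfl⟩ := Submodule.mem_sup.1 hd
  refine Newton.add ?_ (newton_of_mem_span hz)
  refine Submodule.span_induction hs (newton_of_mem_span (zero_mem _))
    (fun _ _ _ _ h1 h2 => h1.add h2) (fun a x _ h => h.mul_left a) hy

/-- The commutation identity attached to Newton data. -/
theorem newton_comm [DecidableEq ι] {F : ι → MvPolynomial σ R} {c : MvPolynomial σ R} {ϖ : R}
    {S : Matrix σ ι (MvPolynomial σ R)} {q : ι → ι → ι → MvPolynomial σ R}
    {r : ι → MvPolynomial σ R} (h : ∀ i, ∑ k, (jac F * S) i k * F k =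
      c * F i + ∑ k, ∑ l, q i k l * (F k * F l) + C ϖ * r i) :
    ∃ (m : ι → σ → ι → MvPolynomial σ R) (m' : ι → σ → MvPolynomial σ R), ∀ i j,
      ((jac F * S - c • (1 : Matrix ι ι (MvPolynomial σ R))) * jac F) i j = ∑ l, m i j l * F l + C ϖ * m' i j := by
  set I := Ideal.span (Set.range F) ⊔ Ideal.span {(C ϖ : MvPolynomial σ R)} with hI
  have hF : ∀ k, F k ∈ I := fun k => Ideal.mem_sup_left (Ideal.subset_span ⟨k, rfl⟩)
  have hϖ : ∀ p, C ϖ * p ∈ I := fun p =>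
    I.mul_mem_right _ (Ideal.mem_sup_right (Ideal.subset_span rfl))
  have key : ∀ i j, ((jac F * S - c • (1 : Matrix ι ι (MvPolynomial σ R))) * jac F) i j ∈ I := by
    intro i j
    have h1 : ∑ k, (jac F * S - c • (1 : Matrix ι ι (MvPolynomial σ R))) i k * F k =
        ∑ k, ∑ l, q i k l * (F k * F l) + C ϖ * r i := by
      simp only [Matrix.sub_apply, sub_mul, Finset.sum_sub_distrib, h i, Matrix.smul_apply,
        Matrix.one_apply, smul_eq_mul, mul_ite, mul_one, mul_zero, ite_mul, zero_mul,
        Finset.sum_ite_eq, Finset.mem_univ, if_true]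
      ring
    have h2 := congrArg (pderiv j) h1
    simp only [map_sum, Derivation.leibniz, map_add, smul_eq_mul, pderiv_C, mul_zero, add_zero,
      Finset.sum_add_distrib] at h2
    rw [Matrix.mul_apply]
    have h3 : ∀ k, jac F k j = pderiv j (F k) := fun k => rfl
    simp only [h3]
    rw [eq_sub_of_add_eq h2]
    refine I.sub_mem (I.add_mem (I.add_mem ?_ ?_) (hϖ _))
      (I.sum_mem fun k _ => I.mul_mem_right _ (hF k))
    · exact I.sum_mem fun k _ => I.sum_mem fun l _ => I.mul_mem_left _
        (I.add_mem (I.mul_mem_right _ (hF k)) (I.mul_mem_right _ (hF l)))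
    · exact I.sum_mem fun k _ => I.sum_mem fun l _ =>
        I.mul_mem_right _ (I.mul_mem_right _ (hF k))
  have : ∀ i j, ∃ (m : ι → MvPolynomial σ R) (m' : MvPolynomial σ R),
      ((jac F * S - c • (1 : Matrix ι ι (MvPolynomial σ R))) * jac F) i j = ∑ l, m l * F l + C ϖ * m' := by
    intro i j
    obtain ⟨y, hy, z, hz, hyz⟩ := Submodule.mem_sup.1 (key i j)
    obtain ⟨m, rfl⟩ := Ideal.mem_span_range_iff_exists_fun.1 hy
    obtain ⟨m', rfl⟩ := Ideal.mem_span_singleton'.1 hz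
    exact ⟨m, m', by rw [← hyz]; ring⟩
  choose m m' hm using this
  exact ⟨m, m', hm⟩

theorem Newton.liftsMod {F : ι → MvPolynomial σ R} {c : MvPolynomial σ R} {ϖ : R}
    {A : Type} [CommRing A] [Algebra R A] {g : MvPolynomial σ R →ₐ[R] A}
    (hg : Function.Surjective g) (hker : RingHom.ker g = Ideal.span (Set.range F))
    (hc : Newton F c ϖ) : LiftsMod R (Ideal.span {ϖ}) A (g c) := by
  intro T _ _ J hϖ hJ f hf
  obtain ⟨S, q, r, hS⟩ := hc
  choose x hx using fun j => Ideal.Quotient.mk_surjective (f (g (X j)))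
  have hmk : ∀ p, Ideal.Quotient.mk J (aeval x p) = f (g p) := by
    have : (Ideal.Quotient.mkₐ R J).comp (aeval x) = f.comp g := by
      ext j; simp [hx]
    exact fun p => DFunLike.congr_fun this p
  have hF0 : ∀ i, g (F i) = 0 := fun i => by
    have : F i ∈ RingHom.ker g := by rw [hker]; exact Ideal.subset_span ⟨i, rfl⟩
    exact this
  have hFJ : ∀ i, aeval x (F i) ∈ J := fun i => by
    rw [← Ideal.Quotient.eq_zero_iff_mem, hmk, hF0, map_zero]
  have hϖ0 : algebraMap R T ϖ = 0 := hϖ (Ideal.subset_span rfl)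
  rw [← hmk] at hf
  obtain ⟨u, hu⟩ := (isUnit_of_isUnit_mk hJ hf).exists_right_inv
  set δ : σ → T := fun j => -(u * ∑ k, aeval x (S j k) * aeval x (F k)) with hδ
  have hδJ : ∀ j, δ j ∈ J := fun j => J.neg_mem (J.mul_mem_left _
    (J.sum_mem fun k _ => J.mul_mem_left _ (hFJ k)))
  have hzero : ∀ i, aeval (x + δ) (F i) = 0 := fun i => by
    rw [aeval_add_of_sq_zero hJ _ _ _ hδJ]
    have h1 : ∑ j, aeval x (pderiv j (F i)) * δ j =
        -(u * aeval x (∑ k, (jac F * S) i k * F k)) := by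
      simp only [hδ, jac, Matrix.mul_apply, Matrix.of_apply, map_sum, map_mul, mul_neg,
        Finset.sum_neg_distrib, Finset.mul_sum, Finset.sum_mul]
      rw [Finset.sum_comm]
      refine congrArg _ (Finset.sum_congr rfl fun k _ => Finset.sum_congr rfl fun j _ => by ring)
    have h2 : ∑ k, ∑ l, aeval x (q i k l) * (aeval x (F k) * aeval x (F l)) = 0 :=
      Finset.sum_eq_zero fun k _ => Finset.sum_eq_zero fun l _ => by
        rw [mul_eq_zero_of_mem_of_sq hJ (hFJ k) (hFJ l), mul_zero]
    rw [h1, hS i]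
    simp only [map_add, map_mul, map_sum, h2, aeval_C, hϖ0]
    linear_combination -(aeval x (F i)) * hu
  have hker' : ∀ p, p ∈ RingHom.ker g → aeval (x + δ) p = 0 := by
    intro p hp
    rw [hker] at hp
    have : Ideal.span (Set.range F) ≤ RingHom.ker (aeval (x + δ) : MvPolynomial σ R →ₐ[R] T) := by
      rw [Ideal.span_le]
      rintro _ ⟨i, rfl⟩
      exact hzero i
    exact this hp
  refine ⟨(Ideal.Quotient.liftₐ (RingHom.ker g) (aeval (x + δ)) hker').comp
    (Ideal.quotientKerAlgEquivOfSurjective hg).symm.toAlgHom, ?_⟩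
  ext a
  obtain ⟨p, rfl⟩ := hg a
  have h3 : (Ideal.quotientKerAlgEquivOfSurjective hg).symm (g p) = Ideal.Quotient.mk _ p := by
    rw [AlgEquiv.symm_apply_eq]; rfl
  have h4 : (Ideal.Quotient.mkₐ R J).comp (aeval (x + δ)) = f.comp g := by
    ext j
    have : Ideal.Quotient.mk J (δ j) = 0 := Ideal.Quotient.eq_zero_iff_mem.2 (hδJ j)
    simp [hx, this]
  have h5 := DFunLike.congr_fun h4 p
  simp only [AlgHom.comp_apply, AlgEquiv.toAlgHom_apply, h3] at h5 ⊢
  exact h5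

theorem newton_det [DecidableEq ι] (F : ι → MvPolynomial σ R)
    (S : Matrix σ ι (MvPolynomial σ R)) (ϖ : R) : Newton F (jac F * S).det ϖ := by
  refine ⟨S * (jac F * S).adjugate, 0, 0, fun i => ?_⟩
  rw [← Matrix.mul_assoc, Matrix.mul_adjugate]
  simp [Matrix.smul_apply, Matrix.one_apply]

theorem sum_sum_mul_left_comm {T : Type} [CommRing T] (a : σ → T) (t : σ → ι → T) (u : T)
    (b : ι → T) : ∑ j, ∑ k, a j * (u * t j k) * b k = u * ∑ j, a j * ∑ k, t j k * b k := by
  simp_rw [Finset.mul_sum]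
  exact Finset.sum_congr rfl fun j _ => Finset.sum_congr rfl fun k _ => by ring

/-- The lifting property forces a power of `c` to be a Newton element. -/
theorem LiftsMod.exists_newton {F : ι → MvPolynomial σ R} {c : MvPolynomial σ R} {ϖ : R}
    {A : Type} [CommRing A] [Algebra R A] {g : MvPolynomial σ R →ₐ[R] A}
    (hg : Function.Surjective g) (hker : RingHom.ker g = Ideal.span (Set.range F))
    (hc : LiftsMod R (Ideal.span {ϖ}) A (g c)) : ∃ M : ℕ, Newton F (c ^ M) ϖ := by
  classical
  set I := Ideal.span (Set.range F) with hI
  set I2 := I ^ 2 ⊔ Ideal.span {(C ϖ : MvPolynomial σ R)} with hI2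
  let Q := MvPolynomial σ R ⧸ I2
  let c' : Q := Ideal.Quotient.mk I2 c
  let T := Localization.Away c'
  let ι' : MvPolynomial σ R →ₐ[R] T :=
    (IsScalarTower.toAlgHom R Q T).comp (Ideal.Quotient.mkₐ R I2)
  set J : Ideal T := I.map ι' with hJdef
  have hι0 : ∀ p ∈ I2, ι' p = 0 := fun p hp => by
    change algebraMap Q T (Ideal.Quotient.mk I2 p) = 0
    rw [Ideal.Quotient.eq_zero_iff_mem.2 hp, map_zero]
  have hJ : J ^ 2 = ⊥ := by
    rw [hJdef, ← Ideal.map_pow, eq_bot_iff, Ideal.map_le_iff_le_comap]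
    intro p hp
    exact hι0 p (Ideal.mem_sup_left hp)
  have hϖ : Ideal.span {ϖ} ≤ RingHom.ker (algebraMap R T) := by
    rw [Ideal.span_singleton_le_iff_mem, RingHom.mem_ker, ← ι'.commutes]
    exact hι0 _ (Ideal.mem_sup_right (Ideal.subset_span rfl))
  have hk : ∀ p ∈ RingHom.ker g, ((Ideal.Quotient.mkₐ R J).comp ι') p = 0 := fun p hp => by
    rw [hker] at hp
    exact Ideal.Quotient.eq_zero_iff_mem.2 (Ideal.mem_map_of_mem _ hp)
  let f : A →ₐ[R] T ⧸ J := (Ideal.Quotient.liftₐ (RingHom.ker g) _ hk).comp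
    (Ideal.quotientKerAlgEquivOfSurjective hg).symm.toAlgHom
  have hf : ∀ p, f (g p) = Ideal.Quotient.mk J (ι' p) := fun p => by
    have h3 : (Ideal.quotientKerAlgEquivOfSurjective hg).symm (g p) = Ideal.Quotient.mk _ p := by
      rw [AlgEquiv.symm_apply_eq]; rfl
    simp only [f, AlgHom.comp_apply, AlgEquiv.toAlgHom_apply, h3]
    rfl
  have hunit : IsUnit (f (g c)) := by
    rw [hf]
    exact (IsLocalization.Away.algebraMap_isUnit (S := T) c').map (Ideal.Quotient.mk J)
  obtain ⟨h, hh⟩ := hc T J hϖ hJ f hunit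
  set δ : σ → T := fun j => h (g (X j)) - ι' (X j) with hδ
  have hδJ : ∀ j, δ j ∈ J := fun j => by
    rw [← Ideal.Quotient.eq_zero_iff_mem, hδ, map_sub, ← hf, ← hh]
    exact sub_self _
  have haev : ∀ p, aeval ((fun j => ι' (X j)) + δ) p = h (g p) := by
    have : aeval ((fun j => ι' (X j)) + δ) = h.comp g := by
      ext j; simp [hδ]
    exact fun p => DFunLike.congr_fun this p
  have haev' : ∀ p, aeval (fun j => ι' (X j)) p = ι' p := fun p => by
    have : aeval (fun j => ι' (X j)) = ι' := by ext j; simp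
    rw [this]
  have hF0 : ∀ i, ι' (F i) + ∑ j, ι' (pderiv j (F i)) * δ j = 0 := fun i => by
    have h1 := aeval_add_of_sq_zero hJ (F i) (fun j => ι' (X j)) _ hδJ
    rw [haev] at h1
    have h2 : g (F i) = 0 := by
      have : F i ∈ RingHom.ker g := by rw [hker]; exact Ideal.subset_span ⟨i, rfl⟩
      exact this
    simp only [haev', h2, map_zero] at h1
    exact h1.symm
  have hJspan : J = Ideal.span (Set.range fun k => ι' (F k)) := by
    rw [hJdef, hI, Ideal.map_span, ← Set.range_comp]; rfl
  have ht : ∀ j, ∃ t : ι → T, ∑ k, t k * ι' (F k) = δ j := fun j => by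
    have := hδJ j
    rw [hJspan] at this
    exact Ideal.mem_span_range_iff_exists_fun.1 this
  choose t ht using ht
  obtain ⟨⟨b, m, rfl⟩, hb⟩ := IsLocalization.exist_integer_multiples_of_finite
    (Submonoid.powers c') (fun jk : σ × ι => t jk.1 jk.2)
  have hb' : ∀ j k, ∃ s : MvPolynomial σ R, ι' s = ι' (c ^ m) * t j k := fun j k => by
    obtain ⟨s, hs⟩ := hb (j, k)
    obtain ⟨s, rfl⟩ := Ideal.Quotient.mk_surjective s
    refine ⟨s, hs.trans ?_⟩
    simp only [Algebra.smul_def, map_pow]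
    rfl
  choose s hs using hb'
  have hz : ∀ i, ι' (c ^ m * F i + ∑ j, ∑ k, pderiv j (F i) * s j k * F k) = 0 := fun i => by
    have h1 : ι' (∑ j, ∑ k, pderiv j (F i) * s j k * F k) =
        ι' (c ^ m) * ∑ j, ι' (pderiv j (F i)) * δ j := by
      simp only [map_sum, map_mul, hs, ← ht]
      exact sum_sum_mul_left_comm _ _ _ _
    rw [map_add, h1, map_mul]
    linear_combination ι' (c ^ m) * hF0 i
  have hn : ∀ i, ∃ n : ℕ,
      c ^ n * (c ^ m * F i + ∑ j, ∑ k, pderiv j (F i) * s j k * F k) ∈ I2 := fun i => by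
    have h1 := hz i
    change algebraMap Q T (Ideal.Quotient.mk I2 _) = 0 at h1
    obtain ⟨⟨_, n, rfl⟩, hn⟩ := (IsLocalization.map_eq_zero_iff (Submonoid.powers c') T _).1 h1
    refine ⟨n, ?_⟩
    rw [← Ideal.Quotient.eq_zero_iff_mem, map_mul, map_pow]
    exact hn
  choose n hn using hn
  refine ⟨∑ i, n i + m, newton_of_mem (-(c ^ (∑ i, n i)) • Matrix.of s) fun i => ?_⟩
  obtain ⟨d, hd⟩ : c ^ n i ∣ c ^ ∑ i, n i :=
    pow_dvd_pow _ (Finset.single_le_sum (f := n) (fun _ _ => Nat.zero_le _) (Finset.mem_univ i))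
  have h6 := I2.mul_mem_left (-d) (hn i)
  convert h6 using 1
  have h7 : ∑ k, (jac F * (-(c ^ (∑ i, n i)) • Matrix.of s)) i k * F k =
      -(c ^ (∑ i, n i)) * ∑ j, ∑ k, pderiv j (F i) * s j k * F k := by
    have e1 : ∀ k, (jac F * (-(c ^ (∑ i, n i)) • Matrix.of s)) i k * F k =
        -(c ^ (∑ i, n i)) * ∑ j, pderiv j (F i) * s j k * F k := fun k => by
      rw [Matrix.mul_smul, Matrix.smul_apply, smul_eq_mul, mul_assoc, Matrix.mul_apply,
        Finset.sum_mul]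
      rfl
    simp_rw [e1, ← Finset.mul_sum]
    rw [Finset.sum_comm]
  rw [h7, pow_add, hd]
  ring

end Newton

section Flat

variable {R : Type} [CommRing R]

theorem LiftsAt.formallySmooth {D : Type} [CommRing D] [Algebra R D] {d : D}
    (hd : LiftsAt R D d) : Algebra.FormallySmooth R (Localization.Away d) := by
  refine Algebra.FormallySmooth.of_comp_surjective fun B _ _ I hI f => ?_
  have hu : IsUnit (f (algebraMap D _ d)) :=
    (IsLocalization.Away.algebraMap_isUnit (S := Localization.Away d) d).map f
  obtain ⟨g, hg⟩ := hd B I bot_le hI (f.comp (IsScalarTower.toAlgHom R D _)) hu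
  have hgd : IsUnit (g d) := by
    refine isUnit_of_isUnit_mk hI ?_
    have := DFunLike.congr_fun hg d
    change Ideal.Quotient.mk I (g d) = _ at this
    rw [this]; exact hu
  refine ⟨IsLocalization.liftAlgHom (M := Submonoid.powers d) (f := g) ?_, ?_⟩
  · rintro ⟨_, n, rfl⟩
    change IsUnit (g (d ^ n))
    rw [map_pow]
    exact hgd.pow n
  · have key : ∀ x : D, (Ideal.Quotient.mkₐ R I).comp (IsLocalization.liftAlgHom
        (M := Submonoid.powers d) (S := Localization.Away d) (f := g) (by
          rintro ⟨_, n, rfl⟩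
          change IsUnit (g (d ^ n))
          rw [map_pow]
          exact hgd.pow n)) (algebraMap D _ x) = f (algebraMap D _ x) := fun x => by
      rw [AlgHom.comp_apply, IsLocalization.liftAlgHom_apply, IsLocalization.lift_eq]
      exact DFunLike.congr_fun hg x
    have := IsLocalization.ringHom_ext (Submonoid.powers d) (S := Localization.Away d)
      (j := ((Ideal.Quotient.mkₐ R I).comp _ : Localization.Away d →ₐ[R] B ⧸ I).toRingHom)
      (k := f.toRingHom) (RingHom.ext key)
    exact AlgHom.ext fun x => RingHom.congr_fun this x

/-- A nonzerodivisor of the base stays one on the smooth locus. -/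
theorem LiftsAt.eq_zero_of_mul [IsNoetherianRing R] {D : Type} [CommRing D] [Algebra R D]
    [Algebra.FiniteType R D] {d : D} (hd : LiftsAt R D d) {π : R}
    (hπ : π ∈ nonZeroDivisors R) {x : Localization.Away d}
    (hx : algebraMap R (Localization.Away d) π * x = 0) : x = 0 := by
  have := hd.formallySmooth
  have : Algebra.FiniteType D (Localization.Away d) :=
    IsLocalization.finiteType_of_monoid_fg (Submonoid.powers d) (Localization.Away d)
  have : Algebra.FiniteType R (Localization.Away d) := .trans ‹Algebra.FiniteType R D› this
  obtain ⟨k, f, hf⟩ := (Algebra.FiniteType.iff_quotient_mvPolynomial'' (R := R)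
    (S := Localization.Away d)).mp inferInstance
  have : Module.Flat R (Localization.Away d) :=
    Algebra.FormallySmooth.flat_of_algHom_of_isNoetherianRing f hf
  have h2 : IsSMulRegular (Localization.Away d) π :=
    Module.Flat.isSMulRegular_of_nonZeroDivisors hπ
  exact h2 (by simpa [Algebra.smul_def] using hx)

end Flat

end

section

open MvPolynomial

section Retract

variable {R : Type} [CommRing R]

theorem LiftsAt.of_retract {Q D : Type} [CommRing Q] [Algebra R Q] [CommRing D] [Algebra R D]
    {γ : Q} (hQ : LiftsAt R Q γ) (ρ : Q →ₐ[R] D) (θ : D →ₐ[R] Localization.Away γ)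
    (hρθ : ∀ (T : Type) [CommRing T] [Algebra R T] (f : D →ₐ[R] T) (h : Localization.Away γ →ₐ[R] T),
      (∀ x, h (algebraMap Q _ x) = f (ρ x)) → ∀ x, h (θ x) = f x) :
    LiftsAt R D (ρ γ) := by
  intro T _ _ J h𝔞 hJ f hf
  obtain ⟨g, hg⟩ := hQ T J h𝔞 hJ (f.comp ρ) hf
  have hg' : ∀ x, Ideal.Quotient.mk J (g x) = f (ρ x) := fun x => DFunLike.congr_fun hg x
  have hu : ∀ y : Submonoid.powers γ, IsUnit (g y) := by
    rintro ⟨_, n, rfl⟩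
    change IsUnit (g (γ ^ n))
    rw [map_pow]
    refine (isUnit_of_isUnit_mk hJ ?_).pow n
    rwa [hg']
  let h : Localization.Away γ →ₐ[R] T := IsLocalization.liftAlgHom (f := g) hu
  have hh : ∀ x, h (algebraMap Q _ x) = g x := fun x => by
    simp [h, IsLocalization.liftAlgHom_apply]
  refine ⟨h.comp θ, AlgHom.ext fun x => ?_⟩
  exact hρθ _ f ((Ideal.Quotient.mkₐ R J).comp h) (fun x => by
    rw [AlgHom.comp_apply, hh]; exact hg' x) x

end Retract

section Dilatation

variable {R σ ι : Type} [CommRing R]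

/-- The saturation of an ideal with respect to the powers of an element. -/
def Ideal.satPow {P : Type} [CommRing P] (I : Ideal P) (a : P) : Ideal P where
  carrier := {p | ∃ j : ℕ, a ^ j * p ∈ I}
  zero_mem' := ⟨0, by simp⟩
  add_mem' := by
    rintro x y ⟨j, hj⟩ ⟨k, hk⟩
    refine ⟨j + k, ?_⟩
    have := I.add_mem (I.mul_mem_left (a ^ k) hj) (I.mul_mem_left (a ^ j) hk)
    convert this using 1
    ring
  smul_mem' := by
    rintro c x ⟨j, hj⟩
    refine ⟨j, ?_⟩
    have := I.mul_mem_left c hj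
    rw [smul_eq_mul]
    convert this using 1
    ring

/-- The equations `G = π ^ 4 * W`. -/
noncomputable def dilEq (G : ι → MvPolynomial σ R) (π : R) (k : ι) : MvPolynomial (σ ⊕ ι) R :=
  rename Sum.inl (G k) - C (π ^ 4) * X (Sum.inr k)

/-- The ideal of relations of the dilatation. -/
noncomputable def dilIdeal (G : ι → MvPolynomial σ R) (π : R) : Ideal (MvPolynomial (σ ⊕ ι) R) :=
  (Ideal.span (Set.range (dilEq G π))).satPow (C π) ⊓
    (Ideal.span {C π} ⊔ Ideal.span (Set.range fun k => X (Sum.inr k)) ⊔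
      Ideal.span (Set.range fun k => rename Sum.inl (G k)))

theorem C_mem_dilRel (G : ι → MvPolynomial σ R) (π : R) :
    (C π : MvPolynomial (σ ⊕ ι) R) ∈ Ideal.span {C π} ⊔ Ideal.span (Set.range fun k => X (Sum.inr k)) ⊔
      Ideal.span (Set.range fun k => rename Sum.inl (G k)) :=
  Ideal.mem_sup_left (Ideal.mem_sup_left (Ideal.subset_span rfl))

theorem X_mem_dilRel (G : ι → MvPolynomial σ R) (π : R) (k : ι) :
    (X (Sum.inr k) : MvPolynomial (σ ⊕ ι) R) ∈
      Ideal.span {C π} ⊔ Ideal.span (Set.range fun k => X (Sum.inr k)) ⊔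
      Ideal.span (Set.range fun k => rename Sum.inl (G k)) :=
  Ideal.mem_sup_left (Ideal.mem_sup_right (Ideal.subset_span ⟨k, rfl⟩))

theorem dilEq_mem (G : ι → MvPolynomial σ R) (π : R) (k : ι) : dilEq G π k ∈ dilIdeal G π := by
  refine ⟨⟨0, by rw [pow_zero, one_mul]; exact Ideal.subset_span ⟨k, rfl⟩⟩, ?_⟩
  refine Ideal.sub_mem _ (Ideal.mem_sup_right (Ideal.subset_span ⟨k, rfl⟩)) ?_
  exact Ideal.mul_mem_left _ _ (X_mem_dilRel G π k)

/-- An algebra map killing the dilatation equations kills the dilatation ideal if `π` is regular. -/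
theorem dilIdeal_le_ker {T : Type} [CommRing T] [Algebra R T] (G : ι → MvPolynomial σ R) (π : R)
    (h : MvPolynomial (σ ⊕ ι) R →ₐ[R] T) (hE : ∀ k, h (dilEq G π k) = 0)
    (hπ : ∀ t : T, algebraMap R T π * t = 0 → t = 0) {p : MvPolynomial (σ ⊕ ι) R}
    (hp : p ∈ dilIdeal G π) : h p = 0 := by
  obtain ⟨⟨j, hj⟩, -⟩ := hp
  have h1 : Ideal.span (Set.range (dilEq G π)) ≤ RingHom.ker h := by
    rw [Ideal.span_le]; rintro _ ⟨k, rfl⟩; exact hE k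
  have h2 : algebraMap R T π ^ j * h p = 0 := by
    have := h1 hj
    rw [RingHom.mem_ker, map_mul, map_pow, ← algebraMap_eq, AlgHom.commutes] at this
    exact this
  clear hj
  induction j with
  | zero => simpa using h2
  | succ j ih => exact ih (hπ _ (by rw [← mul_assoc, ← pow_succ']; exact h2))

/-- The dilatation. -/
abbrev Dil (G : ι → MvPolynomial σ R) (π : R) : Type := MvPolynomial (σ ⊕ ι) R ⧸ dilIdeal G π

theorem dil_eq (G : ι → MvPolynomial σ R) (π : R) (k : ι) :
    (Ideal.Quotient.mk (dilIdeal G π) (rename Sum.inl (G k))) =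
      algebraMap R (Dil G π) π ^ 4 * Ideal.Quotient.mk (dilIdeal G π) (X (Sum.inr k)) := by
  have := Ideal.Quotient.eq_zero_iff_mem.2 (dilEq_mem G π k)
  rw [dilEq, map_sub, sub_eq_zero, map_mul, C_pow, map_pow] at this
  exact this

theorem dil_liftsAt_base (G : ι → MvPolynomial σ R) (π : R) :
    LiftsAt R (Dil G π) (algebraMap R (Dil G π) π) := by
  intro T _ _ J _ hJ f hf
  rw [AlgHom.commutes] at hf
  have hu : IsUnit (algebraMap R T π) := isUnit_of_isUnit_mk hJ hf
  obtain ⟨u, hu'⟩ := hu.exists_right_inv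
  choose z hz using fun i => Ideal.Quotient.mk_surjective
    (f (Ideal.Quotient.mk _ (X (Sum.inl i))))
  let h : MvPolynomial (σ ⊕ ι) R →ₐ[R] T :=
    aeval (Sum.elim z fun k => u ^ 4 * aeval z (G k))
  have hG : ∀ p : MvPolynomial σ R, h (rename Sum.inl p) = aeval z p := fun p => by
    simp only [h, aeval_rename]; rfl
  have hE : ∀ k, h (dilEq G π k) = 0 := fun k => by
    rw [dilEq, map_sub, hG, map_mul, ← algebraMap_eq, AlgHom.commutes]
    simp only [h, aeval_X, Sum.elim_inr, map_pow]
    linear_combination -aeval z (G k) * ((algebraMap R T π * u) ^ 3 + (algebraMap R T π * u) ^ 2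
      + algebraMap R T π * u + 1) * hu'
  have hker : ∀ p ∈ dilIdeal G π, h p = 0 := fun p hp =>
    dilIdeal_le_ker G π h hE (fun t ht => hu.mul_right_eq_zero.1 ht) hp
  refine ⟨Ideal.Quotient.liftₐ _ h hker, ?_⟩
  refine Ideal.Quotient.algHom_ext _ (MvPolynomial.algHom_ext fun i => ?_)
  rcases i with i | k
  · change Ideal.Quotient.mk J (h (X (Sum.inl i))) = _
    simp [h, hz]
  · change Ideal.Quotient.mk J (h (X (Sum.inr k))) = f (Ideal.Quotient.mk _ (X (Sum.inr k)))
    have h1 : Ideal.Quotient.mk J (aeval z (G k)) =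
        f (Ideal.Quotient.mk _ (rename Sum.inl (G k))) := by
      have : (Ideal.Quotient.mkₐ R J).comp (aeval z) =
          (f.comp (Ideal.Quotient.mkₐ R _)).comp (rename Sum.inl) := by
        ext i; simp [hz]
      exact DFunLike.congr_fun this (G k)
    rw [dil_eq, map_mul, map_pow, AlgHom.commutes] at h1
    have h2 : h (X (Sum.inr k)) = u ^ 4 * aeval z (G k) := by simp [h]
    rw [h2, map_mul, map_pow, h1]
    have h3 : algebraMap R (T ⧸ J) π * Ideal.Quotient.mk J u = 1 := by
      rw [← map_one (Ideal.Quotient.mk J), ← hu', map_mul]; rfl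
    have h4 : (algebraMap R (T ⧸ J) π * Ideal.Quotient.mk J u) ^ 4 = 1 := by rw [h3, one_pow]
    linear_combination f (Ideal.Quotient.mk _ (X (Sum.inr k))) * h4

end Dilatation

end

section

open MvPolynomial

section DilNewton

variable {R σ ι : Type} [CommRing R]

theorem pderiv_inl_rename_inl {τ : Type} (j : σ) (p : MvPolynomial σ R) :
    pderiv (Sum.inl j) (rename (Sum.inl : σ → σ ⊕ τ) p) = rename Sum.inl (pderiv j p) := by
  classical
  induction p using MvPolynomial.induction_on with
  | C a => simp
  | add p q hp hq => simp [hp, hq]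
  | mul_X p i hp =>
    simp only [map_mul, rename_X, Derivation.leibniz, hp, pderiv_X, smul_eq_mul, map_add]
    by_cases h : i = j
    · subst h; simp
    · simp [h]

theorem pderiv_inr_rename_inl {τ : Type} (j : τ) (p : MvPolynomial σ R) :
    pderiv (Sum.inr j) (rename (Sum.inl : σ → σ ⊕ τ) p) = 0 := by
  classical
  induction p using MvPolynomial.induction_on with
  | C a => simp
  | add p q hp hq => simp [hp, hq]
  | mul_X p i hp => simp [Derivation.leibniz, hp, pderiv_X]

/-- The basic identity of the Newton method: solving `g = M U + a W` for `g`. -/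
theorem newton_identity {E ι : Type} [CommRing E] [Fintype ι] [DecidableEq ι] (A M : Matrix ι ι E)
    (g U W r : ι → E) (c a b : E) (q m : ι → ι → ι → E) (m' : ι → ι → E)
    (hS : ∀ i, ∑ k, A i k * g k = c * g i + ∑ k, ∑ l, q i k l * (g k * g l) + a * b * r i)
    (hAM : ∀ i k, (A * M) i k = ∑ l, m i k l * g l + a * b * m' i k) (i : ι) :
    ∑ l, ((if i = l then c else 0) + ∑ k, q i k l * g k - ∑ k, m i k l * U k) * g l -
      a * (∑ k, A i k * W k + b * (∑ k, m' i k * U k - r i)) =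
    ∑ k, A i k * (g k - ∑ l, M k l * U l - a * W k) := by
  have h2 : ∑ k, A i k * ∑ l, M k l * U l = ∑ l, (A * M) i l * U l := by
    simp only [Matrix.mul_apply, Finset.mul_sum, Finset.sum_mul]
    rw [Finset.sum_comm]
    exact Finset.sum_congr rfl fun _ _ => Finset.sum_congr rfl fun _ _ => by ring
  have h3 : ∑ k, A i k * (g k - ∑ l, M k l * U l - a * W k) =
      ∑ k, A i k * g k - ∑ l, (A * M) i l * U l - a * ∑ k, A i k * W k := by
    simp only [mul_sub, Finset.sum_sub_distrib, h2]
    rw [Finset.mul_sum]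
    congr 1
    exact Finset.sum_congr rfl fun _ _ => by ring
  have h4 : ∑ l, (A * M) i l * U l =
      ∑ l, (∑ k, m i k l * U k) * g l + a * b * ∑ k, m' i k * U k := by
    simp only [hAM, add_mul, Finset.sum_add_distrib, Finset.mul_sum, Finset.sum_mul]
    rw [Finset.sum_comm]
    congr 1
    · exact Finset.sum_congr rfl fun _ _ => Finset.sum_congr rfl fun _ _ => by ring
    · exact Finset.sum_congr rfl fun _ _ => by ring
  have h5 : ∑ l, ((if i = l then c else 0) + ∑ k, q i k l * g k - ∑ k, m i k l * U k) * g l =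
      c * g i + ∑ k, ∑ l, q i k l * (g k * g l) - ∑ l, (∑ k, m i k l * U k) * g l := by
    simp only [sub_mul, add_mul, Finset.sum_sub_distrib,
      Finset.sum_add_distrib, ite_mul, zero_mul, Finset.sum_ite_eq, Finset.mem_univ, if_true]
    congr 2
    rw [Finset.sum_comm]
    refine Finset.sum_congr rfl fun _ _ => ?_
    rw [Finset.sum_mul]
    exact Finset.sum_congr rfl fun _ _ => by ring
  rw [h3, hS, h5, h4]
  ring

variable [Fintype σ] [Fintype ι] [DecidableEq ι]

/-- The matrix `JS - c` commutes with `JS`, which makes `JS * (JS - c)` small. -/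
theorem newton_mul_eq {F : ι → MvPolynomial σ R} {c : MvPolynomial σ R} {ϖ : R}
    {S : Matrix σ ι (MvPolynomial σ R)} {q : ι → ι → ι → MvPolynomial σ R}
    {r : ι → MvPolynomial σ R} (h : ∀ i, ∑ k, (jac F * S) i k * F k =
      c * F i + ∑ k, ∑ l, q i k l * (F k * F l) + C ϖ * r i) :
    ∃ (m : ι → ι → ι → MvPolynomial σ R) (m' : ι → ι → MvPolynomial σ R), ∀ i k,
      (jac F * S * (jac F * S - c • (1 : Matrix ι ι (MvPolynomial σ R)))) i k =
        ∑ l, m i k l * F l + C ϖ * m' i k := by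
  obtain ⟨m, m', hm⟩ := newton_comm h
  refine ⟨fun i k l => ∑ j, m i j l * S j k, fun i k => ∑ j, m' i j * S j k, fun i k => ?_⟩
  have hcomm : jac F * S * (jac F * S - c • (1 : Matrix ι ι (MvPolynomial σ R))) =
      (jac F * S - c • (1 : Matrix ι ι (MvPolynomial σ R))) * jac F * S := by
    simp [Matrix.mul_sub, Matrix.sub_mul, Matrix.mul_assoc]
  rw [hcomm, Matrix.mul_apply]
  simp only [hm, add_mul, Finset.sum_add_distrib, Finset.sum_mul, Finset.mul_sum]
  rw [Finset.sum_comm]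
  congr 1
  · exact Finset.sum_congr rfl fun _ _ => Finset.sum_congr rfl fun _ _ => by ring
  · exact Finset.sum_congr rfl fun _ _ => by ring

/-- The auxiliary complete intersection `G = M U + π ^ 4 W`. -/
noncomputable def auxEq (G : ι → MvPolynomial σ R) (π : R) (M : Matrix ι ι (MvPolynomial σ R))
    (i : ι) : MvPolynomial (σ ⊕ (ι ⊕ ι)) R :=
  rename Sum.inl (G i) - ∑ k, rename Sum.inl (M i k) * X (Sum.inr (Sum.inl k))
    - C (π ^ 4) * X (Sum.inr (Sum.inr i))

/-- Partial right inverse of the Jacobian of `auxEq`. -/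
noncomputable def auxInv (S : Matrix σ ι (MvPolynomial σ R)) :
    Matrix (σ ⊕ (ι ⊕ ι)) ι (MvPolynomial (σ ⊕ (ι ⊕ ι)) R) :=
  Matrix.of (Sum.elim (fun j k => rename Sum.inl (S j k))
    (Sum.elim (fun k l => if k = l then 1 else 0) fun _ _ => 0))

/-- On `U = 0` the Jacobian of `auxEq` has the right inverse `auxInv`, up to `c`. -/
theorem aux_jac_eval {T : Type} [CommRing T] [Algebra R T] (G : ι → MvPolynomial σ R) (π : R)
    (S : Matrix σ ι (MvPolynomial σ R)) (c : MvPolynomial σ R)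
    (ρ : MvPolynomial (σ ⊕ (ι ⊕ ι)) R →ₐ[R] T) (hρ : ∀ k, ρ (X (Sum.inr (Sum.inl k))) = 0) (i l : ι) :
    ρ ((jac (auxEq G π (jac G * S - c • (1 : Matrix ι ι (MvPolynomial σ R)))) * auxInv S) i l) =
      if i = l then ρ (rename Sum.inl c) else 0 := by
  classical
  set M := jac G * S - c • (1 : Matrix ι ι (MvPolynomial σ R)) with hM
  have hZ : ∀ j, ρ (pderiv (Sum.inl j) (auxEq G π M i)) =
      ρ (rename Sum.inl (pderiv j (G i))) := fun j => by
    simp only [auxEq, map_sub, map_sum, Derivation.leibniz, pderiv_inl_rename_inl, pderiv_C,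
      smul_eq_mul, map_add, map_mul, hρ, zero_mul, mul_zero]
    simp [pderiv_X]
  have hU : ∀ k, ρ (pderiv (Sum.inr (Sum.inl k)) (auxEq G π M i)) =
      -ρ (rename Sum.inl (M i k)) := fun k => by
    simp only [auxEq, map_sub, map_sum, Derivation.leibniz, pderiv_inr_rename_inl, pderiv_C,
      smul_eq_mul, map_add, map_mul, mul_zero]
    simp [pderiv_X, Pi.single_apply]
  rw [Matrix.mul_apply, Fintype.sum_sum_type, Fintype.sum_sum_type]
  simp only [map_add, map_sum, map_mul, auxInv, jac, Matrix.of_apply, Sum.elim_inl, Sum.elim_inr,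
    hZ, hU, mul_zero, Finset.sum_const_zero, add_zero]
  have h1 : ∑ k, -ρ (rename Sum.inl (M i k)) * ρ (if k = l then 1 else 0) =
      -ρ (rename Sum.inl (M i l)) := by
    rw [Finset.sum_eq_single l] <;> simp +contextual
  rw [h1, hM, Matrix.sub_apply, Matrix.mul_apply, Matrix.smul_apply, Matrix.one_apply]
  simp only [map_sub, map_sum, map_mul, jac, Matrix.of_apply, smul_eq_mul]
  split_ifs <;> simp

/-- At a Newton element modulo `π ^ 5`, the dilatation has the lifting property. -/
theorem dil_liftsAt_newton [IsNoetherianRing R] {π : R} (hπ : π ∈ nonZeroDivisors R)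
    {G : ι → MvPolynomial σ R} {c : MvPolynomial σ R} (hc : Newton G c (π ^ 5)) :
    ∃ Q : ι → ι → MvPolynomial σ R,
      (∀ i l, Q i l ∈ Ideal.span (Set.range G)) ∧
      LiftsAt R (Dil G π) (Ideal.Quotient.mk _ (rename Sum.inl
        (c ^ Fintype.card ι * (Matrix.of fun i l => (if i = l then c else 0) + Q i l).det))) := by
  obtain ⟨S, q, r, hS⟩ := hc
  obtain ⟨m, m', hm⟩ := newton_mul_eq hS
  set M := jac G * S - c • (1 : Matrix ι ι (MvPolynomial σ R)) with hM
  let e : MvPolynomial σ R →ₐ[R] MvPolynomial (σ ⊕ (ι ⊕ ι)) R := rename Sum.inl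
  let U : ι → MvPolynomial (σ ⊕ (ι ⊕ ι)) R := fun k => X (Sum.inr (Sum.inl k))
  let W : ι → MvPolynomial (σ ⊕ (ι ⊕ ι)) R := fun k => X (Sum.inr (Sum.inr k))
  let Φ := auxEq G π M
  let B : Matrix ι ι (MvPolynomial (σ ⊕ (ι ⊕ ι)) R) := Matrix.of fun i l =>
    (if i = l then e c else 0) + ∑ k, e (q i k l) * e (G k) - ∑ k, e (m i k l) * U k
  let H : ι → MvPolynomial (σ ⊕ (ι ⊕ ι)) R := fun i =>
    ∑ k, e ((jac G * S) i k) * W k + C π * (∑ k, e (m' i k) * U k - e (r i))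
  have hΦ : ∀ i, Φ i = e (G i) - ∑ k, e (M i k) * U k - C (π ^ 4) * W i := fun i => rfl
  have heC : ∀ a : R, e (C a) = C a := fun a => by simp [e]
  have hBH : ∀ i, ∑ l, B i l * e (G l) - C (π ^ 4) * H i = ∑ k, e ((jac G * S) i k) * Φ k := by
    refine newton_identity (e.mapMatrix (jac G * S)) (e.mapMatrix M) (fun k => e (G k)) U W
      (fun k => e (r k)) (e c) (C (π ^ 4)) (C π) (fun i k l => e (q i k l))
      (fun i k l => e (m i k l)) (fun i k => e (m' i k)) (fun i => ?_) (fun i k => ?_)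
    · have h1 := congrArg e (hS i)
      simp only [map_add, map_sum, map_mul, heC] at h1
      rw [← C_mul, ← pow_succ]
      exact h1
    · have h1 := congrArg e (hm i k)
      simp only [map_add, map_sum, map_mul, heC] at h1
      rw [← C_mul, ← pow_succ, ← map_mul]
      exact h1
  let Qa := MvPolynomial (σ ⊕ (ι ⊕ ι)) R ⧸ Ideal.span (Set.range Φ)
  let mkQ : MvPolynomial (σ ⊕ (ι ⊕ ι)) R →ₐ[R] Qa := Ideal.Quotient.mkₐ R _
  have hmkΦ : ∀ i, mkQ (Φ i) = 0 := fun i =>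
    Ideal.Quotient.eq_zero_iff_mem.2 (Ideal.subset_span ⟨i, rfl⟩)
  let γ := (jac Φ * auxInv S).det
  obtain ⟨g₀, hg₀⟩ : ∃ g₀, g₀ = mkQ (γ * B.det) := ⟨_, rfl⟩
  have hQ : LiftsAt R Qa g₀ := by
    rw [hg₀, map_mul]
    refine LiftsMod.mul_right ?_ _
    have := (newton_det Φ (auxInv S) 0).liftsMod (g := mkQ) Ideal.Quotient.mk_surjective
      (Ideal.mk_ker)
    rwa [Ideal.span_singleton_eq_bot.2 rfl] at this
  let Λ := Localization.Away g₀
  let toL : MvPolynomial (σ ⊕ (ι ⊕ ι)) R →ₐ[R] Λ := (IsScalarTower.toAlgHom R Qa Λ).comp mkQ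
  have hreg : ∀ t : Λ, algebraMap R Λ π * t = 0 → t = 0 := fun t ht => hQ.eq_zero_of_mul hπ ht
  have hBu : IsUnit (toL B.det) := by
    have h1 : IsUnit (toL (γ * B.det)) := by
      have e1 : algebraMap Qa Λ g₀ = toL (γ * B.det) := congrArg (algebraMap Qa Λ) hg₀
      rw [← e1]
      exact IsLocalization.Away.algebraMap_isUnit (S := Λ) g₀
    rw [map_mul] at h1
    exact isUnit_of_mul_isUnit_right h1
  obtain ⟨u, hu⟩ := hBu.exists_right_inv
  have hadj : ∀ k, toL B.det * toL (e (G k)) =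
      algebraMap R Λ π ^ 4 * toL (∑ i, B.adjugate k i * H i) := fun k => by
    have h1 : ∀ i, toL (∑ l, B i l * e (G l)) = algebraMap R Λ π ^ 4 * toL (H i) := fun i => by
      have h2 : toL (∑ k, e ((jac G * S) i k) * Φ k) = 0 := by
        change algebraMap Qa Λ (mkQ (∑ k, e ((jac G * S) i k) * Φ k)) = 0
        rw [map_sum]
        simp only [map_mul, hmkΦ, mul_zero, Finset.sum_const_zero, map_zero]
      rw [← hBH, map_sub, sub_eq_zero] at h2
      rw [h2, map_mul, ← map_pow, ← algebraMap_eq, AlgHom.commutes]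
    have h3 : B.det * e (G k) = ∑ i, B.adjugate k i * ∑ l, B i l * e (G l) := by
      have h4 : (B.adjugate * B).mulVec (fun l => e (G l)) k = B.det * e (G k) := by
        rw [Matrix.adjugate_mul, Matrix.smul_mulVec, Matrix.one_mulVec]; rfl
      rw [← h4, ← Matrix.mulVec_mulVec]; rfl
    rw [← map_mul, h3, map_sum, map_sum, Finset.mul_sum]
    refine Finset.sum_congr rfl fun i _ => ?_
    rw [map_mul, h1, map_mul]; ring
  let ω : ι → Λ := fun k => u * toL (∑ i, B.adjugate k i * H i)
  let θ0 : MvPolynomial (σ ⊕ ι) R →ₐ[R] Λ :=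
    aeval (Sum.elim (fun j => toL (X (Sum.inl j))) ω)
  have hθe : ∀ p : MvPolynomial σ R, θ0 (rename Sum.inl p) = toL (e p) := fun p => by
    have : θ0.comp (rename Sum.inl) = toL.comp e := by
      ext j; simp [θ0, e]
    exact DFunLike.congr_fun this p
  have hθE : ∀ k, θ0 (dilEq G π k) = 0 := fun k => by
    rw [dilEq, map_sub, hθe, map_mul, ← algebraMap_eq, AlgHom.commutes]
    have : θ0 (X (Sum.inr k)) = ω k := by simp [θ0]
    rw [this, map_pow]
    simp only [ω]
    linear_combination -toL (e (G k)) * hu + u * hadj k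
  let θ : Dil G π →ₐ[R] Λ := Ideal.Quotient.liftₐ _ θ0 fun p hp =>
    dilIdeal_le_ker G π θ0 hθE hreg hp
  let mkD : MvPolynomial (σ ⊕ ι) R →ₐ[R] Dil G π := Ideal.Quotient.mkₐ R _
  let ρ0 : MvPolynomial (σ ⊕ (ι ⊕ ι)) R →ₐ[R] Dil G π :=
    aeval (Sum.elim (fun j => mkD (X (Sum.inl j))) (Sum.elim 0 fun k => mkD (X (Sum.inr k))))
  have hρU : ∀ k, ρ0 (X (Sum.inr (Sum.inl k))) = 0 := fun k => by simp [ρ0]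
  have hρW : ∀ k, ρ0 (W k) = mkD (X (Sum.inr k)) := fun k => by simp [ρ0, W]
  have hρe : ∀ p : MvPolynomial σ R, ρ0 (e p) = mkD (rename Sum.inl p) := fun p => by
    have : ρ0.comp e = mkD.comp (rename Sum.inl) := by
      ext j; simp [ρ0, e]
    exact DFunLike.congr_fun this p
  have hρC : ∀ a : R, ρ0 (C a) = algebraMap R _ a := fun a => by
    rw [← algebraMap_eq, AlgHom.commutes]
  have hρΦ : ∀ p ∈ Ideal.span (Set.range Φ), ρ0 p = 0 := by
    intro p hp
    have : Ideal.span (Set.range Φ) ≤ RingHom.ker ρ0 := by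
      rw [Ideal.span_le]
      rintro _ ⟨i, rfl⟩
      change ρ0 (Φ i) = 0
      rw [hΦ, map_sub, map_sub, map_sum, hρe, map_mul, hρW, hρC, map_pow]
      simp only [map_mul, U, hρU, mul_zero, Finset.sum_const_zero, sub_zero]
      rw [sub_eq_zero]
      exact dil_eq G π i
    exact this hp
  let ρ : Qa →ₐ[R] Dil G π := Ideal.Quotient.liftₐ _ ρ0 hρΦ
  have hρmk : ∀ p, ρ (mkQ p) = ρ0 p := fun p => rfl
  let Q : ι → ι → MvPolynomial σ R := fun i l => ∑ k, q i k l * G k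
  have hρB : ∀ i l, ρ0 (B i l) = mkD (rename Sum.inl ((if i = l then c else 0) + Q i l)) := by
    intro i l
    simp only [B, Matrix.of_apply, map_sub, map_add, map_sum, map_mul, U, hρU, mul_zero,
      Finset.sum_const_zero, sub_zero, hρe, Q]
    split_ifs <;> simp [hρe]
  have hρBdet : ρ0 B.det =
      mkD (rename Sum.inl (Matrix.of fun i l => (if i = l then c else 0) + Q i l).det) := by
    rw [AlgHom.map_det, AlgHom.map_det, AlgHom.map_det]
    congr 1
    ext i l
    exact hρB i l
  have hργ : ρ0 γ = mkD (rename Sum.inl (c ^ Fintype.card ι)) := by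
    rw [AlgHom.map_det]
    have : ρ0.mapMatrix (jac Φ * auxInv S) =
        mkD (rename Sum.inl c) • (1 : Matrix ι ι (Dil G π)) := by
      ext i l
      have := aux_jac_eval G π S c ρ0 hρU i l
      change ρ0 ((jac Φ * auxInv S) i l) = _
      rw [this, Matrix.smul_apply, Matrix.one_apply, smul_eq_mul, mul_ite, mul_one, mul_zero]
      congr 1
      exact hρe c
    rw [this, Matrix.det_smul, Matrix.det_one, mul_one, map_pow, map_pow]
  have hrel : ∀ i, ρ0 (H i) = ∑ l, ρ0 (B i l) * mkD (X (Sum.inr l)) := by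
    intro i
    have h1 : ρ0 (H i) = mkD (∑ k, rename Sum.inl ((jac G * S) i k) * X (Sum.inr k)
        - C π * rename Sum.inl (r i)) := by
      simp only [H, map_add, map_sum, map_mul, map_sub, hρe, hρW, U, hρU, hρC, mul_zero,
        Finset.sum_const_zero, zero_sub]
      have h0 : ∀ a b c : Dil G π, a + b * -c = a - b * c := fun a b c => by ring
      exact h0 _ _ _
    have h2 : ∑ l, ρ0 (B i l) * mkD (X (Sum.inr l)) =
        mkD (∑ l, rename Sum.inl ((if i = l then c else 0) + Q i l) * X (Sum.inr l)) := by
      simp only [hρB, map_sum, map_mul]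
    rw [h1, h2, ← sub_eq_zero, ← map_sub]
    refine Ideal.Quotient.eq_zero_iff_mem.2 ⟨⟨4, ?_⟩, ?_⟩
    · have h3 := congrArg (rename (Sum.inl : σ → σ ⊕ ι)) (hS i)
      simp only [map_add, map_sum, map_mul, rename_C] at h3
      have h4 : ∑ l, rename (Sum.inl : σ → σ ⊕ ι) ((if i = l then c else 0) + Q i l) *
          rename Sum.inl (G l) = rename Sum.inl c * rename Sum.inl (G i) +
          ∑ k, ∑ l, rename Sum.inl (q i k l) * (rename Sum.inl (G k) * rename Sum.inl (G l)) := by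
        simp only [Q, map_add, map_sum, map_mul, add_mul, Finset.sum_add_distrib, Finset.sum_mul]
        congr 1
        · rw [Finset.sum_eq_single i] <;> simp +contextual [eq_comm]
        · rw [Finset.sum_comm]
          exact Finset.sum_congr rfl fun _ _ => Finset.sum_congr rfl fun _ _ => by ring
      have h5 : C π ^ 4 * (∑ k, rename Sum.inl ((jac G * S) i k) * X (Sum.inr k)
          - C π * rename Sum.inl (r i) -
          ∑ l, rename Sum.inl ((if i = l then c else 0) + Q i l) * X (Sum.inr l)) =
          ∑ l, (rename Sum.inl ((if i = l then c else 0) + Q i l) -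
            rename Sum.inl ((jac G * S) i l)) * dilEq G π l := by
        simp only [dilEq, sub_mul, mul_sub, Finset.sum_sub_distrib, h4, h3, Finset.mul_sum]
        have h6 : ∀ a b : ι → MvPolynomial (σ ⊕ ι) R,
            ∑ l, a l * (C (π ^ 4) * b l) = ∑ l, C π ^ 4 * (a l * b l) := fun a b =>
          Finset.sum_congr rfl fun _ _ => by rw [C_pow]; ring
        rw [h6, h6, C_pow]
        ring
      rw [h5]
      exact Ideal.sum_mem _ fun l _ => Ideal.mul_mem_left _ _ (Ideal.subset_span ⟨l, rfl⟩)
    · refine Ideal.sub_mem _ (Ideal.sub_mem _ (Ideal.sum_mem _ fun k _ =>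
        Ideal.mul_mem_left _ _ (X_mem_dilRel G π k)) (Ideal.mul_mem_right _ _ (C_mem_dilRel G π)))
        (Ideal.sum_mem _ fun k _ => Ideal.mul_mem_left _ _ (X_mem_dilRel G π k))
  refine ⟨Q, fun i l => Ideal.sum_mem _ fun k _ =>
    Ideal.mul_mem_left _ _ (Ideal.subset_span ⟨k, rfl⟩), ?_⟩
  have hfin := hQ.of_retract ρ θ ?_
  · rw [hg₀, hρmk, map_mul, hργ, hρBdet, ← map_mul, ← map_mul] at hfin
    exact hfin
  · intro T _ _ f h hfh
    have hL : ∀ p, h (toL p) = f (ρ0 p) := fun p => hfh (mkQ p)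
    suffices hs : (h.comp θ).comp mkD = f.comp mkD by
      intro x
      obtain ⟨p, rfl⟩ := Ideal.Quotient.mk_surjective x
      exact DFunLike.congr_fun hs p
    refine MvPolynomial.algHom_ext fun i => ?_
    rcases i with j | k
    · change h (θ0 (X (Sum.inl j))) = f (mkD (X (Sum.inl j)))
      have : θ0 (X (Sum.inl j)) = toL (X (Sum.inl j)) := by simp [θ0]
      rw [this, hL]
      simp [ρ0]
    · change h (θ0 (X (Sum.inr k))) = f (mkD (X (Sum.inr k)))
      have h1 : θ0 (X (Sum.inr k)) = u * toL (∑ i, B.adjugate k i * H i) := by simp [θ0, ω]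
      have h2 : ρ0 (∑ i, B.adjugate k i * H i) = ρ0 B.det * mkD (X (Sum.inr k)) := by
        have h4 : (ρ0.mapMatrix (B.adjugate * B)).mulVec (fun l => mkD (X (Sum.inr l))) k =
            ρ0 B.det * mkD (X (Sum.inr k)) := by
          have h5 : ρ0.mapMatrix (B.adjugate * B) = ρ0 B.det • (1 : Matrix ι ι (Dil G π)) := by
            rw [map_mul, AlgHom.map_adjugate, Matrix.adjugate_mul, ← AlgHom.map_det]
          rw [h5, Matrix.smul_mulVec, Matrix.one_mulVec]
          rfl
        rw [← h4, map_mul, ← Matrix.mulVec_mulVec, map_sum]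
        simp only [map_mul, hrel]
        rfl
      have h3 : f (ρ0 B.det) * h u = 1 := by rw [← hL, ← map_mul, hu, map_one]
      rw [h1, map_mul, hL, h2, map_mul]
      linear_combination f (mkD (X (Sum.inr k))) * h3

end DilNewton

end

section

open MvPolynomial

section Desing

theorem det_one_add_smul_eq {E κ : Type} [CommRing E] [Fintype κ] [DecidableEq κ] (a : E)
    (N : Matrix κ κ E) : ∃ w, (1 + a • N).det = 1 + a * w := by
  have h : Ideal.Quotient.mk (Ideal.span {a}) (1 + a • N).det = Ideal.Quotient.mk _ 1 := by
    rw [RingHom.map_det, map_one, ← Matrix.det_one (n := κ)]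
    congr 1
    ext i j
    have ha : Ideal.Quotient.mk (Ideal.span {a}) a = 0 :=
      Ideal.Quotient.eq_zero_iff_mem.2 (Ideal.subset_span rfl)
    by_cases hij : i = j <;> simp [ha, Matrix.one_apply, hij]
  rw [Ideal.Quotient.eq] at h
  obtain ⟨w, hw⟩ := Ideal.mem_span_singleton'.1 h
  exact ⟨w, by linear_combination -hw⟩

theorem aeval_add_mul_taylor {R σ T : Type} [CommRing R] [Fintype σ] [CommRing T] [Algebra R T]
    (p : MvPolynomial σ R) (x h : σ → T) (a : T) :
    ∃ n, aeval (x + fun j => a * h j) p =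
      aeval x p + ∑ j, aeval x (pderiv j p) * (a * h j) + a ^ 2 * n := by
  obtain ⟨r, hr⟩ := aeval_add_taylor p x (fun j => a * h j)
  refine ⟨∑ j, ∑ k, r j k * (h j * h k), ?_⟩
  rw [hr, Finset.mul_sum]
  simp only [Finset.mul_sum]
  congr 1
  exact Finset.sum_congr rfl fun _ _ => Finset.sum_congr rfl fun _ _ => by ring

theorem aeval_add_mul_eq {R σ T : Type} [CommRing R] [Fintype σ] [CommRing T] [Algebra R T]
    (p : MvPolynomial σ R) (x h : σ → T) (a : T) :
    ∃ n, aeval (x + fun j => a * h j) p = aeval x p + a * n := by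
  obtain ⟨r, hr⟩ := aeval_add_taylor p x (fun j => a * h j)
  refine ⟨∑ j, aeval x (pderiv j p) * h j + ∑ j, ∑ k, r j k * (h j * (a * h k)), ?_⟩
  rw [hr, mul_add, Finset.mul_sum, Finset.mul_sum, add_assoc]
  simp only [Finset.mul_sum]
  congr 2
  · exact Finset.sum_congr rfl fun _ _ => by ring
  · exact Finset.sum_congr rfl fun _ _ => Finset.sum_congr rfl fun _ _ => by ring

theorem eq_zero_of_liftsAt {R D : Type} [CommRing R] [IsNoetherianRing R] {π : R}
    (hπ : π ∈ nonZeroDivisors R) [CommRing D] [Algebra R D] [Algebra.FiniteType R D] {d : D}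
    (hd : LiftsAt R D d) {T : Type} [CommRing T] [Algebra D T] (hT : IsUnit (algebraMap D T d))
    {y : D} (hy : algebraMap R D π * y = 0) : algebraMap D T y = 0 := by
  have h1 : algebraMap D (Localization.Away d) y = 0 := by
    refine hd.eq_zero_of_mul hπ ?_
    rw [IsScalarTower.algebraMap_apply R D, ← map_mul, hy, map_zero]
  obtain ⟨⟨_, n, rfl⟩, hn⟩ := (IsLocalization.map_eq_zero_iff (Submonoid.powers d) _ _).1 h1
  have h2 := congrArg (algebraMap D T) hn
  simp only [map_mul, map_pow, map_zero] at h2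
  exact (hT.pow n).mul_right_eq_zero.1 h2

variable {R D L σ κ : Type} [CommRing R] [CommRing D] [Algebra R D]
  [CommRing L] [Algebra R L] [Algebra D L] [IsScalarTower R D L] [Fintype σ] [Fintype κ]
  [DecidableEq κ]

theorem eq_zero_of_pow_smul {π : L} (hann : ∀ l : L, π ^ 2 * l = 0 → π * l = 0) {n : ℕ} {l : L}
    (h : π ^ (n + 1) * l = 0) : π * l = 0 := by
  induction n generalizing l with
  | zero => simpa using h
  | succ n ih =>
    refine hann l ?_
    have := ih (l := π * l) (by rw [← mul_assoc, ← pow_succ]; exact h)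
    rw [pow_two, mul_assoc]; exact this

set_option maxHeartbeats 2000000 in
/-- Néron desingularization of the solution of a system at a Newton element of the base, starting
from a sufficiently good approximate solution. -/
theorem desing [IsNoetherianRing R] [Algebra.FiniteType R D] {π : R} (hπ : π ∈ nonZeroDivisors R)
    (hann : ∀ l : L, algebraMap R L π ^ 2 * l = 0 → algebraMap R L π * l = 0)
    {F : κ → MvPolynomial σ R} (hF : Newton F (C π) 0) (x : σ → D) (h : κ → D)
    (hx : ∀ i, aeval x (F i) = algebraMap R D π ^ 4 * h i) (ν : σ → L)
    (hz : ∀ i, aeval (fun j => algebraMap D L (x j) + algebraMap R L π ^ 4 * ν j) (F i) = 0) :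
    ∃ (B : Type) (_ : CommRing B) (_ : Algebra D B) (_ : Algebra R B) (_ : IsScalarTower R D B)
      (β : B →ₐ[D] L) (X : σ → B) (b : B) (w : L), Algebra.FiniteType D B ∧
      (∀ i, aeval X (F i) = 0) ∧
      (∀ j, β (X j) = algebraMap D L (x j) + algebraMap R L π ^ 4 * ν j) ∧
      LiftsAt D B (algebraMap R B π) ∧ β b = 1 + algebraMap R L π * w ∧
      ∀ d, LiftsAt R D d → LiftsAt R B (algebraMap D B d * b) := by
  classical
  obtain ⟨S, q, r0, hS⟩ := hF
  obtain ⟨m, m', hm⟩ := newton_mul_eq hS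
  simp only [map_zero, zero_mul, add_zero] at hS hm
  set M := jac F * S - (C π : MvPolynomial σ R) • (1 : Matrix κ κ (MvPolynomial σ R)) with hM
  let PD := MvPolynomial (σ ⊕ κ) D
  obtain ⟨a, ha⟩ : ∃ a : D, a = algebraMap R D π := ⟨_, rfl⟩
  let ca : PD := C a
  have hca : algebraMap R PD π = ca := by
    rw [IsScalarTower.algebraMap_apply R D PD, ← ha]; rfl
  let Y : σ → PD := fun j => X (Sum.inl j)
  let V : κ → PD := fun k => X (Sum.inr k)
  let xC : σ → PD := fun j => C (x j)
  let η : σ → PD := fun j => ca * Y j + ∑ k, C (aeval x (S j k)) * V k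
  let XX : σ → PD := xC + fun j => ca ^ 2 * η j
  have hxC : ∀ p : MvPolynomial σ R, aeval xC p = (C (aeval x p) : PD) := fun p => by
    have : aeval xC = (IsScalarTower.toAlgHom R D PD).comp (aeval x) := by
      refine MvPolynomial.algHom_ext fun j => ?_
      rw [AlgHom.comp_apply, aeval_X, aeval_X]; rfl
    exact DFunLike.congr_fun this p
  have htay : ∀ i, ∃ r : PD, aeval XX (F i) =
      aeval xC (F i) + ∑ j, aeval xC (pderiv j (F i)) * (ca ^ 2 * η j) + ca ^ 4 * r := fun i => by
    obtain ⟨r, hr⟩ := aeval_add_mul_taylor (F i) xC η (ca ^ 2)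
    exact ⟨r, by rw [hr]; ring⟩
  choose r hr using htay
  choose n hn using fun i k => aeval_add_mul_eq (M i k) xC η (ca ^ 2)
  let Q : κ → PD := fun i => r i - ∑ k, n i k * V k
  let Ψ : κ → PD := fun i =>
    V i + ∑ j, C (aeval x (pderiv j (F i))) * Y j + ca * (C (h i) + Q i)
  let g : κ → PD := fun i => aeval XX (F i)
  have hg : ∀ i, g i = ca ^ 2 * ∑ k, aeval XX (M i k) * V k + ca ^ 3 * Ψ i := fun i => by
    have e1 : ∑ k, aeval XX (M i k) * V k =
        ∑ k, C (aeval x (M i k)) * V k + ca ^ 2 * ∑ k, n i k * V k := by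
      rw [Finset.mul_sum, ← Finset.sum_add_distrib]
      refine Finset.sum_congr rfl fun k _ => ?_
      rw [hn i k, hxC]; ring
    have e2 : ∑ j, aeval xC (pderiv j (F i)) * (ca ^ 2 * η j) =
        ca ^ 3 * ∑ j, C (aeval x (pderiv j (F i))) * Y j +
          ca ^ 2 * ∑ k, C (aeval x ((jac F * S) i k)) * V k := by
      have e3 : ∑ k, (C (aeval x ((jac F * S) i k)) : PD) * V k =
          ∑ j, ∑ k, C (aeval x (pderiv j (F i))) * (C (aeval x (S j k)) * V k) := by
        rw [Finset.sum_comm]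
        refine Finset.sum_congr rfl fun k _ => ?_
        rw [Matrix.mul_apply, map_sum, map_sum, Finset.sum_mul]
        exact Finset.sum_congr rfl fun j _ => by
          rw [map_mul, C_mul, mul_assoc]; rfl
      rw [e3, Finset.mul_sum, Finset.mul_sum, ← Finset.sum_add_distrib]
      refine Finset.sum_congr rfl fun j _ => ?_
      rw [hxC, ← Finset.mul_sum]
      simp only [η]
      ring
    have e4 : ∑ k, (C (aeval x (M i k)) : PD) * V k =
        ∑ k, C (aeval x ((jac F * S) i k)) * V k - ca * V i := by
      have : ∀ k, (C (aeval x (M i k)) : PD) * V k =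
          C (aeval x ((jac F * S) i k)) * V k - if i = k then ca * V k else 0 := fun k => by
        rw [hM, Matrix.sub_apply, Matrix.smul_apply, Matrix.one_apply, map_sub, map_sub, sub_mul]
        split_ifs
        · simp [ca, ha]
        · simp
      simp only [this, Finset.sum_sub_distrib, Finset.sum_ite_eq, Finset.mem_univ, if_true]
    have e5 : aeval xC (F i) = ca ^ 4 * (C (h i) : PD) := by
      rw [hxC, hx, ← ha, C_mul, C_pow]
    have e6 := hr i
    rw [e5, e2] at e6
    rw [e1, e4]
    simp only [g, e6, Ψ, Q]
    ring
  let f0 : κ → PD := fun k => ∑ l, aeval XX (M k l) * V l + ca * Ψ k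
  have hf0 : ∀ k, g k = ca ^ 2 * f0 k := fun k => by rw [hg]; simp only [f0]; ring
  let N : Matrix κ κ PD := Matrix.of fun i l =>
    ∑ k, aeval XX (q i k l) * f0 k - ∑ k, aeval XX (m i k l) * V k
  let A : Matrix κ κ PD := (aeval XX : MvPolynomial σ R →ₐ[R] PD).mapMatrix (jac F * S)
  have hmain : ∀ i, ca * (∑ l, (1 + ca • N) i l * g l - ca ^ 2 * ∑ k, A i k * Ψ k) = 0 := by
    intro i
    have e1 := newton_identity A ((aeval XX : MvPolynomial σ R →ₐ[R] PD).mapMatrix M) g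
      (fun k => ca ^ 2 * V k) Ψ 0 ca (ca ^ 3) 0 (fun i k l => aeval XX (q i k l))
      (fun i k l => aeval XX (m i k l)) 0 (fun i => by
        have := congrArg (aeval XX : MvPolynomial σ R →ₐ[R] PD) (hS i)
        simp only [map_add, map_sum, map_mul] at this
        simp only [mul_zero, zero_mul, add_zero]
        refine Eq.trans this ?_
        rw [← algebraMap_eq, AlgHom.commutes, hca]) (fun i k => by
        have := congrArg (aeval XX : MvPolynomial σ R →ₐ[R] PD) (hm i k)
        simp only [map_sum, map_mul] at this
        simp only [mul_zero, zero_mul, add_zero]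
        rw [← map_mul]
        exact this) i
    have e2 : ∀ k, g k - ∑ l, (aeval XX : MvPolynomial σ R →ₐ[R] PD).mapMatrix M k l *
        (ca ^ 2 * V l) - ca ^ 3 * Ψ k = 0 := fun k => by
      have : ∑ l, (aeval XX : MvPolynomial σ R →ₐ[R] PD).mapMatrix M k l * (ca ^ 2 * V l) =
          ca ^ 2 * ∑ l, aeval XX (M k l) * V l := by
        rw [Finset.mul_sum]
        exact Finset.sum_congr rfl fun l _ => by
          change aeval XX (M k l) * (ca ^ 2 * V l) = _
          ring
      rw [this, hg]; ring
    simp only [e2, mul_zero, Finset.sum_const_zero, zero_mul, add_zero] at e1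
    have e3 : ∀ l, ca * ((1 + ca • N) i l * g l) = ((if i = l then ca else 0) +
        ∑ k, aeval XX (q i k l) * g k - ∑ k, aeval XX (m i k l) * (ca ^ 2 * V k)) * g l := by
      intro l
      have h1 : ∑ k, aeval XX (q i k l) * g k = ca ^ 2 * ∑ k, aeval XX (q i k l) * f0 k := by
        rw [Finset.mul_sum]
        exact Finset.sum_congr rfl fun k _ => by rw [hf0]; ring
      have h2 : ∑ k, aeval XX (m i k l) * (ca ^ 2 * V k) =
          ca ^ 2 * ∑ k, aeval XX (m i k l) * V k := by
        rw [Finset.mul_sum]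
        exact Finset.sum_congr rfl fun k _ => by ring
      rw [h1, h2, Matrix.add_apply, Matrix.smul_apply, Matrix.one_apply, smul_eq_mul]
      simp only [N, Matrix.of_apply]
      split_ifs <;> ring
    rw [mul_sub, Finset.mul_sum]
    simp only [e3]
    linear_combination e1
  have hcoef : ∀ (T : Type) [CommRing T] [Algebra D T] (d : D), LiftsAt R D d →
      IsUnit (algebraMap D T d) → ∀ (χ : PD →ₐ[D] T) (u : PD), ca * u = 0 → χ u = 0 := by
    intro T _ _ d hd hdT χ u hu
    have h1 : MvPolynomial.map (algebraMap D T) u = 0 := by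
      ext e
      rw [coeff_map, coeff_zero]
      refine eq_zero_of_liftsAt hπ hd hdT ?_
      have := congrArg (coeff e) hu
      rwa [coeff_C_mul, coeff_zero, ha] at this
    have h2 : χ = aeval fun i => χ (X i) := by ext i; simp
    rw [h2, aeval_def, eval₂_eq_eval_map, h1, map_zero]
  let I : Ideal PD := Ideal.span (Set.range (Sum.elim Ψ g))
  let B := PD ⧸ I
  let mk : PD →ₐ[D] B := Ideal.Quotient.mkₐ D I
  have hmkΨ : ∀ i, mk (Ψ i) = 0 := fun i =>
    Ideal.Quotient.eq_zero_iff_mem.2 (Ideal.subset_span ⟨Sum.inl i, rfl⟩)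
  have hmkg : ∀ i, mk (g i) = 0 := fun i =>
    Ideal.Quotient.eq_zero_iff_mem.2 (Ideal.subset_span ⟨Sum.inr i, rfl⟩)
  have hIker : ∀ (T : Type) [CommRing T] [Algebra D T] (χ : PD →ₐ[D] T), (∀ i, χ (Ψ i) = 0) →
      (∀ i, χ (g i) = 0) → ∀ p ∈ I, χ p = 0 := by
    intro T _ _ χ h1 h2 p hp
    have : I ≤ RingHom.ker χ := by
      rw [Ideal.span_le]
      rintro _ ⟨i | i, rfl⟩
      · exact h1 i
      · exact h2 i
    exact this hp
  have hXX : ∀ (T : Type) [CommRing T] [Algebra D T] [Algebra R T] [IsScalarTower R D T]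
      (χ : PD →ₐ[D] T) (p : MvPolynomial σ R), χ (aeval XX p) = aeval (fun j => χ (XX j)) p := by
    intro T _ _ _ _ χ p
    have : (χ.restrictScalars R).comp (aeval XX) = aeval fun j => χ (XX j) := by
      ext j; simp
    exact DFunLike.congr_fun this p
  have hcT : ∀ (T : Type) [CommRing T] [Algebra D T] [Algebra R T] [IsScalarTower R D T]
      (χ : PD →ₐ[D] T), χ ca = algebraMap R T π := by
    intro T _ _ _ _ χ
    rw [IsScalarTower.algebraMap_apply R D T, ← ha]
    exact χ.commutes a
  have hXXj : ∀ (T : Type) [CommRing T] [Algebra D T] [Algebra R T] [IsScalarTower R D T]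
      (χ : PD →ₐ[D] T) (j : σ), χ (XX j) = algebraMap D T (x j) + algebraMap R T π ^ 2 *
        (algebraMap R T π * χ (Y j) + ∑ k, algebraMap D T (aeval x (S j k)) * χ (V k)) := by
    intro T _ _ _ _ χ j
    have h1 : ∀ y : D, χ (C y) = algebraMap D T y := fun y => χ.commutes y
    simp only [XX, xC, η, Pi.add_apply, map_add, map_mul, map_sum, map_pow, hcT, h1]
  -- the point of `B` with values in `L`
  let β0 : PD →ₐ[D] L := aeval (Sum.elim (fun j => algebraMap R L π * ν j) 0)
  have hβY : ∀ j, β0 (Y j) = algebraMap R L π * ν j := fun j => aeval_X _ (Sum.inl j)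
  have hβV : ∀ j, β0 (V j) = 0 := fun j => aeval_X _ (Sum.inr j)
  have hβXX : ∀ j, β0 (XX j) = algebraMap D L (x j) + algebraMap R L π ^ 4 * ν j := fun j => by
    rw [hXXj]; simp only [hβY, hβV, mul_zero, Finset.sum_const_zero]; ring
  have hβg : ∀ i, β0 (g i) = 0 := fun i => by
    simp only [g, hXX, hβXX]; exact hz i
  have hβΨ : ∀ i, β0 (Ψ i) = 0 := fun i => by
    have h1 : β0 (Ψ i) = algebraMap R L π *
        (∑ j, β0 (C (aeval x (pderiv j (F i)))) * ν j + β0 (C (h i) + Q i)) := by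
      simp only [Ψ, map_add, map_mul, map_sum, hβY, hβV, hcT, zero_add, mul_add, Finset.mul_sum]
      congr 1
      exact Finset.sum_congr rfl fun _ _ => by ring
    rw [h1]
    refine eq_zero_of_pow_smul (n := 3) hann ?_
    have h2 := congrArg β0 (hg i)
    rw [hβg, map_add, map_mul, map_mul, map_sum] at h2
    simp only [map_mul, hβV, mul_zero, Finset.sum_const_zero, zero_add, map_pow, hcT] at h2
    rw [h1] at h2
    rw [h2]; ring
  let β : B →ₐ[D] L := Ideal.Quotient.liftₐ I β0 (hIker L β0 hβΨ hβg)
  -- smoothness of `Ψ = 0` along `V`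
  let Sel : Matrix (σ ⊕ κ) κ PD := Matrix.of (Sum.elim 0 fun k l => if k = l then 1 else 0)
  have hJ : jac Ψ * Sel = 1 + ca • Matrix.of fun i k => pderiv (Sum.inr k) (Q i) := by
    refine Matrix.ext fun i k => ?_
    have h1 : (jac Ψ * Sel) i k = pderiv (Sum.inr k) (Ψ i) := by
      rw [Matrix.mul_apply, Fintype.sum_sum_type]
      simp only [jac, Sel, Matrix.of_apply, Sum.elim_inl, Sum.elim_inr, Pi.zero_apply, mul_zero,
        Finset.sum_const_zero, zero_add, mul_ite, mul_one, Finset.sum_ite_eq', Finset.mem_univ,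
        if_true]
    rw [h1]
    simp only [Ψ, V, Y, ca, map_add, map_sum, Derivation.leibniz, pderiv_C, pderiv_X, smul_eq_mul,
      Matrix.add_apply, Matrix.smul_apply, Matrix.one_apply, Matrix.of_apply]
    simp [Pi.single_apply, eq_comm]
  obtain ⟨w1, hw1⟩ := det_one_add_smul_eq ca (Matrix.of fun i k => pderiv (Sum.inr k) (Q i))
  obtain ⟨w2, hw2⟩ := det_one_add_smul_eq ca N
  rw [← hJ] at hw1
  let b1 := (jac Ψ * Sel).det
  let b2 := (1 + ca • N).det
  refine ⟨B, inferInstance, inferInstance, inferInstance, inferInstance, β, fun j => mk (XX j),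
    mk (b1 * b2), β0 (w1 + w2 + ca * w1 * w2), inferInstance, fun i => ?_, hβXX, ?_, ?_, ?_⟩
  · rw [← hXX]; exact hmkg i
  · -- lifting where `π` is invertible
    intro T _ _ J _ hJ2 f hf
    let _ : Algebra R T := ((algebraMap D T).comp (algebraMap R D)).toAlgebra
    have : IsScalarTower R D T := IsScalarTower.of_algebraMap_eq fun _ => rfl
    let φ : PD →ₐ[D] T ⧸ J := f.comp mk
    obtain ⟨t, ht⟩ : ∃ t, t = algebraMap R T π := ⟨_, rfl⟩
    have htJ : Ideal.Quotient.mk J t = algebraMap R (T ⧸ J) π := by rw [ht]; rfl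
    have hφca : φ ca = algebraMap R (T ⧸ J) π := hcT _ φ
    have htu : IsUnit t := by
      refine isUnit_of_isUnit_mk hJ2 ?_
      rw [htJ, ← hφca]
      have : mk ca = algebraMap R B π := by
        rw [IsScalarTower.algebraMap_apply R D B, ← ha]; rfl
      change IsUnit (f (mk ca))
      rwa [this]
    have htuJ : IsUnit (algebraMap R (T ⧸ J) π) := by rw [← htJ]; exact htu.map _
    obtain ⟨u, hu⟩ := htu.exists_right_inv
    have hA := Newton.liftsMod (g := Ideal.Quotient.mkₐ R (Ideal.span (Set.range F)))
      (c := C π) (ϖ := 0) Ideal.Quotient.mk_surjective Ideal.mk_ker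
      ⟨S, q, 0, by simpa using hS⟩
    have hφF : ∀ i, aeval (fun j => φ (XX j)) (F i) = 0 := fun i => by
      rw [← hXX]
      change f (mk (g i)) = 0
      rw [hmkg, map_zero]
    obtain ⟨gA, hgA⟩ := hA T J (by rw [Ideal.span_singleton_eq_bot.2 rfl]; exact bot_le) hJ2
      (Ideal.Quotient.liftₐ _ (aeval fun j => φ (XX j)) (fun p hp => by
        have : Ideal.span (Set.range F) ≤
            RingHom.ker (aeval (fun j => φ (XX j)) : MvPolynomial σ R →ₐ[R] T ⧸ J) := by
          rw [Ideal.span_le]; rintro _ ⟨i, rfl⟩; exact hφF i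
        exact this hp)) (by
        have : (Ideal.Quotient.mkₐ R (Ideal.span (Set.range F))) (C π) = algebraMap R _ π := rfl
        rw [this, AlgHom.commutes]
        exact htuJ)
    let x' : σ → T := fun j => gA (Ideal.Quotient.mk _ (X j))
    have hx'g : ∀ p, aeval x' p = gA (Ideal.Quotient.mk _ p) := fun p => by
      have : aeval x' = gA.comp (Ideal.Quotient.mkₐ R _) := by ext j; simp [x']
      exact DFunLike.congr_fun this p
    have hx'F : ∀ i, aeval x' (F i) = 0 := fun i => by
      rw [hx'g, (Ideal.Quotient.eq_zero_iff_mem (I := Ideal.span (Set.range F))).2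
        (Ideal.subset_span ⟨i, rfl⟩), map_zero]
    have hx'J : ∀ p : MvPolynomial σ R, Ideal.Quotient.mk J (aeval x' p) = φ (aeval XX p) :=
      fun p => by
        rw [hx'g, hXX]
        exact DFunLike.congr_fun hgA (Ideal.Quotient.mk _ p)
    have hx'j : ∀ j, Ideal.Quotient.mk J (x' j) = φ (XX j) := fun j => by
      have := hx'J (X j); simpa using this
    choose v hv using fun k => Ideal.Quotient.mk_surjective (φ (V k))
    let v' : κ → T := fun i => u * ∑ k, aeval x' ((jac F * S) i k) * v k
    have hcomm : M * (jac F * S) = jac F * S * M := by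
      rw [hM]; simp [Matrix.mul_sub, Matrix.sub_mul]
    have hMv : ∀ i, ∑ k, aeval x' (M i k) * v' k = 0 := fun i => by
      have h1 : ∑ k, aeval x' (M i k) * v' k = u * ∑ l, aeval x' ((M * (jac F * S)) i l) * v l := by
        simp only [v', Matrix.mul_apply (M := M), map_sum, map_mul, Finset.mul_sum, Finset.sum_mul]
        rw [Finset.sum_comm]
        exact Finset.sum_congr rfl fun _ _ => Finset.sum_congr rfl fun _ _ => by ring
      rw [h1, hcomm]
      simp only [hm, map_sum, map_mul, hx'F, mul_zero, Finset.sum_const_zero, zero_mul]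
    have hφMV : ∀ i, ∑ k, φ (aeval XX (M i k)) * φ (V k) = 0 := fun i => by
      have h1 := congrArg (fun p => f (mk p)) (hg i)
      simp only [hmkg, map_add, map_mul, hmkΨ, mul_zero, add_zero, map_zero, map_sum] at h1
      have h2 : f (mk (ca ^ 2)) = algebraMap R (T ⧸ J) π ^ 2 := by
        rw [map_pow, map_pow]; exact congrArg (· ^ 2) hφca
      rw [h2] at h1
      exact (htuJ.pow 2).mul_right_eq_zero.1 h1.symm
    have hv' : ∀ i, Ideal.Quotient.mk J (v' i) = φ (V i) := fun i => by
      have h1 : ∀ k, φ (aeval XX ((jac F * S) i k)) = φ (aeval XX (M i k)) +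
          if i = k then algebraMap R (T ⧸ J) π else 0 := fun k => by
        have : jac F * S = M + (C π : MvPolynomial σ R) • (1 : Matrix κ κ (MvPolynomial σ R)) := by rw [hM]; abel
        rw [this, Matrix.add_apply, map_add, map_add, Matrix.smul_apply, Matrix.one_apply]
        congr 1
        split_ifs
        · rw [smul_eq_mul, mul_one, ← algebraMap_eq, AlgHom.commutes, hca, hφca]
        · simp
      have h2 : Ideal.Quotient.mk J (v' i) = Ideal.Quotient.mk J u *
          ∑ k, φ (aeval XX ((jac F * S) i k)) * φ (V k) := by
        simp only [v', map_mul, map_sum, hx'J, hv]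
      rw [h2]
      simp only [h1, add_mul, Finset.sum_add_distrib, hφMV, ite_mul, zero_mul,
        Finset.sum_ite_eq, Finset.mem_univ, if_true, zero_add]
      rw [← htJ, ← mul_assoc, ← map_mul, mul_comm u, hu, map_one, one_mul]
    let y' : σ → T := fun j => u ^ 3 * (x' j - algebraMap D T (x j) -
      t ^ 2 * ∑ k, algebraMap D T (aeval x (S j k)) * v' k)
    let χ : PD →ₐ[D] T := aeval (Sum.elim y' v')
    have hχY : ∀ j, χ (Y j) = y' j := fun j => aeval_X _ (Sum.inl j)
    have hχV : ∀ j, χ (V j) = v' j := fun j => aeval_X _ (Sum.inr j)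
    have hχXX : ∀ j, χ (XX j) = x' j := fun j => by
      rw [hXXj, hχY]
      simp only [hχV, ← ht, y']
      linear_combination (x' j - algebraMap D T (x j) -
        t ^ 2 * ∑ k, algebraMap D T (aeval x (S j k)) * v' k) * ((t * u) ^ 2 + t * u + 1) * hu
    have hχg : ∀ i, χ (g i) = 0 := fun i => by
      simp only [g, hXX, hχXX]; exact hx'F i
    have hχΨ : ∀ i, χ (Ψ i) = 0 := fun i => by
      have h1 := congrArg χ (hg i)
      rw [hχg, map_add, map_mul, map_mul, map_sum] at h1
      simp only [map_mul, hχV, hXX, hχXX] at h1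
      rw [hMv, mul_zero, zero_add, map_pow, hcT, ← ht] at h1
      exact (htu.pow 3).mul_right_eq_zero.1 h1.symm
    refine ⟨Ideal.Quotient.liftₐ I χ (hIker T χ hχΨ hχg), ?_⟩
    refine Ideal.Quotient.algHom_ext _ (MvPolynomial.algHom_ext fun i => ?_)
    rcases i with j | k
    · change Ideal.Quotient.mk J (χ (Y j)) = φ (Y j)
      have h1 := hx'j j
      rw [hXXj, ← htJ] at h1
      have h2 : Ideal.Quotient.mk J (algebraMap D T (x j)) = algebraMap D (T ⧸ J) (x j) := rfl
      have h3 : ∀ k, Ideal.Quotient.mk J (algebraMap D T (aeval x (S j k))) =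
        algebraMap D (T ⧸ J) (aeval x (S j k)) := fun _ => rfl
      have h4 : Ideal.Quotient.mk J t * Ideal.Quotient.mk J u = 1 := by
        rw [← map_mul, hu, map_one]
      rw [hχY]
      simp only [y', map_mul, map_sub, map_pow, map_sum, h2, h3, hv', h1]
      generalize Ideal.Quotient.mk J t = t' at *
      generalize Ideal.Quotient.mk J u = u' at *
      linear_combination φ (Y j) * ((t' * u') ^ 2 + t' * u' + 1) * h4
    · change Ideal.Quotient.mk J (χ (V k)) = φ (V k)
      rw [hχV, hv']
  · change β0 (b1 * b2) = _
    have : b1 * b2 = 1 + ca * (w1 + w2 + ca * w1 * w2) := by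
      change (jac Ψ * Sel).det * (1 + ca • N).det = _
      rw [hw1, hw2]; ring
    rw [this, map_add, map_one, map_mul, hcT]
  · -- lifting at the special points
    intro d hd T _ _ J _ hJ2 f hf
    rw [map_mul] at hf
    obtain ⟨gD, hgD⟩ := hd T J bot_le hJ2 (f.comp (IsScalarTower.toAlgHom R D B))
      (isUnit_of_mul_isUnit_left hf)
    let _ : Algebra D T := gD.toRingHom.toAlgebra
    have : IsScalarTower R D T := IsScalarTower.of_algebraMap_eq fun y => (gD.commutes y).symm
    let f' : B →ₐ[D] T ⧸ J :=
      { f.toRingHom with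
        commutes' := fun y => (DFunLike.congr_fun hgD y).symm }
    have hdT : IsUnit (algebraMap D T d) := by
      refine isUnit_of_isUnit_mk hJ2 ?_
      have := DFunLike.congr_fun hgD d
      change Ideal.Quotient.mk J (algebraMap D T d) = f (algebraMap D B d) at this
      rw [this]
      exact isUnit_of_mul_isUnit_left hf
    have hb : IsUnit (f' (mk (b1 * b2))) := isUnit_of_mul_isUnit_right hf
    rw [map_mul, map_mul] at hb
    have hB1 := (newton_det Ψ Sel 0).liftsMod
      (g := Ideal.Quotient.mkₐ D (Ideal.span (Set.range Ψ))) Ideal.Quotient.mk_surjective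
      Ideal.mk_ker
    have hle : ∀ p ∈ Ideal.span (Set.range Ψ), (f'.comp mk) p = 0 := fun p hp => by
      have : Ideal.span (Set.range Ψ) ≤ RingHom.ker mk := by
        rw [Ideal.span_le]; rintro _ ⟨i, rfl⟩; exact hmkΨ i
      rw [AlgHom.comp_apply, this hp, map_zero]
    obtain ⟨g1, hg1⟩ := hB1 T J (by rw [Ideal.span_singleton_eq_bot.2 rfl]; exact bot_le) hJ2
      (Ideal.Quotient.liftₐ _ (f'.comp mk) hle) (isUnit_of_mul_isUnit_left hb)
    let χ : PD →ₐ[D] T := g1.comp (Ideal.Quotient.mkₐ D _)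
    have hχΨ : ∀ i, χ (Ψ i) = 0 := fun i => by
      change g1 (Ideal.Quotient.mk _ (Ψ i)) = 0
      rw [(Ideal.Quotient.eq_zero_iff_mem (I := Ideal.span (Set.range Ψ))).2
        (Ideal.subset_span ⟨i, rfl⟩), map_zero]
    have hχJ : ∀ p, Ideal.Quotient.mk J (χ p) = f' (mk p) := fun p =>
      DFunLike.congr_fun hg1 (Ideal.Quotient.mk _ p)
    have hb2 : IsUnit (χ b2) := by
      refine isUnit_of_isUnit_mk hJ2 ?_
      rw [hχJ]; exact isUnit_of_mul_isUnit_right hb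
    have hlin : ∀ i, ∑ l, χ.mapMatrix (1 + ca • N) i l * χ (g l) = 0 := fun i => by
      have h1 := hcoef T d hd hdT χ _ (hmain i)
      rw [map_sub, map_sum, map_mul, map_sum, sub_eq_zero] at h1
      simp only [map_mul, hχΨ, mul_zero, Finset.sum_const_zero] at h1
      exact h1
    have hχg : ∀ i, χ (g i) = 0 := fun i => by
      have h1 : (χ.mapMatrix (1 + ca • N)).mulVec (fun l => χ (g l)) = 0 := funext hlin
      have h2 : χ b2 * χ (g i) = 0 := by
        have h3 := congrFun (congrArg ((χ.mapMatrix (1 + ca • N)).adjugate.mulVec) h1) i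
        rw [Matrix.mulVec_mulVec, Matrix.adjugate_mul, ← AlgHom.map_det, Matrix.smul_mulVec,
          Matrix.one_mulVec, Matrix.mulVec_zero] at h3
        exact h3
      exact hb2.mul_right_eq_zero.1 h2
    refine ⟨(Ideal.Quotient.liftₐ I χ (hIker T χ hχΨ hχg)).restrictScalars R, ?_⟩
    ext y
    obtain ⟨p, rfl⟩ := Ideal.Quotient.mk_surjective y
    exact hχJ p

end Desing

end

section

open MvPolynomial

theorem exists_presentation (R A : Type) [CommRing R] [IsNoetherianRing R] [CommRing A] [Algebra R A]
    [Algebra.FiniteType R A] : ∃ (n r : ℕ) (g : MvPolynomial (Fin n) R →ₐ[R] A)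
      (G : Fin r → MvPolynomial (Fin n) R), Function.Surjective g ∧
      RingHom.ker g = Ideal.span (Set.range G) := by
  obtain ⟨n, g, hg⟩ := (Algebra.FiniteType.iff_quotient_mvPolynomial'' (R := R)
    (S := A)).mp inferInstance
  obtain ⟨r, G, hG⟩ := Submodule.fg_iff_exists_fin_generating_family.1
    (IsNoetherian.noetherian (RingHom.ker g))
  exact ⟨n, r, g, G, hg, hG.symm⟩

/-- One step of desingularization: a solution modulo `π ^ 5` which is smooth modulo `π ^ 5` is
lifted to a smooth solution. -/
theorem desing_step {R L L' Cb σ κ : Type} [CommRing R] [IsNoetherianRing R] {π : R}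
    (hπ : π ∈ nonZeroDivisors R) [CommRing L] [Algebra R L]
    (hann : ∀ l : L, algebraMap R L π ^ 2 * l = 0 → algebraMap R L π * l = 0)
    [CommRing L'] [Algebra R L'] (lam : L →ₐ[R] L') (hlam : Function.Surjective lam)
    (hker : ∀ l, lam l = 0 → ∃ l', l = algebraMap R L π ^ 5 * l')
    [Fintype σ] [Fintype κ] {F : κ → MvPolynomial σ R} (hF : Newton F (C π) 0) (z : σ → L)
    (hz : ∀ k, aeval z (F k) = 0) [CommRing Cb] [Algebra R Cb] [Algebra.FiniteType R Cb]
    (ψ : Cb →ₐ[R] L') (x : σ → Cb) (hx : ∀ k, aeval x (F k) = 0)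
    (hxz : ∀ j, ψ (x j) = lam (z j)) :
    ∃ (B : Type) (_ : CommRing B) (_ : Algebra R B) (β : B →ₐ[R] L) (X : σ → B),
      Algebra.FiniteType R B ∧ (∀ k, aeval X (F k) = 0) ∧ (∀ j, β (X j) = z j) ∧
      ∀ q : Ideal L, q.IsPrime → (algebraMap R L π ∉ q ∨ ∃ c : Cb,
        LiftsMod R (Ideal.span {π ^ 5}) Cb c ∧ ∀ c', lam c' = ψ c → c' ∉ q) →
        ∃ b, LiftsAt R B b ∧ β b ∉ q := by
  classical
  obtain ⟨n, r, g, G, hg, hgker⟩ := exists_presentation R Cb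
  obtain ⟨t, ht⟩ : ∃ t, t = algebraMap R L π := ⟨_, rfl⟩
  rw [← ht] at hann
  choose zC hzC using fun i => hlam (ψ (g (X i)))
  have hlamz : ∀ p, lam (aeval zC p) = ψ (g p) := fun p => by
    have : lam.comp (aeval zC) = ψ.comp g := by
      refine MvPolynomial.algHom_ext fun i => ?_
      simp [hzC]
    exact DFunLike.congr_fun this p
  have hgG : ∀ k, g (G k) = 0 := fun k => by
    have : G k ∈ RingHom.ker g := by rw [hgker]; exact Ideal.subset_span ⟨k, rfl⟩
    exact this
  have hμ : ∀ k, ∃ μ, aeval zC (G k) = t ^ 5 * μ := fun k => by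
    rw [ht]; exact hker _ (by rw [hlamz, hgG, map_zero])
  choose μ hμ using hμ
  let δ0 : MvPolynomial (Fin n ⊕ Fin r) R →ₐ[R] L := aeval (Sum.elim zC fun k => t * μ k)
  have hδr : ∀ p, δ0 (rename Sum.inl p) = aeval zC p := fun p => by
    simp only [δ0, aeval_rename]; rfl
  have hδC : δ0 (C π) = t := by rw [← algebraMap_eq, AlgHom.commutes, ht]
  have hδX : ∀ k, δ0 (X (Sum.inr k)) = t * μ k := fun k => aeval_X _ _
  have hδE : ∀ k, δ0 (dilEq G π k) = 0 := fun k => by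
    rw [dilEq, map_sub, hδr, map_mul, C_pow, map_pow, hδC, hδX, hμ]; ring
  have hδI : ∀ p ∈ dilIdeal G π, δ0 p = 0 := by
    rintro p ⟨⟨j, hj⟩, hp⟩
    have h1 : Ideal.span (Set.range (dilEq G π)) ≤ RingHom.ker δ0 := by
      rw [Ideal.span_le]; rintro _ ⟨k, rfl⟩; exact hδE k
    have h2 : t ^ j * δ0 p = 0 := by
      have := h1 hj
      rwa [RingHom.mem_ker, map_mul, map_pow, hδC] at this
    have h3 : δ0 p ∈ Ideal.span {t} := by
      have h4 : Ideal.span {C π} ⊔ Ideal.span (Set.range fun k => X (Sum.inr k)) ⊔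
          Ideal.span (Set.range fun k => rename Sum.inl (G k)) ≤ (Ideal.span {t}).comap δ0 := by
        have ht' : t ∈ Ideal.span {t} := Ideal.subset_span rfl
        refine sup_le (sup_le ?_ ?_) ?_ <;> rw [Ideal.span_le]
        · rintro _ rfl
          change δ0 (C π) ∈ Ideal.span {t}
          rw [hδC]; exact ht'
        · rintro _ ⟨k, rfl⟩
          change δ0 (X (Sum.inr k)) ∈ Ideal.span {t}
          rw [hδX]; exact Ideal.mul_mem_right _ _ ht'
        · rintro _ ⟨k, rfl⟩
          change δ0 (rename Sum.inl (G k)) ∈ Ideal.span {t}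
          rw [hδr, hμ, pow_succ', mul_assoc]; exact Ideal.mul_mem_right _ _ ht'
      exact h4 hp
    obtain ⟨l, hl⟩ := Ideal.mem_span_singleton'.1 h3
    rw [← hl, mul_comm] at h2 ⊢
    refine eq_zero_of_pow_smul (n := j) hann ?_
    rw [pow_succ']
    linear_combination h2
  let δ : Dil G π →ₐ[R] L := Ideal.Quotient.liftₐ _ δ0 hδI
  have hδmk : ∀ p, δ (Ideal.Quotient.mk _ p) = δ0 p := fun _ => rfl
  choose p hp using fun j => hg (x j)
  let x0 : σ → Dil G π := fun j => Ideal.Quotient.mk _ (rename Sum.inl (p j))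
  have hx0 : ∀ P : MvPolynomial σ R, aeval x0 P =
      Ideal.Quotient.mk (dilIdeal G π) (rename Sum.inl (aeval p P)) := fun P => by
    have : aeval x0 = (Ideal.Quotient.mkₐ R (dilIdeal G π)).comp
        ((rename Sum.inl).comp (aeval p)) := by
      refine MvPolynomial.algHom_ext fun i => ?_
      simp [x0]
    exact DFunLike.congr_fun this P
  have hh : ∀ i, ∃ h, aeval x0 (F i) = algebraMap R (Dil G π) π ^ 4 * h := fun i => by
    have h1 : aeval p (F i) ∈ RingHom.ker g := by
      have : g.comp (aeval p) = aeval x := by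
        refine MvPolynomial.algHom_ext fun i => ?_
        simp [hp]
      exact (DFunLike.congr_fun this (F i)).trans (hx i)
    rw [hgker] at h1
    obtain ⟨e, he⟩ := Ideal.mem_span_range_iff_exists_fun.1 h1
    refine ⟨∑ k, Ideal.Quotient.mk _ (rename Sum.inl (e k)) * Ideal.Quotient.mk _ (X (Sum.inr k)),
      ?_⟩
    rw [hx0, ← he, map_sum, map_sum, Finset.mul_sum]
    refine Finset.sum_congr rfl fun k _ => ?_
    rw [map_mul, map_mul, dil_eq]; ring
  choose h hh using hh
  have hν : ∀ j, ∃ ν, z j = δ (x0 j) + t ^ 4 * (t * ν) := fun j => by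
    obtain ⟨ν, hν⟩ := hker (z j - δ (x0 j)) (by
      rw [map_sub, hδmk, hδr, hlamz, hp, hxz, sub_self])
    exact ⟨ν, by rw [← ht] at hν; linear_combination hν⟩
  choose ν hν using hν
  let _ : Algebra (Dil G π) L := δ.toRingHom.toAlgebra
  have : IsScalarTower R (Dil G π) L := IsScalarTower.of_algebraMap_eq fun y => (δ.commutes y).symm
  obtain ⟨B, _, _, _, _, β, X', b, w, hBft, hX, hβX, hBπ, hβb, hBd⟩ :=
    desing (L := L) hπ (by rw [← ht]; exact hann) hF x0 h hh (fun j => t * ν j) (fun i => by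
      rw [← hz i]
      congr 2
      funext j
      rw [hν, ht]; rfl)
  refine ⟨B, inferInstance, inferInstance, β.restrictScalars R, X', .trans inferInstance hBft, hX,
    fun j => ?_, ?_⟩
  · have h1 := hβX j
    rw [← ht] at h1
    rw [hν]; exact h1
  intro q hq hcase
  have hcase' : algebraMap R L π ∉ q ∨ algebraMap R L π ∈ q ∧ ∃ c : Cb,
      LiftsMod R (Ideal.span {π ^ 5}) Cb c ∧ ∀ c', lam c' = ψ c → c' ∉ q := by tauto
  rcases hcase' with hπq | ⟨hπq, c, hc, hcq⟩
  · refine ⟨_, LiftsMod.comp (dil_liftsAt_base G π) hBπ, ?_⟩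
    rw [map_mul, ← IsScalarTower.algebraMap_apply, AlgHom.commutes]
    exact fun hmem => (hq.mem_or_mem hmem).elim hπq hπq
  · obtain ⟨c0, rfl⟩ := hg c
    obtain ⟨M, hM⟩ := LiftsMod.exists_newton hg hgker hc
    obtain ⟨Q, hQ, hlift⟩ := dil_liftsAt_newton hπ hM
    refine ⟨_, hBd _ hlift, ?_⟩
    have hc0 : aeval zC c0 ∉ q := hcq _ (hlamz c0)
    change β _ ∉ q
    rw [map_mul, AlgHom.commutes]
    have e1 : algebraMap (Dil G π) L (Ideal.Quotient.mk _ (rename Sum.inl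
        ((c0 ^ M) ^ Fintype.card (Fin r) *
          (Matrix.of fun i l => (if i = l then c0 ^ M else 0) + Q i l).det))) =
        aeval zC ((c0 ^ M) ^ Fintype.card (Fin r) *
          (Matrix.of fun i l => (if i = l then c0 ^ M else 0) + Q i l).det) := hδr _
    rw [e1, hβb, ← Ideal.Quotient.eq_zero_iff_mem]
    have hmkπ : Ideal.Quotient.mk q (algebraMap R L π) = 0 := Ideal.Quotient.eq_zero_iff_mem.2 hπq
    have hQ0 : ∀ i l, Ideal.Quotient.mk q (aeval zC (Q i l)) = 0 := fun i l => by
      have h4 : Ideal.span (Set.range G) ≤ RingHom.ker ((Ideal.Quotient.mkₐ R q).comp (aeval zC)) := by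
        rw [Ideal.span_le]
        rintro _ ⟨k, rfl⟩
        change Ideal.Quotient.mk q (aeval zC (G k)) = 0
        rw [hμ, map_mul, map_pow, ht, hmkπ]; simp
      exact h4 (hQ i l)
    have hdet : Ideal.Quotient.mk q (aeval zC (Matrix.of fun i l =>
        (if i = l then c0 ^ M else 0) + Q i l).det) =
        (Ideal.Quotient.mk q (aeval zC c0) ^ M) ^ Fintype.card (Fin r) := by
      rw [AlgHom.map_det, RingHom.map_det]
      have : (Ideal.Quotient.mk q).mapMatrix ((aeval zC).mapMatrix (Matrix.of fun i l =>
          (if i = l then c0 ^ M else 0) + Q i l)) =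
          (Ideal.Quotient.mk q (aeval zC c0) ^ M) • (1 : Matrix (Fin r) (Fin r) (L ⧸ q)) := by
        ext i l
        simp only [RingHom.mapMatrix_apply, AlgHom.mapMatrix_apply, Matrix.map_apply,
          Matrix.of_apply, map_add, hQ0, add_zero, Matrix.smul_apply, Matrix.one_apply]
        split_ifs <;> simp
      rw [this, Matrix.det_smul, Matrix.det_one, mul_one]
    rw [map_mul, map_mul, map_mul, hdet, map_add, map_mul, hmkπ, zero_mul, map_one, add_zero,
      mul_one, map_pow, map_pow, map_pow, map_pow]
    have hne : Ideal.Quotient.mk q (aeval zC c0) ≠ 0 := fun h0 =>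
      hc0 (Ideal.Quotient.eq_zero_iff_mem.1 h0)
    exact mul_ne_zero (pow_ne_zero _ (pow_ne_zero _ hne)) (pow_ne_zero _ (pow_ne_zero _ hne))

end

section

open MvPolynomial

section Transfer

theorem LiftsMod.of_surjective {R₀ R B : Type} [CommRing R₀] [CommRing R] [Algebra R₀ R]
    (hR : Function.Surjective (algebraMap R₀ R)) [CommRing B] [Algebra R₀ B] [Algebra R B]
    [IsScalarTower R₀ R B] {𝔟 : Ideal R₀} {b : B} (h : LiftsMod R₀ 𝔟 B b) :
    LiftsMod R (𝔟.map (algebraMap R₀ R)) B b := by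
  intro T _ _ J h𝔟 hJ f hf
  let _ : Algebra R₀ T := ((algebraMap R T).comp (algebraMap R₀ R)).toAlgebra
  have : IsScalarTower R₀ R T := IsScalarTower.of_algebraMap_eq fun _ => rfl
  obtain ⟨g, hg⟩ := h T J (fun y hy => h𝔟 (Ideal.mem_map_of_mem _ hy)) hJ (f.restrictScalars R₀) hf
  refine ⟨{ g.toRingHom with commutes' := fun r => ?_ }, ?_⟩
  · obtain ⟨r, rfl⟩ := hR r
    change g (algebraMap R B (algebraMap R₀ R r)) = _
    rw [← IsScalarTower.algebraMap_apply, g.commutes]; rfl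
  · ext x
    exact DFunLike.congr_fun hg x

theorem LiftsAt.liftsMod_of_surjective {R₀ R B : Type} [CommRing R₀] [CommRing R] [Algebra R₀ R]
    (hR : Function.Surjective (algebraMap R₀ R)) [CommRing B] [Algebra R₀ B] [Algebra R B]
    [IsScalarTower R₀ R B] {b : B} (h : LiftsAt R B b) :
    LiftsMod R₀ (RingHom.ker (algebraMap R₀ R)) B b := by
  intro T _ _ J h𝔟 hJ f hf
  let _ : Algebra R T := (RingHom.liftOfSurjective (algebraMap R₀ R) hR
    ⟨algebraMap R₀ T, h𝔟⟩).toAlgebra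
  have : IsScalarTower R₀ R T := IsScalarTower.of_algebraMap_eq fun r =>
    (RingHom.liftOfRightInverse_comp_apply _ _ (Function.rightInverse_surjInv hR)
      ⟨algebraMap R₀ T, h𝔟⟩ r).symm
  let f' : B →ₐ[R] T ⧸ J :=
    { f.toRingHom with
      commutes' := fun r => by
        obtain ⟨r, rfl⟩ := hR r
        change f (algebraMap R B (algebraMap R₀ R r)) = _
        rw [← IsScalarTower.algebraMap_apply, f.commutes, ← IsScalarTower.algebraMap_apply] }
  obtain ⟨g, hg⟩ := h T J bot_le hJ f' hf
  exact ⟨g.restrictScalars R₀, AlgHom.ext fun x => DFunLike.congr_fun hg x⟩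

end Transfer

section Chain

variable {R₀ Λ σ κ : Type} [CommRing R₀] [CommRing Λ] [Algebra R₀ Λ]

/-- The system `F` with solution `z` in `Λ` is solved modulo `𝔞` through an algebra which is smooth
modulo `𝔞` at the points of `𝒢`. -/
def SolvedMod (F : κ → MvPolynomial σ R₀) (z : σ → Λ) (𝒢 : Set (Ideal Λ)) (𝔞 : Ideal R₀) : Prop :=
  ∃ (B : Type) (_ : CommRing B) (_ : Algebra R₀ B)
    (β : B →ₐ[R₀] Λ ⧸ 𝔞.map (algebraMap R₀ Λ)) (X : σ → B),
    Algebra.FiniteType R₀ B ∧ 𝔞 ≤ RingHom.ker (algebraMap R₀ B) ∧ (∀ k, aeval X (F k) = 0) ∧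
    (∀ j, β (X j) = Ideal.Quotient.mk _ (z j)) ∧
    ∀ q ∈ 𝒢, q.IsPrime → 𝔞.map (algebraMap R₀ Λ) ≤ q →
      ∃ b, LiftsMod R₀ 𝔞 B b ∧ ∀ c, Ideal.Quotient.mk _ c = β b → c ∉ q

theorem Newton.map {R₀ R σ κ : Type} [CommRing R₀] [CommRing R] [Fintype σ] [Fintype κ]
    (f : R₀ →+* R) {F : κ → MvPolynomial σ R₀} {c : MvPolynomial σ R₀} (h : Newton F c 0) :
    Newton (fun k => MvPolynomial.map f (F k)) (MvPolynomial.map f c) 0 := by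
  obtain ⟨S, q, r, hS⟩ := h
  refine ⟨S.map (MvPolynomial.map f), fun i k l => MvPolynomial.map f (q i k l), 0,
    fun i => ?_⟩
  have h1 := congrArg (MvPolynomial.map f) (hS i)
  simp only [map_add, map_sum, map_mul, map_zero, zero_mul, add_zero] at h1
  simp only [map_zero, zero_mul, add_zero]
  rw [← h1]
  refine Finset.sum_congr rfl fun k _ => ?_
  congr 1
  rw [Matrix.mul_apply, Matrix.mul_apply, map_sum]
  refine Finset.sum_congr rfl fun j _ => ?_
  rw [map_mul]
  congr 1
  simp [jac, pderiv_map]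

theorem SolvedMod.of_sup [IsNoetherianRing R₀] [Fintype σ] [Fintype κ]
    {F : κ → MvPolynomial σ R₀} {z : σ → Λ}
    {𝒢 : Set (Ideal Λ)} {𝔞 : Ideal R₀} {π : R₀} (hF : Newton F (C π) 0)
    (hz : ∀ k, aeval z (F k) = 0)
    (hreg : ∀ y, π * y ∈ 𝔞 → y ∈ 𝔞)
    (hann : ∀ l : Λ, algebraMap R₀ Λ π ^ 2 * l ∈ 𝔞.map (algebraMap R₀ Λ) →
      algebraMap R₀ Λ π * l ∈ 𝔞.map (algebraMap R₀ Λ))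
    (h : SolvedMod F z 𝒢 (𝔞 ⊔ Ideal.span {π ^ 5})) : SolvedMod F z 𝒢 𝔞 := by
  obtain ⟨𝔟, h𝔟⟩ : ∃ 𝔟, 𝔟 = 𝔞 ⊔ Ideal.span {π ^ 5} := ⟨_, rfl⟩
  rw [← h𝔟] at h
  obtain ⟨Cb, _, _, ψ, x, hft, hker, hx, hxz, hsm⟩ := h
  let R := R₀ ⧸ 𝔞
  let L := Λ ⧸ 𝔞.map (algebraMap R₀ Λ)
  let L' := Λ ⧸ 𝔟.map (algebraMap R₀ Λ)
  have hle : 𝔞 ≤ 𝔟 := h𝔟 ▸ le_sup_left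
  have h1 : ∀ y ∈ 𝔞, algebraMap R₀ L y = 0 := fun y hy =>
    Ideal.Quotient.eq_zero_iff_mem.2 (Ideal.mem_map_of_mem (algebraMap R₀ Λ) hy)
  have h2 : ∀ y ∈ 𝔞, algebraMap R₀ L' y = 0 := fun y hy =>
    Ideal.Quotient.eq_zero_iff_mem.2 (Ideal.mem_map_of_mem (algebraMap R₀ Λ) (hle hy))
  have h3 : ∀ y ∈ 𝔞, algebraMap R₀ Cb y = 0 := fun y hy => hker (hle hy)
  let _ : Algebra R L := (Ideal.Quotient.lift 𝔞 (algebraMap R₀ L) h1).toAlgebra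
  let _ : Algebra R L' := (Ideal.Quotient.lift 𝔞 (algebraMap R₀ L') h2).toAlgebra
  let _ : Algebra R Cb := (Ideal.Quotient.lift 𝔞 (algebraMap R₀ Cb) h3).toAlgebra
  have t1 : IsScalarTower R₀ R L := IsScalarTower.of_algebraMap_eq fun _ => rfl
  have t2 : IsScalarTower R₀ R L' := IsScalarTower.of_algebraMap_eq fun _ => rfl
  have t3 : IsScalarTower R₀ R Cb := IsScalarTower.of_algebraMap_eq fun _ => rfl
  have hmk : Function.Surjective (algebraMap R₀ R) := Ideal.Quotient.mk_surjective
  have up : ∀ {U W : Type} [CommRing U] [CommRing W] [Algebra R₀ U] [Algebra R U]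
      [IsScalarTower R₀ R U] [Algebra R₀ W] [Algebra R W] [IsScalarTower R₀ R W]
      (f : U →ₐ[R₀] W) (r : R), f (algebraMap R U r) = algebraMap R W r := by
    intro U W _ _ _ _ _ _ _ _ f r
    obtain ⟨r, rfl⟩ := hmk r
    rw [← IsScalarTower.algebraMap_apply, f.commutes, ← IsScalarTower.algebraMap_apply]
  let lam0 : L →ₐ[R₀] L' := Ideal.Quotient.factorₐ R₀ (Ideal.map_mono hle)
  let lam : L →ₐ[R] L' := { lam0.toRingHom with commutes' := up lam0 }
  let ψ' : Cb →ₐ[R] L' := { ψ.toRingHom with commutes' := up ψ }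
  have hft' : Algebra.FiniteType R Cb := .of_restrictScalars_finiteType R₀ R Cb
  have hπ : algebraMap R₀ R π ∈ nonZeroDivisors R := by
    rw [mem_nonZeroDivisors_iff_right]
    intro y hy
    obtain ⟨y, rfl⟩ := hmk y
    rw [← map_mul, mul_comm] at hy
    exact Ideal.Quotient.eq_zero_iff_mem.2 (hreg y (Ideal.Quotient.eq_zero_iff_mem.1 hy))
  have hπL : algebraMap R L (algebraMap R₀ R π) =
      Ideal.Quotient.mk (𝔞.map (algebraMap R₀ Λ)) (algebraMap R₀ Λ π) := rfl
  have hF' := hF.map (algebraMap R₀ R)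
  rw [map_C] at hF'
  have haev : ∀ {U : Type} [CommRing U] [Algebra R₀ U] [Algebra R U]
      [IsScalarTower R₀ R U] (y : σ → U) (p : MvPolynomial σ R₀),
      aeval y (MvPolynomial.map (algebraMap R₀ R) p) = aeval y p := by
    intro U _ _ _ _ y p
    rw [aeval_map_algebraMap]
  obtain ⟨B, _, _, β, X, hBft, hX, hβX, hBsm⟩ := desing_step (L := L) (L' := L') (Cb := Cb) hπ
    (fun l hl => by
      obtain ⟨l, rfl⟩ := Ideal.Quotient.mk_surjective l
      rw [hπL, ← map_pow, ← map_mul, Ideal.Quotient.eq_zero_iff_mem] at hl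
      rw [hπL, ← map_mul, Ideal.Quotient.eq_zero_iff_mem]
      exact hann l hl) lam (Ideal.Quotient.factor_surjective (Ideal.map_mono hle))
    (fun l hl => by
      obtain ⟨l, rfl⟩ := Ideal.Quotient.mk_surjective l
      have h4 : l ∈ 𝔟.map (algebraMap R₀ Λ) := Ideal.Quotient.eq_zero_iff_mem.1 hl
      rw [h𝔟, Ideal.map_sup, Ideal.map_span, Set.image_singleton] at h4
      obtain ⟨a, ha, b, hb, rfl⟩ := Submodule.mem_sup.1 h4
      obtain ⟨c, rfl⟩ := Ideal.mem_span_singleton'.1 hb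
      refine ⟨Ideal.Quotient.mk _ c, ?_⟩
      rw [hπL, map_add, Ideal.Quotient.eq_zero_iff_mem.2 ha, zero_add, map_mul, map_pow, map_pow,
        mul_comm]) hF' (fun j => Ideal.Quotient.mk _ (z j)) (fun k => by
      rw [haev]
      have h5 : aeval (fun j => Ideal.Quotient.mk (𝔞.map (algebraMap R₀ Λ)) (z j)) (F k) =
          Ideal.Quotient.mkₐ R₀ _ (aeval z (F k)) := by
        rw [← AlgHom.comp_apply]
        congr 1
        refine MvPolynomial.algHom_ext fun i => ?_
        simp
      rw [h5, hz, map_zero]) ψ' x (fun k => by rw [haev, hx]) hxz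
  let _ : Algebra R₀ B := ((algebraMap R B).comp (algebraMap R₀ R)).toAlgebra
  have t4 : IsScalarTower R₀ R B := IsScalarTower.of_algebraMap_eq fun _ => rfl
  have hfR : Algebra.FiniteType R₀ R := .of_surjective (Algebra.ofId R₀ R) hmk
  refine ⟨B, inferInstance, inferInstance, β.restrictScalars R₀, X, .trans hfR hBft,
    fun y hy => ?_, fun k => by rw [← haev]; exact hX k, hβX, fun q hq𝒢 hq hqa => ?_⟩
  · change algebraMap R B (Ideal.Quotient.mk 𝔞 y) = 0
    rw [Ideal.Quotient.eq_zero_iff_mem.2 hy, map_zero]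
  · let qL : Ideal L := q.map (Ideal.Quotient.mk _)
    have hqL : qL.IsPrime := Ideal.map_isPrime_of_surjective Ideal.Quotient.mk_surjective
      (by rw [Ideal.mk_ker]; exact hqa)
    have hmem : ∀ y : Λ, (Ideal.Quotient.mk _ y : L) ∈ qL ↔ y ∈ q := fun y => by
      constructor
      · intro hy
        have := Ideal.mem_comap.2 hy
        rw [Ideal.comap_map_of_surjective _ Ideal.Quotient.mk_surjective, ← RingHom.ker_eq_comap_bot,
          Ideal.mk_ker, sup_eq_left.2 hqa] at this
        exact this
      · exact Ideal.mem_map_of_mem _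
    obtain ⟨b, hb, hbq⟩ := hBsm qL hqL (by
      by_cases hπq : algebraMap R₀ Λ π ∈ q
      · right
        obtain ⟨c, hc, hcq⟩ := hsm q hq𝒢 hq (by
          rw [h𝔟, Ideal.map_sup, Ideal.map_span, Set.image_singleton, map_pow]
          exact sup_le hqa ((Ideal.span_singleton_le_iff_mem _).2
            (Ideal.pow_mem_of_mem _ hπq _ (by norm_num))))
        refine ⟨c, ?_, fun c' hc' => ?_⟩
        · have := hc.of_surjective hmk
          rw [h𝔟, Ideal.map_sup, Ideal.map_span, Set.image_singleton, map_pow] at this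
          have h6 : 𝔞.map (algebraMap R₀ R) = ⊥ := Ideal.map_quotient_self 𝔞
          rwa [h6, bot_sup_eq] at this
        · obtain ⟨c', rfl⟩ := Ideal.Quotient.mk_surjective c'
          rw [hmem]
          exact hcq c' hc'
      · left
        rw [hπL, hmem]; exact hπq)
    refine ⟨b, ?_, fun c hc hcq => hbq ?_⟩
    · have := hb.liftsMod_of_surjective (R₀ := R₀) hmk
      rwa [show RingHom.ker (algebraMap R₀ R) = 𝔞 from Ideal.mk_ker] at this
    · rw [show β b = Ideal.Quotient.mk _ c from hc.symm]
      exact (hmem c).2 hcq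

/-- The ideal generated by given powers of the first `k` elements of a family. -/
def powIdeal {d : ℕ} (T : Fin d → R₀) (e : Fin d → ℕ) (k : ℕ) : Ideal R₀ :=
  Ideal.span ((fun j => T j ^ e j) '' {j | j.val < k})

theorem powIdeal_succ {d : ℕ} (T : Fin d → R₀) (e : Fin d → ℕ) (i : Fin d) (v : ℕ) :
    powIdeal T (Function.update e i v) (i.val + 1) =
      powIdeal T e i.val ⊔ Ideal.span {T i ^ v} := by
  rw [powIdeal, powIdeal, ← Ideal.span_union]
  congr 1
  ext y
  simp only [Set.mem_image, Set.mem_ofPred_eq, Set.mem_union, Set.mem_singleton_iff]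
  constructor
  · rintro ⟨j, hj, rfl⟩
    by_cases hji : j = i
    · subst hji; right; simp
    · left
      refine ⟨j, ?_, by rw [Function.update_of_ne hji]⟩
      have : j.val ≠ i.val := fun h => hji (Fin.ext h)
      omega
  · rintro (⟨j, hj, rfl⟩ | rfl)
    · refine ⟨j, by omega, ?_⟩
      rw [Function.update_of_ne]
      rintro rfl
      exact lt_irrefl _ hj
    · exact ⟨i, by omega, by simp⟩

theorem exists_annihilator_stable [IsNoetherianRing Λ] (I : Ideal Λ) (t : Λ) (K : ℕ) :
    ∃ M : ℕ, K < M ∧ ∀ l, (t ^ M) ^ 2 * l ∈ I → t ^ M * l ∈ I := by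
  let A : ℕ →o Ideal Λ :=
    { toFun := fun n => I.colon {t ^ n}
      monotone' := by
        intro a b hab l hl
        rw [Submodule.mem_colon_singleton, smul_eq_mul] at hl ⊢
        obtain ⟨c, rfl⟩ := Nat.exists_eq_add_of_le hab
        rw [pow_add, ← mul_assoc]
        exact I.mul_mem_right _ hl }
  obtain ⟨n, hn⟩ := monotone_stabilizes_iff_noetherian.2 (inferInstance : IsNoetherian Λ Λ) A
  refine ⟨n + K + 1, by omega, fun l hl => ?_⟩
  have h1 : l ∈ A (2 * (n + K + 1)) := by
    change l ∈ I.colon {t ^ _}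
    rw [Submodule.mem_colon_singleton, smul_eq_mul, mul_comm, mul_comm 2, pow_mul]
    exact hl
  rw [← hn _ (by omega), hn (n + K + 1) (by omega)] at h1
  change l ∈ I.colon {t ^ _} at h1
  rw [Submodule.mem_colon_singleton, smul_eq_mul, mul_comm] at h1
  exact h1

theorem SolvedMod.chain [IsNoetherianRing R₀] [IsNoetherianRing Λ] [Fintype σ] [Fintype κ]
    {F : κ → MvPolynomial σ R₀} {z : σ → Λ} (hz : ∀ k, aeval z (F k) = 0)
    {𝒢 : Set (Ideal Λ)} {d : ℕ} (T : Fin d → R₀) (K : ℕ) (hF : ∀ i, Newton F (C (T i ^ K)) 0)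
    (hreg : ∀ i e y, T i * y ∈ powIdeal T e i.val → y ∈ powIdeal T e i.val)
    (hbot : ∀ e : Fin d → ℕ, (∀ i, 0 < e i) → SolvedMod F z 𝒢 (powIdeal T e d)) :
    SolvedMod F z 𝒢 ⊥ := by
  have key : ∀ k ≤ d, ∃ e : Fin d → ℕ, (∀ i, 0 < e i) ∧
      (SolvedMod F z 𝒢 (powIdeal T e k) → SolvedMod F z 𝒢 ⊥) := by
    intro k
    induction k with
    | zero =>
      refine fun _ => ⟨1, fun _ => one_pos, fun h => ?_⟩
      have : powIdeal T 1 0 = ⊥ := by simp [powIdeal]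
      rwa [this] at h
    | succ k ih =>
      intro hk
      obtain ⟨e, he, hsol⟩ := ih (by omega)
      let i : Fin d := ⟨k, by omega⟩
      obtain ⟨M, hKM, hM⟩ := exists_annihilator_stable ((powIdeal T e k).map (algebraMap R₀ Λ))
        (algebraMap R₀ Λ (T i)) K
      refine ⟨Function.update e i (M * 5), fun j => ?_, fun h => hsol ?_⟩
      · by_cases hji : j = i
        · subst hji; simp; omega
        · rw [Function.update_of_ne hji]; exact he j
      · rw [powIdeal_succ T e i, pow_mul] at h
        refine SolvedMod.of_sup (π := T i ^ M) ?_ hz (fun y hy => ?_) (fun l hl => ?_) h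
        · obtain ⟨c, rfl⟩ := Nat.exists_eq_add_of_le hKM.le
          rw [pow_add, mul_comm, C_mul]
          exact (hF i).mul_left _
        · clear hM h hKM
          induction M with
          | zero => simpa using hy
          | succ M ihM =>
            rw [pow_succ', mul_assoc] at hy
            exact ihM (hreg i e _ hy)
        · rw [map_pow] at hl ⊢
          exact hM l hl
  obtain ⟨e, he, hsol⟩ := key d le_rfl
  exact hsol (hbot e he)

end Chain

end

section

open MvPolynomial

section PowIdeal

variable {R : Type} [CommRing R] {d : ℕ}

theorem mem_powIdeal_X_iff {e : Fin d → ℕ} {k : ℕ} {p : MvPolynomial (Fin d) R} :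
    p ∈ powIdeal (X : Fin d → MvPolynomial (Fin d) R) e k ↔
      ∀ m ∈ p.support, ∃ j : Fin d, j.val < k ∧ e j ≤ m j := by
  have h : powIdeal (X : Fin d → MvPolynomial (Fin d) R) e k =
      Ideal.span ((fun s => monomial s (1 : R)) ''
        ((fun j => Finsupp.single j (e j)) '' {j : Fin d | j.val < k})) := by
    rw [powIdeal, Set.image_image]
    simp only [X_pow_eq_monomial]
  rw [h, mem_ideal_span_monomial_image]
  simp only [Set.exists_mem_image, Set.mem_ofPred_eq, Finsupp.single_le_iff]

theorem mem_powIdeal_of_X_mul_mem (i : Fin d) (e : Fin d → ℕ) (y : MvPolynomial (Fin d) R)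
    (h : X i * y ∈ powIdeal (X : Fin d → MvPolynomial (Fin d) R) e i.val) :
    y ∈ powIdeal (X : Fin d → MvPolynomial (Fin d) R) e i.val := by
  rw [mem_powIdeal_X_iff] at h ⊢
  intro m hm
  obtain ⟨j, hj, hej⟩ := h (Finsupp.single i 1 + m) (by
    rw [mem_support_iff, coeff_X_mul]; exact mem_support_iff.1 hm)
  refine ⟨j, hj, ?_⟩
  rwa [Finsupp.add_apply, Finsupp.single_eq_of_ne (by rintro rfl; omega), zero_add] at hej

end PowIdeal

section GenericSmoothness

theorem formallySmooth_field_of_charZero (K L : Type) [Field K] [Field L] [Algebra K L]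
    [CharZero K] : Algebra.FormallySmooth K L := by
  obtain ⟨s, hs⟩ := exists_isTranscendenceBasis K L
  have h1 : Algebra.IsAlgebraic (IntermediateField.adjoin K (Set.range ((↑) : s → L))) L :=
    hs.isAlgebraic_field
  have : CharZero (IntermediateField.adjoin K (Set.range ((↑) : s → L))) :=
    charZero_of_injective_algebraMap (algebraMap K _).injective
  exact .of_algebraicIndependent_of_isSeparable hs.1

theorem formallySmooth_of_injective_field (R L : Type) [CommRing R] [IsDomain R] [CharZero R]
    [Field L] [Algebra R L] (h : Function.Injective (algebraMap R L)) :
    Algebra.FormallySmooth R L := by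
  let K := FractionRing R
  have : FaithfulSMul R L := (faithfulSMul_iff_algebraMap_injective R L).2 h
  let _ : Algebra K L := FractionRing.liftAlgebra R L
  have : IsScalarTower R K L := FractionRing.isScalarTower_liftAlgebra R L
  have : CharZero K := charZero_of_injective_algebraMap (IsFractionRing.injective R K)
  have := formallySmooth_field_of_charZero K L
  have : Algebra.FormallySmooth R K := .of_isLocalization (nonZeroDivisors R)
  exact .comp R K L

theorem LiftsAt.of_formallySmooth_away {R A : Type} [CommRing R] [CommRing A] [Algebra R A] (a : A)
    [Algebra.FormallySmooth R (Localization.Away a)] : LiftsAt R A a := by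
  intro T _ _ J _ hJ f hf
  let f' : Localization.Away a →ₐ[R] T ⧸ J :=
    IsLocalization.liftAlgHom (M := Submonoid.powers a) (f := f) (by
      rintro ⟨_, n, rfl⟩
      rw [map_pow]; exact hf.pow n)
  obtain ⟨g, hg⟩ := Algebra.FormallySmooth.exists_lift J ⟨2, hJ⟩ f'
  refine ⟨g.comp (IsScalarTower.toAlgHom R A _), AlgHom.ext fun x => ?_⟩
  have := DFunLike.congr_fun hg (algebraMap A (Localization.Away a) x)
  refine this.trans ?_
  exact IsLocalization.lift_eq _ _

theorem exists_liftsAt_ne_zero (R A : Type) [CommRing R] [IsDomain R] [CharZero R]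
    [IsNoetherianRing R] [CommRing A] [IsDomain A] [Algebra R A] [Algebra.FiniteType R A]
    (h : Function.Injective (algebraMap R A)) : ∃ a : A, a ≠ 0 ∧ LiftsAt R A a := by
  let p : Ideal A := ⊥
  have hp : p.IsPrime := Ideal.isPrime_bot
  have hfp : Algebra.FinitePresentation R A := Algebra.FinitePresentation.of_finiteType.1 ‹_›
  have hle : p.primeCompl = nonZeroDivisors A := by
    ext x
    simp [p, Ideal.primeCompl]
  have : IsFractionRing A (Localization.AtPrime p) := by
    change IsLocalization (nonZeroDivisors A) (Localization.AtPrime p)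
    rw [← hle]; infer_instance
  let _ : Field (Localization.AtPrime p) := IsFractionRing.toField A
  have : Algebra.IsSmoothAt R p := by
    refine formallySmooth_of_injective_field R (Localization.AtPrime p) ?_
    rw [IsScalarTower.algebraMap_eq R A]
    exact (IsFractionRing.injective A _).comp h
  obtain ⟨a, ha, hs⟩ := Algebra.IsSmoothAt.exists_notMem_smooth R p
  have := hs.formallySmooth
  exact ⟨a, fun h0 => ha (by rw [h0]; exact p.zero_mem), .of_formallySmooth_away a⟩

end GenericSmoothness

section JacobianRegular

variable {Λ : Type} [CommRing Λ]

theorem exists_dual_derivations {d : ℕ} (t : Fin d → Λ) (D : Fin d → Derivation ℤ Λ Λ) :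
    ∃ E : Fin d → Derivation ℤ Λ Λ, ∀ j i, E j (t i) =
      if i = j then (Matrix.of fun i k => D k (t i)).det else 0 := by
  let A : Matrix (Fin d) (Fin d) Λ := Matrix.of fun i k => D k (t i)
  refine ⟨fun j => ∑ k, A.adjugate k j • D k, fun j i => ?_⟩
  have h := congrFun (congrFun (Matrix.mul_adjugate A) i) j
  rw [Matrix.mul_apply, Matrix.smul_apply, Matrix.one_apply] at h
  have hsum : (∑ k, A.adjugate k j • D k) (t i) = ∑ k, A.adjugate k j * D k (t i) := by
    have := congrFun (map_sum (Derivation.coeFnAddMonoidHom (R := ℤ) (A := Λ) (M := Λ))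
      (fun k => A.adjugate k j • D k) Finset.univ) (t i)
    rw [Finset.sum_apply] at this
    exact this
  change (∑ k, A.adjugate k j • D k) (t i) = _
  rw [hsum]
  rw [show (∑ k, A.adjugate k j * D k (t i)) = ∑ k, A i k * A.adjugate k j from
    Finset.sum_congr rfl fun k _ => by simp [A, mul_comm], h]
  simp [A]

theorem mem_of_mul_prod_pow_mem {q : Ideal Λ} [q.IsPrime] (hq : ∀ n : ℕ, n ≠ 0 → (n : Λ) ∉ q)
    {d : ℕ} {t : Fin d → Λ} (ht : ∀ i, t i ∈ q) {D : Fin d → Derivation ℤ Λ Λ}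
    (hD : (Matrix.of fun i k => D k (t i)).det ∉ q) (n : ℕ) :
    ∀ (m : Fin d → ℕ) (s : Λ), ∑ i, m i = n →
      s * ∏ i, t i ^ m i ∈ Ideal.span (Set.range fun i => t i ^ (m i + 1)) → s ∈ q := by
  classical
  obtain ⟨E, hE⟩ := exists_dual_derivations t D
  set Δ := (Matrix.of fun i k => D k (t i)).det
  induction n with
  | zero =>
    intro m s hm hs
    have hm0 : ∀ i, m i = 0 := fun i => (Finset.sum_eq_zero_iff.1 hm) i (Finset.mem_univ _)
    simp only [hm0, pow_zero, Finset.prod_const_one, mul_one, zero_add, pow_one] at hs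
    refine (Ideal.span_le.2 ?_ : Ideal.span _ ≤ q) hs
    rintro _ ⟨i, rfl⟩; exact ht i
  | succ n ih =>
    intro m s hm hs
    obtain ⟨j, hj⟩ : ∃ j, m j ≠ 0 := by
      by_contra! h
      simp [h] at hm
    obtain ⟨k, hk⟩ := Nat.exists_eq_succ_of_ne_zero hj
    let m' := Function.update m j k
    have hm'j : m' j = k := Function.update_self ..
    have hm'i : ∀ i, i ≠ j → m' i = m i := fun i hi => Function.update_of_ne hi ..
    have hsum : ∑ i, m' i = n := by
      rw [← Finset.add_sum_erase _ _ (Finset.mem_univ j)] at hm ⊢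
      rw [hk] at hm
      rw [Finset.sum_congr rfl fun i hi => hm'i i (Finset.ne_of_mem_erase hi)]
      have h1 : m' j + ∑ i ∈ Finset.univ.erase j, m i = k + ∑ i ∈ Finset.univ.erase j, m i := by
        rw [hm'j]
      refine h1.trans ?_
      omega
    let I := Ideal.span (Set.range fun i => t i ^ (m' i + 1))
    have hI : ∀ i, t i ^ (m' i + 1) ∈ I := fun i => Ideal.subset_span ⟨i, rfl⟩
    have hIj : t j ^ (k + 1) ∈ I := by have := hI j; rwa [hm'j] at this
    obtain ⟨c, hc⟩ := (Ideal.mem_span_range_iff_exists_fun).1 hs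
    let P := ∏ i ∈ Finset.univ.erase j, t i ^ m i
    have hP1 : ∏ i, t i ^ m i = t j ^ (k + 1) * P := by
      rw [← Finset.mul_prod_erase _ _ (Finset.mem_univ j), hk]
    have hP2 : ∏ i, t i ^ m' i = t j ^ k * P := by
      rw [← Finset.mul_prod_erase _ _ (Finset.mem_univ j), hm'j]
      congr 1
      exact Finset.prod_congr rfl fun i hi => by rw [hm'i i (Finset.ne_of_mem_erase hi)]
    have hEpow : ∀ (i : Fin d) (r : ℕ), E j (t i ^ (r + 1)) = if i = j then (r + 1 : Λ) * t j ^ r * Δ else 0 := by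
      intro i r
      rw [Derivation.leibniz_pow, hE]
      split_ifs with h
      · subst h; simp [nsmul_eq_mul, mul_assoc]
      · simp
    have hEP : E j P = 0 := by
      have : ∀ S : Finset (Fin d), j ∉ S → E j (∏ i ∈ S, t i ^ m i) = 0 := by
        intro S
        induction S using Finset.induction_on with
        | empty => intro _; simp
        | insert a S ha ih =>
          intro hjS
          rw [Finset.mem_insert, not_or] at hjS
          rw [Finset.prod_insert ha, Derivation.leibniz, ih hjS.2]
          have : E j (t a ^ m a) = 0 := by
            cases h : m a with
            | zero => simp
            | succ r => rw [hEpow, if_neg (Ne.symm hjS.1)]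
          simp [this]
      exact this _ (Finset.notMem_erase _ _)
    have h1 : E j (s * ∏ i, t i ^ m i) ∈ I := by
      rw [← hc, map_sum]
      refine I.sum_mem fun i _ => ?_
      rw [Derivation.leibniz, hEpow]
      refine I.add_mem ?_ ?_
      · split_ifs with h
        · subst h
          rw [smul_eq_mul, hk]
          rw [show c i * (((k + 1 : ℕ) + 1 : Λ) * t i ^ (k + 1) * Δ) =
            (c i * ((k + 1 : ℕ) + 1) * Δ) * t i ^ (k + 1) by ring]
          exact I.mul_mem_left _ hIj
        · simp
      · rw [smul_eq_mul]
        refine I.mul_mem_right _ ?_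
        by_cases h : i = j
        · subst h; rw [hk, pow_succ]; exact I.mul_mem_right _ hIj
        · rw [← hm'i i h]; exact hI i
    have h2 : E j (s * ∏ i, t i ^ m i) = (E j s * P) * t j ^ (k + 1) +
        (s * ((k + 1 : ℕ) : Λ) * Δ) * ∏ i, t i ^ m' i := by
      rw [hP1, hP2, Derivation.leibniz, Derivation.leibniz, hEP, hEpow, if_pos rfl]
      simp only [smul_eq_mul, mul_zero, zero_add]
      push_cast; ring
    rw [h2, I.add_mem_iff_right (I.mul_mem_left _ hIj)] at h1
    have h3 := ih m' _ hsum h1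
    have hp : q.IsPrime := inferInstance
    rcases hp.mem_or_mem h3 with h4 | h4
    · rcases hp.mem_or_mem h4 with h5 | h5
      · exact h5
      · exact absurd h5 (hq _ (Nat.succ_ne_zero k))
    · exact absurd h4 hD

end JacobianRegular

end

section

open MvPolynomial

section LocalModel

theorem mem_powIdeal_of_eval₂_eq_zero {k O : Type} [Field k] [CommRing O] (s : k →+* O) {d : ℕ}
    (t : Fin d → O) (e : Fin d → ℕ) (ht : ∀ i, t i ^ e i = 0)
    (hNB : ∀ c, c * ∏ i, t i ^ (e i - 1) = 0 → ¬ IsUnit c) (p : MvPolynomial (Fin d) k)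
    (hp : eval₂ s t p = 0) : p ∈ powIdeal (X : Fin d → MvPolynomial (Fin d) k) e d := by
  classical
  rw [mem_powIdeal_X_iff]
  by_contra! hcon
  let U := p.support.filter fun m => ∀ j, m j < e j
  have hU : U.Nonempty := by
    obtain ⟨m, hm, h⟩ := hcon
    exact ⟨m, Finset.mem_filter.2 ⟨hm, fun j => h j j.2⟩⟩
  obtain ⟨a, haU, hmin⟩ := Finset.exists_min_image U (fun m => ∑ j, m j) hU
  obtain ⟨ha, hae⟩ := Finset.mem_filter.1 haU
  have h1 : eval₂ s t p * ∏ i, t i ^ (e i - 1 - a i) = s (coeff a p) * ∏ i, t i ^ (e i - 1) := by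
    rw [eval₂_eq', Finset.sum_mul, Finset.sum_eq_single a]
    · rw [mul_assoc, ← Finset.prod_mul_distrib]
      congr 1
      refine Finset.prod_congr rfl fun i _ => ?_
      rw [← pow_add]; congr 1; have := hae i; omega
    · intro b hb hba
      have : ∃ j, e j ≤ b j + (e j - 1 - a j) := by
        by_contra! h
        have hbU : b ∈ U := Finset.mem_filter.2 ⟨hb, fun j => by have := h j; omega⟩
        have hle : ∀ j, b j ≤ a j := fun j => by have := h j; have := hae j; omega
        refine hba (Finsupp.ext fun j => ?_)
        by_contra hne
        have h3 : ∑ j, b j < ∑ j, a j :=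
          Finset.sum_lt_sum (fun j _ => hle j) ⟨j, Finset.mem_univ _, lt_of_le_of_ne (hle j) hne⟩
        exact absurd (hmin b hbU) (not_le.2 h3)
      obtain ⟨j, hj⟩ := this
      rw [mul_assoc, ← Finset.prod_mul_distrib, Finset.prod_eq_zero (Finset.mem_univ j), mul_zero]
      rw [← pow_add, ← Nat.add_sub_of_le hj, pow_add, ht, zero_mul]
    · intro h; exact absurd ha h
  rw [hp, zero_mul] at h1
  exact hNB _ h1.symm ((IsUnit.mk0 _ (mem_support_iff.1 ha)).map s)

theorem eval₂_surjective_of_nilpotent {k O : Type} [CommRing k] [CommRing O] (s : k →+* O)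
    {d : ℕ} (t : Fin d → O) (hnil : IsNilpotent (Ideal.span (Set.range t)))
    (hs : ∀ o, ∃ a, o - s a ∈ Ideal.span (Set.range t)) (o : O) :
    ∃ p : MvPolynomial (Fin d) k, eval₂ s t p = o := by
  have key : ∀ n : ℕ, ∀ o, ∃ p : MvPolynomial (Fin d) k,
      o - eval₂ s t p ∈ Ideal.span (Set.range t) ^ n := by
    intro n
    induction n with
    | zero => intro o; exact ⟨0, by simp⟩
    | succ n ih =>
      intro o
      obtain ⟨a, ha⟩ := hs o
      obtain ⟨c, hc⟩ := Ideal.mem_span_range_iff_exists_fun.1 ha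
      choose p hp using fun i => ih (c i)
      refine ⟨C a + ∑ i, p i * X i, ?_⟩
      rw [eval₂_add, eval₂_C, eval₂_sum, ← sub_sub, ← hc, ← Finset.sum_sub_distrib]
      refine Ideal.sum_mem _ fun i _ => ?_
      rw [eval₂_mul, eval₂_X, ← sub_mul, pow_succ]
      exact Ideal.mul_mem_mul (hp i) (Ideal.subset_span ⟨i, rfl⟩)
  obtain ⟨n, hn⟩ := hnil
  obtain ⟨p, hp⟩ := key n o
  rw [hn] at hp
  exact ⟨p, (sub_eq_zero.1 hp).symm⟩

set_option maxHeartbeats 1000000 in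
theorem exists_local_model {R : Type} [CommRing R] [IsDomain R] [CharZero R] [IsNoetherianRing R]
    {d : ℕ} {O : Type} [CommRing O] [IsLocalRing O] [Algebra R O]
    [Algebra (MvPolynomial (Fin d) R) O] [IsScalarTower R (MvPolynomial (Fin d) R) O]
    {t : Fin d → O} (htX : ∀ i, algebraMap (MvPolynomial (Fin d) R) O (X i) = t i)
    (hm : IsLocalRing.maximalIdeal O = Ideal.span (Set.range t))
    (hnil : IsNilpotent (IsLocalRing.maximalIdeal O))
    (hinj : Function.Injective (algebraMap R (IsLocalRing.ResidueField O))) (e : Fin d → ℕ)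
    (ht : ∀ i, t i ^ e i = 0) (hNB : ∀ c, c * ∏ i, t i ^ (e i - 1) = 0 → ¬ IsUnit c)
    {σ : Type} [Finite σ] (z : σ → O) :
    ∃ (C : Type) (_ : CommRing C) (_ : Algebra (MvPolynomial (Fin d) R) C)
      (ψ : C →ₐ[MvPolynomial (Fin d) R] O) (x : σ → C) (g : C),
      Algebra.FiniteType (MvPolynomial (Fin d) R) C ∧ Function.Injective ψ ∧ (∀ j, ψ (x j) = z j) ∧
      LiftsMod (MvPolynomial (Fin d) R)
        (powIdeal (X : Fin d → MvPolynomial (Fin d) R) e d) C g ∧ IsUnit (ψ g) := by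
  classical
  let k := O ⧸ IsLocalRing.maximalIdeal O
  let _ : Field k := Ideal.Quotient.field _
  have := formallySmooth_of_injective_field R k hinj
  obtain ⟨s, hs⟩ := Algebra.FormallySmooth.exists_lift (R := R) (A := k)
    (IsLocalRing.maximalIdeal O) hnil (AlgHom.id R k)
  have hs' : ∀ a, Ideal.Quotient.mk _ (s a) = a := fun a => DFunLike.congr_fun hs a
  have hsurj := eval₂_surjective_of_nilpotent s.toRingHom t (hm ▸ hnil) (fun o =>
    ⟨Ideal.Quotient.mk _ o, by rw [← hm, ← Ideal.Quotient.eq]; exact (hs' _).symm⟩)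
  choose p hp using fun j => hsurj (z j)
  have := Fintype.ofFinite σ
  let S : Finset k := Finset.univ.biUnion fun j => (p j).support.image fun m => coeff m (p j)
  let A := Algebra.adjoin R (S : Set k)
  have hAft : Algebra.FiniteType R A :=
    (Subalgebra.fg_iff_finiteType _).1 ⟨S, rfl⟩
  have hAinj : Function.Injective (algebraMap R A) := by
    intro a b hab
    exact hinj (congrArg (algebraMap A k) hab)
  obtain ⟨g, hg0, hg⟩ := exists_liftsAt_ne_zero R A hAinj
  have hp' : ∀ j, ∃ p' : MvPolynomial (Fin d) A, MvPolynomial.map (algebraMap A k) p' = p j := by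
    intro j
    have h0 : p j ∈ Set.range (MvPolynomial.map (algebraMap A k) : MvPolynomial (Fin d) A → _) := by
      rw [mem_range_map_iff_coeffs_subset]
      intro c hc
      obtain ⟨m, hm, rfl⟩ := mem_coeffs_iff.1 hc
      exact ⟨⟨coeff m (p j), Algebra.subset_adjoin (Finset.mem_coe.2 (Finset.mem_biUnion.2
        ⟨j, Finset.mem_univ _, Finset.mem_image.2 ⟨m, hm, rfl⟩⟩))⟩, rfl⟩
    exact h0
  choose p' hp' using hp'
  let _ : Algebra (MvPolynomial (Fin d) R) (MvPolynomial (Fin d) A) :=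
    MvPolynomial.algebraMvPolynomial
  have halg : ∀ q : MvPolynomial (Fin d) R,
      algebraMap _ (MvPolynomial (Fin d) A) q = MvPolynomial.map (algebraMap R A) q := fun q => rfl
  let θ : A →ₐ[R] O := s.comp A.val
  have hRO : ∀ q : MvPolynomial (Fin d) R,
      algebraMap (MvPolynomial (Fin d) R) O q = eval₂ (algebraMap R O) t q := by
    intro q
    have h0 : IsScalarTower.toAlgHom R (MvPolynomial (Fin d) R) O = aeval t :=
      MvPolynomial.algHom_ext fun i => by simp [htX]
    exact DFunLike.congr_fun h0 q
  let Θ : MvPolynomial (Fin d) A →ₐ[MvPolynomial (Fin d) R] O :=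
    { eval₂Hom θ.toRingHom t with
      commutes' := fun q => by
        change eval₂ θ.toRingHom t (MvPolynomial.map (algebraMap R A) q) = _
        rw [eval₂_map, hRO]
        congr 1
        exact RingHom.ext fun r => θ.commutes r }
  have hΘ : ∀ q, Θ q = eval₂ s.toRingHom t (MvPolynomial.map (algebraMap A k) q) := fun q => by
    change eval₂ θ.toRingHom t q = _
    rw [eval₂_map]; rfl
  have hkerΘ : ∀ q, Θ q = 0 → q ∈ powIdeal (X : Fin d → MvPolynomial (Fin d) A) e d := by
    intro q hq
    rw [hΘ] at hq
    have := mem_powIdeal_of_eval₂_eq_zero s.toRingHom t e ht hNB _ hq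
    rw [mem_powIdeal_X_iff] at this ⊢
    rwa [support_map_of_injective _ Subtype.val_injective] at this
  let I := RingHom.ker Θ
  have hIΘ : ∀ q ∈ I, Θ q = 0 := fun q hq => hq
  refine ⟨MvPolynomial (Fin d) A ⧸ I, inferInstance, inferInstance, Ideal.Quotient.liftₐ I Θ hIΘ,
    fun j => Ideal.Quotient.mk I (p' j), Ideal.Quotient.mk I (C g), ?_, ?_, ?_, ?_, ?_⟩
  · have h1 : Algebra.FiniteType R (MvPolynomial (Fin d) A) :=
      Algebra.FiniteType.trans hAft inferInstance
    have : IsScalarTower R (MvPolynomial (Fin d) R) (MvPolynomial (Fin d) A) :=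
      IsScalarTower.of_algebraMap_eq fun r => by
        rw [halg, MvPolynomial.algebraMap_eq, map_C]; rfl
    have h2 : Algebra.FiniteType (MvPolynomial (Fin d) R) (MvPolynomial (Fin d) A) :=
      .of_restrictScalars_finiteType R _ _
    exact h2.of_surjective (Ideal.Quotient.mkₐ _ I) (Ideal.Quotient.mkₐ_surjective _ I)
  · rw [injective_iff_map_eq_zero]
    intro c hc
    obtain ⟨c, rfl⟩ := Ideal.Quotient.mk_surjective c
    exact Ideal.Quotient.eq_zero_iff_mem.2 hc
  · intro j
    change Θ (p' j) = z j
    rw [hΘ, hp', hp]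
  · intro T _ _ J h𝔞 hJ f hf
    let _ : Algebra R T := ((algebraMap (MvPolynomial (Fin d) R) T).comp C).toAlgebra
    have : IsScalarTower R (MvPolynomial (Fin d) R) T := IsScalarTower.of_algebraMap_eq fun _ => rfl
    let f0 : A →ₐ[R] T ⧸ J :=
      { (f.toRingHom.comp (Ideal.Quotient.mk I)).comp C with
        commutes' := fun r => by
          have := f.commutes (C r)
          refine Eq.trans ?_ this
          change f (Ideal.Quotient.mk I (C (algebraMap R A r))) = f (Ideal.Quotient.mk I _)
          rw [halg, map_C] }
    obtain ⟨g0, hg0⟩ := hg T J bot_le hJ f0 hf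
    let τ : Fin d → T := fun i => algebraMap (MvPolynomial (Fin d) R) T (X i)
    let G : MvPolynomial (Fin d) A →ₐ[MvPolynomial (Fin d) R] T :=
      { eval₂Hom g0.toRingHom τ with
        commutes' := fun q => by
          change eval₂ g0.toRingHom τ (MvPolynomial.map (algebraMap R A) q) = _
          rw [eval₂_map]
          have h0 : IsScalarTower.toAlgHom R (MvPolynomial (Fin d) R) T = aeval τ :=
            MvPolynomial.algHom_ext fun i => by simp [τ]
          refine Eq.trans ?_ (DFunLike.congr_fun h0 q).symm
          change _ = eval₂ (algebraMap R T) τ q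
          congr 1
          exact RingHom.ext fun r => g0.commutes r }
    have hGC : ∀ a, G (C a) = g0 a := fun a => eval₂_C _ _ _
    have hGX : ∀ i, G (X i) = τ i := fun i => eval₂_X _ _ _
    have hG : ∀ q ∈ I, G q = 0 := by
      intro q hq
      have h1 : powIdeal (X : Fin d → MvPolynomial (Fin d) A) e d ≤ RingHom.ker G := by
        rw [powIdeal, Ideal.span_le]
        rintro _ ⟨j, hj, rfl⟩
        have h2 : (X j ^ e j : MvPolynomial (Fin d) R) ∈ powIdeal X e d :=
          Ideal.subset_span ⟨j, hj, rfl⟩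
        have h3 := h𝔞 h2
        rw [RingHom.mem_ker, map_pow] at h3
        change G (X j ^ e j) = 0
        rw [map_pow, hGX]; exact h3
      exact h1 (hkerΘ q hq)
    refine ⟨Ideal.Quotient.liftₐ I G hG, ?_⟩
    refine Ideal.Quotient.algHom_ext _ (AlgHom.coe_ringHom_injective ?_)
    refine MvPolynomial.ringHom_ext (fun a => ?_) fun i => ?_
    · change Ideal.Quotient.mk J (G (C a)) = f (Ideal.Quotient.mk I (C a))
      rw [hGC]
      exact DFunLike.congr_fun hg0 a
    · change Ideal.Quotient.mk J (G (X i)) = f (Ideal.Quotient.mk I (X i))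
      rw [hGX]
      have := f.commutes (X i)
      refine this.symm.trans ?_
      change f (Ideal.Quotient.mk I _) = _
      rw [halg, map_X]
  · change IsUnit (Θ (C g))
    have : Θ (C g) = s (algebraMap A k g) := eval₂_C _ _ _
    rw [this]
    exact (IsUnit.mk0 _ (by intro h; exact hg0 (Subtype.val_injective h))).map s

end LocalModel

end

section

open MvPolynomial

section Globalization

/-- The point of affine space with projective coordinates `(v, v * w)`. -/
def conePoint {U ι : Type} [Mul U] (v : U) (w : ι → U) : Option ι → U :=
  fun o => o.elim v fun i => v * w i

theorem exists_homogenization {R ι : Type} [CommRing R] (p : MvPolynomial ι R) :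
    ∃ (D : ℕ) (h : MvPolynomial (Option ι) R), ∀ (U : Type) [CommRing U] [Algebra R U] (v : U)
      (w : ι → U), aeval (conePoint v w) h = v ^ D * aeval w p := by
  induction p using MvPolynomial.induction_on with
  | C a => exact ⟨0, C a, fun U _ _ v w => by simp [algHom_C]⟩
  | add p q hp hq =>
    obtain ⟨D, h, hh⟩ := hp
    obtain ⟨D', h', hh'⟩ := hq
    refine ⟨D + D', X none ^ D' * h + X none ^ D * h', fun U _ _ v w => ?_⟩
    simp only [map_add, map_mul, map_pow, hh, hh', aeval_X]
    simp only [conePoint, Option.elim]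
    ring
  | mul_X p i hp =>
    obtain ⟨D, h, hh⟩ := hp
    refine ⟨D + 1, X (some i) * h, fun U _ _ v w => ?_⟩
    simp only [map_mul, hh, aeval_X]
    simp only [conePoint, Option.elim]
    ring

variable {R Λ σ κ : Type} [CommRing R] [CommRing Λ] [Algebra R Λ]

/-- The equations satisfied by all points `(x, v, v * w)` for `x`, `w` in the image of `C`. -/
def coneIdeal {A : Type} [CommRing A] [Algebra R A] {N : ℕ} (x : σ → A) (w : Fin N → A) :
    Ideal (MvPolynomial (σ ⊕ Option (Fin N)) R) where
  carrier := {h | ∀ (U : Type) [CommRing U] [Algebra R U] (u : A →ₐ[R] U) (v : U),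
    aeval (Sum.elim (fun j => u (x j)) (conePoint v fun i => u (w i))) h = 0}
  add_mem' ha hb := fun U _ _ u v => by rw [map_add, ha, hb, add_zero]
  zero_mem' := fun U _ _ u v => map_zero _
  smul_mem' c h hh := fun U _ _ u v => by rw [smul_eq_mul, map_mul, hh, mul_zero]

/-- The ideal generated by `F`, `𝔞` and `v' * h` for `h` in `H`. -/
noncomputable def gluingIdeal {τ : Type} (F : κ → MvPolynomial σ R) (𝔞 : Ideal R)
    (H : Ideal (MvPolynomial (σ ⊕ τ) R)) : Ideal (MvPolynomial (Option (σ ⊕ τ)) R) :=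
  Ideal.span (Set.range fun k => rename (some ∘ Sum.inl) (F k)) ⊔ 𝔞.map C ⊔
    Ideal.span ((fun h => X none * rename some h) '' (H : Set _))

theorem gluingIdeal_le_ker {τ : Type} {F : κ → MvPolynomial σ R} {𝔞 : Ideal R}
    {H : Ideal (MvPolynomial (σ ⊕ τ) R)} {U : Type} [CommRing U] [Algebra R U]
    (h𝔞 : 𝔞 ≤ RingHom.ker (algebraMap R U)) (p : σ ⊕ τ → U) (v' : U)
    (hF : ∀ k, aeval (fun j => p (Sum.inl j)) (F k) = 0) (hH : ∀ h ∈ H, v' * aeval p h = 0) :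
    ∀ b ∈ gluingIdeal F 𝔞 H, aeval (fun o : Option (σ ⊕ τ) => o.elim v' p) b = 0 := by
  have : gluingIdeal F 𝔞 H ≤
      RingHom.ker (aeval (R := R) (fun o : Option (σ ⊕ τ) => o.elim v' p)) := by
    refine sup_le (sup_le ?_ ?_) ?_
    · rw [Ideal.span_le]
      rintro _ ⟨k, rfl⟩
      change aeval _ (rename _ _) = 0
      rw [aeval_rename]; exact hF k
    · rw [Ideal.map_le_iff_le_comap]
      intro a ha
      change aeval _ (C a) = 0
      rw [algHom_C]; exact h𝔞 ha
    · rw [Ideal.span_le]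
      rintro _ ⟨h, hh, rfl⟩
      change aeval _ _ = 0
      rw [map_mul, aeval_X, aeval_rename]
      exact hH h hh
  exact this

set_option maxHeartbeats 1000000 in
theorem SolvedMod.globalize [IsNoetherianRing R] [Finite σ] {F : κ → MvPolynomial σ R} {z : σ → Λ}
    (hz : ∀ k, aeval z (F k) = 0) {𝔞 : Ideal R} {q : Ideal Λ} [hq : q.IsPrime] {O : Type}
    [CommRing O] [Algebra R O] (ι : Λ →ₐ[R] O)
    (hι0 : ∀ l, ι l = 0 → ∃ s ∉ q, s * l ∈ 𝔞.map (algebraMap R Λ))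
    (hιs : ∀ o, ∃ s ∉ q, ∃ l, ι s * o = ι l) (hιu : ∀ s ∉ q, IsUnit (ι s))
    (hιu' : ∀ l, IsUnit (ι l) → l ∉ q) {A : Type} [CommRing A] [Algebra R A]
    [hA : Algebra.FiniteType R A] (h𝔞A : 𝔞 ≤ RingHom.ker (algebraMap R A)) (ψ : A →ₐ[R] O)
    (x : σ → A) (hx : ∀ k, aeval x (F k) = 0) (hxz : ∀ j, ψ (x j) = ι (z j)) (g : A)
    (hg : LiftsMod R 𝔞 A g) (hgu : IsUnit (ψ g)) (S : Set (MvPolynomial σ R))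
    (hS : ∀ a ∈ S, LiftsAt R (MvPolynomial σ R ⧸ Ideal.span (Set.range F)) (Ideal.Quotient.mk _ a))
    (hSnil : ∀ a ∈ S, ∃ c : ℕ, aeval x a ^ c = 0) :
    SolvedMod F z {q' | q' = q ∨ ∃ a ∈ S, aeval z a ∉ q'} 𝔞 := by
  classical
  obtain ⟨N, γ, hγ⟩ := Algebra.FiniteType.iff_quotient_mvPolynomial''.1 hA
  obtain ⟨w, hw⟩ : ∃ w : Fin N → A, w = fun i => γ (X i) := ⟨_, rfl⟩
  have hγw : ∀ p, γ p = aeval w p := fun p => by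
    have : γ = aeval w := MvPolynomial.algHom_ext fun i => by rw [aeval_X, hw]
    rw [this]
  obtain ⟨H, hH⟩ : ∃ H : Ideal (MvPolynomial (σ ⊕ Option (Fin N)) R), H = coneIdeal x w := ⟨_, rfl⟩
  have hHmem : ∀ h, (∀ (U : Type) [CommRing U] [Algebra R U] (u : A →ₐ[R] U) (v : U),
    aeval (Sum.elim (fun j => u (x j)) (conePoint v fun i => u (w i))) h = 0) → h ∈ H :=
      fun h hh => by rw [hH]; exact hh
  have hHpt : ∀ h ∈ H, ∀ (U : Type) [CommRing U] [Algebra R U] (u : A →ₐ[R] U) (v : U),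
    aeval (Sum.elim (fun j => u (x j)) (conePoint v fun i => u (w i))) h = 0 :=
      fun h hh => by rw [hH] at hh; exact hh
  -- the values in `Λ`
  choose s hsq l hsl using fun i => hιs (ψ (w i))
  obtain ⟨ν, hν⟩ : ∃ ν, ν = ∏ i, s i := ⟨_, rfl⟩
  have hνq : ν ∉ q := by
    rw [hν, hq.prod_mem_iff]; rintro ⟨i, _, hi⟩; exact hsq i hi
  let ε : Fin N → Λ := fun i => (∏ j ∈ Finset.univ.erase i, s j) * l i
  have hε : ∀ i, ι ν * ψ (w i) = ι (ε i) := fun i => by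
    rw [hν, ← Finset.mul_prod_erase _ _ (Finset.mem_univ i), map_mul, map_mul, ← hsl]; ring
  let p0 : σ ⊕ Option (Fin N) → Λ := Sum.elim z fun o => o.elim ν ε
  have hp0 : ∀ h, ι (aeval p0 h) =
      aeval (Sum.elim (fun j => ψ (x j)) (conePoint (ι ν) fun i => ψ (w i))) h := fun h => by
    have : ι.comp (aeval p0) =
        aeval (Sum.elim (fun j => ψ (x j)) (conePoint (ι ν) fun i => ψ (w i))) := by
      refine MvPolynomial.algHom_ext fun o => ?_
      rw [AlgHom.comp_apply, aeval_X, aeval_X]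
      rcases o with j | _ | i
      · exact (hxz j).symm
      · rfl
      · exact (hε i).symm
    exact DFunLike.congr_fun this h
  obtain ⟨gens, hgens⟩ : H.FG := IsNoetherian.noetherian H
  have hs' : ∀ h : MvPolynomial (σ ⊕ Option (Fin N)) R, ∃ s ∉ q, h ∈ gens →
      s * aeval p0 h ∈ 𝔞.map (algebraMap R Λ) := by
    intro h
    by_cases hh : h ∈ gens
    · obtain ⟨s, hs, hs'⟩ := hι0 (aeval p0 h) (by
        rw [hp0]
        exact hHpt h (by rw [← hgens]; exact Ideal.subset_span hh) O ψ (ι ν))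
      exact ⟨s, hs, fun _ => hs'⟩
    · exact ⟨1, fun h1 => hq.ne_top ((Ideal.eq_top_iff_one q).2 h1), fun h => absurd h hh⟩
  choose s' hs'q hs'h using hs'
  obtain ⟨ν', hν'⟩ : ∃ ν', ν' = ∏ h ∈ gens, s' h := ⟨_, rfl⟩
  have hν'q : ν' ∉ q := by
    rw [hν', hq.prod_mem_iff]; rintro ⟨i, _, hi⟩; exact hs'q i hi
  have hν'H : ∀ h ∈ H, ν' * aeval p0 h ∈ 𝔞.map (algebraMap R Λ) := by
    intro h hh
    rw [← hgens] at hh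
    refine Submodule.span_induction (fun h hh => ?_) ?_ (fun a b _ _ ha hb => ?_)
      (fun c a _ ha => ?_) hh
    · rw [hν', ← Finset.prod_erase_mul _ _ (Finset.mem_coe.1 hh), mul_assoc]
      exact Ideal.mul_mem_left _ _ (hs'h h (Finset.mem_coe.1 hh))
    · simp
    · rw [map_add, mul_add]; exact Ideal.add_mem _ ha hb
    · rw [smul_eq_mul, map_mul, mul_left_comm]; exact Ideal.mul_mem_left _ _ ha
  -- the algebra
  let I := gluingIdeal F 𝔞 H
  let M := MvPolynomial (Option (σ ⊕ Option (Fin N))) R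
  let B := M ⧸ I
  let L := Λ ⧸ 𝔞.map (algebraMap R Λ)
  have h𝔞L : 𝔞 ≤ RingHom.ker (algebraMap R L) := fun a ha =>
    Ideal.Quotient.eq_zero_iff_mem.2 (Ideal.mem_map_of_mem (algebraMap R Λ) ha)
  have hmkp : ∀ h, aeval (fun o => (Ideal.Quotient.mk _ (p0 o) : L)) h =
      Ideal.Quotient.mk _ (aeval p0 h) := fun h => by
    have : aeval (fun o => (Ideal.Quotient.mk _ (p0 o) : L)) =
        (Ideal.Quotient.mkₐ R (𝔞.map (algebraMap R Λ))).comp (aeval p0) :=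
      MvPolynomial.algHom_ext fun o => by rw [AlgHom.comp_apply, aeval_X, aeval_X]; rfl
    rw [this]; rfl
  have hmkz : ∀ h, aeval (fun j => (Ideal.Quotient.mk _ (z j) : L)) h =
      Ideal.Quotient.mk _ (aeval z h) := fun h => by
    have : aeval (fun o => (Ideal.Quotient.mk _ (z o) : L)) =
        (Ideal.Quotient.mkₐ R (𝔞.map (algebraMap R Λ))).comp (aeval z) :=
      MvPolynomial.algHom_ext fun o => by rw [AlgHom.comp_apply, aeval_X, aeval_X]; rfl
    rw [this]; rfl
  let β0 : M →ₐ[R] L := aeval fun o => o.elim (Ideal.Quotient.mk _ ν' : L)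
    fun o => Ideal.Quotient.mk _ (p0 o)
  have hβ0 : ∀ b ∈ I, β0 b = 0 := gluingIdeal_le_ker h𝔞L _ _ (fun k => by
      have := hmkz (F k)
      rw [hz, map_zero] at this
      exact this) fun h hh => by
      rw [hmkp, ← map_mul]
      exact Ideal.Quotient.eq_zero_iff_mem.2 (hν'H h hh)
  let β : B →ₐ[R] L := Ideal.Quotient.liftₐ I β0 hβ0
  have hβX : ∀ o, β (Ideal.Quotient.mk I (X o)) = o.elim (Ideal.Quotient.mk _ ν' : L)
    fun o => Ideal.Quotient.mk _ (p0 o) := fun o => aeval_X _ _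
  have hβr : ∀ h, β (Ideal.Quotient.mk I (rename some h)) = Ideal.Quotient.mk _ (aeval p0 h) := by
    intro h
    change β0 (rename some h) = _
    rw [← hmkp]
    exact aeval_rename _ _ _
  have hIF : ∀ k, rename (some ∘ Sum.inl) (F k) ∈ I := fun k =>
    Ideal.mem_sup_left (Ideal.mem_sup_left (Ideal.subset_span ⟨k, rfl⟩))
  have hI𝔞 : ∀ a ∈ 𝔞, (C a : M) ∈ I := fun a ha =>
    Ideal.mem_sup_left (Ideal.mem_sup_right (Ideal.mem_map_of_mem C ha))
  have hIH : ∀ h ∈ H, (X none * rename some h : M) ∈ I := fun h hh =>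
    Ideal.mem_sup_right (Ideal.subset_span ⟨h, hh, rfl⟩)
  have hmkaev : ∀ {U : Type} [CommRing U] [Algebra R U] (f : B →ₐ[R] U)
      (h : MvPolynomial (σ ⊕ Option (Fin N)) R), f (Ideal.Quotient.mk I (rename some h)) =
        aeval (fun o => f (Ideal.Quotient.mk I (X (some o)))) h := by
    intro U _ _ f h
    have : (f.comp (Ideal.Quotient.mkₐ R I)).comp (rename some) =
        aeval (fun o => f (Ideal.Quotient.mk I (X (some o)))) :=
      MvPolynomial.algHom_ext fun o => by
        rw [AlgHom.comp_apply, aeval_X, rename_X]; rfl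
    rw [← this]; rfl
  have hBx : ∀ p : MvPolynomial σ R, aeval (fun j => Ideal.Quotient.mk I (X (some (Sum.inl j)))) p
      = Ideal.Quotient.mk I (rename (some ∘ Sum.inl) p) := fun p => by
    have : aeval (fun j => Ideal.Quotient.mk I (X (some (Sum.inl j)))) =
        (Ideal.Quotient.mkₐ R I).comp (rename (some ∘ Sum.inl)) :=
      MvPolynomial.algHom_ext fun o => by rw [AlgHom.comp_apply, aeval_X, rename_X]; rfl
    rw [this]; rfl
  have hfH : ∀ {U : Type} [CommRing U] [Algebra R U] (f : B →ₐ[R] U), ∀ h ∈ H,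
      f (Ideal.Quotient.mk I (X none)) *
        aeval (fun o => f (Ideal.Quotient.mk I (X (some o)))) h = 0 := by
    intro U _ _ f h hh
    rw [← hmkaev, ← map_mul, ← map_mul, Ideal.Quotient.eq_zero_iff_mem.2 (hIH h hh), map_zero]
  refine ⟨B, inferInstance, inferInstance, β, fun j => Ideal.Quotient.mk I (X (some (Sum.inl j))),
    inferInstance, fun a ha => Ideal.Quotient.eq_zero_iff_mem.2 (hI𝔞 a ha), fun k => ?_,
    fun j => hβX _, ?_⟩
  · rw [hBx]; exact Ideal.Quotient.eq_zero_iff_mem.2 (hIF k)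
  · rintro q' hq' hq'p h𝔞q'
    have hfin : ∀ b c0, β b = Ideal.Quotient.mk _ c0 → c0 ∉ q' → ∀ c, Ideal.Quotient.mk _ c = β b →
        c ∉ q' := by
      intro b c0 hb hc0 c hc hcq
      rw [hb, Ideal.Quotient.eq] at hc
      exact hc0 ((q'.sub_mem_iff_right hcq).1 (h𝔞q' hc))
    rcases hq' with rfl | ⟨a, haS, haq⟩
    · obtain ⟨pg, hpg⟩ := hγ g
      obtain ⟨Dg, hg', hhg⟩ := exists_homogenization pg
      let b0 : B := Ideal.Quotient.mk I (rename some (rename Sum.inr hg'))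
      let bv : B := Ideal.Quotient.mk I (X (some (Sum.inr none)))
      let bv' : B := Ideal.Quotient.mk I (X none)
      refine ⟨bv' * (bv * b0), ?_, hfin _ (ν' * (ν * aeval p0 (rename Sum.inr hg'))) ?_ ?_⟩
      · intro T _ _ J h𝔞T hJ f hf
        rw [map_mul, map_mul] at hf
        have hfv' := isUnit_of_mul_isUnit_left hf
        have hfv := isUnit_of_mul_isUnit_left (isUnit_of_mul_isUnit_right hf)
        have hfg := isUnit_of_mul_isUnit_right (isUnit_of_mul_isUnit_right hf)
        have hfH' : ∀ h ∈ H, aeval (fun o => f (Ideal.Quotient.mk I (X (some o)))) h = 0 :=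
          fun h hh => (hfv'.mul_right_eq_zero).1 (hfH f h hh)
        obtain ⟨y, hy⟩ := hfv.exists_right_inv
        let wb : Fin N → T ⧸ J := fun i => y * f (Ideal.Quotient.mk I (X (some (Sum.inr (some i)))))
        have hwb : ∀ i, f bv * wb i = f (Ideal.Quotient.mk I (X (some (Sum.inr (some i))))) := by
          intro i; rw [← mul_assoc, hy, one_mul]
        have hcone : (fun o => f (Ideal.Quotient.mk I (X (some (Sum.inr o))))) =
            conePoint (f bv) wb := by
          funext o
          cases o with
          | none => rfl
          | some i => exact (hwb i).symm
        have hfinr : ∀ h : MvPolynomial (Option (Fin N)) R,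
            aeval (fun o => f (Ideal.Quotient.mk I (X (some o)))) (rename Sum.inr h) =
              aeval (conePoint (f bv) wb) h := fun h => by
          rw [aeval_rename, ← hcone]; rfl
        have hkill : ∀ p, γ p = 0 → aeval wb p = 0 := by
          intro p hp
          obtain ⟨D, h, hh⟩ := exists_homogenization p
          have h1 := hfH' (rename Sum.inr h) (hHmem _ fun U _ _ u v => by
            rw [aeval_rename, Sum.elim_comp_inr, hh]
            have : aeval (fun i => u (w i)) p = u (aeval w p) := by
              rw [← AlgHom.comp_apply, comp_aeval]
            rw [this, ← hγw, hp, map_zero, mul_zero])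
          rw [hfinr, hh] at h1
          exact ((hfv.pow D).mul_right_eq_zero).1 h1
        let ub : A →ₐ[R] T ⧸ J :=
          { RingHom.liftOfSurjective γ.toRingHom hγ ⟨(aeval wb : _ →ₐ[R] T ⧸ J).toRingHom,
              fun p hp => hkill p hp⟩ with
            commutes' := fun r => by
              have := RingHom.liftOfRightInverse_comp_apply γ.toRingHom _
                (Function.rightInverse_surjInv hγ) ⟨(aeval wb : _ →ₐ[R] T ⧸ J).toRingHom,
                fun p hp => hkill p hp⟩ (C r)
              have h2 : γ (C r) = algebraMap R A r := γ.commutes r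
              change (RingHom.liftOfRightInverse _ _ _ _) (algebraMap R A r) = _
              rw [← h2]
              refine this.trans ?_
              exact (aeval wb : _ →ₐ[R] T ⧸ J).commutes r }
        have hub : ∀ p, ub (γ p) = aeval wb p := fun p =>
          RingHom.liftOfRightInverse_comp_apply γ.toRingHom _
                (Function.rightInverse_surjInv hγ) ⟨(aeval wb : _ →ₐ[R] T ⧸ J).toRingHom,
                fun p hp => hkill p hp⟩ p
        have hubw : ∀ i, ub (w i) = wb i := fun i => by rw [hw, hub, aeval_X]
        have hubx : ∀ j, ub (x j) = f (Ideal.Quotient.mk I (X (some (Sum.inl j)))) := by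
          intro j
          obtain ⟨p, hp⟩ := hγ (x j)
          obtain ⟨D, h, hh⟩ := exists_homogenization p
          have h1 := hfH' (X (Sum.inl j) * X (Sum.inr none) ^ D - rename Sum.inr h)
            (hHmem _ fun U _ _ u v => by
              rw [map_sub, map_mul, map_pow, aeval_X, aeval_X, aeval_rename, Sum.elim_comp_inr, hh]
              have : aeval (fun i => u (w i)) p = u (aeval w p) := by
                rw [← AlgHom.comp_apply, comp_aeval]
              rw [this, ← hγw, hp]
              change u (x j) * v ^ D - _ = 0
              ring)
          rw [map_sub, hfinr, hh, map_mul, map_pow, aeval_X, aeval_X, ← hub, hp] at h1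
          have h2 : f bv ^ D * (f (Ideal.Quotient.mk I (X (some (Sum.inl j)))) - ub (x j)) = 0 := by
            rw [← h1]; ring
          exact (sub_eq_zero.1 (((hfv.pow D).mul_right_eq_zero).1 h2)).symm
        have hubg : IsUnit (ub g) := by
          have h1 : f b0 = f bv ^ Dg * ub g := by
            rw [hmkaev, hfinr, hhg, ← hub, hpg]
          rw [h1] at hfg
          exact isUnit_of_mul_isUnit_right hfg
        obtain ⟨u, hu⟩ := hg T J h𝔞T hJ ub hubg
        have hu' : ∀ a, Ideal.Quotient.mk J (u a) = ub a := fun a => DFunLike.congr_fun hu a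
        obtain ⟨v, hv⟩ := Ideal.Quotient.mk_surjective (f bv)
        obtain ⟨v', hv'⟩ := Ideal.Quotient.mk_surjective (f bv')
        let pt : σ ⊕ Option (Fin N) → T :=
          Sum.elim (fun j => u (x j)) (conePoint v fun i => u (w i))
        have hpt : ∀ b ∈ I, aeval (fun o : Option (σ ⊕ Option (Fin N)) => o.elim v' pt) b = 0 :=
          gluingIdeal_le_ker h𝔞T pt v' (fun k => by
            have : aeval (fun j => u (x j)) (F k) = u (aeval x (F k)) := by
              rw [← AlgHom.comp_apply, comp_aeval]
            refine this.trans ?_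
            rw [hx, map_zero]) fun h hh => by rw [hHpt h hh, mul_zero]
        refine ⟨Ideal.Quotient.liftₐ I (aeval _) hpt, ?_⟩
        refine Ideal.Quotient.algHom_ext _ (MvPolynomial.algHom_ext fun o => ?_)
        refine (congrArg (Ideal.Quotient.mk J) (aeval_X _ _)).trans ?_
        rcases o with _ | j | _ | i
        · exact hv'
        · exact (hu' _).trans (hubx j)
        · exact hv
        · refine (map_mul (Ideal.Quotient.mk J) _ _).trans ?_
          rw [hv, hu', hubw, hwb]; rfl
      · have h1 : β bv' = Ideal.Quotient.mk _ ν' := hβX _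
        have h2 : β bv = Ideal.Quotient.mk _ ν := hβX _
        rw [map_mul, map_mul, map_mul, map_mul, hβr, h1, h2]
      · have h1 : aeval p0 (rename Sum.inr hg') ∉ q' := by
          apply hιu'
          rw [hp0, aeval_rename, Sum.elim_comp_inr, hhg]
          have : aeval (fun i => ψ (w i)) pg = ψ (aeval w pg) := by
            rw [← AlgHom.comp_apply, comp_aeval]
          rw [this, ← hγw, hpg]
          exact ((hιu ν hνq).pow _).mul hgu
        intro h2
        rcases hq.mem_or_mem h2 with h3 | h3
        · exact hν'q h3
        · exact (hq.mem_or_mem h3).elim hνq h1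
    · refine ⟨Ideal.Quotient.mk I (rename some (rename Sum.inl a)), ?_,
        hfin _ (aeval p0 (rename Sum.inl a)) (hβr _) ?_⟩
      · intro T _ _ J h𝔞T hJ f hf
        have hf1 := hf
        rw [hmkaev, aeval_rename] at hf
        let A' := MvPolynomial σ R ⧸ Ideal.span (Set.range F)
        let f0 : MvPolynomial σ R →ₐ[R] T ⧸ J :=
          aeval fun j => f (Ideal.Quotient.mk I (X (some (Sum.inl j))))
        have hf0 : ∀ p ∈ Ideal.span (Set.range F), f0 p = 0 := by
          have : Ideal.span (Set.range F) ≤ RingHom.ker f0 := by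
            rw [Ideal.span_le]
            rintro _ ⟨k, rfl⟩
            change f0 (F k) = 0
            have h1 : f0 = f.comp (aeval fun j => Ideal.Quotient.mk I (X (some (Sum.inl j)))) :=
              MvPolynomial.algHom_ext fun j => by rw [AlgHom.comp_apply, aeval_X, aeval_X]
            rw [h1, AlgHom.comp_apply, hBx, Ideal.Quotient.eq_zero_iff_mem.2 (hIF k), map_zero]
          exact this
        obtain ⟨g', hg'⟩ := hS a haS T J bot_le hJ (Ideal.Quotient.liftₐ _ f0 hf0) hf
        let xt : σ → T := fun j => g' (Ideal.Quotient.mk _ (X j))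
        have hxt : ∀ p, aeval xt p = g' (Ideal.Quotient.mk _ p) := fun p => by
          have : aeval xt = g'.comp (Ideal.Quotient.mkₐ R _) :=
            MvPolynomial.algHom_ext fun j => by rw [AlgHom.comp_apply, aeval_X]; rfl
          rw [this]; rfl
        have hxtj : ∀ j, Ideal.Quotient.mk J (xt j) =
            f (Ideal.Quotient.mk I (X (some (Sum.inl j)))) := fun j => by
          refine (DFunLike.congr_fun hg' (Ideal.Quotient.mk _ (X j))).trans ?_
          exact aeval_X _ _
        have hfv' : f (Ideal.Quotient.mk I (X none)) = 0 := by
          obtain ⟨c, hc⟩ := hSnil a haS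
          have h1 := hfH f (rename Sum.inl a ^ c) (hHmem _ fun U _ _ u v => by
            rw [map_pow, aeval_rename, Sum.elim_comp_inl]
            have : aeval (fun i => u (x i)) a = u (aeval x a) := by
              rw [← AlgHom.comp_apply, comp_aeval]
            rw [this, ← map_pow, hc, map_zero])
          rw [map_pow, aeval_rename] at h1
          exact ((hf.pow c).mul_left_eq_zero).1 h1
        choose y hy using fun o : Option (Fin N) =>
          Ideal.Quotient.mk_surjective (f (Ideal.Quotient.mk I (X (some (Sum.inr o)))))
        have hpt : ∀ b ∈ I, aeval (fun o : Option (σ ⊕ Option (Fin N)) =>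
            o.elim 0 (Sum.elim xt y)) b = 0 :=
          gluingIdeal_le_ker h𝔞T (Sum.elim xt y) 0 (fun k => by
            refine (hxt (F k)).trans ?_
            rw [Ideal.Quotient.eq_zero_iff_mem.2 (Ideal.subset_span (Set.mem_range_self k)), map_zero])
            fun h hh => zero_mul _
        refine ⟨Ideal.Quotient.liftₐ I (aeval _) hpt, ?_⟩
        refine Ideal.Quotient.algHom_ext _ (MvPolynomial.algHom_ext fun o => ?_)
        refine (congrArg (Ideal.Quotient.mk J) (aeval_X _ _)).trans ?_
        rcases o with _ | j | o
        · exact (map_zero _).trans hfv'.symm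
        · exact hxtj j
        · exact hy o
      · rw [aeval_rename, Sum.elim_comp_inl]; exact haq

end Globalization

end

section

open MvPolynomial

section Thickening

variable {Λ : Type} [CommRing Λ]

theorem exists_nilpotent_thickening {q : Ideal Λ} [hq : q.IsPrime] {d : ℕ} {t : Fin d → Λ}
    (ht : ∀ i, t i ∈ q) (hgen : ∀ x ∈ q, ∃ s ∉ q, s * x ∈ Ideal.span (Set.range t))
    (e : Fin d → ℕ) (he : ∀ i, 0 < e i) :
    ∃ (O : Type) (_ : CommRing O) (_ : IsLocalRing O) (ι : Λ →+* O),
      (∀ l, ι l = 0 → ∃ s ∉ q, s * l ∈ Ideal.span (Set.range fun i => t i ^ e i)) ∧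
      (∀ i, ι (t i) ^ e i = 0) ∧ (∀ o, ∃ s ∉ q, ∃ l, ι s * o = ι l) ∧
      (∀ l, IsUnit (ι l) ↔ l ∉ q) ∧
      IsLocalRing.maximalIdeal O = Ideal.span (Set.range fun i => ι (t i)) ∧
      IsNilpotent (IsLocalRing.maximalIdeal O) := by
  let Q := Localization.AtPrime q
  let I : Ideal Λ := Ideal.span (Set.range fun i => t i ^ e i)
  let J : Ideal Q := I.map (algebraMap Λ Q)
  have hIq : I ≤ q := by
    rw [Ideal.span_le]
    rintro _ ⟨i, rfl⟩
    exact Ideal.pow_mem_of_mem q (ht i) _ (he i)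
  have hJ : J ≤ IsLocalRing.maximalIdeal Q := by
    refine (Ideal.map_mono hIq).trans ?_
    rw [Localization.AtPrime.map_eq_maximalIdeal]
  have hJne : J ≠ ⊤ := fun h => (IsLocalRing.maximalIdeal.isMaximal Q).ne_top
    (top_le_iff.1 (h ▸ hJ))
  have : Nontrivial (Q ⧸ J) := Ideal.Quotient.nontrivial_iff.2 hJne
  have hloc : IsLocalRing (Q ⧸ J) :=
    .of_surjective' (Ideal.Quotient.mk J) Ideal.Quotient.mk_surjective
  let ι : Λ →+* Q ⧸ J := (Ideal.Quotient.mk J).comp (algebraMap Λ Q)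
  have hloc' : IsLocalHom (Ideal.Quotient.mk J) :=
    .of_surjective _ Ideal.Quotient.mk_surjective
  have hunit : ∀ l, IsUnit (ι l) ↔ l ∉ q := fun l => by
    change IsUnit (Ideal.Quotient.mk J (algebraMap Λ Q l)) ↔ _
    rw [isUnit_map_iff, IsLocalization.AtPrime.isUnit_to_map_iff Q q]; rfl
  have hsurj : ∀ o, ∃ s ∉ q, ∃ l, ι s * o = ι l := by
    intro o
    obtain ⟨o, rfl⟩ := Ideal.Quotient.mk_surjective o
    obtain ⟨⟨l, s⟩, hls⟩ := IsLocalization.surj q.primeCompl o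
    refine ⟨s, s.2, l, ?_⟩
    have := congrArg (Ideal.Quotient.mk J) hls
    rw [map_mul, mul_comm] at this
    exact this
  have hzero : ∀ i, ι (t i) ^ e i = 0 := fun i => by
    rw [← map_pow]
    exact Ideal.Quotient.eq_zero_iff_mem.2
      (Ideal.mem_map_of_mem _ (Ideal.subset_span ⟨i, rfl⟩))
  have hmax : IsLocalRing.maximalIdeal (Q ⧸ J) = Ideal.span (Set.range fun i => ι (t i)) := by
    refine le_antisymm (fun o ho => ?_) (Ideal.span_le.2 ?_)
    · obtain ⟨s, hs, l, hl⟩ := hsurj o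
      have h1 : l ∈ q := by
        by_contra h
        have h2 := (hunit l).2 h
        rw [← hl] at h2
        exact ho (isUnit_of_mul_isUnit_right h2)
      obtain ⟨s', hs', h2⟩ := hgen l h1
      have h3 : ι (s' * l) ∈ Ideal.span (Set.range fun i => ι (t i)) := by
        have h4 := Ideal.mem_map_of_mem ι h2
        rw [Ideal.map_span, ← Set.range_comp] at h4
        exact h4
      rw [map_mul, ← hl, ← mul_assoc] at h3
      exact (Ideal.unit_mul_mem_iff_mem _ (((hunit s').2 hs').mul ((hunit s).2 hs))).1 h3
    · rintro _ ⟨i, rfl⟩ h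
      exact (hunit (t i)).1 h (ht i)
  refine ⟨Q ⧸ J, inferInstance, hloc, ι, fun l hl => ?_, hzero, hsurj, hunit, hmax, ?_⟩
  · have h1 : algebraMap Λ Q l ∈ J := Ideal.Quotient.eq_zero_iff_mem.1 hl
    rw [IsLocalization.algebraMap_mem_map_algebraMap_iff q.primeCompl] at h1
    obtain ⟨s, hs, h⟩ := h1
    exact ⟨s, hs, h⟩
  · rw [hmax, Ideal.FG.isNilpotent_iff_le_nilradical
      (Submodule.fg_span (Set.finite_range _)), Ideal.span_le]
    rintro _ ⟨i, rfl⟩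
    exact ⟨e i, hzero i⟩

theorem exists_mul_pow_mem_of_mem_minimalPrimes {I q : Ideal Λ} (hq : q ∈ I.minimalPrimes) {x : Λ}
    (hx : x ∈ q) : ∃ y ∉ q, ∃ n : ℕ, y * x ^ n ∈ I := by
  have hqp : q.IsPrime := hq.1.1
  by_contra! hcon
  obtain ⟨p, hp, hIp, hdis⟩ := Ideal.exists_le_prime_disjoint I (q.primeCompl ⊔ Submonoid.powers x)
    (by
      rw [Set.disjoint_left]
      intro a haI ha
      obtain ⟨y, hy, _, ⟨n, rfl⟩, rfl⟩ := Submonoid.mem_sup.1 ha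
      exact hcon y hy n haI)
  have hpq : p ≤ q := by
    intro a ha
    by_contra haq
    exact Set.disjoint_left.1 hdis ha (SetLike.le_def.1 le_sup_left haq)
  exact Set.disjoint_left.1 hdis (hq.2 ⟨hp, hIp⟩ hpq hx)
    (SetLike.le_def.1 le_sup_right (Submonoid.mem_powers x))

/-- A Jacobian criterion: `q` is locally generated by elements whose Jacobian determinant with
respect to some derivations does not vanish at `q`. -/
def JacReg (q : Ideal Λ) : Prop :=
  ∃ (d : ℕ) (t : Fin d → Λ) (D : Fin d → Derivation ℤ Λ Λ), (∀ i, t i ∈ q) ∧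
    (Matrix.of fun i k => D k (t i)).det ∉ q ∧ ∀ x ∈ q, ∃ s ∉ q, s * x ∈ Ideal.span (Set.range t)

theorem JacReg.exists_pow_mem {I q : Ideal Λ} (hq : q ∈ I.minimalPrimes) (h : JacReg q) :
    ∃ (d : ℕ) (t : Fin d → Λ) (D : Fin d → Derivation ℤ Λ Λ) (N : ℕ), (∀ i, t i ∈ q) ∧
      (Matrix.of fun i k => D k (t i)).det ∉ q ∧
      (∀ x ∈ q, ∃ s ∉ q, s * x ∈ Ideal.span (Set.range t)) ∧ ∀ i, t i ^ N ∈ I := by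
  classical
  have hqp : q.IsPrime := hq.1.1
  obtain ⟨d, t, D, ht, hdet, hgen⟩ := h
  choose y hy n hn using fun i => exists_mul_pow_mem_of_mem_minimalPrimes hq (ht i)
  let lam := ∏ i, y i
  have hlam : lam ∉ q := by
    rw [hqp.prod_mem_iff]; rintro ⟨i, _, hi⟩; exact hy i hi
  refine ⟨d, fun i => lam * t i, D, ∑ i, n i + 1, fun i => q.mul_mem_left _ (ht i), ?_, ?_, ?_⟩
  · rw [← Ideal.Quotient.eq_zero_iff_mem, RingHom.map_det] at hdet ⊢
    have : (Ideal.Quotient.mk q).mapMatrix (Matrix.of fun i k => D k (lam * t i)) =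
        Ideal.Quotient.mk q lam • (Ideal.Quotient.mk q).mapMatrix
          (Matrix.of fun i k => D k (t i)) := by
      ext i k
      simp only [RingHom.mapMatrix_apply, Matrix.map_apply, Matrix.of_apply, Matrix.smul_apply,
        Derivation.leibniz, smul_eq_mul, map_add, map_mul,
        Ideal.Quotient.eq_zero_iff_mem.2 (ht i), zero_mul, add_zero]
    rw [this, Matrix.det_smul]
    refine mul_ne_zero (pow_ne_zero _ ?_) hdet
    rwa [Ne, Ideal.Quotient.eq_zero_iff_mem]
  · intro x hx
    obtain ⟨s, hs, h⟩ := hgen x hx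
    refine ⟨lam * s, fun h => (hqp.mem_or_mem h).elim hlam hs, ?_⟩
    obtain ⟨c, hc⟩ := Ideal.mem_span_range_iff_exists_fun.1 h
    refine Ideal.mem_span_range_iff_exists_fun.2 ⟨c, ?_⟩
    rw [mul_assoc, ← hc, Finset.mul_sum]
    exact Finset.sum_congr rfl fun i _ => by ring
  · intro i
    have h1 : n i ≤ ∑ i, n i := Finset.single_le_sum (fun _ _ => Nat.zero_le _) (Finset.mem_univ i)
    have h2 : (lam * t i) ^ (∑ i, n i + 1) = (lam ^ (∑ i, n i) * (∏ j ∈ Finset.univ.erase i, y j) *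
        t i ^ (∑ i, n i + 1 - n i)) * (y i * t i ^ n i) := by
      have h3 : lam = y i * ∏ j ∈ Finset.univ.erase i, y j :=
        (Finset.mul_prod_erase _ _ (Finset.mem_univ i)).symm
      have h4 : t i ^ (∑ i, n i + 1) = t i ^ (∑ i, n i + 1 - n i) * t i ^ n i := by
        rw [← pow_add]; congr 1; omega
      rw [mul_pow, h4, pow_succ]
      nth_rewrite 2 [h3]
      ring
    rw [h2]
    exact I.mul_mem_left _ (hn i)

end Thickening

section Combination

variable {R R₀ A σ κ : Type} [CommRing R] [CommRing R₀] [Algebra R R₀] [CommRing A] [Algebra R A]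

/-- The system `G` together with the equations `c i = ∑ l, a l * y (i, l)`. -/
noncomputable def combEq {d s : ℕ} (R₀ : Type) [CommRing R₀] [Algebra R R₀]
    (G : κ → MvPolynomial σ R) (a : Fin s → MvPolynomial σ R) (c : Fin d → R₀) :
    κ ⊕ Fin d → MvPolynomial (σ ⊕ Fin d × Fin s) R₀ :=
  Sum.elim (fun k => rename Sum.inl (MvPolynomial.map (algebraMap R R₀) (G k)))
    fun i => C (c i) -
      ∑ l, rename Sum.inl (MvPolynomial.map (algebraMap R R₀) (a l)) * X (Sum.inr (i, l))

theorem aeval_rename_inl_map {U τ : Type} [CommRing U] [Algebra R U] [Algebra R₀ U]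
    [IsScalarTower R R₀ U] (p : σ ⊕ τ → U) (h : MvPolynomial σ R) :
    aeval p (rename Sum.inl (MvPolynomial.map (algebraMap R R₀) h)) =
      aeval (fun j => p (Sum.inl j)) h := by
  rw [aeval_rename, aeval_map_algebraMap]; rfl

theorem liftsAt_combEq {G : κ → MvPolynomial σ R} {g : MvPolynomial σ R →ₐ[R] A}
    (hg : Function.Surjective g) (hker : RingHom.ker g = Ideal.span (Set.range G)) {d s : ℕ}
    (a : Fin s → MvPolynomial σ R) (c : Fin d → R₀) (l₀ : Fin s) (hl : LiftsAt R A (g (a l₀))) :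
    LiftsAt R₀ (MvPolynomial (σ ⊕ Fin d × Fin s) R₀ ⧸ Ideal.span (Set.range (combEq R₀ G a c)))
      (Ideal.Quotient.mk _ (rename Sum.inl (MvPolynomial.map (algebraMap R R₀) (a l₀)))) := by
  classical
  intro T _ _ J _ hJ f hf
  let _ : Algebra R T := ((algebraMap R₀ T).comp (algebraMap R R₀)).toAlgebra
  have : IsScalarTower R R₀ T := IsScalarTower.of_algebraMap_eq fun _ => rfl
  let P := MvPolynomial (σ ⊕ Fin d × Fin s) R₀
  let I : Ideal P := Ideal.span (Set.range (combEq R₀ G a c))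
  let p : σ ⊕ Fin d × Fin s → T ⧸ J := fun o => f (Ideal.Quotient.mk I (X o))
  have hp : ∀ h : P, f (Ideal.Quotient.mk I h) = aeval p h := fun h => by
    have : f.comp (Ideal.Quotient.mkₐ R₀ I) = aeval p :=
      MvPolynomial.algHom_ext fun o => by rw [AlgHom.comp_apply, aeval_X]; rfl
    rw [← this]; rfl
  have hpF : ∀ k, aeval p (combEq R₀ G a c k) = 0 := fun k => by
    rw [← hp, Ideal.Quotient.eq_zero_iff_mem.2 (Ideal.subset_span (Set.mem_range_self k)), map_zero]
  let px : σ → T ⧸ J := fun j => p (Sum.inl j)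
  have hpG : ∀ k, aeval px (G k) = 0 := fun k => by
    have := hpF (Sum.inl k)
    simp only [combEq, Sum.elim_inl] at this
    rwa [aeval_rename_inl_map] at this
  have hkill : RingHom.ker g ≤ RingHom.ker (aeval px : MvPolynomial σ R →ₐ[R] T ⧸ J) := by
    rw [hker, Ideal.span_le]
    rintro _ ⟨k, rfl⟩
    exact hpG k
  let f0 : A →ₐ[R] T ⧸ J := AlgHom.liftOfSurjective g hg (aeval px) hkill
  have hf0 : ∀ h, f0 (g h) = aeval px h := fun h => AlgHom.liftOfSurjective_apply _ _ _ _ _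
  rw [hp, aeval_rename_inl_map] at hf
  obtain ⟨g', hg'⟩ := hl T J bot_le hJ f0 (by rw [hf0]; exact hf)
  have hg'' : ∀ y, Ideal.Quotient.mk J (g' y) = f0 y := fun y => DFunLike.congr_fun hg' y
  let xt : σ → T := fun j => g' (g (X j))
  have hxt : ∀ h, aeval xt h = g' (g h) := fun h => by
    have : aeval xt = g'.comp g :=
      MvPolynomial.algHom_ext fun j => by rw [AlgHom.comp_apply, aeval_X]
    rw [this]; rfl
  have hu : IsUnit (g' (g (a l₀))) := isUnit_of_isUnit_mk hJ (by
    rw [hg'', hf0]; exact hf)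
  obtain ⟨ω, hω⟩ := hu.exists_right_inv
  choose y₀ hy₀ using fun o => Ideal.Quotient.mk_surjective (p (Sum.inr o))
  let r : Fin d → T := fun i => algebraMap R₀ T (c i) - ∑ l, g' (g (a l)) * y₀ (i, l)
  have hr : ∀ i, Ideal.Quotient.mk J (r i) = 0 := fun i => by
    have h1 := hpF (Sum.inr i)
    simp only [combEq, Sum.elim_inr, map_sub, map_sum, map_mul, aeval_X] at h1
    simp only [aeval_rename_inl_map] at h1
    rw [← h1]
    simp only [r, map_sub, map_sum, map_mul, hg'', hf0, hy₀]
    rw [algHom_C]; rfl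
  let yt : Fin d × Fin s → T := fun o => y₀ o + if o.2 = l₀ then ω * r o.1 else 0
  let pt : σ ⊕ Fin d × Fin s → T := Sum.elim xt yt
  have hpt : ∀ b ∈ I, aeval pt b = 0 := by
    have : I ≤ RingHom.ker (aeval (R := R₀) pt) := by
      rw [Ideal.span_le]
      rintro _ ⟨k | i, rfl⟩
      · change aeval pt _ = 0
        simp only [combEq, Sum.elim_inl]
        rw [aeval_rename_inl_map]
        change aeval xt (G k) = 0
        have h1 : G k ∈ RingHom.ker g := by rw [hker]; exact Ideal.subset_span ⟨k, rfl⟩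
        rw [hxt, RingHom.mem_ker.1 h1, map_zero]
      · change aeval pt _ = 0
        simp only [combEq, Sum.elim_inr, map_sub, map_sum, map_mul, aeval_X]
        simp only [aeval_rename_inl_map, algHom_C]
        change algebraMap R₀ T (c i) - ∑ l, aeval xt (a l) * yt (i, l) = 0
        simp only [hxt, yt, mul_add, Finset.sum_add_distrib, mul_ite, mul_zero,
          Finset.sum_ite_eq', Finset.mem_univ, if_true]
        rw [← mul_assoc, hω, one_mul]
        simp only [r]; ring
    exact this
  refine ⟨Ideal.Quotient.liftₐ I (aeval pt) hpt, ?_⟩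
  refine Ideal.Quotient.algHom_ext _ (MvPolynomial.algHom_ext fun o => ?_)
  refine (congrArg (Ideal.Quotient.mk J) (aeval_X _ _)).trans ?_
  rcases o with j | o
  · refine (hg'' _).trans ?_
    rw [hf0, aeval_X]; rfl
  · change Ideal.Quotient.mk J (y₀ o + if o.2 = l₀ then ω * r o.1 else 0) = p (Sum.inr o)
    rw [map_add, hy₀]
    split_ifs
    · rw [map_mul, hr, mul_zero, add_zero]
    · rw [map_zero, add_zero]

end Combination

end

section

open MvPolynomial

section Improvement

theorem exists_newton_combEq {R R₀ A σ κ : Type} [CommRing R] [CommRing R₀] [Algebra R R₀]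
    [CommRing A] [Algebra R A] [Fintype σ] [Fintype κ] {G : κ → MvPolynomial σ R}
    {g : MvPolynomial σ R →ₐ[R] A} (hg : Function.Surjective g)
    (hker : RingHom.ker g = Ideal.span (Set.range G)) {d s : ℕ} (a : Fin s → MvPolynomial σ R)
    (c : Fin d → R₀) (hl : ∀ l, LiftsAt R A (g (a l))) :
    ∃ K : ℕ, ∀ i, Newton (combEq R₀ G a c) (C (c i ^ K)) 0 := by
  classical
  let a' : Fin s → MvPolynomial (σ ⊕ Fin d × Fin s) R₀ := fun l =>
    rename Sum.inl (MvPolynomial.map (algebraMap R R₀) (a l))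
  have h1 : ∀ l, ∃ M, Newton (combEq R₀ G a c) (a' l ^ M) 0 := fun l => by
    have h2 := liftsAt_combEq hg hker a c l (hl l)
    refine LiftsMod.exists_newton (g := Ideal.Quotient.mkₐ R₀ (Ideal.span (Set.range
      (combEq R₀ G a c)))) (Ideal.Quotient.mkₐ_surjective R₀ _)
      (Ideal.Quotient.mkₐ_ker R₀ _) ?_
    rw [Ideal.span_singleton_eq_bot.2 rfl]
    exact h2
  choose M hM using h1
  let S : Set (MvPolynomial (σ ⊕ Fin d × Fin s) R₀) := Set.range fun l => a' l ^ M l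
  let I := Ideal.span S ⊔ Ideal.span (Set.range (combEq R₀ G a c))
  have h2 : ∀ i, ∃ K : ℕ, (C (c i) : MvPolynomial (σ ⊕ Fin d × Fin s) R₀) ^ K ∈ I := fun i => by
    change C (c i) ∈ I.radical
    have h3 : (C (c i) : MvPolynomial (σ ⊕ Fin d × Fin s) R₀) =
        combEq R₀ G a c (Sum.inr i) + ∑ l, a' l * X (Sum.inr (i, l)) := by
      simp [combEq, a']
    rw [h3]
    refine I.radical.add_mem (Ideal.le_radical (Ideal.mem_sup_right (Ideal.subset_span
      (Set.mem_range_self _)))) (I.radical.sum_mem fun l _ => I.radical.mul_mem_right _ ?_)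
    exact ⟨M l, Ideal.mem_sup_left (Ideal.subset_span (Set.mem_range_self l))⟩
  choose K hK using h2
  refine ⟨∑ i, K i, fun i => newton_of_mem_span_image (s := S) (by rintro _ ⟨l, rfl⟩; exact hM l) ?_⟩
  rw [C_pow]
  exact I.pow_mem_of_pow_mem (hK i)
    (Finset.single_le_sum (fun _ _ => Nat.zero_le _) (Finset.mem_univ i))

variable {R Λ : Type} [CommRing R] [CommRing Λ] [Algebra R Λ]

/-- The ideal of `Λ` generated by the image of the smooth locus of `A`. -/
def smoothIdeal {A : Type} [CommRing A] [Algebra R A] (φ : A →ₐ[R] Λ) : Ideal Λ :=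
  Ideal.span (φ '' {a | LiftsAt R A a})

theorem exists_smoothIdeal_eq_span [IsNoetherianRing Λ] {A : Type} [CommRing A] [Algebra R A]
    (φ : A →ₐ[R] Λ) : ∃ (s : ℕ) (a : Fin s → A), (∀ l, LiftsAt R A (a l)) ∧
      smoothIdeal φ = Ideal.span (Set.range fun l => φ (a l)) := by
  obtain ⟨S, hS, hspan⟩ := (Submodule.fg_span_iff_fg_span_finset_subset (R := Λ)
    (φ '' {a | LiftsAt R A a})).1 (IsNoetherian.noetherian _)
  choose a ha haφ using fun l : S => hS l.2
  refine ⟨S.card, fun l => a (S.equivFin.symm l), fun l => ha _, ?_⟩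
  refine hspan.trans (congrArg _ ?_)
  ext y
  constructor
  · intro hy
    exact ⟨S.equivFin ⟨y, hy⟩, by simp [haφ]⟩
  · rintro ⟨l, rfl⟩
    simp only [haφ]
    exact (S.equivFin.symm l).2

set_option maxHeartbeats 1000000 in
theorem exists_improvement [IsDomain R] [CharZero R] [IsNoetherianRing R] [IsNoetherianRing Λ]
    {A : Type} [CommRing A] [Algebra R A] [Algebra.FiniteType R A] (φ : A →ₐ[R] Λ) {q : Ideal Λ}
    (hq : q ∈ (smoothIdeal φ).minimalPrimes) (hqR : ∀ r, algebraMap R Λ r ∈ q → r = 0)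
    (hreg : JacReg q) :
    ∃ (B : Type) (_ : CommRing B) (_ : Algebra R B) (ι : A →ₐ[R] B) (β : B →ₐ[R] Λ),
      Algebra.FiniteType R B ∧ β.comp ι = φ ∧ smoothIdeal φ ≤ (smoothIdeal β).radical ∧
      ¬ smoothIdeal β ≤ q := by
  classical
  have hqp : q.IsPrime := hq.1.1
  obtain ⟨s, a, ha, hspan⟩ := exists_smoothIdeal_eq_span φ
  obtain ⟨n, r, g, G, hg, hker⟩ := exists_presentation R A
  obtain ⟨d, t, D, N, ht, hdet, hgen, hpow⟩ := hreg.exists_pow_mem hq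
  choose a' ha' using fun l => hg (a l)
  have hpow' : ∀ i, ∃ y : Fin s → Λ, ∑ l, y l * φ (a l) = t i ^ N := fun i => by
    have := hpow i
    rw [hspan] at this
    exact Ideal.mem_span_range_iff_exists_fun.1 this
  choose y hy using hpow'
  let R₀ := MvPolynomial (Fin d) R
  let _ : Algebra R₀ Λ := (aeval t : R₀ →ₐ[R] Λ).toRingHom.toAlgebra
  have hRΛ : ∀ p : R₀, algebraMap R₀ Λ p = aeval t p := fun _ => rfl
  have : IsScalarTower R R₀ Λ := IsScalarTower.of_algebraMap_eq fun r => by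
    rw [hRΛ, AlgHom.commutes]
  let c : Fin d → R₀ := fun i => X i ^ N
  let F := combEq R₀ G a' c
  let z : Fin n ⊕ Fin d × Fin s → Λ := Sum.elim (fun j => φ (g (X j))) fun o => y o.1 o.2
  have hzx : ∀ p : MvPolynomial (Fin n) R, aeval (fun j => z (Sum.inl j)) p = φ (g p) := fun p => by
    have : (aeval fun j => z (Sum.inl j)) = φ.comp g :=
      MvPolynomial.algHom_ext fun j => by rw [AlgHom.comp_apply, aeval_X]; rfl
    rw [this]; rfl
  have hgG : ∀ k, g (G k) = 0 := fun k => by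
    have : G k ∈ RingHom.ker g := by rw [hker]; exact Ideal.subset_span ⟨k, rfl⟩
    exact this
  have hz : ∀ k, aeval z (F k) = 0 := by
    rintro (k | i)
    · simp only [F, combEq, Sum.elim_inl]
      rw [aeval_rename_inl_map, hzx, hgG, map_zero]
    · simp only [F, combEq, Sum.elim_inr, map_sub, map_sum, map_mul, aeval_X, algHom_C]
      simp only [aeval_rename_inl_map, hzx, ha']
      rw [hRΛ, map_pow, aeval_X, ← hy, sub_eq_zero]
      exact Finset.sum_congr rfl fun l _ => mul_comm _ _
  let al : Fin s → MvPolynomial (Fin n ⊕ Fin d × Fin s) R₀ := fun l =>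
    rename Sum.inl (MvPolynomial.map (algebraMap R R₀) (a' l))
  have hal : ∀ l, aeval z (al l) = φ (a l) := fun l => by
    simp only [al]
    rw [aeval_rename_inl_map, hzx, ha']
  have hla : ∀ l, LiftsAt R A (g (a' l)) := fun l => by rw [ha']; exact ha l
  obtain ⟨K, hK⟩ := exists_newton_combEq hg hker a' c hla
  have hbot : ∀ e : Fin d → ℕ, (∀ i, 0 < e i) → SolvedMod F z
      {q' | q' = q ∨ ∃ b ∈ Set.range al, aeval z b ∉ q'} (powIdeal (X : Fin d → R₀) e d) := by
    intro e he
    obtain ⟨O, _, _, ι, hι0, hιt, hιs, hιu, hmax, hnil⟩ := exists_nilpotent_thickening ht hgen e he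
    let _ : Algebra R₀ O := (ι.comp (algebraMap R₀ Λ)).toAlgebra
    let _ : Algebra R O := (ι.comp (algebraMap R Λ)).toAlgebra
    have : IsScalarTower R R₀ O := IsScalarTower.of_algebraMap_eq fun r => by
      change ι (algebraMap R Λ r) = ι (algebraMap R₀ Λ (algebraMap R R₀ r))
      rw [← IsScalarTower.algebraMap_apply]
    let ι' : Λ →ₐ[R₀] O := { ι with commutes' := fun _ => rfl }
    have hι' : ∀ l, ι' l = ι l := fun _ => rfl
    have hmapa : (powIdeal (X : Fin d → R₀) e d).map (algebraMap R₀ Λ) =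
        Ideal.span (Set.range fun i => t i ^ e i) := by
      rw [powIdeal, Ideal.map_span, Set.image_image]
      congr 1
      ext x
      simp only [Set.mem_image, Set.mem_ofPred_eq, Set.mem_range, map_pow, hRΛ, aeval_X]
      exact ⟨fun ⟨i, _, h⟩ => ⟨i, h⟩, fun ⟨i, h⟩ => ⟨i, i.2, h⟩⟩
    have hNB : ∀ o : O, o * ∏ i, ι (t i) ^ (e i - 1) = 0 → ¬ IsUnit o := by
      intro o ho hou
      obtain ⟨s, hs, l, hl⟩ := hιs o
      have h1 : ι (l * ∏ i, t i ^ (e i - 1)) = 0 := by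
        rw [map_mul, ← hl, map_prod]
        simp only [map_pow]
        rw [mul_assoc, ho, mul_zero]
      obtain ⟨s', hs', h2⟩ := hι0 _ h1
      rw [← mul_assoc] at h2
      have h3 := mem_of_mul_prod_pow_mem (q := q) (fun n hn h => hn (by
        have := hqR n (by rwa [map_natCast])
        exact_mod_cast this)) ht hdet _ (fun i => e i - 1) (s' * l) rfl (by
          simp only [Nat.sub_add_cancel (he _)]; exact h2)
      have h4 : l ∈ q := (hqp.mem_or_mem h3).resolve_left hs'
      exact (hιu l).1 (hl ▸ ((hιu s).2 hs).mul hou) h4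
    obtain ⟨Cc, _, _, ψ, x, gc, hCft, hψ, hψx, hlift, hgu⟩ := exists_local_model (R := R) (O := O)
      (t := fun i => ι (t i)) (fun i => by
        change ι (algebraMap R₀ Λ (X i)) = _
        rw [hRΛ, aeval_X]) hmax hnil (by
        rw [injective_iff_map_eq_zero]
        intro r hr
        refine hqR r ?_
        by_contra h
        have h1 : IsUnit (algebraMap R O r) := (hιu _).2 h
        have h2 := h1.map (IsLocalRing.residue O)
        have h3 : IsLocalRing.residue O (algebraMap R O r) = 0 := hr
        rw [h3] at h2
        exact not_isUnit_zero h2) e hιt hNB (fun j => ι (z j))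
    have hψaev : ∀ p, ψ (aeval x p) = ι' (aeval z p) := fun p => by
      have : ψ.comp (aeval x) = ι'.comp (aeval z) := MvPolynomial.algHom_ext fun j => by
        rw [AlgHom.comp_apply, AlgHom.comp_apply, aeval_X, aeval_X, hψx]; rfl
      exact DFunLike.congr_fun this p
    refine SolvedMod.globalize hz ι' (fun l hl => by rw [hmapa]; exact hι0 l hl) hιs
      (fun s hs => (hιu s).2 hs) (fun l hl => (hιu l).1 hl) (A := Cc) ?_ ψ x (fun k => hψ ?_) hψx gc
      hlift hgu (Set.range al) ?_ ?_
    · intro p hp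
      refine hψ ?_
      rw [AlgHom.commutes, map_zero]
      change ι (algebraMap R₀ Λ p) = 0
      have h1 : algebraMap R₀ Λ p ∈ Ideal.span (Set.range fun i => t i ^ e i) := by
        rw [← hmapa]; exact Ideal.mem_map_of_mem _ hp
      have h2 : Ideal.span (Set.range fun i => t i ^ e i) ≤ RingHom.ker ι := by
        rw [Ideal.span_le]
        rintro _ ⟨i, rfl⟩
        change ι (t i ^ e i) = 0
        rw [map_pow, hιt]
      exact h2 h1
    · rw [hψaev, hz, map_zero, map_zero]
    · rintro _ ⟨l, rfl⟩
      exact liftsAt_combEq hg hker a' c l (hla l)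
    · rintro _ ⟨l, rfl⟩
      obtain ⟨k, hk⟩ := hnil
      refine ⟨k, hψ ?_⟩
      rw [map_pow, hψaev, hal, map_zero]
      have h1 : ι' (φ (a l)) ∈ IsLocalRing.maximalIdeal O := by
        intro h
        refine (hιu _).1 h (hq.1.2 ?_)
        exact Ideal.subset_span ⟨a l, ha l, rfl⟩
      have h2 := Ideal.pow_mem_pow h1 k
      rwa [hk] at h2
  obtain ⟨B, _, _, β, Y, hBft, -, hY, hβY, hBsm⟩ := SolvedMod.chain hz (X : Fin d → R₀) (N * K)
    (fun i => by
      have := hK i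
      simp only [c, ← pow_mul] at this
      exact this) (fun i e y h => mem_powIdeal_of_X_mul_mem i e y h) hbot
  let _ : Algebra R B := ((algebraMap R₀ B).comp (algebraMap R R₀)).toAlgebra
  have : IsScalarTower R R₀ B := IsScalarTower.of_algebraMap_eq fun _ => rfl
  have hbotmap : (⊥ : Ideal R₀).map (algebraMap R₀ Λ) = ⊥ := Ideal.map_bot
  let π' : Λ ⧸ (⊥ : Ideal R₀).map (algebraMap R₀ Λ) →ₐ[R₀] Λ :=
    Ideal.Quotient.liftₐ _ (AlgHom.id R₀ Λ) fun x hx => by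
      rw [hbotmap] at hx; exact hx
  have hπ' : ∀ x, π' (Ideal.Quotient.mk _ x) = x := fun _ => rfl
  let β' : B →ₐ[R] Λ := (π'.comp β).restrictScalars R
  have hkill : RingHom.ker g ≤ RingHom.ker
      (aeval (fun j => Y (Sum.inl j)) : MvPolynomial (Fin n) R →ₐ[R] B) := by
    rw [hker, Ideal.span_le]
    rintro _ ⟨k, rfl⟩
    have := hY (Sum.inl k)
    simp only [F, combEq, Sum.elim_inl] at this
    rwa [aeval_rename_inl_map] at this
  let ι : A →ₐ[R] B := AlgHom.liftOfSurjective g hg _ hkill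
  have hι : ∀ p, ι (g p) = aeval (fun j => Y (Sum.inl j)) p := fun p =>
    AlgHom.liftOfSurjective_apply _ _ _ _ _
  have hlift : ∀ b, LiftsMod R₀ ⊥ B b → LiftsAt R B b := fun b hb => by
    have h1 := (liftsMod_mvPolynomial (R := R) ⊥ (Fin d)).comp (B := B) (b := b) hb
    rwa [map_one, one_mul] at h1
  have hgood : ∀ q', q'.IsPrime → (q' = q ∨ ∃ l, φ (a l) ∉ q') → ¬ smoothIdeal β' ≤ q' := by
    intro q' hq' h hle
    obtain ⟨b, hb, hbq⟩ := hBsm q' (h.imp id fun ⟨l, hl⟩ => ⟨al l, ⟨l, rfl⟩, by rwa [hal]⟩) hq'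
      (by rw [hbotmap]; exact bot_le)
    obtain ⟨x, hx⟩ := Ideal.Quotient.mk_surjective (β b)
    refine hbq x hx (hle ?_)
    have : β' b = x := by
      change π' (β b) = x
      rw [← hx]; exact hπ' x
    rw [← this]
    exact Ideal.subset_span ⟨b, hlift b hb, rfl⟩
  refine ⟨B, inferInstance, inferInstance, ι, β', ?_, ?_, ?_, hgood q hqp (Or.inl rfl)⟩
  · exact Algebra.FiniteType.trans (inferInstance : Algebra.FiniteType R R₀) hBft
  · refine AlgHom.ext fun x => ?_
    obtain ⟨p, rfl⟩ := hg x
    have : (β'.comp ι).comp g = φ.comp g := MvPolynomial.algHom_ext fun j => by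
      simp only [AlgHom.comp_apply, hι, aeval_X]
      change π' (β (Y (Sum.inl j))) = _
      rw [hβY]; exact hπ' _
    exact DFunLike.congr_fun this p
  · rw [Ideal.radical_eq_sInf]
    refine le_sInf ?_
    rintro p ⟨hp, hpp⟩
    by_contra hcon
    rw [hspan, Ideal.span_le] at hcon
    have : ∃ l, φ (a l) ∉ p := by
      by_contra! h
      exact hcon (by rintro _ ⟨l, rfl⟩; exact h l)
    exact hgood p hpp (Or.inr this) hp

/-- Generic smoothing: if `Λ` satisfies the Jacobian criterion at the primes lying over zero, each
algebra of finite type over `R` with a map to `Λ` maps to one which is smooth over a nonempty open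
part of the base. -/
theorem exists_generic_smoothing [IsDomain R] [CharZero R] [IsNoetherianRing R]
    [IsNoetherianRing Λ]
    (hreg : ∀ q : Ideal Λ, q.IsPrime → (∀ r, algebraMap R Λ r ∈ q → r = 0) → JacReg q)
    {A : Type} [CommRing A] [Algebra R A] [Algebra.FiniteType R A] (φ : A →ₐ[R] Λ) :
    ∃ (B : Type) (_ : CommRing B) (_ : Algebra R B) (ι : A →ₐ[R] B) (β : B →ₐ[R] Λ),
      Algebra.FiniteType R B ∧ β.comp ι = φ ∧
      ∃ π : R, π ≠ 0 ∧ algebraMap R Λ π ∈ smoothIdeal β := by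
  let 𝒮 : Set (Ideal Λ) := {I | ∃ (B : Type) (_ : CommRing B) (_ : Algebra R B) (ι : A →ₐ[R] B)
    (β : B →ₐ[R] Λ), Algebra.FiniteType R B ∧ β.comp ι = φ ∧ I = (smoothIdeal β).radical}
  obtain ⟨I, ⟨B, _, _, ι, β, hB, hβ, hI⟩, hmax⟩ := set_has_maximal_iff_noetherian.2
    (inferInstance : IsNoetherian Λ Λ) 𝒮 ⟨_, A, inferInstance, inferInstance, AlgHom.id R A, φ,
      inferInstance, AlgHom.comp_id _, rfl⟩
  refine ⟨B, inferInstance, inferInstance, ι, β, hB, hβ, ?_⟩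
  by_contra! hcon
  obtain ⟨p, hp, hIp, hdis⟩ := Ideal.exists_le_prime_disjoint (smoothIdeal β)
    ((nonZeroDivisors R).map (algebraMap R Λ)) (by
      rw [Set.disjoint_left]
      rintro _ hx ⟨r, hr, rfl⟩
      exact hcon r (nonZeroDivisors.ne_zero hr) hx)
  obtain ⟨q, hq, hqp⟩ := Ideal.exists_minimalPrimes_le hIp
  have hqR : ∀ r, algebraMap R Λ r ∈ q → r = 0 := by
    intro r hr
    by_contra h
    exact Set.disjoint_left.1 hdis (hqp hr) ⟨r, mem_nonZeroDivisors_of_ne_zero h, rfl⟩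
  obtain ⟨B', _, _, ι', β', hB', hβ', hle, hnle⟩ := exists_improvement β hq hqR
    (hreg q hq.1.1 hqR)
  refine hmax _ ⟨B', inferInstance, inferInstance, ι'.comp ι, β', hB', ?_, rfl⟩ ?_
  · rw [← AlgHom.comp_assoc, hβ', hβ]
  · rw [hI]
    refine lt_of_le_of_ne (Ideal.radical_le_radical_iff.2 hle) fun h => hnle ?_
    refine Ideal.le_radical.trans (h.symm.le.trans ?_)
    exact (hq.1.1.radical_le_iff).2 hq.1.2

end Improvement

end

section

section Completeness

variable {k : Type} [Field k] {N : ℕ}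

theorem MvPowerSeries.mem_maximalIdeal_iff {σ : Type} {f : MvPowerSeries σ k} :
    f ∈ IsLocalRing.maximalIdeal (MvPowerSeries σ k) ↔ constantCoeff f = 0 := by
  rw [IsLocalRing.mem_maximalIdeal, mem_nonunits_iff, isUnit_iff_constantCoeff,
    isUnit_iff_ne_zero, not_not]

theorem MvPowerSeries.le_order_of_mem_maximalIdeal_pow {σ : Type} (n : ℕ) :
    ∀ f ∈ IsLocalRing.maximalIdeal (MvPowerSeries σ k) ^ n, (n : ℕ∞) ≤ f.order := by
  induction n with
  | zero => intro f _; simp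
  | succ n ih =>
    intro f hf
    rw [pow_succ] at hf
    refine Submodule.mul_induction_on hf (fun a ha b hb => ?_) fun a b ha hb => ?_
    · have h1 : (1 : ℕ∞) ≤ b.order := by
        rw [MvPowerSeries.one_le_order_iff_constCoeff_eq_zero]
        exact MvPowerSeries.mem_maximalIdeal_iff.1 hb
      push_cast
      exact (add_le_add (ih a ha) h1).trans MvPowerSeries.le_order_mul
    · exact (le_min ha hb).trans MvPowerSeries.min_order_le_add

theorem MvPowerSeries.coeff_mul_X_eq_ite {σ : Type} {R : Type} [CommRing R] [DecidableEq σ]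
    (m : σ →₀ ℕ) (i : σ) (f : MvPowerSeries σ R) :
    coeff m (f * X i) = if m i ≠ 0 then coeff (m - Finsupp.single i 1) f else 0 := by
  rw [X, coeff_mul_monomial, mul_one]
  simp only [Finsupp.single_le_iff, Nat.one_le_iff_ne_zero]

theorem MvPowerSeries.mem_span_X_pow (n : ℕ) :
    ∀ f : MvPowerSeries (Fin N) k, (∀ m : Fin N →₀ ℕ, m.degree < n → coeff m f = 0) →
      f ∈ Ideal.span (Set.range (X : Fin N → MvPowerSeries (Fin N) k)) ^ n := by
  classical
  induction n with
  | zero => intro f _; simp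
  | succ n ih =>
    intro f hf
    let g : Fin N → MvPowerSeries (Fin N) k := fun i m =>
      if ∀ j < i, m j = 0 then coeff (m + Finsupp.single i 1) f else 0
    have hg : ∀ i m, coeff m (g i) =
        if ∀ j < i, m j = 0 then coeff (m + Finsupp.single i 1) f else 0 := fun i m => rfl
    have hfg : f = ∑ i, g i * X i := by
      ext m
      rw [map_sum]
      by_cases hm : m = 0
      · subst hm
        rw [hf 0 (by simp), Finset.sum_eq_zero]
        intro i _
        rw [coeff_mul_X_eq_ite, if_neg (by simp)]
      · have hne : (Finset.univ.filter fun i => m i ≠ 0).Nonempty := by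
          by_contra h
          rw [Finset.not_nonempty_iff_eq_empty, Finset.filter_eq_empty_iff] at h
          exact hm (Finsupp.ext fun i => not_not.1 (h (Finset.mem_univ i)))
        let i := (Finset.univ.filter fun i => m i ≠ 0).min' hne
        have hi : m i ≠ 0 := (Finset.mem_filter.1 (Finset.min'_mem _ hne)).2
        have hmin : ∀ j < i, m j = 0 := fun j hj => by
          by_contra h
          exact absurd (Finset.min'_le _ j (Finset.mem_filter.2 ⟨Finset.mem_univ _, h⟩))
            (not_le.2 hj)
        have hle : Finsupp.single i 1 ≤ m := by
          rw [Finsupp.single_le_iff]; omega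
        rw [Finset.sum_eq_single i]
        · rw [coeff_mul_X_eq_ite, if_pos hi, hg, if_pos, tsub_add_cancel_of_le hle]
          intro j hj
          rw [Finsupp.tsub_apply, hmin j hj, zero_tsub]
        · intro j _ hj
          rw [coeff_mul_X_eq_ite]
          split_ifs with h
          · rw [hg, if_neg]
            intro h2
            rcases lt_trichotomy j i with h3 | h3 | h3
            · exact h (hmin j h3)
            · exact hj h3
            · have := h2 i h3
              rw [Finsupp.tsub_apply, Finsupp.single_eq_of_ne (ne_of_lt h3)] at this
              exact hi (by simpa using this)
          · rfl
        · simp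
    rw [hfg, pow_succ]
    refine Ideal.sum_mem _ fun i _ => Ideal.mul_mem_mul (ih (g i) fun m hm => ?_)
      (Ideal.subset_span ⟨i, rfl⟩)
    rw [hg]
    split_ifs
    · refine hf _ ?_
      rw [map_add, Finsupp.degree_single]; omega
    · rfl

theorem MvPowerSeries.mem_maximalIdeal_pow_iff {n : ℕ} {f : MvPowerSeries (Fin N) k} :
    f ∈ IsLocalRing.maximalIdeal (MvPowerSeries (Fin N) k) ^ n ↔
      ∀ m : Fin N →₀ ℕ, m.degree < n → coeff m f = 0 := by
  constructor
  · intro h m hm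
    refine coeff_of_lt_order (lt_of_lt_of_le ?_ (le_order_of_mem_maximalIdeal_pow n f h))
    exact_mod_cast hm
  · intro h
    refine Ideal.pow_right_mono ?_ n (mem_span_X_pow n f h)
    rw [Ideal.span_le]
    rintro _ ⟨i, rfl⟩
    exact mem_maximalIdeal_iff.2 (constantCoeff_X i)

instance MvPowerSeries.isAdicComplete_maximalIdeal :
    IsAdicComplete (IsLocalRing.maximalIdeal (MvPowerSeries (Fin N) k))
      (MvPowerSeries (Fin N) k) where
  haus' f hf := by
    ext m
    have h1 := hf (m.degree + 1)
    rw [SModEq.zero, smul_eq_mul, Ideal.mul_top, mem_maximalIdeal_pow_iff] at h1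
    exact h1 m (Nat.lt_succ_self _)
  prec' f hf := by
    let g : MvPowerSeries (Fin N) k := fun m => coeff m (f (m.degree + 1))
    have hg : ∀ m, coeff m g = coeff m (f (m.degree + 1)) := fun m => rfl
    refine ⟨g, fun n => ?_⟩
    rw [SModEq.sub_mem, smul_eq_mul, Ideal.mul_top, mem_maximalIdeal_pow_iff]
    intro m hm
    have h1 := hf (show m.degree + 1 ≤ n from hm)
    rw [SModEq.sub_mem, smul_eq_mul, Ideal.mul_top, mem_maximalIdeal_pow_iff] at h1
    have h2 := h1 m (Nat.lt_succ_self _)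
    rw [map_sub, sub_eq_zero] at h2 ⊢
    rw [hg, h2]

end Completeness

section RegularCoordinates

open MvPowerSeries

variable {k : Type} [Field k] {N : ℕ}

theorem exists_regular_coordinates [Infinite k] {f : MvPowerSeries (Fin (N + 1)) k} (hf : f ≠ 0) :
    ∃ e : MvPowerSeries (Fin (N + 1)) k ≃+* PowerSeries (MvPowerSeries (Fin N) k),
      (e f).map (IsLocalRing.residue (MvPowerSeries (Fin N) k)) ≠ 0 := by
  classical
  obtain ⟨m₀, hm₀⟩ := MvPowerSeries.exists_coeff_ne_zero_and_order
    (ne_zero_iff_order_finite.1 hf)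
  obtain ⟨hm₀f, hm₀d⟩ := hm₀
  let d := m₀.degree
  have hd : ∀ m : Fin (N + 1) →₀ ℕ, m.degree < d → coeff m f = 0 := fun m hm =>
    coeff_of_lt_order (by rw [← hm₀d]; exact_mod_cast hm)
  let p : MvPolynomial (Fin (N + 1)) k := truncTotal (d + 1) f
  have hp : ∀ m, MvPolynomial.coeff m p = if m.degree < d + 1 then coeff m f else 0 := fun m =>
    coeff_truncTotal_eq_ite ..
  have hp0 : p ≠ 0 := by
    intro h
    have := hp m₀
    rw [h, if_pos (Nat.lt_succ_self _)] at this
    exact hm₀f this.symm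
  obtain ⟨c, hc⟩ : ∃ c : Fin (N + 1) → k, MvPolynomial.eval c (p * MvPolynomial.X 0) ≠ 0 := by
    by_contra! h
    exact mul_ne_zero hp0 (MvPolynomial.X_ne_zero 0) (MvPolynomial.funext fun x => by rw [h, map_zero])
  rw [map_mul, MvPolynomial.eval_X] at hc
  have hc0 : c 0 ≠ 0 := right_ne_zero_of_mul hc
  have hpc : MvPolynomial.eval c p ≠ 0 := left_ne_zero_of_mul hc
  let P := MvPowerSeries (Fin (N + 1)) k
  let a : Fin (N + 1) → P := Fin.cons (C (c 0) * X 0) fun i => X i.succ + C (c i.succ) * X 0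
  let b : Fin (N + 1) → P := Fin.cons (C (c 0)⁻¹ * X 0) fun i =>
    X i.succ - C (c i.succ * (c 0)⁻¹) * X 0
  have ha : HasSubst a := hasSubst_of_constantCoeff_zero fun i => by
    refine Fin.cases ?_ (fun i => ?_) i <;> simp [a]
  have hb : HasSubst b := hasSubst_of_constantCoeff_zero fun i => by
    refine Fin.cases ?_ (fun i => ?_) i <;> simp [b]
  have hC : ∀ (s : Fin (N + 1) → P) (hs : HasSubst s) (r : k), substAlgHom hs (C r : P) = C r :=
    fun s hs r => (substAlgHom hs).commutes r
  have hab : ∀ s, subst b (a s) = X s := fun s => by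
    rw [← coe_substAlgHom hb]
    refine Fin.cases ?_ (fun i => ?_) s
    · simp only [a, Fin.cons_zero, map_mul, hC, substAlgHom_X]
      simp only [b, Fin.cons_zero]
      rw [← mul_assoc, ← map_mul, mul_inv_cancel₀ hc0, map_one, one_mul]
    · simp only [a, Fin.cons_succ, map_mul, map_add, hC, substAlgHom_X]
      simp only [b, Fin.cons_zero, Fin.cons_succ, map_mul]
      ring
  have hba : ∀ s, subst a (b s) = X s := fun s => by
    rw [← coe_substAlgHom ha]
    refine Fin.cases ?_ (fun i => ?_) s
    · simp only [b, Fin.cons_zero, map_mul, hC, substAlgHom_X]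
      simp only [a, Fin.cons_zero]
      rw [← mul_assoc, ← map_mul, inv_mul_cancel₀ hc0, map_one, one_mul]
    · simp only [b, Fin.cons_succ, map_mul, map_sub, hC, substAlgHom_X]
      simp only [a, Fin.cons_zero, Fin.cons_succ]
      have : (C (c 0)⁻¹ * C (c 0) : P) = 1 := by rw [← map_mul, inv_mul_cancel₀ hc0, map_one]
      linear_combination -(C (c i.succ) * X 0 : P) * this
  let e0 : P ≃ₐ[k] P := AlgEquiv.ofAlgHom (substAlgHom ha) (substAlgHom hb)
    (by
      refine AlgHom.ext fun g => ?_
      change substAlgHom ha (substAlgHom hb g) = g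
      rw [coe_substAlgHom, coe_substAlgHom, subst_comp_subst_apply hb ha]
      have : (fun s => subst a (b s)) = (X : Fin (N + 1) → P) := funext hba
      rw [this, subst_self]; rfl)
    (by
      refine AlgHom.ext fun g => ?_
      change substAlgHom hb (substAlgHom ha g) = g
      rw [coe_substAlgHom, coe_substAlgHom, subst_comp_subst_apply ha hb]
      have : (fun s => subst b (a s)) = (X : Fin (N + 1) → P) := funext hab
      rw [this, subst_self]; rfl)
  refine ⟨(e0.trans (finSuccEquiv k N)).toRingEquiv, fun hzero => hpc ?_⟩
  have h1 := congrArg (PowerSeries.coeff d) hzero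
  rw [PowerSeries.coeff_map, map_zero, IsLocalRing.residue_eq_zero_iff,
    MvPowerSeries.mem_maximalIdeal_iff, ← coeff_zero_eq_constantCoeff_apply] at h1
  change coeff 0 (PowerSeries.coeff d (finSuccEquiv k N (e0 f))) = 0 at h1
  rw [coeff_coeff_finSuccEquiv] at h1
  have he0 : e0 f = subst a f := by
    change substAlgHom ha f = _
    rw [coe_substAlgHom]
  let emb : Unit ↪ Fin (N + 1) := ⟨fun _ => 0, fun _ _ _ => rfl⟩
  have hemb : Finsupp.embDomain emb (Finsupp.single () d) = Finsupp.cons d 0 := by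
    rw [Finsupp.embDomain_single]
    ext i
    refine Fin.cases ?_ (fun i => ?_) i
    · rw [Finsupp.cons_zero]
      exact Finsupp.single_eq_same
    · rw [Finsupp.cons_succ, Finsupp.single_eq_of_ne]
      · rfl
      · exact Fin.succ_ne_zero i
  have hka : ∀ i, killCompl emb (a i) = C (c i) * (X () : MvPowerSeries Unit k) := fun i => by
    have h0 : killCompl emb (X 0 : P) = X () := killCompl_X (e := emb) ()
    refine Fin.cases ?_ (fun i => ?_) i
    · simp only [a, Fin.cons_zero, map_mul, killCompl_C, h0]
    · simp only [a, Fin.cons_succ, map_mul, map_add, killCompl_C, h0]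
      rw [killCompl_X_eq_zero, zero_add]
      rintro ⟨_, h⟩
      exact Fin.succ_ne_zero i h.symm
  have hterm : ∀ m : Fin (N + 1) →₀ ℕ, coeff (Finsupp.cons d 0) (m.prod fun s j => a s ^ j) =
      if m.degree = d then ∏ i, c i ^ m i else 0 := fun m => by
    rw [← hemb, ← coeff_killCompl, Finsupp.prod_fintype _ _ (by simp), map_prod]
    simp only [map_pow, hka, mul_pow]
    rw [Finset.prod_mul_distrib, Finset.prod_pow_eq_pow_sum, ← Finsupp.degree_eq_sum]
    have : (∏ i, (C (c i) : MvPowerSeries Unit k) ^ m i) = C (∏ i, c i ^ m i) := by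
      rw [map_prod]; simp only [map_pow]
    rw [this, X_pow_eq, coeff_C_mul, coeff_monomial]
    by_cases h : m.degree = d
    · rw [if_pos h, if_pos (by rw [h]), mul_one]
    · rw [if_neg h, if_neg, mul_zero]
      intro h2
      exact h (by simpa using (DFunLike.congr_fun h2 ()).symm)
  have hkey : coeff (Finsupp.cons d 0) (subst a f) = MvPolynomial.eval c p := by
    rw [coeff_subst ha, MvPolynomial.eval_eq', finsum_eq_sum_of_support_subset _ (s := p.support)]
    · refine Finset.sum_congr rfl fun m hm => ?_
      rw [MvPolynomial.mem_support_iff, hp] at hm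
      rw [hp]
      split_ifs at hm ⊢ with h
      · have h2 : m.degree = d := by
          by_contra hne
          exact hm (hd m (by omega))
        rw [hterm, if_pos h2, smul_eq_mul]
      · exact absurd rfl hm
    · intro m hm
      rw [Function.mem_support, hterm] at hm
      rw [Finset.mem_coe, MvPolynomial.mem_support_iff, hp]
      split_ifs at hm with h
      · rw [if_pos (by omega)]
        exact left_ne_zero_of_smul hm
      · simp at hm
  rw [← hkey, ← he0]
  exact h1

end RegularCoordinates

end

section

section JacRegPowerSeries

/-- The derivation given by an additive map satisfying the Leibniz rule. -/
def Derivation.ofLeibniz {Λ : Type} [CommRing Λ] (f : Λ →+ Λ)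
    (h : ∀ a b, f (a * b) = a * f b + b * f a) : Derivation ℤ Λ Λ :=
  Derivation.mk' f.toIntLinearMap h

/-- Extension of a derivation to power series, coefficient by coefficient. -/
noncomputable def PowerSeries.mapDerivation {S : Type} [CommRing S] (D : Derivation ℤ S S) :=
  Derivation.ofLeibniz (Λ := PowerSeries S)
    { toFun := fun f => PowerSeries.mk fun n => D (PowerSeries.coeff n f)
      map_add' := fun f g => by ext n; simp
      map_zero' := by ext n; simp } fun f g => by
    ext n
    simp only [AddMonoidHom.coe_mk, ZeroHom.coe_mk, PowerSeries.coeff_mk, PowerSeries.coeff_mul,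
      map_sum, Derivation.leibniz, smul_eq_mul, map_add, Finset.sum_add_distrib]
    congr 1
    exact (Finset.Nat.sum_antidiagonal_swap (f := fun x : ℕ × ℕ =>
      PowerSeries.coeff x.1 g * D (PowerSeries.coeff x.2 f)))

theorem PowerSeries.mapDerivation_C {S : Type} [CommRing S] (D : Derivation ℤ S S) (s : S) :
    PowerSeries.mapDerivation D (PowerSeries.C s) = PowerSeries.C (D s) := by
  ext n
  change PowerSeries.coeff n (PowerSeries.mk fun n => D (PowerSeries.coeff n (PowerSeries.C s))) = _
  rw [PowerSeries.coeff_mk, PowerSeries.coeff_C, PowerSeries.coeff_C]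
  split_ifs <;> simp

variable {S : Type} [CommRing S]

open Polynomial in
theorem JacReg.powerSeries [IsDomain S] {q : Ideal (PowerSeries S)} [hq : q.IsPrime]
    (hnat : ∀ n : ℕ, n ≠ 0 → (n : S) ∉ q.comap PowerSeries.C)
    (hp : JacReg (q.comap PowerSeries.C)) {P : S[X]} (hP : P.Monic) (hPq : (P : PowerSeries S) ∈ q)
    (hdiv : ∀ g : PowerSeries S, ∃ (a : PowerSeries S) (r : S[X]), g = P * a + r) : JacReg q := by
  classical
  obtain ⟨p, hpdef⟩ : ∃ p, p = q.comap PowerSeries.C := ⟨_, rfl⟩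
  rw [← hpdef] at hnat hp
  have hpp : p.IsPrime := by rw [hpdef]; exact Ideal.comap_isPrime _ _
  have hpq : ∀ s, s ∈ p ↔ PowerSeries.C s ∈ q := fun s => by rw [hpdef]; rfl
  let co : S[X] →+* PowerSeries S := Polynomial.coeToPowerSeries.ringHom
  have hco : ∀ f : S[X], co f = (f : PowerSeries S) := fun f => rfl
  have hcoC : ∀ s, co (Polynomial.C s) = PowerSeries.C s := fun s => Polynomial.coe_C s
  let q' : Ideal S[X] := q.comap co
  have hq' : ∀ f, f ∈ q' ↔ co f ∈ q := fun f => Iff.rfl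
  have hCq' : ∀ s, s ∈ p → Polynomial.C s ∈ q' := fun s hs => by
    rw [hq', hcoC]; exact (hpq s).1 hs
  have hCq'' : ∀ s, Polynomial.C s ∈ q' → s ∈ p := fun s hs => by
    rw [hq', hcoC] at hs; exact (hpq s).2 hs
  have h1p : (1 : S) ∉ p := fun h => hpp.ne_top ((Ideal.eq_top_iff_one p).2 h)
  obtain ⟨h, ⟨hhq, hhc⟩, hmin⟩ : ∃ h : S[X], (h ∈ q' ∧ h.leadingCoeff ∉ p) ∧
      ∀ g : S[X], g ∈ q' → g.leadingCoeff ∉ p → h.natDegree ≤ g.natDegree := by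
    have hne : {n : ℕ | ∃ h : S[X], (h ∈ q' ∧ h.leadingCoeff ∉ p) ∧ h.natDegree = n}.Nonempty :=
      ⟨_, P, ⟨hPq, by rw [hP.leadingCoeff]; exact h1p⟩, rfl⟩
    obtain ⟨h, hh, hn⟩ := Nat.sInf_mem hne
    exact ⟨h, hh, fun g hg hg' => hn ▸ Nat.sInf_le ⟨g, ⟨hg, hg'⟩, rfl⟩⟩
  obtain ⟨c, hc⟩ : ∃ c, c = h.leadingCoeff := ⟨_, rfl⟩
  rw [← hc] at hhc
  have hc0 : c ≠ 0 := fun h0 => hhc (h0 ▸ p.zero_mem)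
  have hh0 : h ≠ 0 := fun h0 => hc0 (by rw [hc, h0, leadingCoeff_zero])
  have hdeg : 0 < h.natDegree := by
    by_contra h0
    have h1 := eq_C_of_natDegree_eq_zero (Nat.eq_zero_of_not_pos h0)
    refine hhc (hCq'' _ ?_)
    have : c = h.coeff 0 := by rw [hc, leadingCoeff, Nat.eq_zero_of_not_pos h0]
    rw [this, ← h1]; exact hhq
  have hsmall : ∀ (n : ℕ) (r : S[X]), r.support.card ≤ n → r ∈ q' → r.natDegree < h.natDegree →
      ∀ i, r.coeff i ∈ p := by
    intro n
    induction n with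
    | zero =>
      intro r hr _ _ i
      rw [Nat.le_zero, Finset.card_eq_zero, support_eq_empty] at hr
      rw [hr, coeff_zero]; exact p.zero_mem
    | succ n ih =>
      intro r hr hrq hrd i
      by_cases hr0 : r = 0
      · rw [hr0, coeff_zero]; exact p.zero_mem
      have hl : r.leadingCoeff ∈ p := by
        by_contra hl
        exact absurd (hmin r hrq hl) (not_le.2 hrd)
      have hmon : monomial r.natDegree r.leadingCoeff ∈ q' := by
        rw [← C_mul_X_pow_eq_monomial]
        exact q'.mul_mem_right _ (hCq' _ hl)
      have he : r.eraseLead ∈ q' := by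
        rw [← self_sub_monomial_natDegree_leadingCoeff]
        exact q'.sub_mem hrq hmon
      have h1 := ih r.eraseLead (by
        have := eraseLead_support_card_lt hr0
        omega) he (lt_of_le_of_lt (eraseLead_natDegree_le_aux) hrd) i
      rw [← eraseLead_add_monomial_natDegree_leadingCoeff r, coeff_add, coeff_monomial]
      refine p.add_mem h1 ?_
      split_ifs
      · exact hl
      · exact p.zero_mem
  have hgenpoly : ∀ (n : ℕ) (g : S[X]), g.natDegree < n → g ∈ q' →
      ∃ s ∉ p, Polynomial.C s * g ∈ Ideal.span {h} ⊔ p.map Polynomial.C := by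
    intro n
    induction n with
    | zero => intro g hg; exact absurd hg (Nat.not_lt_zero _)
    | succ n ih =>
      intro g hgn hgq
      by_cases hlt : g.natDegree < h.natDegree
      · refine ⟨1, h1p, ?_⟩
        rw [map_one, one_mul]
        exact Ideal.mem_sup_right (Ideal.mem_map_C_iff.2 (hsmall _ g le_rfl hgq hlt))
      · rw [not_lt] at hlt
        have hg0 : g ≠ 0 := by
          rintro rfl
          rw [natDegree_zero] at hlt; omega
        let g1 := Polynomial.C c * g -
          Polynomial.C g.leadingCoeff * X ^ (g.natDegree - h.natDegree) * h
        have hg1q : g1 ∈ q' := q'.sub_mem (q'.mul_mem_left _ hgq) (q'.mul_mem_left _ hhq)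
        have hlg0 : g.leadingCoeff ≠ 0 := leadingCoeff_ne_zero.2 hg0
        have hd1 : (Polynomial.C c * g).degree = g.degree := by
          rw [degree_mul, degree_C hc0, zero_add]
        have hd2 : (Polynomial.C g.leadingCoeff * X ^ (g.natDegree - h.natDegree) * h).degree =
            g.degree := by
          rw [degree_mul, degree_C_mul_X_pow _ hlg0, degree_eq_natDegree hh0,
            degree_eq_natDegree hg0, ← Nat.cast_add, Nat.sub_add_cancel hlt]
        have hlt1 : g1.degree < g.degree := by
          rw [← hd1]
          refine degree_sub_lt_left (hd1.trans hd2.symm) (mul_ne_zero (C_ne_zero.2 hc0) hg0) ?_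
          rw [leadingCoeff_mul, leadingCoeff_mul, leadingCoeff_C, leadingCoeff_mul_X_pow,
            leadingCoeff_C, ← hc, mul_comm]
        have hlt2 : g1.natDegree < n := by
          have hgpos : 0 < g.natDegree := by omega
          have : g1.natDegree < g.natDegree := by
            by_cases hg10 : g1 = 0
            · rw [hg10, natDegree_zero]; exact hgpos
            · exact natDegree_lt_natDegree hg10 hlt1
          omega
        obtain ⟨s, hs, hsg⟩ := ih g1 hlt2 hg1q
        refine ⟨s * c, fun h => (hpp.mem_or_mem h).elim hs hhc, ?_⟩
        have : Polynomial.C (s * c) * g = Polynomial.C s * g1 + (Polynomial.C s *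
            (Polynomial.C g.leadingCoeff * X ^ (g.natDegree - h.natDegree))) * h := by
          simp only [g1, map_mul]; ring
        rw [this]
        exact Ideal.add_mem _ hsg (Ideal.mem_sup_left
          (Ideal.mul_mem_left _ _ (Ideal.mem_span_singleton_self h)))
  obtain ⟨d, t, D, ht, hdet, hgen⟩ := hp
  let t' : Fin (d + 1) → PowerSeries S := Fin.cons (h : PowerSeries S) fun i => PowerSeries.C (t i)
  let I := Ideal.span (Set.range t')
  have hhI : co h ∈ I := Ideal.subset_span ⟨0, rfl⟩
  have htI : ∀ i, PowerSeries.C (t i) ∈ I := fun i => Ideal.subset_span ⟨i.succ, rfl⟩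
  have hpI : ∀ y ∈ p.map Polynomial.C, ∃ s ∉ p, PowerSeries.C s * co y ∈ I := by
    intro y hy
    refine Submodule.span_induction (fun y hy => ?_) ?_ (fun a b _ _ ha hb => ?_)
      (fun a y _ hy => ?_) hy
    · obtain ⟨x, hx, rfl⟩ := hy
      obtain ⟨s, hs, hsx⟩ := hgen x hx
      refine ⟨s, hs, ?_⟩
      rw [hcoC, ← map_mul]
      have h1 : Ideal.span (Set.range t) ≤ I.comap PowerSeries.C := by
        rw [Ideal.span_le]
        rintro _ ⟨i, rfl⟩
        exact htI i
      exact h1 hsx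
    · exact ⟨1, h1p, by rw [map_zero, mul_zero]; exact I.zero_mem⟩
    · obtain ⟨s, hs, h1⟩ := ha
      obtain ⟨s', hs', h2⟩ := hb
      refine ⟨s * s', fun h => (hpp.mem_or_mem h).elim hs hs', ?_⟩
      have : PowerSeries.C (s * s') * co (a + b) = PowerSeries.C s' * (PowerSeries.C s * co a) +
          PowerSeries.C s * (PowerSeries.C s' * co b) := by
        rw [map_mul, map_add]; ring
      rw [this]
      exact I.add_mem (I.mul_mem_left _ h1) (I.mul_mem_left _ h2)
    · obtain ⟨s, hs, h1⟩ := hy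
      refine ⟨s, hs, ?_⟩
      rw [smul_eq_mul, map_mul, mul_left_comm]
      exact I.mul_mem_left _ h1
  have hqI : ∀ g ∈ q', ∃ s ∉ p, PowerSeries.C s * co g ∈ I := by
    intro g hg
    obtain ⟨s, hs, hsg⟩ := hgenpoly _ g (Nat.lt_succ_self _) hg
    obtain ⟨u, hu, v, hv, huv⟩ := Submodule.mem_sup.1 hsg
    obtain ⟨s', hs', hv'⟩ := hpI v hv
    refine ⟨s' * s, fun h => (hpp.mem_or_mem h).elim hs' hs, ?_⟩
    have h1 : PowerSeries.C (s' * s) * co g = PowerSeries.C s' * co u + PowerSeries.C s' * co v := by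
      rw [map_mul, mul_assoc, ← hcoC s, ← map_mul, ← huv, map_add, mul_add]
    rw [h1]
    refine I.add_mem (I.mul_mem_left _ ?_) hv'
    obtain ⟨w, rfl⟩ := Ideal.mem_span_singleton'.1 hu
    rw [map_mul]
    exact I.mul_mem_left _ hhI
  let dX := Derivation.ofLeibniz (Λ := PowerSeries S)
    (PowerSeries.derivative S).toLinearMap.toAddMonoidHom
    (fun a b => (PowerSeries.derivative S).leibniz a b)
  let DD := fun k : Fin (d + 1) => Fin.cases (motive := fun _ => _) dX
    (fun i => PowerSeries.mapDerivation (D i)) k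
  refine ⟨d + 1, t', DD, ?_, ?_, ?_⟩
  · intro i
    refine Fin.cases hhq (fun i => ?_) i
    exact (hpq _).1 (ht i)
  · rw [Matrix.det_succ_column_zero, Fin.sum_univ_succ, Finset.sum_eq_zero, add_zero]
    · have h1 : (Matrix.submatrix (Matrix.of fun i k => DD k (t' i)) (Fin.succAbove 0) Fin.succ) =
          (PowerSeries.C).mapMatrix (Matrix.of fun i k => D k (t i)) := by
        ext1 i k
        simp only [Matrix.submatrix_apply, Matrix.of_apply, Fin.cons_succ, RingHom.mapMatrix_apply,
          Matrix.map_apply, Fin.zero_succAbove, t']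
        exact PowerSeries.mapDerivation_C _ _
      rw [h1, ← RingHom.map_det]
      simp only [Fin.val_zero, pow_zero, one_mul, Matrix.of_apply, Fin.cons_zero]
      intro hmem
      rcases hq.mem_or_mem hmem with h2 | h2
      · have h3 : (derivative h : S[X]) ∈ q' := by
          rw [hq', hco, ← PowerSeries.derivative_coe]; exact h2
        have h4 := hsmall _ _ le_rfl h3 (natDegree_derivative_lt (by omega)) (h.natDegree - 1)
        rw [coeff_derivative, Nat.sub_add_cancel hdeg] at h4
        rcases hpp.mem_or_mem h4 with h5 | h5
        · exact hhc (by rw [hc]; exact h5)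
        · refine hnat h.natDegree (by omega) ?_
          have : ((h.natDegree - 1 : ℕ) : S) + 1 = (h.natDegree : S) := by
            rw [← Nat.cast_succ, Nat.succ_eq_add_one, Nat.sub_add_cancel hdeg]
          rwa [this] at h5
      · exact hdet ((hpq _).2 h2)
    · intro i _
      have : DD 0 (t' i.succ) = 0 := by
        change PowerSeries.derivative S (PowerSeries.C (t i)) = 0
        exact PowerSeries.derivative_C
      simp only [Matrix.of_apply, Fin.cons_zero]
      rw [this]; ring
  · intro x hx
    obtain ⟨a, r, har⟩ := hdiv x
    have hr : r ∈ q' := by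
      rw [hq', hco]
      have : (r : PowerSeries S) = x - P * a := by rw [har]; ring
      rw [this]
      exact q.sub_mem hx (q.mul_mem_right _ hPq)
    obtain ⟨s, hs, h1⟩ := hqI r hr
    obtain ⟨s', hs', h2⟩ := hqI P hPq
    refine ⟨PowerSeries.C (s * s'), fun h => (hpp.mem_or_mem ((hpq _).2 h)).elim hs hs', ?_⟩
    have : PowerSeries.C (s * s') * x = (PowerSeries.C s * a) * (PowerSeries.C s' * co P) +
        PowerSeries.C s' * (PowerSeries.C s * co r) := by
      rw [har, map_mul, hco, hco]; ring
    rw [this]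
    exact I.add_mem (I.mul_mem_left _ h2) (I.mul_mem_left _ h1)

theorem JacReg.of_ringEquiv {Λ Λ' : Type} [CommRing Λ] [CommRing Λ'] (e : Λ ≃+* Λ') {q : Ideal Λ'}
    (h : JacReg (q.comap e)) : JacReg q := by
  obtain ⟨d, t, D, ht, hdet, hgen⟩ := h
  have hq : ∀ x, x ∈ q.comap e ↔ e x ∈ q := fun x => Iff.rfl
  let D' : Fin d → Derivation ℤ Λ' Λ' := fun i =>
    Derivation.mk' ((e.toAddEquiv.toAddMonoidHom.comp ((D i).toLinearMap.toAddMonoidHom.comp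
      e.symm.toAddEquiv.toAddMonoidHom)).toIntLinearMap) fun a b => by
        change e (D i (e.symm (a * b))) = a • e (D i (e.symm b)) + b • e (D i (e.symm a))
        rw [map_mul, Derivation.leibniz]
        simp
  have hD' : ∀ i x, D' i (e x) = e (D i x) := fun i x => by
    change e (D i (e.symm (e x))) = _
    rw [e.symm_apply_apply]
  refine ⟨d, fun i => e (t i), D', ht, ?_, fun x hx => ?_⟩
  · simp only [hD']
    have : (Matrix.of fun i k => e (D k (t i))) =
        (e : Λ →+* Λ').mapMatrix (Matrix.of fun i k => D k (t i)) := rfl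
    rw [this, ← RingHom.map_det]
    exact hdet
  · obtain ⟨s, hs, h1⟩ := hgen (e.symm x) (by rw [hq, e.apply_symm_apply]; exact hx)
    refine ⟨e s, hs, ?_⟩
    have h2 : Ideal.span (Set.range t) ≤ (Ideal.span (Set.range fun i => e (t i))).comap e := by
      rw [Ideal.span_le]
      rintro _ ⟨i, rfl⟩
      exact Ideal.subset_span ⟨i, rfl⟩
    have h3 : e (s * e.symm x) ∈ Ideal.span (Set.range fun i => e (t i)) := h2 h1
    rwa [map_mul, e.apply_symm_apply] at h3

theorem jacReg_bot {Λ : Type} [CommRing Λ] [Nontrivial Λ] : JacReg (⊥ : Ideal Λ) :=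
  ⟨0, Fin.elim0, Fin.elim0, fun i => i.elim0, by simp, fun x hx => ⟨1, by simp, by
    rw [(Ideal.mem_bot).1 hx, mul_zero]; exact Ideal.zero_mem _⟩⟩

theorem exists_distinguished {A : Type} [CommRing A] [IsLocalRing A]
    [IsAdicComplete (IsLocalRing.maximalIdeal A) A] {f : PowerSeries A}
    (hf : f.map (IsLocalRing.residue A) ≠ 0) :
    ∃ P : Polynomial A, P.Monic ∧ (∃ u, f = P * u ∧ IsUnit u) ∧
      ∀ g : PowerSeries A, ∃ (a : PowerSeries A) (r : Polynomial A), r.degree < P.degree ∧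
        g = P * a + r := by
  obtain ⟨P, u, H⟩ := PowerSeries.exists_isWeierstrassFactorization hf
  refine ⟨P, H.isDistinguishedAt.monic, ⟨u, H.eq_mul, H.isUnit⟩, fun g => ?_⟩
  have hW := H.isDistinguishedAt.isWeierstrassDivisorAt'
  obtain ⟨h1, h2⟩ := hW.isWeierstrassDivisionAt_div_mod g
  refine ⟨_, _, lt_of_lt_of_eq h1 ?_, h2⟩
  rw [H.isDistinguishedAt.degree_eq_coe_lift_order_map (P : PowerSeries A) 1 (by
    rw [PowerSeries.constantCoeff_one, ← Ideal.ne_top_iff_one]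
    exact (IsLocalRing.maximalIdeal.isMaximal A).ne_top) (by simp)]
  rw [ENat.lift_eq_toNat_of_lt_top]

theorem jacReg_mvPowerSeries {k : Type} [Field k] [CharZero k] (N : ℕ) :
    ∀ q : Ideal (MvPowerSeries (Fin N) k), q.IsPrime → JacReg q := by
  induction N with
  | zero =>
    intro q hq
    have : q = ⊥ := by
      have hf : IsField (MvPowerSeries (Fin 0) k) :=
        (MvPowerSeries.isEmptyEquiv (Fin 0) k).toMulEquiv.isField (Field.toIsField k)
      let _ := hf.toField
      exact (Ideal.eq_bot_or_top q).resolve_right hq.ne_top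
    rw [this]; exact jacReg_bot
  | succ N ih =>
    intro q hq
    by_cases hbot : q = ⊥
    · rw [hbot]; exact jacReg_bot
    obtain ⟨f, hfq, hf0⟩ := Submodule.exists_mem_ne_zero_of_ne_bot hbot
    obtain ⟨e, he⟩ := exists_regular_coordinates hf0
    refine JacReg.of_ringEquiv e.symm ?_
    obtain ⟨P, hP, ⟨u, hu, huu⟩, hdiv⟩ := exists_distinguished he
    have hprime : (q.comap e.symm).IsPrime := Ideal.comap_isPrime _ _
    have : IsDomain (MvPowerSeries (Fin N) k) := NoZeroDivisors.to_isDomain _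
    refine JacReg.powerSeries (fun n hn h => ?_) (ih _ (Ideal.comap_isPrime _ _)) hP ?_ fun g => ?_
    · have h1 : ((n : ℕ) : MvPowerSeries (Fin (N + 1)) k) ∈ q := by
        have h2 : e.symm (PowerSeries.C (n : MvPowerSeries (Fin N) k)) ∈ q := h
        rwa [map_natCast, map_natCast] at h2
      refine hq.ne_top (Ideal.eq_top_of_isUnit_mem q h1 ?_)
      rw [MvPowerSeries.isUnit_iff_constantCoeff, map_natCast, isUnit_iff_ne_zero]
      exact_mod_cast hn
    · have h1 : e f ∈ q.comap e.symm := by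
        change e.symm (e f) ∈ q
        rwa [e.symm_apply_apply]
      rw [hu] at h1
      exact (hprime.mem_or_mem h1).resolve_right fun h2 =>
        hprime.ne_top (Ideal.eq_top_of_isUnit_mem _ h2 huu)
    · obtain ⟨a, r, -, h⟩ := hdiv g
      exact ⟨a, r, h⟩

theorem nonempty_mvPowerSeries_ringEquiv (k : Type) [CommRing k] (n m : ℕ) :
    Nonempty (MvPowerSeries (Fin n) (MvPowerSeries (Fin m) k) ≃+* MvPowerSeries (Fin (n + m)) k) := by
  induction n with
  | zero =>
    rw [Nat.zero_add]
    exact ⟨(MvPowerSeries.isEmptyEquiv (Fin 0) _).toRingEquiv⟩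
  | succ n ih =>
    obtain ⟨e⟩ := ih
    let e1 : PowerSeries (MvPowerSeries (Fin n) (MvPowerSeries (Fin m) k)) ≃+*
        PowerSeries (MvPowerSeries (Fin (n + m)) k) :=
      RingEquiv.ofRingHom (PowerSeries.map e.toRingHom) (PowerSeries.map e.symm.toRingHom)
        (by ext f : 1; ext m : 1; simp) (by ext f : 1; ext m : 1; simp)
    rw [Nat.add_right_comm]
    exact ⟨(MvPowerSeries.finSuccEquiv _ n).toRingEquiv.trans
      (e1.trans (MvPowerSeries.finSuccEquiv k (n + m)).symm.toRingEquiv)⟩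

theorem jacReg_mvPowerSeries_mvPowerSeries {k : Type} [Field k] [CharZero k] (n m : ℕ)
    (q : Ideal (MvPowerSeries (Fin n) (MvPowerSeries (Fin m) k))) (hq : q.IsPrime) : JacReg q := by
  obtain ⟨e⟩ := nonempty_mvPowerSeries_ringEquiv k n m
  exact JacReg.of_ringEquiv e.symm (jacReg_mvPowerSeries _ _ (Ideal.comap_isPrime _ _))

end JacRegPowerSeries

end

section

open MvPolynomial
open scoped TensorProduct

section WeilRestriction

theorem exists_coefficientwise_division {R' R τ : Type} [CommRing R'] [CommRing R] [Algebra R' R]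
    {D : ℕ} (e : Fin D → R) (g : R)
    (hdiv : ∀ r : R, ∃ (r' : Fin D → R') (s : R), r = ∑ i, algebraMap R' R (r' i) * e i + g * s)
    (p : MvPolynomial τ R) : ∃ (p' : Fin D → MvPolynomial τ R') (s : MvPolynomial τ R),
      p = ∑ i, MvPolynomial.map (algebraMap R' R) (p' i) * C (e i) + C g * s := by
  induction p using MvPolynomial.induction_on' with
  | monomial m r =>
    obtain ⟨r', s, h⟩ := hdiv r
    refine ⟨fun i => monomial m (r' i), monomial m s, ?_⟩
    rw [h, map_add, map_sum, C_mul_monomial]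
    congr 1
    refine Finset.sum_congr rfl fun i _ => ?_
    rw [map_monomial, mul_comm, mul_comm _ (C (e i)), C_mul_monomial]
  | add p q hp hq =>
    obtain ⟨p', s, h⟩ := hp
    obtain ⟨q', s', h'⟩ := hq
    refine ⟨fun i => p' i + q' i, s + s', ?_⟩
    nth_rewrite 1 [h, h']
    simp only [map_add, add_mul, Finset.sum_add_distrib]
    ring

/-- Each algebra of finite type over `R` with a map to `Λ` maps to one which is smooth at the
closed point of the local ring `Λ`. -/
def LocallySmoothable (R Λ : Type) [CommRing R] [CommRing Λ] [Algebra R Λ] : Prop :=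
  ∀ (A : Type) [CommRing A] [Algebra R A], Algebra.FiniteType R A → ∀ φ : A →ₐ[R] Λ,
    ∃ (B : Type) (_ : CommRing B) (_ : Algebra R B) (ι : A →ₐ[R] B) (β : B →ₐ[R] Λ),
      Algebra.FiniteType R B ∧ β.comp ι = φ ∧ ∃ b, LiftsAt R B b ∧ IsUnit (β b)

set_option maxHeartbeats 1000000 in
theorem LocallySmoothable.exists_model_mod {R' R Λ' Λ : Type} [CommRing R'] [CommRing R]
    [CommRing Λ'] [CommRing Λ] [Algebra R' R] [Algebra R' Λ'] [Algebra R Λ] (γ : Λ' →+* Λ)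
    (hγ : ∀ r, γ (algebraMap R' Λ' r) = algebraMap R Λ (algebraMap R' R r)) {D : ℕ} (e : Fin D → R)
    (g : R)
    (hdivR : ∀ r : R, ∃ (r' : Fin D → R') (s : R), r = ∑ i, algebraMap R' R (r' i) * e i + g * s)
    (hdivΛ : ∀ l : Λ, ∃ (l' : Fin D → Λ') (s : Λ),
      l = ∑ i, γ (l' i) * algebraMap R Λ (e i) + algebraMap R Λ g * s)
    (huniq : ∀ (l' : Fin D → Λ') (s : Λ),
      ∑ i, γ (l' i) * algebraMap R Λ (e i) = algebraMap R Λ g * s → ∀ i, l' i = 0)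
    (h : LocallySmoothable R' Λ') {σ κ : Type} [Finite σ] (F : κ → MvPolynomial σ R)
    (z : σ → Λ) (hz : ∀ k, aeval z (F k) = 0) :
    ∃ (Cb : Type) (_ : CommRing Cb) (_ : Algebra R Cb)
      (ψ : Cb →ₐ[R] Λ ⧸ Ideal.span {algebraMap R Λ g}) (x : σ → Cb) (c : Cb),
      Algebra.FiniteType R Cb ∧ (∀ k, aeval x (F k) = 0) ∧
      (∀ j, ψ (x j) = Ideal.Quotient.mk _ (z j)) ∧ LiftsMod R (Ideal.span {g}) Cb c ∧
      ∃ u : Λ, IsUnit u ∧ ψ c = Ideal.Quotient.mk _ u := by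
  classical
  let _ : Algebra R' Λ := ((algebraMap R Λ).comp (algebraMap R' R)).toAlgebra
  have : IsScalarTower R' R Λ := IsScalarTower.of_algebraMap_eq fun _ => rfl
  let L := Λ ⧸ Ideal.span {algebraMap R Λ g}
  have hgL : algebraMap R L g = 0 :=
    Ideal.Quotient.eq_zero_iff_mem.2 (Ideal.mem_span_singleton_self _)
  choose z' s hs using fun j => hdivΛ (z j)
  let Fh : κ → MvPolynomial (σ × Fin D) R := fun k =>
    aeval (fun j => ∑ i, X (j, i) * C (e i)) (F k)
  choose F' t hF' using fun k => exists_coefficientwise_division e g hdivR (Fh k)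
  have hFh : ∀ {U : Type} [CommRing U] [Algebra R U] (y : σ × Fin D → U) (k : κ),
      aeval y (Fh k) = aeval (fun j => ∑ i, y (j, i) * algebraMap R U (e i)) (F k) := by
    intro U _ _ y k
    have : (aeval y).comp (aeval fun j => ∑ i, X (j, i) * C (e i)) =
        (aeval fun j => ∑ i, y (j, i) * algebraMap R U (e i) : MvPolynomial σ R →ₐ[R] U) :=
      MvPolynomial.algHom_ext fun j => by simp [algHom_C]
    exact DFunLike.congr_fun this (F k)
  have hFh' : ∀ {U : Type} [CommRing U] [Algebra R U] [Algebra R' U] [IsScalarTower R' R U]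
      (y : σ × Fin D → U) (k : κ),
      aeval y (Fh k) = ∑ i, aeval y (F' k i) * algebraMap R U (e i) +
        algebraMap R U g * aeval y (t k) := by
    intro U _ _ _ _ y k
    rw [hF' k]
    simp only [map_add, map_sum, map_mul, algHom_C, aeval_map_algebraMap]
  let γ' : Λ' →ₐ[R'] Λ := { γ with commutes' := hγ }
  let y' : σ × Fin D → Λ' := fun o => z' o.1 o.2
  have hF'z : ∀ k i, aeval y' (F' k i) = 0 := by
    intro k
    have h1 : Ideal.Quotient.mk (Ideal.span {algebraMap R Λ g})
        (aeval (fun o => γ (y' o)) (Fh k)) = 0 := by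
      rw [hFh]
      have h2 : ∀ w : σ → Λ, Ideal.Quotient.mk (Ideal.span {algebraMap R Λ g}) (aeval w (F k)) =
          aeval (fun j => Ideal.Quotient.mk (Ideal.span {algebraMap R Λ g}) (w j)) (F k) := by
        intro w
        have : (Ideal.Quotient.mkₐ R (Ideal.span {algebraMap R Λ g})).comp (aeval w) =
            aeval fun j => Ideal.Quotient.mk (Ideal.span {algebraMap R Λ g}) (w j) :=
          MvPolynomial.algHom_ext fun j => by rw [AlgHom.comp_apply, aeval_X, aeval_X]; rfl
        exact DFunLike.congr_fun this (F k)
      rw [h2]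
      have h3 : ∀ j, Ideal.Quotient.mk (Ideal.span {algebraMap R Λ g})
          (∑ i, γ (y' (j, i)) * algebraMap R Λ (e i)) = Ideal.Quotient.mk _ (z j) := fun j => by
        rw [eq_comm, Ideal.Quotient.eq, hs j]
        simp only [y', add_sub_cancel_left]
        exact Ideal.mul_mem_right _ _ (Ideal.mem_span_singleton_self _)
      simp only [h3]
      rw [← h2, hz, map_zero]
    rw [Ideal.Quotient.eq_zero_iff_mem, hFh' (fun o => γ (y' o)) k] at h1
    obtain ⟨w, hw⟩ := Ideal.mem_span_singleton'.1 h1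
    refine huniq (fun i => aeval y' (F' k i)) (w - aeval (fun o => γ (y' o)) (t k)) ?_
    have h4 : ∀ i, γ (aeval y' (F' k i)) = aeval (fun o => γ (y' o)) (F' k i) := fun i => by
      have : γ'.comp (aeval y') = aeval fun o => γ (y' o) :=
        MvPolynomial.algHom_ext fun j => by rw [AlgHom.comp_apply, aeval_X, aeval_X]; rfl
      exact DFunLike.congr_fun this (F' k i)
    simp only [h4]
    linear_combination -hw
  let I' : Ideal (MvPolynomial (σ × Fin D) R') :=
    Ideal.span (Set.range fun o : κ × Fin D => F' o.1 o.2)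
  have hI' : ∀ p ∈ I', aeval y' p = 0 := by
    have : I' ≤ RingHom.ker (aeval (R := R') y') := by
      rw [Ideal.span_le]
      rintro _ ⟨o, rfl⟩
      exact hF'z o.1 o.2
    exact this
  obtain ⟨B', _, _, ι', β', hB', hβ', b', hb', hbu⟩ := h (MvPolynomial (σ × Fin D) R' ⧸ I')
    inferInstance (Ideal.Quotient.liftₐ I' (aeval y') hI')
  let w : σ × Fin D → B' := fun o => ι' (Ideal.Quotient.mk I' (X o))
  have hβw : ∀ o, β' (w o) = y' o := fun o => by
    refine (DFunLike.congr_fun hβ' (Ideal.Quotient.mk I' (X o))).trans ?_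
    exact aeval_X _ _
  have hwF : ∀ k i, aeval w (F' k i) = 0 := fun k i => by
    have : (aeval w : _ →ₐ[R'] B') = ι'.comp (Ideal.Quotient.mkₐ R' I') :=
      MvPolynomial.algHom_ext fun j => by rw [AlgHom.comp_apply, aeval_X]; rfl
    rw [this, AlgHom.comp_apply, Ideal.Quotient.mkₐ_eq_mk, Ideal.Quotient.eq_zero_iff_mem.2, map_zero]
    exact Ideal.subset_span ⟨(k, i), rfl⟩
  let Q := R ⊗[R'] B'
  let J : Ideal Q := Ideal.span {algebraMap R Q g}
  let inR : B' →ₐ[R'] Q := Algebra.TensorProduct.includeRight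
  let ψ0 : Q →ₐ[R] Λ := Algebra.TensorProduct.lift (Algebra.ofId R Λ) (γ'.comp β')
    fun _ _ => Commute.all _ _
  have hψ0 : ∀ b, ψ0 (inR b) = γ (β' b) := fun b => by
    refine (Algebra.TensorProduct.lift_tmul _ _ _ 1 b).trans ?_
    rw [map_one, one_mul]; rfl
  have hψJ : ∀ q ∈ J, (Ideal.Quotient.mkₐ R (Ideal.span {algebraMap R Λ g})).comp ψ0 q = 0 := by
    have : J ≤ RingHom.ker ((Ideal.Quotient.mkₐ R (Ideal.span {algebraMap R Λ g})).comp ψ0) := by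
      rw [Ideal.span_le, Set.singleton_subset_iff]
      change ((Ideal.Quotient.mkₐ R (Ideal.span {algebraMap R Λ g})).comp ψ0) _ = 0
      rw [AlgHom.commutes]
      exact hgL
    exact this
  let Cb := Q ⧸ J
  have hgC : algebraMap R Cb g = 0 :=
    Ideal.Quotient.eq_zero_iff_mem.2 (Ideal.mem_span_singleton_self _)
  let inC : B' →ₐ[R'] Cb := (Ideal.Quotient.mkₐ R' J).comp inR
  let ψ : Cb →ₐ[R] L := Ideal.Quotient.liftₐ J _ hψJ
  have hψ : ∀ b, ψ (inC b) = Ideal.Quotient.mk _ (γ (β' b)) := fun b => by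
    change Ideal.Quotient.mk _ (ψ0 (inR b)) = _
    rw [hψ0]
  let x : σ → Cb := fun j => ∑ i, inC (w (j, i)) * algebraMap R Cb (e i)
  refine ⟨Cb, inferInstance, inferInstance, ψ, x, inC b', ?_, ?_, ?_, ?_, γ (β' b'),
    hbu.map γ, hψ b'⟩
  · have : Algebra.FiniteType R Q := Algebra.FiniteType.baseChange R
    exact this.of_surjective (Ideal.Quotient.mkₐ R J) (Ideal.Quotient.mkₐ_surjective R J)
  · intro k
    rw [← hFh (fun o => inC (w o)) k, hFh', hgC, zero_mul, add_zero]
    refine Finset.sum_eq_zero fun i _ => ?_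
    have : (aeval fun o => inC (w o)) = inC.comp (aeval w) :=
      MvPolynomial.algHom_ext fun j => by rw [AlgHom.comp_apply, aeval_X, aeval_X]
    rw [this, AlgHom.comp_apply, hwF, map_zero, zero_mul]
  · intro j
    simp only [x, map_sum, map_mul, AlgHom.commutes, hψ, hβw, y']
    rw [hs j, map_add, map_mul, map_sum, eq_comm]
    have : (Ideal.Quotient.mk (Ideal.span {algebraMap R Λ g})) (algebraMap R Λ g) = 0 := hgL
    rw [this, zero_mul, add_zero]
    exact Finset.sum_congr rfl fun i _ => map_mul _ _ _
  · intro T _ _ J' hT hJ' f hf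
    let _ : Algebra R' T := ((algebraMap R T).comp (algebraMap R' R)).toAlgebra
    have : IsScalarTower R' R T := IsScalarTower.of_algebraMap_eq fun _ => rfl
    obtain ⟨g', hg'⟩ := hb' T J' bot_le hJ' ((f.restrictScalars R').comp inC) hf
    let G : Q →ₐ[R] T := Algebra.TensorProduct.lift (Algebra.ofId R T) g' fun _ _ => Commute.all _ _
    have hG : ∀ b, G (inR b) = g' b := fun b => by
      refine (Algebra.TensorProduct.lift_tmul _ _ _ 1 b).trans ?_
      rw [map_one, one_mul]
    have hGJ : ∀ q ∈ J, G q = 0 := by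
      have : J ≤ RingHom.ker G := by
        rw [Ideal.span_le, Set.singleton_subset_iff]
        change G _ = 0
        rw [AlgHom.commutes]
        exact hT (Ideal.mem_span_singleton_self g)
      exact this
    refine ⟨Ideal.Quotient.liftₐ J G hGJ, ?_⟩
    refine Ideal.Quotient.algHom_ext _ ?_
    refine Algebra.TensorProduct.ext (Subsingleton.elim _ _) (AlgHom.ext fun b => ?_)
    change Ideal.Quotient.mk J' (G (inR b)) = f (inC b)
    rw [hG]
    exact DFunLike.congr_fun hg' b

end WeilRestriction

end

section

open MvPolynomial

section LocalSmoothing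

theorem Polynomial.coe_eq_sum_of_degree_lt {A : Type} [CommRing A] {D : ℕ} {p : Polynomial A}
    (hp : p.degree < D) :
    (p : PowerSeries A) = ∑ i : Fin D, PowerSeries.C (p.coeff i) * PowerSeries.X ^ i.val := by
  ext j
  rw [Polynomial.coeff_coe, map_sum]
  simp only [PowerSeries.coeff_C_mul, PowerSeries.coeff_X_pow, mul_ite, mul_one, mul_zero]
  by_cases hj : j < D
  · rw [Finset.sum_eq_single ⟨j, hj⟩]
    · simp
    · intro i _ hi
      rw [if_neg]
      rintro rfl
      exact hi rfl
    · simp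
  · rw [(Polynomial.degree_lt_iff_coeff_zero p D).1 hp j (not_lt.1 hj), Finset.sum_eq_zero]
    intro i _
    rw [if_neg]
    rintro rfl
    exact hj i.2

theorem exists_finite_free_quotient {k : Type} [Field k] [Infinite k] {m : ℕ}
    {g : MvPowerSeries (Fin (m + 1)) k} (hg : g ≠ 0) :
    ∃ (c : MvPowerSeries (Fin m) k →+* MvPowerSeries (Fin (m + 1)) k) (D : ℕ)
      (e : Fin D → MvPowerSeries (Fin (m + 1)) k),
      (∀ r, ∃ (r' : Fin D → MvPowerSeries (Fin m) k) (s : MvPowerSeries (Fin (m + 1)) k),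
        r = ∑ i, c (r' i) * e i + g * s) ∧
      ∀ (r' : Fin D → MvPowerSeries (Fin m) k) (s : MvPowerSeries (Fin (m + 1)) k),
        ∑ i, c (r' i) * e i = g * s → ∀ i, r' i = 0 := by
  obtain ⟨ε, hε⟩ := exists_regular_coordinates hg
  have hW := PowerSeries.IsWeierstrassDivisor.of_map_ne_zero hε
  obtain ⟨D, hD⟩ : ∃ D, D = ((ε g).map (Ideal.Quotient.mk (IsLocalRing.maximalIdeal
    (MvPowerSeries (Fin m) k)))).order.toNat := ⟨_, rfl⟩
  refine ⟨ε.symm.toRingHom.comp PowerSeries.C, D, fun i => ε.symm (PowerSeries.X ^ i.val),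
    fun r => ?_, fun r' s h i => ?_⟩
  · obtain ⟨h1, h2⟩ := hW.isWeierstrassDivisionAt_div_mod (ε r)
    refine ⟨fun i => (hW.mod (ε r)).coeff i, ε.symm (hW.div (ε r)), ε.injective ?_⟩
    rw [← hD] at h1
    simp only [map_add, map_sum, map_mul, RingEquiv.apply_symm_apply, RingHom.comp_apply,
      RingEquiv.toRingHom_eq_coe, RingEquiv.coe_toRingHom]
    nth_rewrite 1 [h2]
    rw [add_comm]
    congr 1
    exact Polynomial.coe_eq_sum_of_degree_lt h1
  · have h1 := congrArg ε h
    simp only [map_sum, map_mul, RingEquiv.apply_symm_apply, RingHom.comp_apply,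
      RingEquiv.toRingHom_eq_coe, RingEquiv.coe_toRingHom] at h1
    let r : Polynomial (MvPowerSeries (Fin m) k) := ∑ i : Fin D, Polynomial.monomial i.val (r' i)
    have hr : (r : PowerSeries (MvPowerSeries (Fin m) k)) =
        ∑ i, PowerSeries.C (r' i) * PowerSeries.X ^ i.val := by
      have : (r : PowerSeries (MvPowerSeries (Fin m) k)) =
        Polynomial.coeToPowerSeries.ringHom r := rfl
      rw [this, map_sum]
      refine Finset.sum_congr rfl fun i _ => ?_
      rw [← Polynomial.C_mul_X_pow_eq_monomial, map_mul, map_pow]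
      simp
    have hdeg : r.degree < D := by
      rw [Polynomial.degree_lt_iff_coeff_zero]
      intro j hj
      simp only [r, Polynomial.finsetSum_coeff, Polynomial.coeff_monomial]
      refine Finset.sum_eq_zero fun i _ => if_neg ?_
      have := i.2
      omega
    have h2 := (hW.eq_zero_of_mul_eq (by rw [← hD]; exact hdeg) (h1.symm.trans hr.symm)).2
    have h3 := congrArg (fun p => Polynomial.coeff p i.val) h2
    simp only [r, Polynomial.finsetSum_coeff, Polynomial.coeff_monomial,
      Polynomial.coeff_zero] at h3
    rw [Finset.sum_eq_single i] at h3
    · simpa using h3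
    · intro j _ hj
      rw [if_neg fun h => hj (Fin.ext h)]
    · simp

theorem isUnit_of_eq_span_top {Λ : Type} [CommRing Λ] [IsLocalRing Λ] {s : ℕ} {a : Fin s → Λ}
    (h : Ideal.span (Set.range a) = ⊤) : ∃ l, IsUnit (a l) := by
  by_contra! hcon
  refine (IsLocalRing.maximalIdeal.isMaximal Λ).ne_top (top_le_iff.1 ?_)
  rw [← h, Ideal.span_le]
  rintro _ ⟨l, rfl⟩
  exact hcon l

set_option maxHeartbeats 1000000 in
theorem locallySmoothable_of_generic {R Λ : Type} [CommRing R] [CommRing Λ] [Algebra R Λ]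
    [IsDomain R] [CharZero R] [IsNoetherianRing R] [IsNoetherianRing Λ] [IsDomain Λ] [IsLocalRing Λ]
    (hinj : ∀ r : R, IsUnit (algebraMap R Λ r) → IsUnit r)
    (hreg : ∀ q : Ideal Λ, q.IsPrime → JacReg q)
    (hmodel : ∀ g : R, g ≠ 0 → ¬ IsUnit g → ∀ (σ κ : Type) [Finite σ] (F : κ → MvPolynomial σ R)
      (z : σ → Λ), (∀ k, aeval z (F k) = 0) →
      ∃ (Cb : Type) (_ : CommRing Cb) (_ : Algebra R Cb)
        (ψ : Cb →ₐ[R] Λ ⧸ Ideal.span {algebraMap R Λ g}) (x : σ → Cb) (c : Cb),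
        Algebra.FiniteType R Cb ∧ (∀ k, aeval x (F k) = 0) ∧
        (∀ j, ψ (x j) = Ideal.Quotient.mk _ (z j)) ∧ LiftsMod R (Ideal.span {g}) Cb c ∧
        ∃ u : Λ, IsUnit u ∧ ψ c = Ideal.Quotient.mk _ u) : LocallySmoothable R Λ := by
  classical
  intro A _ _ hA φ
  obtain ⟨B₀, _, _, ι₀, β₀, hB₀, hβ₀, π, hπ0, hπ⟩ :=
    exists_generic_smoothing (fun q hq _ => hreg q hq) φ
  obtain ⟨s, a, ha, hspan⟩ := exists_smoothIdeal_eq_span β₀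
  by_cases hu : IsUnit π
  · obtain ⟨l, hl⟩ := isUnit_of_eq_span_top (a := fun l => β₀ (a l)) (by
      rw [← hspan]
      exact Ideal.eq_top_of_isUnit_mem _ hπ (hu.map (algebraMap R Λ)))
    exact ⟨B₀, inferInstance, inferInstance, ι₀, β₀, hB₀, hβ₀, a l, ha l, hl⟩
  obtain ⟨n, r, g, G, hg, hker⟩ := exists_presentation R B₀
  choose a' ha' using fun l => hg (a l)
  rw [hspan] at hπ
  obtain ⟨y, hy⟩ := Ideal.mem_span_range_iff_exists_fun.1 hπ
  let F := combEq R G a' fun _ : Fin 1 => π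
  let z : Fin n ⊕ Fin 1 × Fin s → Λ := Sum.elim (fun j => β₀ (g (X j))) fun o => y o.2
  have hzx : ∀ p : MvPolynomial (Fin n) R, aeval (fun j => z (Sum.inl j)) p = β₀ (g p) :=
    fun p => by
      have : (aeval fun j => z (Sum.inl j)) = β₀.comp g :=
        MvPolynomial.algHom_ext fun j => by rw [AlgHom.comp_apply, aeval_X]; rfl
      rw [this]; rfl
  have hgG : ∀ k, g (G k) = 0 := fun k => by
    have : G k ∈ RingHom.ker g := by rw [hker]; exact Ideal.subset_span ⟨k, rfl⟩
    exact this
  have hz : ∀ k, aeval z (F k) = 0 := by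
    rintro (k | i)
    · simp only [F, combEq, Sum.elim_inl]
      rw [aeval_rename_inl_map, hzx, hgG, map_zero]
    · simp only [F, combEq, Sum.elim_inr, map_sub, map_sum, map_mul, aeval_X, algHom_C]
      simp only [aeval_rename_inl_map, hzx, ha']
      rw [← hy, sub_eq_zero]
      exact Finset.sum_congr rfl fun l _ => mul_comm _ _
  obtain ⟨K, hK⟩ := exists_newton_combEq (R₀ := R) hg hker a' (fun _ : Fin 1 => π)
    fun l => by rw [ha']; exact ha l
  obtain ⟨ϖ, hϖ⟩ : ∃ ϖ, ϖ = π ^ (K + 1) := ⟨_, rfl⟩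
  have hϖ0 : ϖ ≠ 0 := hϖ ▸ pow_ne_zero _ hπ0
  have hϖu : ¬ IsUnit ϖ := fun h => hu ((isUnit_pow_iff (Nat.succ_ne_zero K)).1 (hϖ ▸ h))
  have hgu : ¬ IsUnit (ϖ ^ 5) := fun h => hϖu ((isUnit_pow_iff (by norm_num)).1 h)
  have hN : Newton F (C ϖ) 0 := by
    have := (hK 0).mul_left (C π)
    rwa [← C_mul, ← pow_succ', ← hϖ] at this
  obtain ⟨Cb, _, _, ψ, x, c, hCft, hx, hψx, hlift, u, huu, hψc⟩ :=
    hmodel (ϖ ^ 5) (pow_ne_zero _ hϖ0) hgu _ _ F z hz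
  obtain ⟨B, _, _, β, Y, hB, hY, hβY, hsm⟩ := desing_step (L := Λ) (π := ϖ)
    (mem_nonZeroDivisors_of_ne_zero hϖ0) (fun l hl => by
      rw [pow_two, mul_assoc] at hl
      rcases mul_eq_zero.1 hl with h | h
      · rw [h, zero_mul]
      · exact h) (Ideal.Quotient.mkₐ R (Ideal.span {algebraMap R Λ (ϖ ^ 5)}))
    (Ideal.Quotient.mkₐ_surjective R _) (fun l hl => by
      have h1 : l ∈ Ideal.span {algebraMap R Λ (ϖ ^ 5)} := Ideal.Quotient.eq_zero_iff_mem.1 hl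
      obtain ⟨l', hl'⟩ := Ideal.mem_span_singleton'.1 h1
      exact ⟨l', by rw [← hl', map_pow, mul_comm]⟩) hN z hz ψ x hx hψx
  obtain ⟨b, hb, hbq⟩ := hsm (IsLocalRing.maximalIdeal Λ) inferInstance (Or.inr ⟨c, hlift,
    fun c' hc' hmem => by
      rw [hψc] at hc'
      have h1 := Ideal.Quotient.eq.1 hc'
      have h2 : c' - u ∈ IsLocalRing.maximalIdeal Λ := by
        refine (Ideal.span_le.2 ?_ : Ideal.span {algebraMap R Λ (ϖ ^ 5)} ≤ _) h1
        rw [Set.singleton_subset_iff]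
        exact fun h => hgu (hinj _ h)
      exact (((IsLocalRing.maximalIdeal Λ).sub_mem_iff_right hmem).1 h2) huu⟩)
  have hkill : RingHom.ker g ≤ RingHom.ker
      (aeval (fun j => Y (Sum.inl j)) : MvPolynomial (Fin n) R →ₐ[R] B) := by
    rw [hker, Ideal.span_le]
    rintro _ ⟨k, rfl⟩
    have := hY (Sum.inl k)
    simp only [F, combEq, Sum.elim_inl] at this
    rwa [aeval_rename_inl_map] at this
  let ι : B₀ →ₐ[R] B := AlgHom.liftOfSurjective g hg _ hkill
  have hι : ∀ p, ι (g p) = aeval (fun j => Y (Sum.inl j)) p := fun p =>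
    AlgHom.liftOfSurjective_apply _ _ _ _ _
  have hβι : β.comp ι = β₀ := by
    refine AlgHom.ext fun w => ?_
    obtain ⟨p, rfl⟩ := hg w
    have : (β.comp ι).comp g = β₀.comp g := MvPolynomial.algHom_ext fun j => by
      simp only [AlgHom.comp_apply, hι, aeval_X]
      exact hβY (Sum.inl j)
    exact DFunLike.congr_fun this p
  refine ⟨B, inferInstance, inferInstance, ι.comp ι₀, β, hB, ?_, b, hb, ?_⟩
  · rw [← AlgHom.comp_assoc, hβι, hβ₀]
  · exact not_not.1 hbq

theorem locallySmoothable_mvPowerSeries (k : Type) [Field k] [CharZero k] (n m : ℕ) :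
    LocallySmoothable (MvPowerSeries (Fin m) k)
      (MvPowerSeries (Fin n) (MvPowerSeries (Fin m) k)) := by
  have hdom : ∀ m, IsDomain (MvPowerSeries (Fin m) k) := fun m => NoZeroDivisors.to_isDomain _
  have hdom' : ∀ m, IsDomain (MvPowerSeries (Fin n) (MvPowerSeries (Fin m) k)) := fun m =>
    NoZeroDivisors.to_isDomain _
  have hchar : ∀ m, CharZero (MvPowerSeries (Fin m) k) := fun m =>
    charZero_of_injective_ringHom (f := (MvPowerSeries.C : k →+* MvPowerSeries (Fin m) k))
      MvPowerSeries.C_injective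
  have hunit : ∀ m, ∀ r : MvPowerSeries (Fin m) k,
      IsUnit (algebraMap _ (MvPowerSeries (Fin n) (MvPowerSeries (Fin m) k)) r) → IsUnit r :=
    fun m r h => by
      have := h.map (MvPowerSeries.constantCoeff (σ := Fin n) (R := MvPowerSeries (Fin m) k))
      rwa [MvPowerSeries.algebraMap_apply, Algebra.algebraMap_self, RingHom.id_apply,
        MvPowerSeries.constantCoeff_C] at this
  induction m with
  | zero =>
    refine locallySmoothable_of_generic (hunit 0) (jacReg_mvPowerSeries_mvPowerSeries n 0) ?_
    intro g hg hgu
    have hf : IsField (MvPowerSeries (Fin 0) k) :=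
      (MvPowerSeries.isEmptyEquiv (Fin 0) k).toMulEquiv.isField (Field.toIsField k)
    obtain ⟨y, hy⟩ := hf.mul_inv_cancel hg
    exact absurd (IsUnit.of_mul_eq_one y hy) hgu
  | succ m ih =>
    refine locallySmoothable_of_generic (hunit _) (jacReg_mvPowerSeries_mvPowerSeries n _) ?_
    intro g hg _ σ κ _ F z hz
    obtain ⟨c, D, e, hdiv, huniq⟩ := exists_finite_free_quotient hg
    let R := MvPowerSeries (Fin (m + 1)) k
    let Λ := MvPowerSeries (Fin n) R
    let _ : Algebra (MvPowerSeries (Fin m) k) (MvPowerSeries (Fin (m + 1)) k) := c.toAlgebra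
    let γ : MvPowerSeries (Fin n) (MvPowerSeries (Fin m) k) →+* Λ := MvPowerSeries.map c
    have hco : ∀ (i : Fin n →₀ ℕ) (l : Fin D → MvPowerSeries (Fin n) (MvPowerSeries (Fin m) k)),
        MvPowerSeries.coeff i (∑ j, γ (l j) * algebraMap R Λ (e j)) =
          ∑ j, c (MvPowerSeries.coeff i (l j)) * e j := fun i l => by
      rw [map_sum]
      refine Finset.sum_congr rfl fun j _ => ?_
      exact (MvPowerSeries.coeff_mul_C i _ _).trans (by rw [MvPowerSeries.coeff_map])
    have hcog : ∀ (i : Fin n →₀ ℕ) (s : Λ), MvPowerSeries.coeff i (algebraMap R Λ g * s) =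
        g * MvPowerSeries.coeff i s := fun i s => MvPowerSeries.coeff_C_mul i s g
    refine LocallySmoothable.exists_model_mod (Λ' := MvPowerSeries (Fin n) (MvPowerSeries (Fin m) k))
      γ (fun r => ?_) e g hdiv (fun l => ?_) (fun l' s h j => ?_) ih F z hz
    · exact MvPowerSeries.map_C c r
    · choose r' s hs using fun i : Fin n →₀ ℕ => hdiv (MvPowerSeries.coeff i l)
      let l' : Fin D → MvPowerSeries (Fin n) (MvPowerSeries (Fin m) k) := fun j i => r' i j
      let s' : Λ := fun i => s i
      refine ⟨l', s', MvPowerSeries.ext fun i => ?_⟩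
      rw [map_add, hco, hcog]
      exact hs i
    · ext1 i
      refine huniq (fun j => MvPowerSeries.coeff i (l' j)) (MvPowerSeries.coeff i s) ?_ j
      rw [← hco, h, hcog]

end LocalSmoothing

end

section

open MvPolynomial
open scoped Topology

lemma MvPolynomial.analyticAt_eval {σ : Type*} [Fintype σ] (p : MvPolynomial σ ℝ) (x : σ → ℝ) :
    AnalyticAt ℝ (fun y : σ → ℝ => eval y p) x := by
  induction p using MvPolynomial.induction_on with
  | C a => simpa using analyticAt_const
  | add p q hp hq => simp only [map_add]; exact hp.add hq
  | mul_X p i hp =>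
    simp only [map_mul, eval_X]
    exact hp.mul ((ContinuousLinearMap.proj (R := ℝ) (φ := fun _ : σ => ℝ) i).analyticAt x)

lemma MvPolynomial.hasFDerivAt_eval {σ : Type*} [Fintype σ] (p : MvPolynomial σ ℝ) (x : σ → ℝ) :
    HasFDerivAt (fun y : σ → ℝ => eval y p)
      (∑ i, eval x (pderiv i p) • ContinuousLinearMap.proj (R := ℝ) (φ := fun _ : σ => ℝ) i) x := by
  classical
  induction p using MvPolynomial.induction_on with
  | C a => simpa using hasFDerivAt_const a x
  | add p q hp hq =>
    simp only [map_add, add_smul, Finset.sum_add_distrib]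
    exact hp.add hq
  | mul_X p i hp =>
    have h := hp.mul
      (ContinuousLinearMap.proj (R := ℝ) (φ := fun _ : σ => ℝ) i).hasFDerivAt (x := x)
    simp only [map_mul, eval_X]
    refine h.congr_fderiv ?_
    ext v
    simp [Derivation.leibniz, pderiv_X, Pi.single_apply, add_mul, Finset.sum_add_distrib,
      Finset.mul_sum, mul_assoc, ite_mul, apply_ite (eval x)]

/-- The implicit function theorem for polynomial systems, with an analytic solution. -/
theorem exists_analyticAt_implicit {ω ς : Type*} [Fintype ω] [Fintype ς] [DecidableEq ω]
    (G : ω → MvPolynomial (ω ⊕ ς) ℝ) (w : ω → ℝ) (c₀ : ς → ℝ)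
    (hG : ∀ k, eval (Sum.elim w c₀) (G k) = 0)
    (hdet : (Matrix.of fun k l => eval (Sum.elim w c₀) (pderiv (Sum.inl l) (G k))).det ≠ 0) :
    ∃ W : (ς → ℝ) → ω → ℝ, AnalyticAt ℝ W c₀ ∧ W c₀ = w ∧
      ∀ᶠ c in 𝓝 c₀, ∀ k, eval (Sum.elim (W c) c) (G k) = 0 := by
  classical
  let s : ((ω → ℝ) × (ς → ℝ)) →L[ℝ] (ω ⊕ ς → ℝ) := ContinuousLinearMap.pi fun i =>
    Sum.rec (fun l => (ContinuousLinearMap.proj l).comp (ContinuousLinearMap.fst ℝ _ _))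
      (fun l => (ContinuousLinearMap.proj l).comp (ContinuousLinearMap.snd ℝ _ _)) i
  have hs : ∀ v : ((ω → ℝ) × (ς → ℝ)), s v = Sum.elim v.1 v.2 := by
    intro v; ext i; cases i <;> rfl
  let Ψ : ((ω → ℝ) × (ς → ℝ)) → ((ω → ℝ) × (ς → ℝ)) := fun v => (fun k => eval (s v) (G k), v.2)
  have hΨ : AnalyticAt ℝ Ψ (w, c₀) := by
    refine AnalyticAt.prod ?_ ((ContinuousLinearMap.snd ℝ (ω → ℝ) (ς → ℝ)).analyticAt _)
    refine AnalyticAt.pi fun k => ?_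
    exact ((G k).analyticAt_eval (s (w, c₀))).comp (s.analyticAt (w, c₀))
  let D : ((ω → ℝ) × (ς → ℝ)) →L[ℝ] ((ω → ℝ) × (ς → ℝ)) := ContinuousLinearMap.prod
    (ContinuousLinearMap.pi fun k => (∑ i, eval (s (w, c₀)) (pderiv i (G k)) •
      ContinuousLinearMap.proj (R := ℝ) (φ := fun _ : ω ⊕ ς => ℝ) i).comp s)
    (ContinuousLinearMap.snd ℝ (ω → ℝ) (ς → ℝ))
  have hD : HasFDerivAt Ψ D (w, c₀) := by
    refine HasFDerivAt.prodMk ?_ (ContinuousLinearMap.snd ℝ (ω → ℝ) (ς → ℝ)).hasFDerivAt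
    rw [hasFDerivAt_pi]
    intro k
    exact ((G k).hasFDerivAt_eval (s (w, c₀))).comp (w, c₀) s.hasFDerivAt
  have hinj : Function.Injective D := by
    rw [injective_iff_map_eq_zero]
    rintro ⟨v, c⟩ hv
    have hc : c = 0 := congrArg Prod.snd hv
    subst hc
    have h1 := congrArg Prod.fst hv
    have : v = 0 := by
      refine Matrix.eq_zero_of_mulVec_eq_zero hdet (funext fun k => ?_)
      have := congrFun h1 k
      simp only [D, ContinuousLinearMap.prod_apply, ContinuousLinearMap.pi_apply,
        ContinuousLinearMap.comp_apply, sum_apply, hs] at this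
      simpa [Fintype.sum_sum_type, Matrix.mulVec, dotProduct] using this
    rw [this]; rfl
  let e : ((ω → ℝ) × (ς → ℝ)) ≃L[ℝ] ((ω → ℝ) × (ς → ℝ)) := (LinearEquiv.ofInjectiveEndo (D : ((ω → ℝ) × (ς → ℝ)) →ₗ[ℝ] ((ω → ℝ) × (ς → ℝ))) hinj).toContinuousLinearEquiv
  have he : (e : ((ω → ℝ) × (ς → ℝ)) →L[ℝ] ((ω → ℝ) × (ς → ℝ))) = D := by ext v <;> rfl
  have hst : HasStrictFDerivAt Ψ (e : ((ω → ℝ) × (ς → ℝ)) →L[ℝ] ((ω → ℝ) × (ς → ℝ))) (w, c₀) := by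
    rw [he, ← hD.fderiv]; exact hΨ.hasStrictFDerivAt
  let H := hst.toOpenPartialHomeomorph Ψ
  have hH : (H : ((ω → ℝ) × (ς → ℝ)) → ((ω → ℝ) × (ς → ℝ))) = Ψ := hst.toOpenPartialHomeomorph_coe
  have hsrc : (w, c₀) ∈ H.source := hst.mem_toOpenPartialHomeomorph_source
  have hval : Ψ (w, c₀) = (0, c₀) := by
    refine Prod.ext (funext fun k => ?_) rfl
    simpa [Ψ, hs] using hG k
  have hsymm : AnalyticAt ℝ H.symm (0, c₀) := by
    rw [← hval, ← hH]
    refine H.analyticAt_symm' (i := e) hsrc (by rw [hH]; exact hΨ) ?_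
    rw [hH, he, hD.fderiv]
  have hin : AnalyticAt ℝ (fun c : ς → ℝ => ((0 : ω → ℝ), c)) c₀ :=
    (ContinuousLinearMap.inr ℝ (ω → ℝ) (ς → ℝ)).analyticAt c₀
  have hsym0 : H.symm (0, c₀) = (w, c₀) := by
    rw [← hval, ← hH]; exact H.left_inv hsrc
  refine ⟨fun c => (H.symm (0, c)).1, ?_, by simp [hsym0], ?_⟩
  · exact ((ContinuousLinearMap.fst ℝ (ω → ℝ) (ς → ℝ)).analyticAt _).comp
      (hsymm.comp_of_eq hin rfl)
  · have ht : ∀ᶠ v in 𝓝 ((0 : ω → ℝ), c₀), v ∈ H.target := by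
      refine H.open_target.mem_nhds ?_
      rw [← hval, ← hH]; exact H.map_source hsrc
    have ht' := hin.continuousAt.eventually ht
    filter_upwards [ht'] with c hc k
    have h1 : Ψ (H.symm (0, c)) = (0, c) := by rw [← hH]; exact H.right_inv hc
    have h2 : (H.symm (0, c)).2 = c := congrArg Prod.snd h1
    have h3 := congrFun (congrArg Prod.fst h1) k
    simp only [Ψ, hs, h2] at h3
    exact h3

/-- Solve a polynomial system that is of Newton type at a point along prescribed directions. -/
theorem exists_smooth_solution {ω ς κ ι : Type} [Fintype ω] [Fintype ς] [Fintype κ] [Fintype ι]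
    [DecidableEq ω] [DecidableEq ι]
    (F : κ → MvPolynomial (ω ⊕ ς) ℝ) (φ : ι → MvPolynomial (ω ⊕ ς) ℝ) (w : ω → ℝ) (c₀ : ς → ℝ)
    (hF : ∀ k, eval (Sum.elim w c₀) (F k) = 0) (hφ : ∀ i, eval (Sum.elim w c₀) (φ i) = 0)
    (τ : ι → ω → ℝ)
    (hFτ : ∀ k j, ∑ l, eval (Sum.elim w c₀) (pderiv (Sum.inl l) (F k)) * τ j l = 0)
    (hφτ : ∀ i j, ∑ l, eval (Sum.elim w c₀) (pderiv (Sum.inl l) (φ i)) * τ j l =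
      if i = j then 1 else 0)
    (S : ω → κ → MvPolynomial (ω ⊕ ς) ℝ) (q : κ → κ → κ → MvPolynomial (ω ⊕ ς) ℝ)
    (d : MvPolynomial (ω ⊕ ς) ℝ) (hd : eval (Sum.elim w c₀) d ≠ 0) :
    ∃ (W : (ς → ℝ) → ω → ℝ) (G : ω → MvPolynomial (ω ⊕ ς) ℝ), AnalyticAt ℝ W c₀ ∧ W c₀ = w ∧
      (∀ᶠ c in 𝓝 c₀, ∀ i, eval (Sum.elim (W c) c) (φ i) = 0) ∧
      (∀ᶠ c in 𝓝 c₀, ∀ l, eval (Sum.elim (W c) c) (G l) = 0) ∧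
      (Matrix.of fun k l => eval (Sum.elim w c₀) (pderiv (Sum.inl l) (G k))).det ≠ 0 ∧
      ∀ᶠ c in 𝓝 c₀,
        (∀ i, eval (Sum.elim (W c) c) (∑ k, (∑ l, pderiv (Sum.inl l) (F i) * S l k) * F k) =
          eval (Sum.elim (W c) c) (d * F i + ∑ k, ∑ l, q i k l * (F k * F l))) →
        ∀ k, eval (Sum.elim (W c) c) (F k) = 0 := by
  classical
  set pt := Sum.elim w c₀ with hpt
  let J : κ → ω → ℝ := fun k l => eval pt (pderiv (Sum.inl l) (F k))
  let dφ : ι → ω → ℝ := fun i l => eval pt (pderiv (Sum.inl l) (φ i))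
  obtain ⟨κ', a, hainj, haspan, hali⟩ := exists_linearIndependent' ℝ J
  haveI : Finite κ' := Finite.of_injective a hainj
  haveI := Fintype.ofFinite κ'
  have hpair : ∀ j, ∀ v ∈ Submodule.span ℝ (Set.range (J ∘ a)), ∑ l, v l * τ j l = 0 := by
    intro j v hv
    induction hv using Submodule.span_induction with
    | mem v hv => obtain ⟨k, rfl⟩ := hv; exact hFτ (a k) j
    | zero => simp
    | add x y _ _ hx hy => simp [add_mul, Finset.sum_add_distrib, hx, hy]
    | smul r x _ hx => simp [mul_assoc, ← Finset.mul_sum, hx]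
  have hli : LinearIndependent ℝ (Sum.elim (J ∘ a) dφ) := by
    rw [Fintype.linearIndependent_iff]
    intro g hg
    rw [Fintype.sum_sum_type] at hg
    simp only [Sum.elim_inl, Sum.elim_inr] at hg
    have hr : ∀ j, g (Sum.inr j) = 0 := by
      intro j
      have h1 : ∑ l, (∑ k, g (Sum.inl k) • (J ∘ a) k + ∑ i, g (Sum.inr i) • dφ i) l * τ j l = 0 := by
        rw [hg]; simp
      have h2 := hpair j (∑ k, g (Sum.inl k) • (J ∘ a) k)
        (Submodule.sum_mem _ fun k _ => Submodule.smul_mem _ _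
          (Submodule.subset_span (Set.mem_range_self k)))
      simp only [Pi.add_apply, add_mul, Finset.sum_add_distrib, h2, zero_add] at h1
      simp only [Finset.sum_apply, Pi.smul_apply, smul_eq_mul, Finset.sum_mul] at h1
      rw [Finset.sum_comm] at h1
      have h3 : ∀ i, ∑ l, g (Sum.inr i) * dφ i l * τ j l = g (Sum.inr i) * if i = j then 1 else 0 := by
        intro i
        rw [← hφτ i j, Finset.mul_sum]
        exact Finset.sum_congr rfl fun l _ => mul_assoc _ _ _
      simpa [h3] using h1
    simp only [hr, zero_smul, Finset.sum_const_zero, add_zero] at hg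
    have hl := Fintype.linearIndependent_iff.1 hali _ hg
    rintro (k | j)
    exacts [hl k, hr j]
  let b := Module.Basis.sumExtend hli
  have hb : ∀ i, b (Sum.inl i) = Sum.elim (J ∘ a) dφ i := fun i => by
    simp only [b, Module.Basis.sumExtend, Module.Basis.reindex_apply, Module.Basis.extend_apply_self]
    rfl
  let e : ω ≃ (κ' ⊕ ι) ⊕ Module.Basis.sumExtendIndex hli :=
    (Pi.basisFun ℝ ω).indexEquiv b
  let G' : (κ' ⊕ ι) ⊕ Module.Basis.sumExtendIndex hli → MvPolynomial (ω ⊕ ς) ℝ := Sum.elim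
    (Sum.elim (fun k => F (a k)) φ)
    (fun t => ∑ l, C (b (Sum.inr t) l) * (X (Sum.inl l) - C (w l)))
  have hG'0 : ∀ i, eval pt (G' i) = 0 := by
    rintro ((k | i) | t)
    · exact hF _
    · exact hφ _
    · simp [G', hpt]
  have hG'd : ∀ i l, eval pt (pderiv (Sum.inl l) (G' i)) = b i l := by
    rintro ((k | i) | t) l
    · rw [hb]; rfl
    · rw [hb]; rfl
    · simp [G', pderiv_X, Pi.single_apply, Derivation.leibniz]
  have hdet : (Matrix.of fun k l => eval pt (pderiv (Sum.inl l) (G' (e k)))).det ≠ 0 := by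
    have h1 : LinearIndependent ℝ (Matrix.of fun k l => eval pt (pderiv (Sum.inl l) (G' (e k)))).row := by
      have : (Matrix.of fun k l => eval pt (pderiv (Sum.inl l) (G' (e k)))).row = b ∘ e := by
        funext k l; exact hG'd _ _
      rw [this]
      exact b.linearIndependent.comp e e.injective
    rw [Matrix.linearIndependent_rows_iff_isUnit, Matrix.isUnit_iff_isUnit_det] at h1
    exact h1.ne_zero
  obtain ⟨W, hW, hW0, hWG⟩ := exists_analyticAt_implicit (fun l => G' (e l)) w c₀
    (fun k => hG'0 _) hdet
  have hWG' : ∀ᶠ c in 𝓝 c₀, ∀ i, eval (Sum.elim (W c) c) (G' i) = 0 := by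
    filter_upwards [hWG] with c hc i
    simpa using hc (e.symm i)
  refine ⟨W, _, hW, hW0, ?_, hWG, hdet, ?_⟩
  · filter_upwards [hWG'] with c hc i using hc (Sum.inl (Sum.inr i))
  have hM : ∀ k, ∃ m : κ' → ℝ, ∑ s, m s • J (a s) = J k := by
    intro k
    have : J k ∈ Submodule.span ℝ (Set.range (J ∘ a)) := by
      rw [haspan]; exact Submodule.subset_span (Set.mem_range_self k)
    exact (Submodule.mem_span_range_iff_exists_fun ℝ).1 this
  choose m hm using hM
  let A : Matrix κ κ (MvPolynomial (ω ⊕ ς) ℝ) := Matrix.of fun k j =>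
    ∑ l, (pderiv (Sum.inl l) (F k) - ∑ s, C (m k s) * pderiv (Sum.inl l) (F (a s))) * S l j
    - ∑ i, (q k j i - ∑ s, C (m k s) * q (a s) j i) * F i
  let T : Matrix κ κ (MvPolynomial (ω ⊕ ς) ℝ) := d • 1 - A
  have hA0 : ∀ k j, eval pt (A k j) = 0 := by
    intro k j
    have h1 : ∀ l, eval pt (pderiv (Sum.inl l) (F k)) -
        ∑ s, m k s * eval pt (pderiv (Sum.inl l) (F (a s))) = 0 := by
      intro l
      have := congrFun (hm k) l
      simp only [Finset.sum_apply, Pi.smul_apply, smul_eq_mul] at this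
      exact sub_eq_zero.2 this.symm
    simp [A, hF, h1]
  have hTdet : eval pt T.det ≠ 0 := by
    rw [RingHom.map_det]
    have : (eval pt).mapMatrix T = (eval pt d) • 1 := by
      ext i j
      by_cases h : i = j
      · subst h; simp [T, hA0]
      · simp [T, hA0, h]
    rw [this]
    rw [Matrix.det_smul]
    simpa using fun h => absurd h hd
  have hcont : ContinuousAt (fun c => Sum.elim (W c) c) c₀ := by
    rw [continuousAt_pi]
    rintro (l | l)
    · exact (continuousAt_pi.1 hW.continuousAt) l
    · exact continuousAt_apply l c₀
  have hev : ∀ᶠ c in 𝓝 c₀, eval (Sum.elim (W c) c) T.det ≠ 0 := by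
    have h1 : ContinuousAt (fun c => eval (Sum.elim (W c) c) T.det) c₀ :=
      ContinuousAt.comp (f := fun c => Sum.elim (W c) c) (g := fun y => eval y T.det)
        (T.det.analyticAt_eval _).continuousAt hcont
    refine h1.eventually_ne ?_
    simpa [hW0] using hTdet
  filter_upwards [hev, hWG'] with c hc hG hN k
  set P := Sum.elim (W c) c
  have ha0 : ∀ s, eval P (F (a s)) = 0 := fun s => hG (Sum.inl (Sum.inl s))
  rw [RingHom.map_det] at hc
  refine congrFun (Matrix.eq_zero_of_mulVec_eq_zero (v := fun k => eval P (F k)) hc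
    (funext fun i => ?_)) k
  have key : ∑ j, A i j * F j = (∑ k, (∑ l, pderiv (Sum.inl l) (F i) * S l k) * F k
        - ∑ k, ∑ l, q i k l * (F k * F l)) - ∑ s, C (m i s) *
      (∑ k, (∑ l, pderiv (Sum.inl l) (F (a s)) * S l k) * F k
        - ∑ k, ∑ l, q (a s) k l * (F k * F l)) := by
    have hswap : ∀ (f : κ → κ' → MvPolynomial (ω ⊕ ς) ℝ),
      ∑ s, ∑ j, f j s = ∑ j, ∑ s, f j s := fun f => Finset.sum_comm
    have hswap2 : ∀ (f : κ → κ → κ' → MvPolynomial (ω ⊕ ς) ℝ),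
      ∑ s, ∑ j, ∑ i, f j i s = ∑ j, ∑ i, ∑ s, f j i s := fun f => by
        rw [Finset.sum_comm]; exact Finset.sum_congr rfl fun _ _ => Finset.sum_comm
    have hswap3 : ∀ (f : κ → ω → κ' → MvPolynomial (ω ⊕ ς) ℝ),
      ∑ s, ∑ j, ∑ i, f j i s = ∑ j, ∑ i, ∑ s, f j i s := fun f => by
        rw [Finset.sum_comm]; exact Finset.sum_congr rfl fun _ _ => Finset.sum_comm
    simp only [A, Matrix.of_apply, sub_mul, mul_sub, Finset.sum_sub_distrib, Finset.sum_mul,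
      Finset.mul_sum, hswap2, hswap3]
    have e1 : ∀ x i_1, q i x i_1 * F i_1 * F x = q i x i_1 * (F x * F i_1) := by intros; ring
    have e2 : ∀ x i_1 s, C (m i s) * q (a s) x i_1 * F i_1 * F x
      = C (m i s) * (q (a s) x i_1 * (F x * F i_1)) := by intros; ring
    have e3 : ∀ x l s, C (m i s) * pderiv (Sum.inl l) (F (a s)) * S l x * F x
      = C (m i s) * (pderiv (Sum.inl l) (F (a s)) * S l x * F x) := by intros; ring
    simp only [e1, e2, e3]
    ring
  have key2 := congrArg (eval P) key
  have hN' : ∀ i, eval P (∑ k, (∑ l, pderiv (Sum.inl l) (F i) * S l k) * F k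
        - ∑ k, ∑ l, q i k l * (F k * F l)) = eval P (d * F i) := by
    intro i
    rw [map_sub, hN i, map_add]; ring
  rw [map_sub, hN', map_sum (eval P), map_sum (eval P)] at key2
  simp only [map_mul, hN', ha0, mul_zero, Finset.sum_const_zero, sub_zero] at key2
  have hT : ∀ j, eval P (T i j) * eval P (F j) = (if i = j then eval P d * eval P (F j) else 0)
      - eval P (A i j) * eval P (F j) := by
    intro j
    by_cases h : i = j
    · subst h; simp [T, sub_mul]
    · simp [T, h]
  simp only [Matrix.mulVec, dotProduct, RingHom.mapMatrix_apply, Matrix.map_apply, hT,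
    Finset.sum_sub_distrib, key2]
  simp

end

section

open MvPolynomial
open scoped Topology

lemma MvPolynomial.derivation_aeval {R B ω M : Type*} [CommRing R] [CommRing B] [Algebra R B]
    [AddCommGroup M] [Module B M] [Module R M] [Fintype ω] (D : Derivation R B M) (v : ω → B)
    (p : MvPolynomial ω R) : D (aeval v p) = ∑ l, aeval v (pderiv l p) • D (v l) := by
  classical
  induction p using MvPolynomial.induction_on with
  | C a => simp
  | add p q hp hq => simp [hp, hq, add_smul, Finset.sum_add_distrib]
  | mul_X p i hp =>
    simp only [map_mul, aeval_X, Derivation.leibniz, hp, smul_eq_mul, pderiv_X, map_add,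
      add_smul, Finset.sum_add_distrib, Finset.smul_sum, mul_smul, Pi.single_apply]
    simp

/-- Solutions of a square polynomial system with invertible Jacobian are algebraic. -/
theorem isAlgebraic_of_jacobian_det_ne_zero {k K ω : Type*} [Field k] [CharZero k] [Field K]
    [Algebra k K] [Fintype ω] [DecidableEq ω] (u : ω → K) (G : ω → MvPolynomial ω k)
    (hG : ∀ i, aeval u (G i) = 0)
    (hdet : (Matrix.of fun i l => aeval u (pderiv l (G i))).det ≠ 0) (j : ω) :
    IsAlgebraic k (u j) := by
  classical
  let L := IntermediateField.adjoin k (Set.range u)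
  have hmem : ∀ j, u j ∈ L := fun j => IntermediateField.subset_adjoin k _ (Set.mem_range_self j)
  let v : ω → L := fun j => ⟨u j, hmem j⟩
  have hv : ∀ p : MvPolynomial ω k, ((aeval v p : L) : K) = aeval u p := by
    intro p
    have : (L.val.comp (aeval v)) = aeval u := by
      apply MvPolynomial.algHom_ext; intro i; simp [v]
    exact DFunLike.congr_fun this p
  haveI : Algebra.EssFiniteType k L := by
    rw [IntermediateField.essFiniteType_iff]
    exact IntermediateField.fg_adjoin_of_finite (Set.finite_range u)
  let D := KaehlerDifferential.D k L
  have hDv : ∀ l, D (v l) = 0 := by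
    let N : Matrix ω ω L := Matrix.of fun i l => aeval v (pderiv l (G i))
    have hN : N.det ≠ 0 := by
      intro h0
      apply hdet
      have := congrArg (algebraMap L K) h0
      rw [RingHom.map_det, map_zero] at this
      rw [← this]
      congr 1
      ext i l
      exact (hv _).symm
    intro l
    have h1 : ∀ i, ∑ l, N i l • D (v l) = 0 := by
      intro i
      rw [← map_zero D, ← show aeval v (G i) = 0 from Subtype.ext (by rw [hv, hG]; rfl),
        derivation_aeval]
      rfl
    have h2 : ∑ i, N.adjugate l i • ∑ l', N i l' • D (v l') = N.det • D (v l) := by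
      simp only [Finset.smul_sum, smul_smul]
      rw [Finset.sum_comm]
      simp only [← Finset.sum_smul]
      have : ∀ y, ∑ x, N.adjugate l x * N x y = if l = y then N.det else 0 := by
        intro y
        have := congrFun (congrFun N.adjugate_mul l) y
        rw [Matrix.mul_apply] at this
        rw [this]; simp [Matrix.one_apply]
      simp [this]
    simp only [h1, smul_zero, Finset.sum_const_zero] at h2
    exact (smul_eq_zero.1 h2.symm).resolve_left hN
  have hD0 : ∀ x : L, D x = 0 := by
    rintro ⟨x, hx⟩
    induction hx using IntermediateField.adjoin_induction with
    | mem x hx => obtain ⟨i, rfl⟩ := hx; exact hDv i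
    | algebraMap x => exact D.map_algebraMap x
    | add x y hx hy h1 h2 =>
      have : (⟨x + y, add_mem hx hy⟩ : L) = ⟨x, hx⟩ + ⟨y, hy⟩ := rfl
      rw [this, map_add, h1, h2, add_zero]
    | mul x y hx hy h1 h2 =>
      have : (⟨x * y, mul_mem hx hy⟩ : L) = ⟨x, hx⟩ * ⟨y, hy⟩ := rfl
      rw [this, D.leibniz, h1, h2]; simp
    | inv x hx h1 =>
      have : (⟨x⁻¹, inv_mem hx⟩ : L) = (⟨x, hx⟩ : L)⁻¹ := rfl
      rw [this, D.leibniz_inv, h1]; simp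
  haveI : Subsingleton (Ω[L⁄k]) := by
    have h1 := KaehlerDifferential.span_range_derivation k L
    have h2 : Set.range (KaehlerDifferential.D k L) ⊆ {0} := by
      rintro _ ⟨x, rfl⟩; exact hD0 x
    have h3 : (⊤ : Submodule L (Ω[L⁄k])) ≤ ⊥ := by
      rw [← h1, Submodule.span_le]; exact h2
    exact (Submodule.subsingleton_iff L).1 (subsingleton_of_bot_eq_top (le_bot_iff.1 h3).symm)
  haveI : Algebra.FormallyUnramified k L := ⟨inferInstance⟩
  haveI : Algebra.IsSeparable k L := (Algebra.FormallyUnramified.iff_isSeparable k L).1 inferInstance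
  have h1 : IsAlgebraic k (v j) := Algebra.IsAlgebraic.isAlgebraic _
  exact h1.algebraMap (A := K)

/-- The algebra of real functions on `ℝⁿ` that are analytic at the origin. -/
def analyticFun (n : ℕ) : Subalgebra ℝ ((Fin n → ℝ) → ℝ) where
  carrier := {h | AnalyticAt ℝ h 0}
  mul_mem' ha hb := AnalyticAt.mul ha hb
  add_mem' ha hb := AnalyticAt.add ha hb
  algebraMap_mem' _ := analyticAt_const

/-- The ideal of functions that vanish near the origin. -/
def germZero (n : ℕ) : Ideal (analyticFun n) where
  carrier := {h | ∀ᶠ x in 𝓝 0, (h : (Fin n → ℝ) → ℝ) x = 0}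
  add_mem' {a b} ha hb := by
    filter_upwards [ha, hb] with x h1 h2
    simp [h1, h2]
  zero_mem' := by simp
  smul_mem' c x hx := by
    filter_upwards [hx] with y hy
    simp [hy]

lemma AnalyticAt.eventually_eq_zero_or_of_mul {n : ℕ} {f g : (Fin n → ℝ) → ℝ}
    (hf : AnalyticAt ℝ f 0) (hg : AnalyticAt ℝ g 0) (h : ∀ᶠ x in 𝓝 0, f x * g x = 0) :
    (∀ᶠ x in 𝓝 0, f x = 0) ∨ ∀ᶠ x in 𝓝 0, g x = 0 := by
  obtain ⟨r, hr, hball⟩ := Metric.eventually_nhds_iff_ball.1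
    (hf.eventually_analyticAt.and (hg.eventually_analyticAt.and h))
  by_cases hp : ∃ p ∈ Metric.ball (0 : Fin n → ℝ) r, f p ≠ 0
  · right
    obtain ⟨p, hpb, hp⟩ := hp
    have hg' : AnalyticOnNhd ℝ g (Metric.ball 0 r) := fun x hx => (hball x hx).2.1
    have h0 : ∀ᶠ x in 𝓝 p, g x = 0 := by
      filter_upwards [(hball p hpb).1.continuousAt.eventually_ne hp,
        Metric.isOpen_ball.mem_nhds hpb] with x h1 h2
      exact (mul_eq_zero.1 (hball x h2).2.2).resolve_left h1
    have := hg'.eqOn_zero_of_preconnected_of_eventuallyEq_zero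
      (convex_ball _ _).isPreconnected hpb h0
    filter_upwards [Metric.ball_mem_nhds _ hr] with x hx using this hx
  · left
    push Not at hp
    filter_upwards [Metric.ball_mem_nhds _ hr] with x hx using hp x hx

instance germZero_isPrime (n : ℕ) : (germZero n).IsPrime where
  ne_top' := by
    rw [Ne, Ideal.eq_top_iff_one]
    intro h
    have h' : ∀ᶠ x : Fin n → ℝ in 𝓝 0, (1 : ℝ) = 0 := h
    exact one_ne_zero h'.self_of_nhds
  mem_or_mem' {x y} h := AnalyticAt.eventually_eq_zero_or_of_mul x.2 y.2 h

/-- The field of fractions of the ring of germs of analytic functions at the origin. -/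
def MeroGerm (n : ℕ) : Type := (germZero n).ResidueField

noncomputable instance (n : ℕ) : Field (MeroGerm n) :=
  inferInstanceAs (Field (germZero n).ResidueField)

noncomputable instance (n : ℕ) : Algebra ℝ (MeroGerm n) :=
  inferInstanceAs (Algebra ℝ (germZero n).ResidueField)

/-- The class of an analytic function in the field of meromorphic germs. -/
noncomputable def toMero (n : ℕ) : analyticFun n →ₐ[ℝ] MeroGerm n :=
  IsScalarTower.toAlgHom ℝ (analyticFun n) (germZero n).ResidueField

lemma toMero_eq_zero_iff {n : ℕ} (h : analyticFun n) :
    toMero n h = 0 ↔ ∀ᶠ x in 𝓝 0, (h : (Fin n → ℝ) → ℝ) x = 0 :=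
  Ideal.algebraMap_residueField_eq_zero (I := germZero n)

lemma aeval_analyticFun_apply {n : ℕ} {σ : Type*} (h : σ → analyticFun n) (p : MvPolynomial σ ℝ)
    (x : Fin n → ℝ) :
    ((aeval h p : analyticFun n) : (Fin n → ℝ) → ℝ) x = eval (fun i => (h i : (Fin n → ℝ) → ℝ) x) p := by
  have : ((Pi.evalAlgHom ℝ (fun _ : Fin n → ℝ => ℝ) x).comp (analyticFun n).val).comp (aeval h) =
      aeval (fun i => (h i : (Fin n → ℝ) → ℝ) x) := by
    apply MvPolynomial.algHom_ext; intro i; simp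
  exact DFunLike.congr_fun this p

lemma aeval_toMero_eq_zero_iff {n : ℕ} {σ : Type*} (h : σ → analyticFun n)
    (p : MvPolynomial σ ℝ) :
    aeval (fun i => toMero n (h i)) p = 0 ↔
      ∀ᶠ x in 𝓝 0, eval (fun i => (h i : (Fin n → ℝ) → ℝ) x) p = 0 := by
  have : aeval (fun i => toMero n (h i)) p = toMero n (aeval h p) := by
    have : aeval (fun i => toMero n (h i)) = (toMero n).comp (aeval h) := by
      apply MvPolynomial.algHom_ext; intro i; simp
    exact DFunLike.congr_fun this p
  rw [this, toMero_eq_zero_iff]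
  simp only [aeval_analyticFun_apply]

/-- The coordinate functions. -/
def coordFun (n : ℕ) (i : Fin n) : analyticFun n :=
  ⟨fun x => x i, (ContinuousLinearMap.proj (R := ℝ) (φ := fun _ : Fin n => ℝ) i).analyticAt 0⟩

lemma MvPolynomial.eq_zero_of_eventually_eval_eq_zero {n : ℕ} (p : MvPolynomial (Fin n) ℝ)
    (h : ∀ᶠ x in 𝓝 0, eval x p = 0) : p = 0 := by
  have h1 : AnalyticOnNhd ℝ (fun x : Fin n → ℝ => eval x p) Set.univ :=
    fun x _ => p.analyticAt_eval x
  have h2 := h1.eqOn_zero_of_preconnected_of_eventuallyEq_zero isPreconnected_univ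
    (Set.mem_univ 0) h
  exact MvPolynomial.funext fun x => by simpa using h2 (Set.mem_univ x)

lemma algebraicIndependent_coordFun (n : ℕ) :
    AlgebraicIndependent ℝ (fun i => toMero n (coordFun n i)) := by
  rw [algebraicIndependent_iff]
  intro p hp
  rw [aeval_toMero_eq_zero_iff] at hp
  exact p.eq_zero_of_eventually_eval_eq_zero hp

/-- The field generated by the coordinate functions. -/
noncomputable abbrev coordField (n : ℕ) : IntermediateField ℝ (MeroGerm n) :=
  IntermediateField.adjoin ℝ (Set.range fun i => toMero n (coordFun n i))

/-- A scalar Nash function germ at the origin (without constraint on its value there). -/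
def NashFun {n : ℕ} (h : (Fin n → ℝ) → ℝ) : Prop :=
  AnalyticAt ℝ h 0 ∧ ∃ P : MvPolynomial (Fin (n + 1)) ℝ, P ≠ 0 ∧
    ∀ᶠ x : Fin n → ℝ in 𝓝 0, eval (Fin.snoc x (h x)) P = 0

open scoped IntermediateField.algebraAdjoinAdjoin in
lemma nashFun_iff_isAlgebraic {n : ℕ} (h : analyticFun n) :
    NashFun (h : (Fin n → ℝ) → ℝ) ↔ IsAlgebraic (coordField n) (toMero n h) := by
  have h1 : IsAlgebraic (coordField n) (toMero n h) ↔
      IsAlgebraic (Algebra.adjoin ℝ (Set.range fun i => toMero n (coordFun n i))) (toMero n h) :=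
    (IsFractionRing.isAlgebraic_iff _ _ _).symm
  have h2 := (algebraicIndependent_coordFun n).option_iff_transcendental (toMero n h)
  have h3 : IsAlgebraic (Algebra.adjoin ℝ (Set.range fun i => toMero n (coordFun n i)))
      (toMero n h) ↔ ¬ AlgebraicIndependent ℝ
        (fun o : Option (Fin n) => o.elim (toMero n h) fun i => toMero n (coordFun n i)) := by
    rw [h2, Transcendental, not_not]
  have h4 : (fun o : Option (Fin n) => o.elim (toMero n h) fun i => toMero n (coordFun n i)) =
      fun o => toMero n (o.elim h (coordFun n)) := by
    funext o; cases o <;> rfl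
  have h5 : ∀ (x : Fin n → ℝ) (P : MvPolynomial (Option (Fin n)) ℝ),
      eval (Fin.snoc x ((h : (Fin n → ℝ) → ℝ) x)) (rename (finSuccEquivLast (n := n)).symm P) =
      eval (fun o : Option (Fin n) => ((o.elim h (coordFun n) : analyticFun n) :
        (Fin n → ℝ) → ℝ) x) P := by
    intro x P
    rw [eval_rename]
    congr 2
    funext o
    cases o <;> simp [coordFun]
  rw [h1, h3, h4, algebraicIndependent_iff]
  push Not
  constructor
  · rintro ⟨-, P, hP, hPx⟩
    refine ⟨rename (finSuccEquivLast (n := n)) P, ?_, ?_⟩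
    · rw [aeval_toMero_eq_zero_iff]
      filter_upwards [hPx] with x hx
      rw [← h5, rename_rename]
      simpa using hx
    · exact (map_ne_zero_iff _ (rename_injective _ (Equiv.injective _))).2 hP
  · rintro ⟨P, hP, hP0⟩
    rw [aeval_toMero_eq_zero_iff] at hP
    refine ⟨h.2, rename (finSuccEquivLast (n := n)).symm P,
      (map_ne_zero_iff _ (rename_injective _ (Equiv.injective _))).2 hP0, ?_⟩
    filter_upwards [hP] with x hx
    rw [h5, hx]

/-- Substitution of constants for the second group of variables. -/
noncomputable def MvPolynomial.specialize {k R ω ς : Type*} [CommRing k] [CommRing R] [Algebra k R]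
    (a : ς → R) : MvPolynomial (ω ⊕ ς) k →ₐ[k] MvPolynomial ω R :=
  aeval (Sum.elim X fun s => C (a s))

lemma MvPolynomial.pderiv_specialize {k R ω ς : Type*} [CommRing k] [CommRing R] [Algebra k R]
    (a : ς → R) (l : ω) (p : MvPolynomial (ω ⊕ ς) k) :
    pderiv l (specialize a p) = specialize a (pderiv (Sum.inl l) p) := by
  classical
  induction p using MvPolynomial.induction_on with
  | C r =>
    have : specialize a (C r : MvPolynomial (ω ⊕ ς) k) = C (algebraMap k R r) := by
      simp [specialize, MvPolynomial.algebraMap_eq, IsScalarTower.algebraMap_apply k R (MvPolynomial ω R)]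
    rw [this]; simp
  | add p q hp hq => simp [hp, hq]
  | mul_X p i hp =>
    rw [map_mul, Derivation.leibniz, Derivation.leibniz, hp]
    cases i <;> simp [specialize, pderiv_X, Pi.single_apply, apply_ite]

lemma MvPolynomial.aeval_specialize {k R B ω ς : Type*} [CommRing k] [CommRing R] [Algebra k R]
    [CommRing B] [Algebra k B] [Algebra R B] [IsScalarTower k R B]
    (a : ς → R) (u : ω → B) (p : MvPolynomial (ω ⊕ ς) k) :
    aeval u (specialize a p) = aeval (Sum.elim u fun s => algebraMap R B (a s)) p := by
  have : ((aeval u : MvPolynomial ω R →ₐ[R] B).restrictScalars k).comp (specialize a) =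
      aeval (Sum.elim u fun s => algebraMap R B (a s)) := by
    apply MvPolynomial.algHom_ext
    rintro (i | i) <;> simp [specialize]
  exact DFunLike.congr_fun this p

theorem nashFun_of_square_system {n : ℕ} {ω ς : Type} [Fintype ω] [DecidableEq ω]
    (G : ω → MvPolynomial (ω ⊕ ς) ℝ) (c : ς → (Fin n → ℝ) → ℝ) (hc : ∀ s, NashFun (c s))
    (u : ω → (Fin n → ℝ) → ℝ) (hu : ∀ l, AnalyticAt ℝ (u l) 0)
    (hG : ∀ᶠ x in 𝓝 0, ∀ k, eval (Sum.elim (fun l => u l x) (fun s => c s x)) (G k) = 0)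
    (hdet : (Matrix.of fun k l => eval (Sum.elim (fun l => u l 0) (fun s => c s 0))
      (pderiv (Sum.inl l) (G k))).det ≠ 0) (j : ω) : NashFun (u j) := by
  let u' : ω → analyticFun n := fun l => ⟨u l, hu l⟩
  let c' : ς → analyticFun n := fun s => ⟨c s, (hc s).1⟩
  let A := algebraicClosure (coordField n) (MeroGerm n)
  haveI : CharZero A := charZero_of_injective_algebraMap (algebraMap ℝ A).injective
  haveI : IsScalarTower ℝ A (MeroGerm n) := IsScalarTower.of_algebraMap_eq fun _ => rfl
  let γ : ς → A := fun s => ⟨toMero n (c' s),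
    mem_algebraicClosure_iff.2 ((nashFun_iff_isAlgebraic (c' s)).1 (hc s))⟩
  have hev : ∀ p : MvPolynomial (ω ⊕ ς) ℝ, aeval (fun l => toMero n (u' l)) (specialize γ p) =
      aeval (fun i => toMero n (Sum.elim u' c' i)) p := by
    intro p
    rw [aeval_specialize]
    congr 2
    funext i; cases i <;> rfl
  have hx : ∀ x, (fun i => ((Sum.elim u' c' i : analyticFun n) : (Fin n → ℝ) → ℝ) x) =
      Sum.elim (fun l => u l x) (fun s => c s x) := by
    intro x; funext i; cases i <;> rfl
  have h1 : IsAlgebraic A (toMero n (u' j)) := by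
    refine isAlgebraic_of_jacobian_det_ne_zero (fun l => toMero n (u' l))
      (fun k => specialize γ (G k)) ?_ ?_ j
    · intro k
      rw [hev, aeval_toMero_eq_zero_iff]
      filter_upwards [hG] with x h
      rw [hx]; exact h k
    · intro h0
      apply hdet
      let N : Matrix ω ω (MvPolynomial (ω ⊕ ς) ℝ) := Matrix.of fun k l => pderiv (Sum.inl l) (G k)
      have h2 : aeval (fun i => toMero n (Sum.elim u' c' i)) N.det = 0 := by
        rw [AlgHom.map_det, ← h0]
        congr 1
        ext k l
        simp only [Matrix.of_apply, AlgHom.mapMatrix_apply, Matrix.map_apply, N,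
          pderiv_specialize, hev]
      rw [aeval_toMero_eq_zero_iff] at h2
      have h3 := h2.self_of_nhds
      rw [hx, RingHom.map_det] at h3
      exact h3
  have h2 : IsAlgebraic (coordField n) (toMero n (u' j)) := by
    by_contra h
    exact Transcendental.algebraicClosure h h1
  exact (nashFun_iff_isAlgebraic (u' j)).2 h2

end

section

open MvPolynomial
open scoped Topology

/-- Polynomials over an algebra arise by specialization from polynomials over the base. -/
lemma MvPolynomial.exists_specialize_eq {k R ω s J : Type} [CommRing k] [CommRing R] [Algebra k R]
    [Finite J] (a : s → R) (P : J → MvPolynomial ω R) :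
    ∃ (t : Type) (_ : Fintype t) (b : t → R) (P' : J → MvPolynomial (ω ⊕ (s ⊕ t)) k),
      ∀ j, specialize (Sum.elim a b) (P' j) = P j := by
  classical
  haveI := Fintype.ofFinite J
  refine ⟨Σ j, (P j).support, inferInstance, fun i => (P i.1).coeff i.2, fun j =>
    ∑ m ∈ (P j).support.attach, X (Sum.inr (Sum.inr ⟨j, m⟩)) * rename Sum.inl (monomial m.1 1), ?_⟩
  intro j
  rw [map_sum]
  conv_rhs => rw [(P j).as_sum, ← Finset.sum_attach]
  refine Finset.sum_congr rfl fun m _ => ?_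
  have h : ∀ p : MvPolynomial ω k, specialize (Sum.elim a fun i : Σ j, (P j).support =>
      (P i.1).coeff i.2) (rename Sum.inl p) = map (algebraMap k R) p := by
    intro p
    have : (specialize (Sum.elim a fun i : Σ j, (P j).support =>
      (P i.1).coeff i.2)).comp (rename Sum.inl) = mapAlgHom (σ := ω) (Algebra.ofId k R) := by
      apply MvPolynomial.algHom_ext; intro i; simp [specialize]
    exact DFunLike.congr_fun this p
  rw [map_mul, h, map_monomial, map_one]
  simp [specialize, C_mul_monomial]

/-- A polynomial killed by specialization is killed by finitely many relations of the constants. -/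
lemma MvPolynomial.exists_relations_of_specialize_eq_zero {k R ω ς J : Type} [CommRing k]
    [CommRing R] [Algebra k R] [Finite J] (a : ς → R) (T : J → MvPolynomial (ω ⊕ ς) k)
    (h : ∀ j, specialize a (T j) = 0) :
    ∃ (K : Type) (_ : Fintype K) (r : K → MvPolynomial ς k), (∀ i, aeval a (r i) = 0) ∧
      ∀ (w : ω → k) (c : ς → k), (∀ i, eval c (r i) = 0) → ∀ j, eval (Sum.elim w c) (T j) = 0 := by
  classical
  haveI := Fintype.ofFinite J
  refine ⟨Σ j, (sumAlgEquiv k ω ς (T j)).support, inferInstance,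
    fun i => (sumAlgEquiv k ω ς (T i.1)).coeff i.2, ?_, ?_⟩
  · rintro ⟨j, m⟩
    have h1 : ∀ p : MvPolynomial (ω ⊕ ς) k,
        specialize a p = map (aeval a : _ →ₐ[k] R).toRingHom (sumAlgEquiv k ω ς p) := by
      intro p
      have : specialize a = (mapAlgHom (aeval a : _ →ₐ[k] R)).comp
          (sumAlgEquiv k ω ς).toAlgHom := by
        apply MvPolynomial.algHom_ext
        rintro (i | i) <;> simp [specialize]
      exact DFunLike.congr_fun this p
    have h2 := congrArg (coeff m.1) (h j)
    rw [h1, coeff_map] at h2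
    simpa using h2
  · intro w c hc j
    have h1 : ∀ p : MvPolynomial (ω ⊕ ς) k,
        eval (Sum.elim w c) p = eval w (map (eval c) (sumAlgEquiv k ω ς p)) := by
      intro p
      have : (aeval (Sum.elim w c) : _ →ₐ[k] k) = ((aeval w : _ →ₐ[k] k).comp
          (mapAlgHom (aeval c : _ →ₐ[k] k))).comp (sumAlgEquiv k ω ς).toAlgHom := by
        apply MvPolynomial.algHom_ext
        rintro (i | i) <;> simp
      exact DFunLike.congr_fun this p
    rw [h1]
    have h2 : map (eval c) (sumAlgEquiv k ω ς (T j)) = 0 := by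
      ext m
      rw [coeff_map, coeff_zero]
      by_cases hm : m ∈ (sumAlgEquiv k ω ς (T j)).support
      · exact hc ⟨j, ⟨m, hm⟩⟩
      · rw [notMem_support_iff.1 hm, map_zero]
    rw [h2, map_zero]

set_option maxHeartbeats 1000000 in
/-- A system of polynomial equations satisfied in a locally smoothable algebra factors through a
system of Newton type, all of whose data are defined over the ground field up to finitely many
constants. -/
theorem LocallySmoothable.exists_newton_system {k R Λ : Type} [CommRing k] [CommRing R]
    [IsNoetherianRing R] [Algebra k R] [CommRing Λ] [Algebra R Λ] [Algebra k Λ] [IsScalarTower k R Λ]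
    (hsm : LocallySmoothable R Λ) {E s K : Type} [Finite E] [Finite K]
    (e : E → Λ) (a : s → R) (p : K → MvPolynomial (E ⊕ s) k)
    (hp : ∀ i, aeval (Sum.elim e fun i => algebraMap R Λ (a i)) (p i) = 0) :
    ∃ (M r : ℕ) (t : Type) (_ : Fintype t) (b : t → R) (u : Fin M → Λ)
      (F : Fin r → MvPolynomial (Fin M ⊕ (s ⊕ t)) k)
      (S : Fin M → Fin r → MvPolynomial (Fin M ⊕ (s ⊕ t)) k)
      (q : Fin r → Fin r → Fin r → MvPolynomial (Fin M ⊕ (s ⊕ t)) k)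
      (d : MvPolynomial (Fin M ⊕ (s ⊕ t)) k)
      (ee : E → MvPolynomial (Fin M ⊕ (s ⊕ t)) k)
      (K' : Type) (_ : Fintype K') (rr : K' → MvPolynomial (s ⊕ t) k),
      (∀ i, aeval (Sum.elim a b) (rr i) = 0) ∧
      (∀ i, aeval u (specialize (Sum.elim a b) (F i)) = 0) ∧
      IsUnit (aeval u (specialize (Sum.elim a b) d)) ∧
      (∀ i, aeval u (specialize (Sum.elim a b) (ee i)) = e i) ∧
      ∀ (w : Fin M → k) (c : s ⊕ t → k), (∀ i, eval c (rr i) = 0) →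
        (∀ i, eval (Sum.elim w c) (∑ k, (∑ l, pderiv (Sum.inl l) (F i) * S l k) * F k) =
          eval (Sum.elim w c) (d * F i + ∑ k, ∑ l, q i k l * (F k * F l))) ∧
        ((∀ i, eval (Sum.elim w c) (F i) = 0) → ∀ i,
          eval (Sum.elim (fun i => eval (Sum.elim w c) (ee i)) fun i => c (Sum.inl i)) (p i) = 0) := by
  classical
  let A := Algebra.adjoin R (Set.range e)
  have hA : Algebra.FiniteType R A :=
    (Subalgebra.fg_iff_finiteType _).1
      (Subalgebra.fg_def.2 ⟨Set.range e, Set.finite_range e, rfl⟩)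
  obtain ⟨B, _, _, ι, β, hB, hβι, b₀, hb₀, hunit⟩ := hsm A hA A.val
  obtain ⟨M, r, g, F, hg, hker⟩ := exists_presentation R B
  obtain ⟨c₀, rfl⟩ := hg b₀
  obtain ⟨N, S, q, r₀, hN⟩ := LiftsMod.exists_newton (ϖ := 0) hg hker
    (by rw [Ideal.span_singleton_eq_bot.2 rfl]; exact hb₀)
  let eA : E → A := fun i => ⟨e i, Algebra.subset_adjoin (Set.mem_range_self i)⟩
  choose ε hε using fun i => hg (ι (eA i))
  have hpA : ∀ i, aeval (Sum.elim eA fun i => algebraMap R A (a i)) (p i) = 0 := by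
    intro i
    apply Subtype.val_injective
    have : (A.val.restrictScalars k).comp (aeval (Sum.elim eA fun i => algebraMap R A (a i))) =
        aeval (Sum.elim e fun i => algebraMap R Λ (a i)) := by
      apply MvPolynomial.algHom_ext; rintro (i | i) <;> simp [eA] <;> rfl
    exact (DFunLike.congr_fun this (p i)).trans (hp i)
  letI : Algebra k B := Algebra.compHom B (algebraMap k R)
  haveI : IsScalarTower k R B := IsScalarTower.of_algebraMap_eq fun _ => rfl
  have hpB : ∀ i, g (aeval (Sum.elim ε fun i => C (a i)) (p i)) = 0 := by
    intro i
    have : (g.restrictScalars k).comp (aeval (Sum.elim ε fun i => C (a i))) =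
        (ι.restrictScalars k).comp (aeval (Sum.elim eA fun i => algebraMap R A (a i))) := by
      apply MvPolynomial.algHom_ext
      rintro (i | i)
      · simp [hε]
      · simp [algHom_C]
    refine (DFunLike.congr_fun this (p i)).trans ?_
    change ι (aeval _ (p i)) = 0
    rw [hpA, map_zero]
  have hv : ∀ i, ∃ v : Fin r → MvPolynomial (Fin M) R,
      ∑ l, v l * F l = aeval (Sum.elim ε fun i => C (a i)) (p i) := by
    intro i
    have : aeval (Sum.elim ε fun i => C (a i)) (p i) ∈ Ideal.span (Set.range F) := by
      rw [← hker]; exact hpB i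
    exact (Submodule.mem_span_range_iff_exists_fun _).1 this
  choose v hv using hv
  obtain ⟨t, ht, b, P', hP'⟩ := exists_specialize_eq (k := k) (J := Fin r ⊕ (Fin M × Fin r) ⊕
      (Fin r × Fin r × Fin r) ⊕ Unit ⊕ E ⊕ (K × Fin r)) a
    (Sum.elim F (Sum.elim (fun x => S x.1 x.2) (Sum.elim (fun x => q x.1 x.2.1 x.2.2)
      (Sum.elim (fun _ => c₀ ^ N) (Sum.elim ε (fun x => v x.1 x.2))))))
  let F' := fun i => P' (Sum.inl i)
  let S' := fun l i => P' (Sum.inr (Sum.inl (l, i)))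
  let q' := fun i j l => P' (Sum.inr (Sum.inr (Sum.inl (i, j, l))))
  let d' := P' (Sum.inr (Sum.inr (Sum.inr (Sum.inl ()))))
  let ε' := fun i => P' (Sum.inr (Sum.inr (Sum.inr (Sum.inr (Sum.inl i)))))
  let v' := fun i l => P' (Sum.inr (Sum.inr (Sum.inr (Sum.inr (Sum.inr (i, l))))))
  have hF : ∀ i, specialize (Sum.elim a b) (F' i) = F i := fun i => hP' _
  have hS : ∀ l i, specialize (Sum.elim a b) (S' l i) = S l i := fun _ _ => hP' _
  have hq : ∀ i j l, specialize (Sum.elim a b) (q' i j l) = q i j l := fun _ _ _ => hP' _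
  have hd : specialize (Sum.elim a b) d' = c₀ ^ N := hP' _
  have hε' : ∀ i, specialize (Sum.elim a b) (ε' i) = ε i := fun _ => hP' _
  have hv' : ∀ i l, specialize (Sum.elim a b) (v' i l) = v i l := fun _ _ => hP' _
  let ψ : MvPolynomial (E ⊕ s) k →ₐ[k] MvPolynomial (Fin M ⊕ (s ⊕ t)) k :=
    aeval (Sum.elim ε' fun i => X (Sum.inr (Sum.inl i)))
  have hψ : ∀ p, specialize (Sum.elim a b) (ψ p) = aeval (Sum.elim ε fun i => C (a i)) p := by
    intro p
    have : (specialize (Sum.elim a b)).comp ψ = aeval (Sum.elim ε fun i => C (a i)) := by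
      apply MvPolynomial.algHom_ext
      rintro (i | i)
      · simp [ψ, hε']
      · simp [ψ, specialize]
    exact DFunLike.congr_fun this p
  obtain ⟨K', hK', rr, hrr, hT⟩ := exists_relations_of_specialize_eq_zero (Sum.elim a b)
    (Sum.elim (fun i : Fin r => ∑ k, (∑ l, pderiv (Sum.inl l) (F' i) * S' l k) * F' k -
      (d' * F' i + ∑ k, ∑ l, q' i k l * (F' k * F' l)))
      (fun i : K => ∑ l, v' i l * F' l - ψ (p i))) (by
        rintro (i | i)
        · have := hN i
          simp only [Sum.elim_inl, map_sub, map_sum, map_mul, map_add, ← pderiv_specialize, hF, hS,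
            hq, hd]
          simp only [Matrix.mul_apply, jac, Matrix.of_apply, map_zero, zero_mul, add_zero] at this
          rw [this, sub_self]
        · simp only [Sum.elim_inr, map_sub, map_sum, map_mul, hF, hv', hψ, hv, sub_self])
  have hu : ∀ P : MvPolynomial (Fin M) R, aeval (fun l => β (g (X l))) P = β (g P) := by
    intro P
    have : aeval (fun l => β (g (X l))) = β.comp g := by
      apply MvPolynomial.algHom_ext; intro i; simp
    exact DFunLike.congr_fun this P
  refine ⟨M, r, t, ht, b, fun l => β (g (X l)), F', S', q', d', ε', K', hK', rr, hrr, ?_, ?_, ?_, ?_⟩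
  · intro i
    have : F i ∈ RingHom.ker g := by rw [hker]; exact Ideal.subset_span (Set.mem_range_self i)
    rw [hu, hF, (RingHom.mem_ker).1 this, map_zero]
  · rw [hu, hd, map_pow, map_pow]; exact hunit.pow N
  · intro i
    rw [hu, hε', hε]
    exact DFunLike.congr_fun hβι (eA i)
  · intro w c hc
    have hT' := hT w c hc
    refine ⟨fun i => ?_, fun hF0 i => ?_⟩
    · have := hT' (Sum.inl i)
      rw [Sum.elim_inl, map_sub, sub_eq_zero] at this
      exact this
    · have := hT' (Sum.inr i)
      have h0 : eval (Sum.elim w c) (∑ l, v' i l * F' l) = 0 := by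
        simp [hF0]
      rw [Sum.elim_inr, map_sub, h0, zero_sub, neg_eq_zero] at this
      have h1 : (aeval (Sum.elim w c) : _ →ₐ[k] k).comp ψ =
          aeval (Sum.elim (fun i => eval (Sum.elim w c) (ε' i)) fun i => c (Sum.inl i)) := by
        apply MvPolynomial.algHom_ext
        rintro (i | i)
        · simp [ψ]
        · simp [ψ]
      exact (DFunLike.congr_fun h1 (p i)).symm.trans this

end

section

open MvPolynomial
open scoped Topology

lemma NashFun.eval_mvPolynomial {n : ℕ} {σ : Type} [Fintype σ] (c : σ → (Fin n → ℝ) → ℝ)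
    (hc : ∀ s, NashFun (c s)) (p : MvPolynomial σ ℝ) : NashFun (fun x => eval (fun i => c i x) p) := by
  have hcx : AnalyticAt ℝ (fun x i => c i x) 0 := AnalyticAt.pi fun i => (hc i).1
  refine nashFun_of_square_system (ω := Unit)
    (fun _ => X (Sum.inl ()) - rename Sum.inr p) c hc (fun _ x => eval (fun i => c i x) p) ?_ ?_ ?_ ()
  · exact fun _ => (p.analyticAt_eval _).comp hcx
  · refine Filter.Eventually.of_forall fun x k => ?_
    simp [eval_rename, Function.comp_def]
  · classical
    have h : pderiv (Sum.inl ()) (rename Sum.inr p : MvPolynomial (Unit ⊕ σ) ℝ) = 0 := by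
      apply pderiv_eq_zero_of_notMem_vars
      intro h
      have := vars_rename _ _ h
      simp at this
    simp [h]

/-- Realization of a polynomial system over `R⟦x⟧` by analytic functions, given realizations of
finite systems over `R`. -/
theorem LocallySmoothable.exists_analytic_realization {R : Type} [CommRing R] [IsNoetherianRing R]
    [Algebra ℝ R] {n : ℕ} (hsm : LocallySmoothable R (MvPowerSeries (Fin n) R)) (ε : R →ₐ[ℝ] ℝ)
    (Q : ∀ s : Type, (s → R) → (s → (Fin n → ℝ) → ℝ) → Prop)
    (hQ : ∀ (s : Type) [Fintype s] (a : s → R) (K : Type) [Fintype K] (r : K → MvPolynomial s ℝ),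
      (∀ k, aeval a (r k) = 0) → ∃ a' : s → (Fin n → ℝ) → ℝ, Q s a a' ∧
        (∀ i, AnalyticAt ℝ (a' i) 0) ∧ (∀ i, a' i 0 = ε (a i)) ∧
        ∀ᶠ x in 𝓝 0, ∀ k, eval (fun i => a' i x) (r k) = 0)
    {E s K : Type} [Fintype E] [Fintype s] [Fintype K] (e : E → MvPowerSeries (Fin n) R) (a : s → R)
    (p : K → MvPolynomial ((E ⊕ Fin n) ⊕ s) ℝ)
    (hp : ∀ k, aeval (Sum.elim (Sum.elim e MvPowerSeries.X)
      fun i => algebraMap R (MvPowerSeries (Fin n) R) (a i)) (p k) = 0) :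
    ∃ (t : Type) (_ : Fintype t) (b : t → R) (c' : s ⊕ t → (Fin n → ℝ) → ℝ)
      (e' : E → (Fin n → ℝ) → ℝ), Q (s ⊕ t) (Sum.elim a b) c' ∧ (∀ i, AnalyticAt ℝ (e' i) 0) ∧
      (∀ᶠ x in 𝓝 0, ∀ k, eval (Sum.elim (Sum.elim (fun i => e' i x) x)
        fun i => c' (Sum.inl i) x) (p k) = 0) ∧
      ∀ (q : ℕ) (h : (Fin q → ℝ) → (Fin n → ℝ)), AnalyticAt ℝ h 0 → h 0 = 0 →
        (∀ j, NashFun fun x => h x j) → (∀ i, NashFun fun x => c' i (h x)) →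
        ∀ i, NashFun fun x => e' i (h x) := by
  classical
  obtain ⟨M, r, t, _, b, u, F, S, q, d, ee, K', _, rr, hrr, hF, hd, hee, hsys⟩ :=
    hsm.exists_newton_system (k := ℝ) _ a p hp
  obtain ⟨c', hQc, hc'an, hc'0, hc'rr⟩ := hQ (s ⊕ t) (Sum.elim a b) K' rr hrr
  let ev : MvPowerSeries (Fin n) R →+* ℝ := ε.toRingHom.comp MvPowerSeries.constantCoeff
  have hevC : ∀ x : R, ev (algebraMap R (MvPowerSeries (Fin n) R) x) = ε x := by
    intro x
    change ε (MvPowerSeries.constantCoeff (MvPowerSeries.C x)) = ε x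
    simp
  let evA : MvPowerSeries (Fin n) R →ₐ[ℝ] ℝ := { ev with
    commutes' := fun x => by
      have : algebraMap ℝ (MvPowerSeries (Fin n) R) x =
        algebraMap R (MvPowerSeries (Fin n) R) (algebraMap ℝ R x) :=
          IsScalarTower.algebraMap_apply ℝ R _ x
      rw [this]
      exact (hevC _).trans (ε.commutes x) }
  let w : Fin M → ℝ := fun l => ev (u l)
  let z : s ⊕ t → ℝ := fun i => ε (Sum.elim a b i)
  have hpt : ∀ P : MvPolynomial (Fin M ⊕ (s ⊕ t)) ℝ,
      eval (Sum.elim w z) P = ev (aeval u (specialize (Sum.elim a b) P)) := by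
    intro P
    rw [aeval_specialize]
    have : aeval (Sum.elim w z) = evA.comp (aeval (Sum.elim u fun s =>
        algebraMap R (MvPowerSeries (Fin n) R) (Sum.elim a b s))) := by
      apply MvPolynomial.algHom_ext
      rintro (i | i)
      · simp only [aeval_X, AlgHom.comp_apply, Sum.elim_inl]; rfl
      · simp only [aeval_X, AlgHom.comp_apply, Sum.elim_inr]; exact (hevC _).symm
    exact DFunLike.congr_fun this P
  let τ : Fin n → Fin M → ℝ := fun j l => ev (MvPowerSeries.pderiv R j (u l))
  have hτ : ∀ (P : MvPolynomial (Fin M ⊕ (s ⊕ t)) ℝ) j,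
      ∑ l, eval (Sum.elim w z) (pderiv (Sum.inl l) P) * τ j l =
        ev (MvPowerSeries.pderiv R j (aeval u (specialize (Sum.elim a b) P))) := by
    intro P j
    rw [derivation_aeval, map_sum]
    refine Finset.sum_congr rfl fun l _ => ?_
    rw [smul_eq_mul, map_mul, pderiv_specialize, hpt]
  let ρ : Fin M ⊕ (s ⊕ t) → Fin M ⊕ ((s ⊕ t) ⊕ Fin n) := Sum.map id Sum.inl
  have hρ : Function.Injective ρ := Sum.map_injective.2 ⟨Function.injective_id, Sum.inl_injective⟩
  have hρe : ∀ (W : Fin M → ℝ) (y : s ⊕ t → ℝ) (x : Fin n → ℝ) (P : MvPolynomial (Fin M ⊕ (s ⊕ t)) ℝ),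
      eval (Sum.elim W (Sum.elim y x)) (rename ρ P) = eval (Sum.elim W y) P := by
    intro W y x P
    rw [eval_rename]
    congr 2
    funext i; cases i <;> rfl
  have hρd : ∀ (P : MvPolynomial (Fin M ⊕ (s ⊕ t)) ℝ) (l : Fin M),
      pderiv (Sum.inl l) (rename ρ P) = rename ρ (pderiv (Sum.inl l) P) := fun P l =>
    pderiv_rename hρ (x := Sum.inl l) P
  obtain ⟨W, G, hW, hW0, hWφ, hWG, hdet, hWN⟩ := exists_smooth_solution (fun k => rename ρ (F k))
    (fun j : Fin n => rename ρ (ee (Sum.inr j)) - X (Sum.inr (Sum.inr j))) w (Sum.elim z 0)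
    (by intro k; rw [hρe, hpt, hF, map_zero])
    (by
      intro j
      rw [map_sub, hρe, hpt, hee]
      simp [ev])
    τ
    (by
      intro k j
      simp only [hρd, hρe, hτ, hF, map_zero])
    (by
      intro i j
      have h1 : ∀ l, pderiv (Sum.inl l) (X (Sum.inr (Sum.inr i)) :
          MvPolynomial (Fin M ⊕ ((s ⊕ t) ⊕ Fin n)) ℝ) = 0 := fun l =>
        pderiv_X_of_ne (by simp)
      simp only [map_sub, hρd, h1, map_zero, sub_zero, hρe, hτ, hee, Sum.elim_inr]
      rw [MvPowerSeries.pderiv_X]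
      by_cases hij : i = j
      · subst hij; simp
      · simp [hij, Ne.symm hij])
    (fun l k => rename ρ (S l k)) (fun i k l => rename ρ (q i k l)) (rename ρ d)
    (by rw [hρe, hpt]; exact (hd.map ev).ne_zero)
  let c : (Fin n → ℝ) → (s ⊕ t) ⊕ Fin n → ℝ := fun x => Sum.elim (fun i => c' i x) x
  have hc0 : c 0 = Sum.elim z 0 := by
    funext i; rcases i with i | i
    · exact hc'0 i
    · rfl
  have hcan : AnalyticAt ℝ c 0 := by
    refine AnalyticAt.pi fun i => ?_
    rcases i with i | i
    · exact hc'an i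
    · exact (ContinuousLinearMap.proj (R := ℝ) (φ := fun _ : Fin n => ℝ) i).analyticAt 0
  have hct : Filter.Tendsto c (𝓝 0) (𝓝 (Sum.elim z 0)) := hc0 ▸ hcan.continuousAt
  have hWc : AnalyticAt ℝ (fun x => W (c x)) 0 := hW.comp_of_eq hcan hc0
  have hpair : AnalyticAt ℝ (fun x => (Sum.elim (W (c x)) (fun i => c' i x) : Fin M ⊕ (s ⊕ t) → ℝ)) 0 := by
    refine AnalyticAt.pi fun i => ?_
    rcases i with i | i
    · exact (analyticAt_pi_iff.1 hWc) i
    · exact hc'an i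
  refine ⟨t, inferInstance, b, c', fun i x => eval (Sum.elim (W (c x)) fun i => c' i x) (ee (Sum.inl i)),
    hQc, ?_, ?_, ?_⟩
  · intro i
    exact ((ee (Sum.inl i)).analyticAt_eval _).comp hpair
  · filter_upwards [hc'rr, hct.eventually hWφ, hct.eventually hWN] with x hx1 hx2 hx3 k
    have h1 := hsys (W (c x)) (fun i => c' i x) hx1
    have hF0 : ∀ k, eval (Sum.elim (W (c x)) fun i => c' i x) (F k) = 0 := by
      intro k
      rw [← hρe _ _ x]
      refine hx3 (fun i => ?_) k
      have := h1.1 i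
      rw [← hρe _ _ x, ← hρe _ _ x] at this
      simpa only [hρd, map_sum, map_mul, map_add] using this
    rw [← h1.2 hF0 k]
    congr 2
    funext i
    rcases i with (i | i) | i
    · rfl
    · have := hx2 i
      rw [map_sub, sub_eq_zero, hρe] at this
      simpa [c] using this.symm
    · rfl
  · intro q h hh hh0 hhN hcN i
    have hch : AnalyticAt ℝ (fun x => c (h x)) 0 := hcan.comp_of_eq hh hh0
    have hNc : ∀ i, NashFun fun x => c (h x) i := by
      rintro (i | i)
      · exact hcN i
      · exact hhN i
    have hch0 : c (h 0) = Sum.elim z 0 := by rw [hh0, hc0]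
    have hWh : ∀ l, AnalyticAt ℝ (fun x => W (c (h x)) l) 0 := fun l =>
      ((analyticAt_pi_iff.1 hWc) l).comp_of_eq hh hh0
    have hNW : ∀ l, NashFun fun x => W (c (h x)) l := by
      intro l
      refine nashFun_of_square_system G (fun i x => c (h x) i) hNc (fun l x => W (c (h x)) l) hWh
        ?_ ?_ l
      · have : Filter.Tendsto (fun x => c (h x)) (𝓝 0) (𝓝 (Sum.elim z 0)) :=
          hch0 ▸ hch.continuousAt
        exact this.eventually hWG
      · simp only [hch0, hW0]; exact hdet
    refine NashFun.eval_mvPolynomial (fun i x => (Sum.elim (W (c (h x))) (fun i => c' i (h x)) :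
      Fin M ⊕ (s ⊕ t) → ℝ) i) ?_ (ee (Sum.inl i))
    rintro (l | l)
    · exact hNW l
    · exact hcN l

end

section

open MvPolynomial
open scoped Topology

section Taylor

variable {E F : Type*} [NormedAddCommGroup E] [NormedSpace ℝ E] [NormedAddCommGroup F]
  [NormedSpace ℝ F]

lemma ContDiffAt.isBigO_sub_taylor [CompleteSpace F] {φ : E → F} (hφ : ContDiffAt ℝ (⊤ : ℕ∞) φ 0) (N : ℕ) :
    (fun x => φ x - ∑ k ∈ Finset.range N, (k.factorial : ℝ)⁻¹ • iteratedFDeriv ℝ k φ 0 fun _ => x)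
      =O[𝓝 0] fun x => ‖x‖ ^ N := by
  cases N with
  | zero =>
    simpa using hφ.continuousAt.isBigO_one ℝ
  | succ j =>
    have h1 : ∀ᶠ x in 𝓝 (0 : E), ContDiffAt ℝ (j + 1 : ℕ) φ x :=
      (hφ.of_le (by exact_mod_cast le_top)).eventually (by simp)
    have hc : ContinuousAt (iteratedFDeriv ℝ (j + 1) φ) 0 :=
      (hφ.iteratedFDeriv_right (m := 0) (i := j + 1) (by exact_mod_cast le_top)).continuousAt
    have h2 : ∀ᶠ x in 𝓝 (0 : E), ‖iteratedFDeriv ℝ (j + 1) φ x‖ <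
        ‖iteratedFDeriv ℝ (j + 1) φ 0‖ + 1 :=
      hc.norm.eventually_lt continuousAt_const (lt_add_one _)
    obtain ⟨r, hr, hball⟩ := Metric.eventually_nhds_iff_ball.1 (h1.and h2)
    set A := ‖iteratedFDeriv ℝ (j + 1) φ 0‖ + 1 with hA
    refine Asymptotics.IsBigO.of_bound ((j.factorial : ℝ)⁻¹ * A) ?_
    filter_upwards [Metric.ball_mem_nhds _ hr] with x hx
    have hseg : ∀ t ∈ Set.Icc (0 : ℝ) 1, (0 : E) + t • x ∈ Metric.ball (0 : E) r := by
      intro t ht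
      rw [mem_ball_zero_iff] at hx ⊢
      rw [zero_add, norm_smul, Real.norm_of_nonneg ht.1]
      exact (mul_le_of_le_one_left (norm_nonneg _) ht.2).trans_lt hx
    have := map_add_eq_sum_add_integral_iteratedFDeriv (f := φ) (x := 0) (y := x) (n := j)
      (fun t ht => by exact_mod_cast (hball _ (hseg t ht)).1)
    rw [zero_add] at this
    nth_rewrite 1 [this]
    rw [add_sub_cancel_left, norm_smul, norm_inv, mul_assoc, norm_pow, norm_norm,
      Real.norm_of_nonneg (by positivity : (0 : ℝ) ≤ (j.factorial : ℝ))]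
    gcongr
    have hb := intervalIntegral.norm_integral_le_of_norm_le_const (a := (0 : ℝ)) (b := 1)
      (f := fun t => (1 - t) ^ j • iteratedFDeriv ℝ (j + 1) φ (0 + t • x) fun _ => x)
      (C := A * ‖x‖ ^ (j + 1)) ?_
    · simpa using hb
    · intro t ht
      rw [Set.uIoc_of_le zero_le_one] at ht
      have ht' : t ∈ Set.Icc (0 : ℝ) 1 := ⟨ht.1.le, ht.2⟩
      rw [norm_smul, norm_pow, Real.norm_of_nonneg (sub_nonneg.2 ht.2)]
      have e1 : (1 - t) ^ j ≤ 1 := pow_le_one₀ (sub_nonneg.2 ht.2) (by linarith [ht.1])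
      have e2 : ‖iteratedFDeriv ℝ (j + 1) φ (0 + t • x) fun _ => x‖ ≤ A * ‖x‖ ^ (j + 1) := by
        refine (ContinuousMultilinearMap.le_opNorm _ _).trans ?_
        simp only [Finset.prod_const, Finset.card_univ, Fintype.card_fin]
        gcongr
        exact (hball _ (hseg t ht')).2.le
      calc _ ≤ 1 * (A * ‖x‖ ^ (j + 1)) := by gcongr
        _ = _ := one_mul _

lemma ContDiffAt.isBigO_sub_of_iteratedFDeriv_eq [CompleteSpace F] {φ ψ : E → F} (hφ : ContDiffAt ℝ (⊤ : ℕ∞) φ 0)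
    (hψ : ContDiffAt ℝ (⊤ : ℕ∞) ψ 0) (h : ∀ k, iteratedFDeriv ℝ k φ 0 = iteratedFDeriv ℝ k ψ 0)
    (N : ℕ) : (fun x => φ x - ψ x) =O[𝓝 0] fun x => ‖x‖ ^ N := by
  have := (hφ.isBigO_sub_taylor N).sub (hψ.isBigO_sub_taylor N)
  simpa only [h, sub_sub_sub_cancel_right] using this

lemma AnalyticAt.eventually_eq_zero_of_isBigO {φ : E → F} (hφ : AnalyticAt ℝ φ 0)
    (h : ∀ N : ℕ, φ =O[𝓝 0] fun x => ‖x‖ ^ N) : ∀ᶠ x in 𝓝 0, φ x = 0 := by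
  obtain ⟨p, hp⟩ := hφ
  have hp0 : ∀ k (y : E), p k (fun _ => y) = 0 := by
    intro k
    induction k using Nat.strong_induction_on with
    | _ k ih =>
      have h1 := hp.isBigO_sub_partialSum_pow (k + 1)
      have h2 := (h (k + 1)).sub h1
      have h3 : (fun y : E => p k fun _ => y) =O[𝓝 0] fun y => ‖y‖ ^ (k + 1) := by
        refine h2.congr_left fun y => ?_
        simp only [zero_add, sub_sub_cancel]
        rw [FormalMultilinearSeries.partialSum, Finset.sum_range_succ,
          Finset.sum_eq_zero (fun i hi => ih i (Finset.mem_range.1 hi) y), zero_add]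
      exact h3.continuousMultilinearMap_apply_eq_zero
  filter_upwards [hp.eventually_hasSum] with y hy
  rw [zero_add] at hy
  refine hy.unique ?_
  simp only [hp0]
  exact hasSum_zero

end Taylor

section Jets

variable {n : ℕ}

lemma isBigO_norm_pow_of_le {N k : ℕ} (h : N ≤ k) :
    (fun x : Fin n → ℝ => ‖x‖ ^ k) =O[𝓝 0] fun x => ‖x‖ ^ N := by
  refine Asymptotics.IsBigO.of_bound 1 ?_
  filter_upwards [Metric.ball_mem_nhds (0 : Fin n → ℝ) one_pos] with x hx
  rw [mem_ball_zero_iff] at hx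
  simpa using pow_le_pow_of_le_one (norm_nonneg x) hx.le h

lemma MvPolynomial.norm_eval_monomial_le (m : Fin n →₀ ℕ) (a : ℝ) (x : Fin n → ℝ) :
    ‖eval x (monomial m a)‖ ≤ ‖a‖ * ‖x‖ ^ m.degree := by
  rw [eval_monomial, norm_mul, Finsupp.prod_fintype _ _ (fun i => pow_zero _), norm_prod,
    Finsupp.degree_eq_sum, ← Finset.prod_pow_eq_pow_sum]
  gcongr with i _
  rw [norm_pow]
  gcongr
  exact norm_le_pi_norm x i

lemma MvPolynomial.isBigO_eval {N : ℕ} (q : MvPolynomial (Fin n) ℝ)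
    (hq : ∀ m : Fin n →₀ ℕ, m.degree < N → q.coeff m = 0) :
    (fun x : Fin n → ℝ => eval x q) =O[𝓝 0] fun x : Fin n → ℝ => ‖x‖ ^ N := by
  have h1 : (fun x : Fin n → ℝ => eval x q) = fun x => ∑ m ∈ q.support, eval x (monomial m (q.coeff m)) := by
    funext x
    conv_lhs => rw [q.as_sum, map_sum]
  rw [h1]
  have hm' : ∀ m ∈ q.support, (fun x : Fin n → ℝ => eval x (monomial m (q.coeff m)))
      =O[𝓝 0] fun x : Fin n → ℝ => ‖x‖ ^ N := ?_
  · refine (Asymptotics.IsBigO.sum hm').congr_left fun x => ?_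
    simp only [Finset.sum_apply]
  intro m hm
  have hN : N ≤ m.degree := by
    by_contra h
    exact (mem_support_iff.1 hm) (hq m (not_le.1 h))
  refine Asymptotics.IsBigO.trans (g := fun x : Fin n → ℝ => ‖x‖ ^ m.degree) ?_
    (isBigO_norm_pow_of_le hN)
  refine Asymptotics.IsBigO.of_bound ‖q.coeff m‖ (Filter.Eventually.of_forall fun x => ?_)
  rw [norm_pow, norm_norm]
  exact norm_eval_monomial_le m _ x

lemma Polynomial.coeff_eq_zero_of_isBigO {N : ℕ} (p : Polynomial ℝ)
    (h : (fun t : ℝ => p.eval t) =O[𝓝[≠] 0] fun t => t ^ N) {k : ℕ} (hk : k < N) :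
    p.coeff k = 0 := by
  induction N generalizing p k with
  | zero => omega
  | succ N ih =>
    have h0 : p.coeff 0 = 0 := by
      have h1 : Filter.Tendsto (fun t : ℝ => p.eval t) (𝓝[≠] 0) (𝓝 0) := by
        refine h.trans_tendsto ?_
        have : Filter.Tendsto (fun t : ℝ => t ^ (N + 1)) (𝓝 0) (𝓝 (0 ^ (N + 1))) :=
          (continuous_pow (N + 1)).tendsto 0
        rw [zero_pow (Nat.succ_ne_zero N)] at this
        exact this.mono_left nhdsWithin_le_nhds
      have h2 : Filter.Tendsto (fun t : ℝ => p.eval t) (𝓝[≠] 0) (𝓝 (p.eval 0)) :=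
        (p.continuous.tendsto 0).mono_left nhdsWithin_le_nhds
      rw [Polynomial.coeff_zero_eq_eval_zero]
      exact tendsto_nhds_unique h2 h1
    cases k with
    | zero => exact h0
    | succ k =>
      rw [← Polynomial.coeff_divX]
      refine ih p.divX ?_ (by omega)
      have hp := p.divX_mul_X_add
      rw [h0, map_zero, add_zero] at hp
      obtain ⟨c, hc⟩ := h.bound
      refine Asymptotics.IsBigO.of_bound c ?_
      filter_upwards [hc, self_mem_nhdsWithin] with t ht ht0
      rw [← hp, Polynomial.eval_mul, Polynomial.eval_X, pow_succ, norm_mul, norm_mul,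
        ← mul_assoc] at ht
      exact le_of_mul_le_mul_right ht (norm_pos_iff.2 ht0)

lemma MvPolynomial.IsHomogeneous.eval_smul {k : ℕ} {q : MvPolynomial (Fin n) ℝ}
    (hq : q.IsHomogeneous k) (t : ℝ) (x : Fin n → ℝ) : eval (t • x) q = t ^ k * eval x q := by
  rw [eval_eq', eval_eq', Finset.mul_sum]
  refine Finset.sum_congr rfl fun d hd => ?_
  have hk : d.degree = k := by
    rw [Finsupp.degree_eq_weight_one]
    exact hq (mem_support_iff.1 hd)
  simp only [Pi.smul_apply, smul_eq_mul, mul_pow, Finset.prod_mul_distrib]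
  rw [Finset.prod_pow_eq_pow_sum, ← Finsupp.degree_eq_sum, hk]
  ring

lemma MvPolynomial.coeff_eq_zero_of_isBigO {N : ℕ} (q : MvPolynomial (Fin n) ℝ)
    (h : (fun x : Fin n → ℝ => eval x q) =O[𝓝 0] fun x => ‖x‖ ^ N) {m : Fin n →₀ ℕ} (hm : m.degree < N) :
    q.coeff m = 0 := by
  have key : homogeneousComponent m.degree q = 0 := by
    refine MvPolynomial.funext fun x => ?_
    rw [map_zero]
    let P : Polynomial ℝ := aeval (fun i => Polynomial.C (x i) * Polynomial.X) q
    have hP : ∀ t, P.eval t = eval (t • x) q := by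
      intro t
      have : (Polynomial.aeval t).comp (aeval fun i => Polynomial.C (x i) * Polynomial.X) =
          aeval (t • x) := by
        apply MvPolynomial.algHom_ext
        intro i
        simp only [AlgHom.comp_apply, aeval_X, map_mul, Polynomial.aeval_X, Pi.smul_apply,
          smul_eq_mul, Polynomial.aeval_C, Algebra.algebraMap_self_apply]
        exact mul_comm _ _
      exact DFunLike.congr_fun this q
    have hcoef : P.coeff m.degree = eval x (homogeneousComponent m.degree q) := by
      have : P = ∑ k ∈ Finset.range (q.totalDegree + 1),
          Polynomial.C (eval x (homogeneousComponent k q)) * Polynomial.X ^ k := by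
        apply Polynomial.funext
        intro t
        rw [hP, Polynomial.eval_finsetSum]
        conv_lhs => rw [← sum_homogeneousComponent q, map_sum]
        refine Finset.sum_congr rfl fun k _ => ?_
        rw [Polynomial.eval_mul, Polynomial.eval_C, Polynomial.eval_pow, Polynomial.eval_X,
          (homogeneousComponent_isHomogeneous k q).eval_smul, mul_comm]
      rw [this, Polynomial.finsetSum_coeff]
      simp only [Polynomial.coeff_C_mul, Polynomial.coeff_X_pow, mul_ite, mul_one, mul_zero,
        Finset.sum_ite_eq, Finset.mem_range]
      split_ifs with hlt
      · rfl
      · rw [homogeneousComponent_eq_zero _ _ (by omega), map_zero]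
    rw [← hcoef]
    refine P.coeff_eq_zero_of_isBigO (N := N) ?_ hm
    have ht : Filter.Tendsto (fun t : ℝ => t • x) (𝓝[≠] 0) (𝓝 0) := by
      have : Filter.Tendsto (fun t : ℝ => t • x) (𝓝 0) (𝓝 ((0 : ℝ) • x)) :=
        (continuous_id.smul continuous_const).tendsto 0
      rw [zero_smul] at this
      exact this.mono_left nhdsWithin_le_nhds
    have h1 := h.comp_tendsto ht
    simp only [Function.comp_def, ← hP] at h1
    refine h1.trans (Asymptotics.IsBigO.of_bound (‖x‖ ^ N) (Filter.Eventually.of_forall fun t => ?_))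
    rw [norm_smul, mul_pow, norm_mul, norm_pow, norm_norm, norm_pow, norm_norm, norm_pow, mul_comm]
  have := congrArg (coeff m) key
  rwa [coeff_homogeneousComponent, if_pos rfl] at this

end Jets

end

section

open MvPolynomial
open scoped Topology

section Jets

variable {n : ℕ}

/-- The function `φ` has the Taylor expansion `s` up to order `N`. -/
def HasJet (N : ℕ) (φ : (Fin n → ℝ) → ℝ) (s : MvPowerSeries (Fin n) ℝ) : Prop :=
  ∃ q : MvPolynomial (Fin n) ℝ, (∀ m, m.degree < N → q.coeff m = MvPowerSeries.coeff m s) ∧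
    (fun x => φ x - eval x q) =O[𝓝 0] fun x => ‖x‖ ^ N

variable {N : ℕ} {φ ψ : (Fin n → ℝ) → ℝ} {s t : MvPowerSeries (Fin n) ℝ}

lemma HasJet.isBigO_sub (h : HasJet N φ s) (h' : HasJet N ψ s) :
    (fun x => φ x - ψ x) =O[𝓝 0] fun x => ‖x‖ ^ N := by
  obtain ⟨q, hq, hφ⟩ := h
  obtain ⟨r, hr, hψ⟩ := h'
  have h1 := isBigO_eval (N := N) (q - r) (fun m hm => by rw [coeff_sub, hq m hm, hr m hm, sub_self])
  refine ((hφ.sub hψ).add h1).congr_left fun x => ?_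
  rw [map_sub]; ring

lemma HasJet.congr (h : HasJet N φ s) (hψ : (fun x => ψ x - φ x) =O[𝓝 0] fun x => ‖x‖ ^ N) :
    HasJet N ψ s := by
  obtain ⟨q, hq, hφ⟩ := h
  exact ⟨q, hq, (hψ.add hφ).congr_left fun x => by ring⟩

lemma HasJet.coeff_eq (h : HasJet N φ s) (h' : HasJet N φ t) {m : Fin n →₀ ℕ} (hm : m.degree < N) :
    MvPowerSeries.coeff m s = MvPowerSeries.coeff m t := by
  obtain ⟨q, hq, hφ⟩ := h
  obtain ⟨r, hr, hψ⟩ := h'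
  rw [← hq m hm, ← hr m hm, ← sub_eq_zero, ← coeff_sub]
  refine coeff_eq_zero_of_isBigO _ ?_ hm
  refine (hψ.sub hφ).congr_left fun x => ?_
  rw [map_sub]; ring

lemma HasJet.eval_mvPolynomial_self (N : ℕ) (q : MvPolynomial (Fin n) ℝ) :
    HasJet N (fun x => eval x q) (q : MvPowerSeries (Fin n) ℝ) :=
  ⟨q, fun m _ => (MvPolynomial.coeff_coe q m).symm, by simpa using Asymptotics.isBigO_zero _ _⟩

lemma HasJet.add (h : HasJet N φ s) (h' : HasJet N ψ t) :
    HasJet N (fun x => φ x + ψ x) (s + t) := by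
  obtain ⟨q, hq, hφ⟩ := h
  obtain ⟨r, hr, hψ⟩ := h'
  refine ⟨q + r, fun m hm => by rw [coeff_add, hq m hm, hr m hm, map_add], ?_⟩
  refine (hφ.add hψ).congr_left fun x => ?_
  rw [map_add]; ring

lemma MvPolynomial.isBigO_eval_one (q : MvPolynomial (Fin n) ℝ) :
    (fun x : Fin n → ℝ => eval x q) =O[𝓝 0] fun _ => (1 : ℝ) :=
  (q.analyticAt_eval 0).continuousAt.isBigO_one ℝ

lemma isBigO_norm_pow_one (N : ℕ) : (fun x : Fin n → ℝ => ‖x‖ ^ N) =O[𝓝 0] fun _ => (1 : ℝ) := by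
  simpa using isBigO_norm_pow_of_le (n := n) (Nat.zero_le N)

lemma HasJet.mul (h : HasJet N φ s) (h' : HasJet N ψ t) :
    HasJet N (fun x => φ x * ψ x) (s * t) := by
  classical
  obtain ⟨q, hq, hφ⟩ := h
  obtain ⟨r, hr, hψ⟩ := h'
  refine ⟨q * r, fun m hm => ?_, ?_⟩
  · rw [coeff_mul, MvPowerSeries.coeff_mul]
    refine Finset.sum_congr rfl fun x hx => ?_
    have hx' : x.1.degree + x.2.degree = m.degree := by
      rw [← Finset.HasAntidiagonal.mem_antidiagonal.1 hx, map_add]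
    rw [hq _ (by omega), hr _ (by omega)]
  · have hψ1 : ψ =O[𝓝 0] fun _ => (1 : ℝ) :=
      ((hψ.trans (isBigO_norm_pow_one N)).add r.isBigO_eval_one).congr_left fun x => by ring
    have h1 := hφ.mul hψ1
    have h2 := q.isBigO_eval_one.mul hψ
    simp only [mul_one] at h1
    simp only [one_mul] at h2
    refine (h1.add h2).congr_left fun x => ?_
    rw [map_mul]; ring

lemma HasJet.eval_mvPolynomial {σ : Type*} {φ : σ → (Fin n → ℝ) → ℝ}
    {s : σ → MvPowerSeries (Fin n) ℝ} (h : ∀ i, HasJet N (φ i) (s i)) (p : MvPolynomial σ ℝ) :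
    HasJet N (fun x => eval (fun i => φ i x) p) (aeval s p) := by
  induction p using MvPolynomial.induction_on with
  | C a => simpa [MvPowerSeries.algebraMap_apply] using HasJet.eval_mvPolynomial_self N (C a)
  | add p q hp hq => simpa using hp.add hq
  | mul_X p i hp => simpa using hp.mul (h i)

lemma HasJet.eq_zero (h : ∀ N, HasJet N φ s) (h0 : ∀ᶠ x in 𝓝 0, φ x = 0) : s = 0 := by
  ext m
  have h1 : HasJet (m.degree + 1) φ 0 := by
    refine ⟨0, fun m _ => by simp, ?_⟩
    refine (Asymptotics.isBigO_zero _ _).congr' ?_ Filter.EventuallyEq.rfl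
    filter_upwards [h0] with x hx
    simp [hx]
  exact (h (m.degree + 1)).coeff_eq h1 (Nat.lt_succ_self _)

lemma exists_homogeneous_eval_eq {k : ℕ} (T : ContinuousMultilinearMap ℝ (fun _ : Fin k => Fin n → ℝ) ℝ) :
    ∃ p : MvPolynomial (Fin n) ℝ, p.IsHomogeneous k ∧ ∀ x, eval x p = T fun _ => x := by
  classical
  refine ⟨∑ μ : Fin k → Fin n, C (T fun i => Pi.single (μ i) 1) * ∏ i, X (μ i), ?_, ?_⟩
  · refine IsHomogeneous.sum _ _ _ fun μ _ => ?_
    have h1 := IsHomogeneous.prod Finset.univ (fun i => (X (μ i) : MvPolynomial (Fin n) ℝ))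
      (fun _ => 1) (fun i _ => isHomogeneous_X ℝ (μ i))
    have h2 := (isHomogeneous_C (Fin n) (T fun i => Pi.single (μ i) 1)).mul h1
    simpa using h2
  · intro x
    have hx : x = ∑ i, x i • (Pi.single i (1 : ℝ) : Fin n → ℝ) := by
      funext j; simp [Pi.single_apply]
    have h1 : (T fun _ => x) = T fun _ => ∑ i, x i • (Pi.single i (1 : ℝ) : Fin n → ℝ) := by
      rw [← hx]
    rw [h1, ContinuousMultilinearMap.map_sum, map_sum]
    refine Finset.sum_congr rfl fun μ _ => ?_
    rw [ContinuousMultilinearMap.map_smul_univ]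
    simp [mul_comm]

lemma ContDiffAt.exists_hasJet (h : ContDiffAt ℝ (⊤ : ℕ∞) φ 0) :
    ∃ s : MvPowerSeries (Fin n) ℝ, ∀ N, HasJet N φ s := by
  choose p hp hpe using fun k => exists_homogeneous_eval_eq
    (((k.factorial : ℝ)⁻¹) • iteratedFDeriv ℝ k φ 0)
  refine ⟨fun m => (p m.degree).coeff m, fun N => ⟨∑ k ∈ Finset.range N, p k, fun m hm => ?_, ?_⟩⟩
  · rw [coeff_sum, Finset.sum_eq_single m.degree]
    · rfl
    · intro k _ hk
      by_contra h
      exact hk (by rw [Finsupp.degree_eq_weight_one]; exact (hp k h).symm)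
    · intro h; exact absurd (Finset.mem_range.2 hm) h
  · refine (h.isBigO_sub_taylor N).congr_left fun x => ?_
    simp [map_sum, hpe]

lemma HasJet.hasFDerivAt (h : HasJet 2 φ s) (h' : HasJet 2 ψ s) {L : (Fin n → ℝ) →L[ℝ] ℝ}
    (hL : HasFDerivAt φ L 0) : HasFDerivAt ψ L 0 := by
  have h1 := h'.isBigO_sub h
  have h2 : HasFDerivAt (fun x => ψ x - φ x) (0 : (Fin n → ℝ) →L[ℝ] ℝ) 0 :=
    Asymptotics.IsBigO.hasFDerivAt (n := 2) (by simpa using h1) one_lt_two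
  exact ((h2.add hL).congr_of_eventuallyEq (.of_forall fun x => by simp)).congr_fderiv (by simp)

end Jets

end

section

open MvPolynomial
open scoped Topology

lemma MvPowerSeries.exists_eq_truncTotal_add {n : ℕ} (N : ℕ) (s : MvPowerSeries (Fin n) ℝ) :
    ∃ (T : Type) (_ : Fintype T) (r : T → MvPowerSeries (Fin n) ℝ) (m : T → (Fin n →₀ ℕ)),
      (∀ i, (m i).degree = N) ∧ s = (truncTotal N s : MvPolynomial (Fin n) ℝ) +
        ∑ i, r i * ((MvPolynomial.monomial (m i) 1 : MvPolynomial (Fin n) ℝ) : MvPowerSeries (Fin n) ℝ) := by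
  have h1 : s - (truncTotal N s : MvPolynomial (Fin n) ℝ) ∈
      Ideal.span (Set.range (X : Fin n → MvPowerSeries (Fin n) ℝ)) ^ N := by
    refine mem_span_X_pow N _ fun m hm => ?_
    rw [map_sub, MvPolynomial.coeff_coe, coeff_truncTotal _ hm, sub_self]
  rw [Ideal.mem_span_pow_iff_exists_isHomogeneous] at h1
  obtain ⟨p, hp, hpe⟩ := h1
  refine ⟨p.support, inferInstance, fun i => p.coeff i, fun i => i.1, fun i => ?_, ?_⟩
  · rw [Finsupp.degree_eq_weight_one]
    exact hp (MvPolynomial.mem_support_iff.1 i.2)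
  · rw [← sub_eq_iff_eq_add', ← hpe, MvPolynomial.eval_eq', ← Finset.sum_coe_sort]
    refine Finset.sum_congr rfl fun d _ => ?_
    congr 1
    rw [MvPolynomial.monomial_eq, map_one, one_mul, Finsupp.prod_fintype _ _ (fun i => pow_zero _)]
    change _ = MvPolynomial.coeToMvPowerSeries.ringHom _
    rw [map_prod]
    simp

lemma MvPolynomial.aeval_mvPowerSeries_X {n : ℕ} {R : Type} [CommRing R] [Algebra ℝ R]
    (P : MvPolynomial (Fin n) ℝ) :
    aeval (MvPowerSeries.X : Fin n → MvPowerSeries (Fin n) R) P =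
      MvPowerSeries.map (algebraMap ℝ R) (P : MvPowerSeries (Fin n) ℝ) := by
  induction P using MvPolynomial.induction_on with
  | C a => simp [MvPowerSeries.algebraMap_apply]
  | add p q hp hq => simp [hp, hq]
  | mul_X p i hp => simp [hp]

set_option maxHeartbeats 1000000 in
/-- Realization of a polynomial system with prescribed jets. -/
theorem LocallySmoothable.exists_jet_realization {R : Type} [CommRing R] [IsNoetherianRing R]
    [Algebra ℝ R] {n : ℕ} (hsm : LocallySmoothable R (MvPowerSeries (Fin n) R)) (ε : R →ₐ[ℝ] ℝ)
    (Q : ∀ s : Type, (s → R) → (s → (Fin n → ℝ) → ℝ) → Prop)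
    (hQ : ∀ (s : Type) [Fintype s] (a : s → R) (K : Type) [Fintype K] (r : K → MvPolynomial s ℝ),
      (∀ k, aeval a (r k) = 0) → ∃ a' : s → (Fin n → ℝ) → ℝ, Q s a a' ∧
        (∀ i, AnalyticAt ℝ (a' i) 0) ∧ (∀ i, a' i 0 = ε (a i)) ∧
        ∀ᶠ x in 𝓝 0, ∀ k, eval (fun i => a' i x) (r k) = 0) (N : ℕ)
    {E₀ E₁ s K : Type} [Fintype E₀] [Fintype E₁] [Fintype s] [Fintype K]
    (e₀ : E₀ → MvPowerSeries (Fin n) ℝ) (e₁ : E₁ → MvPowerSeries (Fin n) R) (a : s → R)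
    (p : K → MvPolynomial (((E₀ ⊕ E₁) ⊕ Fin n) ⊕ s) ℝ)
    (hp : ∀ k, aeval (Sum.elim (Sum.elim (Sum.elim
      (fun i => MvPowerSeries.map (algebraMap ℝ R) (e₀ i)) e₁) MvPowerSeries.X)
      fun i => algebraMap R (MvPowerSeries (Fin n) R) (a i)) (p k) = 0) :
    ∃ (t : Type) (_ : Fintype t) (b : t → R) (c' : s ⊕ t → (Fin n → ℝ) → ℝ)
      (e₀' : E₀ → (Fin n → ℝ) → ℝ) (e₁' : E₁ → (Fin n → ℝ) → ℝ), Q (s ⊕ t) (Sum.elim a b) c' ∧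
      (∀ i, AnalyticAt ℝ (e₀' i) 0) ∧ (∀ i, HasJet N (e₀' i) (e₀ i)) ∧
      (∀ᶠ x in 𝓝 0, ∀ k, eval (Sum.elim (Sum.elim (Sum.elim (fun i => e₀' i x) fun i => e₁' i x) x)
        fun i => c' (Sum.inl i) x) (p k) = 0) ∧
      ∀ (q : ℕ) (h : (Fin q → ℝ) → (Fin n → ℝ)), AnalyticAt ℝ h 0 → h 0 = 0 →
        (∀ j, NashFun fun x => h x j) → (∀ i, NashFun fun x => c' i (h x)) →
        ∀ i, NashFun fun x => e₀' i (h x) := by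
  choose T hT r m hm hr using fun i => MvPowerSeries.exists_eq_truncTotal_add N (e₀ i)
  let e : (E₀ ⊕ E₁) ⊕ (Σ i, T i) → MvPowerSeries (Fin n) R :=
    Sum.elim (Sum.elim (fun i => MvPowerSeries.map (algebraMap ℝ R) (e₀ i)) e₁)
      fun i => MvPowerSeries.map (algebraMap ℝ R) (r i.1 i.2)
  let v : Fin n → (((E₀ ⊕ E₁) ⊕ (Σ i, T i)) ⊕ Fin n) ⊕ s := fun j => Sum.inl (Sum.inr j)
  let p' : K ⊕ E₀ → MvPolynomial ((((E₀ ⊕ E₁) ⊕ (Σ i, T i)) ⊕ Fin n) ⊕ s) ℝ := Sum.elim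
    (fun k => rename (Sum.map (Sum.map Sum.inl id) id) (p k))
    (fun i => X (Sum.inl (Sum.inl (Sum.inl (Sum.inl i)))) -
      (rename v (MvPowerSeries.truncTotal N (e₀ i)) +
        ∑ j, X (Sum.inl (Sum.inl (Sum.inr ⟨i, j⟩))) * rename v (monomial (m i j) 1)))
  have hp' : ∀ k, aeval (Sum.elim (Sum.elim e MvPowerSeries.X)
      fun i => algebraMap R (MvPowerSeries (Fin n) R) (a i)) (p' k) = 0 := by
    rintro (k | i)
    · change aeval _ (rename _ (p k)) = 0
      rw [aeval_rename, ← hp k]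
      congr 2
      funext i
      rcases i with ((i | i) | i) | i <;> rfl
    · have hv : ∀ P : MvPolynomial (Fin n) ℝ, aeval (Sum.elim (Sum.elim e MvPowerSeries.X)
          fun i => algebraMap R (MvPowerSeries (Fin n) R) (a i)) (rename v P) =
          MvPowerSeries.map (algebraMap ℝ R) (P : MvPowerSeries (Fin n) ℝ) := by
        intro P
        rw [aeval_rename, ← aeval_mvPowerSeries_X]
        rfl
      simp only [p', Sum.elim_inr, map_sub, map_add, map_sum, map_mul, hv, aeval_X, Sum.elim_inl, e]
      rw [sub_eq_zero]
      conv_lhs => rw [hr i]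
      simp only [map_add, map_sum, map_mul]
  obtain ⟨t, _, b, c', e', hQc, he', hrel, hN⟩ :=
    hsm.exists_analytic_realization ε Q hQ e a p' hp'
  refine ⟨t, inferInstance, b, c', fun i => e' (Sum.inl (Sum.inl i)),
    fun i => e' (Sum.inl (Sum.inr i)), hQc, fun i => he' _, fun i => ?_, ?_, ?_⟩
  · refine ⟨MvPowerSeries.truncTotal N (e₀ i), fun m hm => MvPowerSeries.coeff_truncTotal _ hm, ?_⟩
    have h1 : ∀ j, (fun x => e' (Sum.inr ⟨i, j⟩) x * eval x (monomial (m i j) (1 : ℝ))) =O[𝓝 0]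
        fun x => ‖x‖ ^ N := by
      intro j
      have h2 := ((he' (Sum.inr ⟨i, j⟩)).continuousAt.isBigO_one ℝ).mul
        (isBigO_eval (N := N) (monomial (m i j) (1 : ℝ)) (fun m' hm' => by
          classical
          rw [coeff_monomial, if_neg]
          rintro rfl
          exact absurd (hm i j) hm'.ne))
      simpa using h2
    have h2 : (fun x => ∑ j, e' (Sum.inr ⟨i, j⟩) x * eval x (monomial (m i j) (1 : ℝ))) =O[𝓝 0]
        fun x => ‖x‖ ^ N := by
      refine (Asymptotics.IsBigO.sum (s := Finset.univ) fun j _ => h1 j).congr_left fun x => ?_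
      simp only [Finset.sum_apply]
    refine h2.congr' ?_ Filter.EventuallyEq.rfl
    filter_upwards [hrel] with x hx
    have := hx (Sum.inr i)
    simp only [p', Sum.elim_inr, map_sub, map_add, map_sum, map_mul, eval_X, Sum.elim_inl,
      eval_rename] at this
    rw [sub_eq_zero] at this
    rw [this]
    simp only [Function.comp_def, v, Sum.elim_inl, Sum.elim_inr]
    ring
  · filter_upwards [hrel] with x hx k
    have := hx (Sum.inl k)
    simp only [p', Sum.elim_inl, eval_rename] at this
    rw [← this]
    congr 2
    funext i
    rcases i with ((i | i) | i) | i <;> rfl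
  · intro q h hh hh0 hhN hcN i
    exact hN q h hh hh0 hhN hcN _

end

section

open MvPolynomial
open scoped Topology

lemma NashFun.const {n : ℕ} (a : ℝ) : NashFun (fun _ : Fin n → ℝ => a) := by
  simpa using NashFun.eval_mvPolynomial (σ := Empty) (n := n) (fun i => i.elim) (fun i => i.elim) (C a)

lemma NashFun.coord {n : ℕ} (j : Fin n) : NashFun (fun x : Fin n → ℝ => x j) :=
  (nashFun_iff_isAlgebraic (coordFun n j)).2 (isAlgebraic_algebraMap (A := MeroGerm n)
    (⟨_, IntermediateField.subset_adjoin ℝ _ (Set.mem_range_self j)⟩ : coordField n))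

lemma HasJet.apply_zero {n N : ℕ} {φ : (Fin n → ℝ) → ℝ} {s : MvPowerSeries (Fin n) ℝ}
    (h : HasJet N φ s) (hN : N ≠ 0) : φ 0 = MvPowerSeries.constantCoeff s := by
  obtain ⟨q, hq, hφ⟩ := h
  obtain ⟨c, hc⟩ := hφ.bound
  have h1 := hc.self_of_nhds
  rw [norm_zero, zero_pow hN, norm_zero, mul_zero, norm_le_zero_iff, sub_eq_zero] at h1
  have h2 : eval (0 : Fin n → ℝ) q = q.coeff 0 := by
    rw [← constantCoeff_eq, ← eval_zero]
  rw [h1, h2, hq 0 (by simpa using Nat.pos_of_ne_zero hN), MvPowerSeries.coeff_zero_eq_constantCoeff]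

theorem locallySmoothable_real_mvPowerSeries (m : ℕ) :
    LocallySmoothable ℝ (MvPowerSeries (Fin m) ℝ) := by
  haveI : IsDomain (MvPowerSeries (Fin m) ℝ) := NoZeroDivisors.to_isDomain _
  refine locallySmoothable_of_generic (fun r hr => ?_) (fun q hq => jacReg_mvPowerSeries m q hq) ?_
  · refine isUnit_iff_ne_zero.2 fun h => ?_
    rw [h, map_zero] at hr
    exact not_isUnit_zero hr
  · intro g hg hg'
    exact absurd (isUnit_iff_ne_zero.2 hg) hg'

/-- Approximation of formal solutions of polynomial systems by Nash solutions. -/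
theorem exists_nash_realization {m : ℕ} (N : ℕ) {E K : Type} [Fintype E] [Fintype K]
    (e : E → MvPowerSeries (Fin m) ℝ) (p : K → MvPolynomial (E ⊕ Fin m) ℝ)
    (hp : ∀ k, aeval (Sum.elim e MvPowerSeries.X) (p k) = 0) :
    ∃ e' : E → (Fin m → ℝ) → ℝ, (∀ i, AnalyticAt ℝ (e' i) 0) ∧ (∀ i, HasJet N (e' i) (e i)) ∧
      (∀ᶠ y in 𝓝 0, ∀ k, eval (Sum.elim (fun i => e' i y) y) (p k) = 0) ∧
      ∀ (q : ℕ) (h : (Fin q → ℝ) → (Fin m → ℝ)), AnalyticAt ℝ h 0 → h 0 = 0 →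
        (∀ j, NashFun fun x => h x j) → ∀ i, NashFun fun x => e' i (h x) := by
  let v : E ⊕ Fin m → ((E ⊕ Empty) ⊕ Fin m) ⊕ Empty := fun i => Sum.inl (Sum.map Sum.inl id i)
  obtain ⟨t, _, b, c', e', _, hQ, he', hjet, hrel, hN⟩ :=
    (locallySmoothable_real_mvPowerSeries m).exists_jet_realization (AlgHom.id ℝ ℝ)
      (fun s a c' => ∀ i, c' i = fun _ => a i)
      (fun s _ a K _ r hr => ⟨fun i _ => a i, fun _ => rfl, fun i => analyticAt_const,
        fun i => rfl, Filter.Eventually.of_forall fun x k => hr k⟩) N e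
      (E₁ := Empty) (s := Empty) (fun i => i.elim) (fun i => i.elim)
      (fun k => rename v (p k)) (fun k => by
        rw [aeval_rename, ← hp k]
        congr 2
        funext i
        rcases i with i | i
        · simp [v]
        · simp [v])
  refine ⟨e', he', hjet, ?_, ?_⟩
  · filter_upwards [hrel] with y hy k
    have := hy k
    rw [eval_rename] at this
    rw [← this]
    congr 2
    funext i
    rcases i with i | i <;> rfl
  · intro q h hh hh0 hhN i
    refine hN q h hh hh0 hhN (fun i => ?_) i
    simp only [hQ]
    exact NashFun.const _

/-- Nested approximation: formal solutions over `ℝ⟦y⟧⟦x⟧`, part of which depend on `y` only, are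
approximated on the graph of a Nash map by Nash functions with the same dependence. -/
theorem exists_nested_nash_realization {n m N : ℕ} (hN : N ≠ 0) {f : (Fin n → ℝ) → (Fin m → ℝ)}
    (hfa : AnalyticAt ℝ f 0) (hf0 : f 0 = 0) (hfN : ∀ j, NashFun fun x => f x j) {E₀ E₁ s K : Type} [Fintype E₀] [Fintype E₁] [Fintype s] [Fintype K]
    (e₀ : E₀ → MvPowerSeries (Fin n) ℝ)
    (e₁ : E₁ → MvPowerSeries (Fin n) (MvPowerSeries (Fin m) ℝ)) (a : s → MvPowerSeries (Fin m) ℝ)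
    (p : K → MvPolynomial (((E₀ ⊕ E₁) ⊕ Fin n) ⊕ (s ⊕ Fin m)) ℝ)
    (hp : ∀ k, aeval (Sum.elim (Sum.elim (Sum.elim
      (fun i => MvPowerSeries.map (algebraMap ℝ (MvPowerSeries (Fin m) ℝ)) (e₀ i)) e₁)
        MvPowerSeries.X)
      fun i => algebraMap (MvPowerSeries (Fin m) ℝ) (MvPowerSeries (Fin n) (MvPowerSeries (Fin m) ℝ))
        (Sum.elim a MvPowerSeries.X i)) (p k) = 0) :
    ∃ (e₀' : E₀ → (Fin n → ℝ) → ℝ) (e₁' : E₁ → (Fin n → ℝ) → ℝ) (a' : s → (Fin m → ℝ) → ℝ),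
      (∀ i, NashFun (e₀' i)) ∧ (∀ i, HasJet N (e₀' i) (e₀ i)) ∧ (∀ i, NashFun (a' i)) ∧
      (∀ i, HasJet N (a' i) (a i)) ∧
      ∀ᶠ x in 𝓝 0, ∀ k, eval (Sum.elim (Sum.elim (Sum.elim (fun i => e₀' i x) fun i => e₁' i x) x)
        (Sum.elim (fun i => a' i (f x)) (f x))) (p k) = 0 := by
  classical
  have hft : Filter.Tendsto f (𝓝 0) (𝓝 0) := by
    have := hfa.continuousAt.tendsto
    rwa [hf0] at this
  let ε : MvPowerSeries (Fin m) ℝ →ₐ[ℝ] ℝ :=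
    { (MvPowerSeries.constantCoeff : MvPowerSeries (Fin m) ℝ →+* ℝ) with
      commutes' := fun x => by simp [MvPowerSeries.algebraMap_apply] }
  let Q : ∀ s : Type, (s → MvPowerSeries (Fin m) ℝ) → (s → (Fin n → ℝ) → ℝ) → Prop :=
    fun s a c' => ∃ a'' : s → (Fin m → ℝ) → ℝ, (∀ i, c' i = fun x => a'' i (f x)) ∧
      (∀ i, NashFun (a'' i)) ∧ (∀ i, NashFun (c' i)) ∧ (∀ i, HasJet N (a'' i) (a i)) ∧
      ∀ i j, a i = MvPowerSeries.X j → ∀ᶠ y in 𝓝 0, a'' i y = y j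
  obtain ⟨t, _, b, c', e₀', e₁', ⟨a'', hc', ha''N, hc'N, ha''jet, ha''X⟩, -, hjet, hrel, hNash⟩ :=
    (locallySmoothable_mvPowerSeries ℝ n m).exists_jet_realization ε Q (by
      intro s _ a K _ r hr
      obtain ⟨e', he', hjet, hrel, hNash⟩ := exists_nash_realization N a
        (K := K ⊕ {ij : s × Fin m // a ij.1 = MvPowerSeries.X ij.2})
        (Sum.elim (fun k => rename Sum.inl (r k))
          fun ij => X (Sum.inl ij.1.1) - X (Sum.inr ij.1.2)) (by
          rintro (k | ij)
          · simp only [Sum.elim_inl, aeval_rename]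
            exact hr k
          · simp [ij.2])
      have hid : ∀ i, NashFun (e' i) := hNash m id analyticAt_id rfl NashFun.coord
      refine ⟨fun i x => e' i (f x), ⟨e', fun _ => rfl, hid, hNash n f hfa hf0 hfN, hjet, ?_⟩,
        fun i => (he' i).comp_of_eq hfa hf0, fun i => ?_, ?_⟩
      · intro i j hij
        filter_upwards [hrel] with y hy
        have := hy (Sum.inr ⟨(i, j), hij⟩)
        simpa [sub_eq_zero] using this
      · change e' i (f 0) = _
        rw [hf0]
        exact (hjet i).apply_zero hN
      · filter_upwards [hft.eventually hrel] with x hx k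
        have := hx (Sum.inl k)
        rwa [Sum.elim_inl, eval_rename] at this) N e₀ e₁ (Sum.elim a MvPowerSeries.X) p hp
  refine ⟨e₀', e₁', fun i => a'' (Sum.inl (Sum.inl i)), ?_, hjet, fun i => ha''N _,
    fun i => ha''jet _, ?_⟩
  · exact hNash n id analyticAt_id rfl NashFun.coord hc'N
  · have hX : ∀ᶠ y in 𝓝 0, ∀ j, a'' (Sum.inl (Sum.inr j)) y = y j :=
      Filter.eventually_all.2 fun j => ha''X _ j rfl
    filter_upwards [hrel, hft.eventually hX] with x hx hx2 k
    rw [← hx k]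
    congr 2
    funext i
    rcases i with i | (i | i)
    · rfl
    · simp [hc']
    · simp [hc', hx2]

end

section

open MvPolynomial
open scoped Topology

lemma finite_toMero_roots {n : ℕ} {P : MvPolynomial (Fin (n + 1)) ℝ} (hP : P ≠ 0) :
    {z : MeroGerm n | ∃ ψ : analyticFun n, toMero n ψ = z ∧
      ∀ᶠ x in 𝓝 0, eval (Fin.snoc x ((ψ : (Fin n → ℝ) → ℝ) x)) P = 0}.Finite := by
  let xh : Fin n → MeroGerm n := fun i => toMero n (coordFun n i)
  let P' : MvPolynomial (Option (Fin n)) ℝ := rename (finSuccEquivLast (n := n)) P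
  let p : Polynomial (MeroGerm n) :=
    (optionEquivLeft ℝ (Fin n) P').map (aeval xh : MvPolynomial (Fin n) ℝ →ₐ[ℝ] MeroGerm n).toRingHom
  have hp : p ≠ 0 := by
    have h1 : P' ≠ 0 := (map_ne_zero_iff _ (rename_injective _ (Equiv.injective _))).2 hP
    have h2 : optionEquivLeft ℝ (Fin n) P' ≠ 0 :=
      (map_ne_zero_iff _ (optionEquivLeft ℝ (Fin n)).injective).2 h1
    exact (Polynomial.map_ne_zero_iff
      (algebraicIndependent_iff_injective_aeval.1 (algebraicIndependent_coordFun n))).2 h2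
  have hev : ∀ (z : MeroGerm n) (q : MvPolynomial (Option (Fin n)) ℝ),
      Polynomial.eval₂ (aeval xh : MvPolynomial (Fin n) ℝ →ₐ[ℝ] MeroGerm n).toRingHom z
        (optionEquivLeft ℝ (Fin n) q) = aeval (fun o : Option (Fin n) => o.elim z xh) q := by
    intro z q
    induction q using MvPolynomial.induction_on with
    | C a => simp
    | add p q hp hq => rw [map_add, Polynomial.eval₂_add, hp, hq, map_add]
    | mul_X p i hp =>
      rw [map_mul, Polynomial.eval₂_mul, hp, map_mul, aeval_X]
      cases i <;> simp
  refine (p.rootSet_finite (MeroGerm n)).subset ?_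
  rintro z ⟨ψ, rfl, hψ⟩
  rw [Polynomial.mem_rootSet']
  refine ⟨by simpa using hp, ?_⟩
  have h1 : Polynomial.aeval (toMero n ψ) p = Polynomial.eval₂
      (aeval xh : MvPolynomial (Fin n) ℝ →ₐ[ℝ] MeroGerm n).toRingHom (toMero n ψ)
      (optionEquivLeft ℝ (Fin n) P') := by
    rw [Polynomial.coe_aeval_eq_eval, Polynomial.eval_map]
  rw [h1, hev]
  have h2 : (fun o : Option (Fin n) => o.elim (toMero n ψ) xh) =
      fun o => toMero n (o.elim ψ (coordFun n)) := by
    funext o; cases o <;> rfl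
  rw [h2, aeval_toMero_eq_zero_iff]
  filter_upwards [hψ] with x hx
  rw [eval_rename, ← hx]
  congr 2
  funext i
  refine Fin.lastCases ?_ (fun i => ?_) i
  · simp
  · simp [coordFun]

/-- Analytic roots of a polynomial are separated by jets of some finite order. -/
theorem exists_order_separating_roots {n : ℕ} {P : MvPolynomial (Fin (n + 1)) ℝ} (hP : P ≠ 0)
    {φ : (Fin n → ℝ) → ℝ} (hφ : AnalyticAt ℝ φ 0) :
    ∃ N : ℕ, ∀ ψ : (Fin n → ℝ) → ℝ, AnalyticAt ℝ ψ 0 →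
      (∀ᶠ x in 𝓝 0, eval (Fin.snoc x (ψ x)) P = 0) →
      ((fun x => ψ x - φ x) =O[𝓝 0] fun x => ‖x‖ ^ N) → ∀ᶠ x in 𝓝 0, ψ x = φ x := by
  have hfin := finite_toMero_roots hP
  have hz : ∀ z : MeroGerm n, ∃ N : ℕ, ∀ ψ : analyticFun n, toMero n ψ = z →
      ((fun x => (ψ : (Fin n → ℝ) → ℝ) x - φ x) =O[𝓝 0] fun x => ‖x‖ ^ N) →
      ∀ᶠ x in 𝓝 0, (ψ : (Fin n → ℝ) → ℝ) x = φ x := by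
    intro z
    by_cases hex : ∃ ψ : analyticFun n, toMero n ψ = z ∧
        ¬ ∀ᶠ x in 𝓝 0, (ψ : (Fin n → ℝ) → ℝ) x = φ x
    · obtain ⟨ψ₀, hψ₀, hne⟩ := hex
      have h1 : ∃ N : ℕ, ¬ ((fun x => (ψ₀ : (Fin n → ℝ) → ℝ) x - φ x) =O[𝓝 0] fun x => ‖x‖ ^ N) := by
        by_contra hall
        push Not at hall
        apply hne
        filter_upwards [AnalyticAt.eventually_eq_zero_of_isBigO (AnalyticAt.sub ψ₀.2 hφ) hall]
          with x hx
        exact sub_eq_zero.1 hx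
      obtain ⟨N, hN⟩ := h1
      refine ⟨N, fun ψ hψ hO => absurd (hO.congr' ?_ Filter.EventuallyEq.rfl) hN⟩
      have h2 : toMero n (ψ - ψ₀) = 0 := by rw [map_sub, hψ, hψ₀, sub_self]
      rw [toMero_eq_zero_iff] at h2
      filter_upwards [h2] with x hx
      have hx' : (ψ : (Fin n → ℝ) → ℝ) x - (ψ₀ : (Fin n → ℝ) → ℝ) x = 0 := hx
      rw [sub_eq_zero.1 hx']
    · push Not at hex
      exact ⟨0, fun ψ hψ _ => hex ψ hψ⟩
  choose Nz hNz using hz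
  refine ⟨hfin.toFinset.sup Nz, fun ψ hψ hroot hO => ?_⟩
  refine hNz (toMero n ⟨ψ, hψ⟩) ⟨ψ, hψ⟩ rfl (hO.trans (isBigO_norm_pow_of_le ?_))
  exact Finset.le_sup (f := Nz) (hfin.mem_toFinset.2 ⟨⟨ψ, hψ⟩, rfl, hroot⟩)

section Graph

variable {R : Type*} [CommRing R]

lemma Ideal.mem_of_forall_mem_sup_pow [IsNoetherianRing R] [IsLocalRing R] (I : Ideal R) {w : R}
    (h : ∀ N : ℕ, w ∈ I ⊔ IsLocalRing.maximalIdeal R ^ N) : w ∈ I := by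
  have h1 := Ideal.iInf_pow_smul_eq_bot_of_isLocalRing (M := R ⧸ I) (IsLocalRing.maximalIdeal R)
    (Ideal.IsPrime.ne_top inferInstance)
  have h2 : Ideal.Quotient.mk I w ∈
      (⨅ i : ℕ, IsLocalRing.maximalIdeal R ^ i • ⊤ : Submodule R (R ⧸ I)) := by
    rw [Submodule.mem_iInf]
    intro N
    obtain ⟨a, ha, b, hb, rfl⟩ := Submodule.mem_sup.1 (h N)
    have h3 : Ideal.Quotient.mk I (a + b) = b • (1 : R ⧸ I) := by
      rw [map_add, Ideal.Quotient.eq_zero_iff_mem.2 ha, zero_add, Algebra.smul_def, mul_one]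
      rfl
    rw [h3]
    exact Submodule.smul_mem_smul hb Submodule.mem_top
  rw [h1, Submodule.mem_bot, Ideal.Quotient.eq_zero_iff_mem] at h2
  exact h2

lemma MvPolynomial.aeval_sub_aeval_mem {k σ : Type*} [CommRing k] [Algebra k R] (I : Ideal R)
    {a b : σ → R} (h : ∀ i, a i - b i ∈ I) (q : MvPolynomial σ k) : aeval a q - aeval b q ∈ I := by
  rw [← Ideal.Quotient.eq_zero_iff_mem, map_sub, sub_eq_zero]
  have : (Ideal.Quotient.mkₐ k I).comp (aeval a) = (Ideal.Quotient.mkₐ k I).comp (aeval b) := by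
    apply MvPolynomial.algHom_ext
    intro i
    simp only [AlgHom.comp_apply, aeval_X, Ideal.Quotient.mkₐ_eq_mk]
    rw [← sub_eq_zero, ← map_sub]
    exact Ideal.Quotient.eq_zero_iff_mem.2 (h i)
  exact DFunLike.congr_fun this q

end Graph

lemma MvPowerSeries.map_algebraMap_aeval {n : ℕ} {R : Type} [CommRing R] [Algebra ℝ R] {σ : Type*}
    (s : σ → MvPowerSeries (Fin n) ℝ) (p : MvPolynomial σ ℝ) :
    map (algebraMap ℝ R) (MvPolynomial.aeval s p) =
      MvPolynomial.aeval (fun i => map (algebraMap ℝ R) (s i)) p := by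
  induction p using MvPolynomial.induction_on with
  | C a => simp [MvPowerSeries.algebraMap_apply]
  | add p q hp hq => simp [hp, hq]
  | mul_X p i hp => simp [hp]

/-- A formal identity `G(x) = π(f(x))` gives a linear combination over `ℝ⟦y⟧⟦x⟧` on the graph. -/
theorem exists_graph_combination {n m : ℕ} {f : (Fin n → ℝ) → (Fin m → ℝ)}
    {fh : Fin m → MvPowerSeries (Fin n) ℝ} (hf : ∀ j N, HasJet N (fun x => f x j) (fh j))
    (hfO : f =O[𝓝 0] fun x => x) (hf0 : Filter.Tendsto f (𝓝 0) (𝓝 0))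
    {π : (Fin m → ℝ) → ℝ} {πh : MvPowerSeries (Fin m) ℝ} (hπ : ∀ N, HasJet N π πh)
    {Gh : MvPowerSeries (Fin n) ℝ} (hG : ∀ N, HasJet N (fun x => π (f x)) Gh) :
    ∃ h : Fin m → MvPowerSeries (Fin n) (MvPowerSeries (Fin m) ℝ),
      MvPowerSeries.map (algebraMap ℝ (MvPowerSeries (Fin m) ℝ)) Gh -
        algebraMap (MvPowerSeries (Fin m) ℝ) _ πh =
      ∑ i, h i * (algebraMap (MvPowerSeries (Fin m) ℝ) _ (MvPowerSeries.X i) -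
        MvPowerSeries.map (algebraMap ℝ (MvPowerSeries (Fin m) ℝ)) (fh i)) := by
  let R := MvPowerSeries (Fin m) ℝ
  let Λ := MvPowerSeries (Fin n) R
  let μ : MvPowerSeries (Fin n) ℝ →+* Λ := MvPowerSeries.map (algebraMap ℝ R)
  let I : Ideal Λ := Ideal.span (Set.range fun i : Fin m =>
    algebraMap R Λ (MvPowerSeries.X i) - μ (fh i))
  have hX : Ideal.span (Set.range (MvPowerSeries.X : Fin n → Λ)) ≤ IsLocalRing.maximalIdeal Λ := by
    rw [Ideal.span_le]
    rintro _ ⟨i, rfl⟩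
    change MvPowerSeries.X i ∈ IsLocalRing.maximalIdeal Λ
    rw [IsLocalRing.mem_maximalIdeal, mem_nonunits_iff]
    intro h
    have := h.map (MvPowerSeries.constantCoeff (σ := Fin n) (R := R))
    rw [MvPowerSeries.constantCoeff_X] at this
    exact not_isUnit_zero this
  have hY : Ideal.span (Set.range fun i : Fin m => algebraMap R Λ (MvPowerSeries.X i)) ≤
      IsLocalRing.maximalIdeal Λ := by
    rw [Ideal.span_le]
    rintro _ ⟨i, rfl⟩
    change algebraMap R Λ (MvPowerSeries.X i) ∈ IsLocalRing.maximalIdeal Λ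
    rw [IsLocalRing.mem_maximalIdeal, mem_nonunits_iff]
    intro h
    have h1 := h.map (MvPowerSeries.constantCoeff (σ := Fin n) (R := R))
    have h2 : MvPowerSeries.constantCoeff (algebraMap R Λ (MvPowerSeries.X i)) =
        (MvPowerSeries.X i : R) := MvPowerSeries.constantCoeff_C _
    rw [h2] at h1
    have h3 := h1.map (MvPowerSeries.constantCoeff (σ := Fin m) (R := ℝ))
    rw [MvPowerSeries.constantCoeff_X] at h3
    exact not_isUnit_zero h3
  have hw : μ Gh - algebraMap R Λ πh ∈ I := by
    refine Ideal.mem_of_forall_mem_sup_pow I fun N => ?_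
    obtain ⟨q, hq, hqO⟩ := hπ N
    have h1 : μ (Gh - aeval fh q) ∈ IsLocalRing.maximalIdeal Λ ^ N := by
      have ha : Gh - aeval fh q ∈
          Ideal.span (Set.range (MvPowerSeries.X : Fin n → MvPowerSeries (Fin n) ℝ)) ^ N := by
        refine MvPowerSeries.mem_span_X_pow N _ fun m hm => ?_
        rw [map_sub, sub_eq_zero]
        refine (hG N).coeff_eq ?_ hm
        refine (HasJet.eval_mvPolynomial (fun j => hf j N) q).congr ?_
        have hb := hqO.comp_tendsto hf0
        exact hb.trans ((hfO.norm_norm).pow N)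
      have hb := Ideal.mem_map_of_mem μ ha
      rw [Ideal.map_pow, Ideal.map_span, ← Set.range_comp] at hb
      have hc : μ ∘ MvPowerSeries.X = (MvPowerSeries.X : Fin n → Λ) := by
        funext i; exact MvPowerSeries.map_X _ i
      rw [hc] at hb
      exact Ideal.pow_right_mono hX N hb
    have h3 : algebraMap R Λ ((q : MvPowerSeries (Fin m) ℝ) - πh) ∈
        IsLocalRing.maximalIdeal Λ ^ N := by
      have ha : (q : MvPowerSeries (Fin m) ℝ) - πh ∈
          Ideal.span (Set.range (MvPowerSeries.X : Fin m → R)) ^ N := by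
        refine MvPowerSeries.mem_span_X_pow N _ fun m hm => ?_
        rw [map_sub, MvPolynomial.coeff_coe, hq m hm, sub_self]
      have hb := Ideal.mem_map_of_mem (algebraMap R Λ) ha
      rw [Ideal.map_pow, Ideal.map_span, ← Set.range_comp] at hb
      exact Ideal.pow_right_mono hY N hb
    have e1 : μ (aeval fh q) = aeval (fun i => μ (fh i)) q :=
      MvPowerSeries.map_algebraMap_aeval fh q
    have e2 : algebraMap R Λ (q : MvPowerSeries (Fin m) ℝ) =
        aeval (fun i : Fin m => algebraMap R Λ (MvPowerSeries.X i)) q := by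
      have h0 : (q : MvPowerSeries (Fin m) ℝ) = aeval MvPowerSeries.X q := by
        rw [aeval_mvPowerSeries_X]; simp
      rw [h0]
      exact (aeval_algebraMap_apply Λ (MvPowerSeries.X : Fin m → R) q).symm
    have h2 : aeval (fun i => μ (fh i)) q -
        aeval (fun i : Fin m => algebraMap R Λ (MvPowerSeries.X i)) q ∈ I := by
      refine aeval_sub_aeval_mem I (fun i => ?_) q
      rw [← neg_sub]
      exact I.neg_mem (Ideal.subset_span (Set.mem_range_self i))
    have hsum : μ Gh - algebraMap R Λ πh = (aeval (fun i => μ (fh i)) q -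
        aeval (fun i : Fin m => algebraMap R Λ (MvPowerSeries.X i)) q) +
        (μ (Gh - aeval fh q) + algebraMap R Λ ((q : MvPowerSeries (Fin m) ℝ) - πh)) := by
      rw [map_sub, map_sub, e1, e2]; ring
    rw [hsum]
    exact Submodule.add_mem_sup h2 (add_mem h1 h3)
  obtain ⟨h, hh⟩ := (Submodule.mem_span_range_iff_exists_fun Λ).1 hw
  exact ⟨h, hh.symm⟩

end

section

open MvPolynomial
open scoped Topology

lemma HasJet.mono {n N N' : ℕ} {φ : (Fin n → ℝ) → ℝ} {s : MvPowerSeries (Fin n) ℝ}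
    (h : HasJet N φ s) (hN : N' ≤ N) : HasJet N' φ s := by
  obtain ⟨q, hq, hO⟩ := h
  exact ⟨q, fun m hm => hq m (hm.trans_le hN), hO.trans (isBigO_norm_pow_of_le hN)⟩

/-- The formal analogue of a polynomial relation between smooth functions. -/
lemma aeval_eq_zero_of_hasJet {n : ℕ} {σ : Type*} {φ : σ → (Fin n → ℝ) → ℝ}
    {s : σ → MvPowerSeries (Fin n) ℝ} (h : ∀ i N, HasJet N (φ i) (s i)) {p : MvPolynomial σ ℝ}
    (hp : ∀ᶠ x in 𝓝 0, eval (fun i => φ i x) p = 0) : aeval s p = 0 :=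
  HasJet.eq_zero (fun N => HasJet.eval_mvPolynomial (fun i => h i N) p) hp

/-- If `G` is an analytic root of `Q(τ(x), T)` which agrees to high order with `g ∘ τ`, where `τ` is
an analytic diffeomorphism germ, then `G = g ∘ τ`. -/
lemma eventually_eq_comp_of_isBigO {n N : ℕ} {Q : MvPolynomial (Fin (n + 1)) ℝ}
    {g G : (Fin n → ℝ) → ℝ} {τ : (Fin n → ℝ) → (Fin n → ℝ)}
    (hN : ∀ ψ : (Fin n → ℝ) → ℝ, AnalyticAt ℝ ψ 0 →
      (∀ᶠ x in 𝓝 0, eval (Fin.snoc x (ψ x)) Q = 0) →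
      ((fun x => ψ x - g x) =O[𝓝 0] fun x => ‖x‖ ^ N) → ∀ᶠ x in 𝓝 0, ψ x = g x)
    (hG : AnalyticAt ℝ G 0) (hτ : AnalyticAt ℝ τ 0) (hτ0 : τ 0 = 0)
    {D : (Fin n → ℝ) ≃L[ℝ] (Fin n → ℝ)}
    (hD : HasFDerivAt τ (D : (Fin n → ℝ) →L[ℝ] (Fin n → ℝ)) 0)
    (hQ : ∀ᶠ x in 𝓝 0, eval (Fin.snoc (τ x) (G x)) Q = 0)
    (hO : (fun x => G x - g (τ x)) =O[𝓝 0] fun x => ‖x‖ ^ N) : ∀ᶠ x in 𝓝 0, G x = g (τ x) := by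
  have hst : HasStrictFDerivAt τ (D : (Fin n → ℝ) →L[ℝ] (Fin n → ℝ)) 0 := by
    rw [← hD.fderiv]; exact hτ.hasStrictFDerivAt
  let H := hst.toOpenPartialHomeomorph τ
  have hH : (H : (Fin n → ℝ) → (Fin n → ℝ)) = τ := hst.toOpenPartialHomeomorph_coe
  have hsrc : (0 : Fin n → ℝ) ∈ H.source := hst.mem_toOpenPartialHomeomorph_source
  have hH0 : H 0 = 0 := by rw [hH, hτ0]
  have htgt : (0 : Fin n → ℝ) ∈ H.target := by
    have := H.map_source hsrc
    rwa [hH0] at this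
  have hσ0 : H.symm 0 = 0 := by
    have := H.left_inv hsrc
    rwa [hH0] at this
  have hσ : AnalyticAt ℝ H.symm 0 := by
    have := H.analyticAt_symm' (i := D) hsrc (by rw [hH]; exact hτ) (by rw [hH, hD.fderiv])
    rwa [hH0] at this
  have hσt : Filter.Tendsto H.symm (𝓝 0) (𝓝 0) := by
    have := hσ.continuousAt.tendsto
    rwa [hσ0] at this
  have hτt : Filter.Tendsto τ (𝓝 0) (𝓝 0) := by
    have := hτ.continuousAt.tendsto
    rwa [hτ0] at this
  have hright : ∀ᶠ z in 𝓝 0, τ (H.symm z) = z := by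
    filter_upwards [H.open_target.mem_nhds htgt] with z hz
    rw [← hH]; exact H.right_inv hz
  have hσO : H.symm =O[𝓝 0] fun z => z := by
    have := hσ.differentiableAt.isBigO_sub
    simpa [hσ0] using this
  have hψ : ∀ᶠ z in 𝓝 0, G (H.symm z) = g z := by
    refine hN (fun z => G (H.symm z)) (hG.comp_of_eq hσ hσ0) ?_ ?_
    · filter_upwards [hσt.eventually hQ, hright] with z h1 h2
      rwa [h2] at h1
    · have h1 := (hO.comp_tendsto hσt).trans (hσO.norm_norm.pow N)
      refine h1.congr' ?_ Filter.EventuallyEq.rfl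
      filter_upwards [hright] with z hz
      simp [hz]
  filter_upwards [hτt.eventually hψ, H.open_source.mem_nhds hsrc] with x h1 h2
  rw [← h1, ← hH, H.left_inv h2]

end

/-- Two formally R-L equivalent Nash map germs are Nash R-L equivalent. -/
theorem formally_RL_equiv_implies_Nash_RL_equiv {n m : ℕ}
    {f g : (Fin n → ℝ) → (Fin m → ℝ)}
    (hf : NashGerm f) (hg : NashGerm g)
    (hformal : ∃ (τ : (Fin n → ℝ) → (Fin n → ℝ)) (π : (Fin m → ℝ) → (Fin m → ℝ)),
      ContDiffAt ℝ (⊤ : ℕ∞) τ 0 ∧ τ 0 = 0 ∧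
      (∃ Dτ : (Fin n → ℝ) ≃L[ℝ] (Fin n → ℝ),
        HasFDerivAt τ (Dτ : (Fin n → ℝ) →L[ℝ] (Fin n → ℝ)) 0) ∧
      ContDiffAt ℝ (⊤ : ℕ∞) π 0 ∧ π 0 = 0 ∧
      (∃ Dπ : (Fin m → ℝ) ≃L[ℝ] (Fin m → ℝ),
        HasFDerivAt π (Dπ : (Fin m → ℝ) →L[ℝ] (Fin m → ℝ)) 0) ∧
      ∀ k : ℕ, iteratedFDeriv ℝ k (g ∘ τ) 0 = iteratedFDeriv ℝ k (π ∘ f) 0) :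
    ∃ (τ : (Fin n → ℝ) → (Fin n → ℝ)) (π : (Fin m → ℝ) → (Fin m → ℝ)),
      NashDiffeoGerm τ ∧ NashDiffeoGerm π ∧
      ∀ᶠ x : Fin n → ℝ in 𝓝 0, g (τ x) = π (f x) := by
  classical
  obtain ⟨hfa, hf0, hfP⟩ := hf
  obtain ⟨hga, hg0, hgQ⟩ := hg
  obtain ⟨τ, π, hτ, hτ0, ⟨Dτ, hDτ⟩, hπ, hπ0, ⟨Dπ, hDπ⟩, hformal⟩ := hformal
  choose P hP0 hP using hfP
  choose Q hQ0 hQ using hgQ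
  have hfaj : ∀ j, AnalyticAt ℝ (fun x => f x j) 0 := analyticAt_pi_iff.1 hfa
  have hgaj : ∀ j, AnalyticAt ℝ (fun x => g x j) 0 := analyticAt_pi_iff.1 hga
  have hft : Filter.Tendsto f (𝓝 0) (𝓝 0) := by
    have := hfa.continuousAt.tendsto
    rwa [hf0] at this
  have hτt : Filter.Tendsto τ (𝓝 0) (𝓝 0) := by
    have := hτ.continuousAt.tendsto
    rwa [hτ0] at this
  have hfc : ContDiffAt ℝ (⊤ : ℕ∞) f 0 := hfa.contDiffAt
  have hgτ : ContDiffAt ℝ (⊤ : ℕ∞) (g ∘ τ) 0 :=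
    ContDiffAt.comp 0 (by rw [hτ0]; exact hga.contDiffAt) hτ
  have hπf : ContDiffAt ℝ (⊤ : ℕ∞) (π ∘ f) 0 :=
    ContDiffAt.comp 0 (by rw [hf0]; exact hπ) hfc
  choose τh hτh using fun i => (contDiffAt_pi.1 hτ i).exists_hasJet
  choose πh hπh using fun j => (contDiffAt_pi.1 hπ j).exists_hasJet
  choose fh hfh using fun j => (contDiffAt_pi.1 hfc j).exists_hasJet
  choose Gh hGh using fun j => (contDiffAt_pi.1 hgτ j).exists_hasJet
  have hGh' : ∀ j N, HasJet N (fun x => π (f x) j) (Gh j) := by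
    intro j N
    refine (hGh j N).congr ?_
    have h1 := hπf.isBigO_sub_of_iteratedFDeriv_eq hgτ (fun k => (hformal k).symm) N
    exact (Asymptotics.isBigO_pi.1 h1) j
  have hfO : f =O[𝓝 0] fun x => x := by
    have := hfa.differentiableAt.isBigO_sub
    simpa [hf0] using this
  choose h hh using fun j => exists_graph_combination hfh hfO hft (hπh j) (hGh' j)
  choose N₁ hN₁ using fun j => exists_order_separating_roots (hP0 j) (hfaj j)
  choose N₂ hN₂ using fun j => exists_order_separating_roots (hQ0 j) (hgaj j)
  obtain ⟨N, hN2, hNN₁, hNN₂⟩ : ∃ N : ℕ, 2 ≤ N ∧ (∀ j, N₁ j ≤ N) ∧ ∀ j, N₂ j ≤ N :=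
    ⟨2 + ∑ j, N₁ j + ∑ j, N₂ j, by omega,
      fun j => by
        have := Finset.single_le_sum (f := N₁) (fun i _ => Nat.zero_le _) (Finset.mem_univ j)
        omega,
      fun j => by
        have := Finset.single_le_sum (f := N₂) (fun i _ => Nat.zero_le _) (Finset.mem_univ j)
        omega⟩
  have hsnoc : ∀ {k : ℕ} {α β : Type} (F : α → β) (v : Fin k → α) (a : α),
      (fun i => F ((Fin.snoc v a : Fin (k + 1) → α) i)) = Fin.snoc (fun i => F (v i)) (F a) := by
    intro k α β F v a
    funext i
    refine Fin.lastCases ?_ (fun i => ?_) i <;> simp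
  let V := (((Fin n ⊕ (Fin m ⊕ Fin m)) ⊕ (Fin m × Fin m)) ⊕ Fin n) ⊕ (Fin m ⊕ Fin m)
  let vτ : Fin n → V := fun i => Sum.inl (Sum.inl (Sum.inl (Sum.inl i)))
  let vf : Fin m → V := fun i => Sum.inl (Sum.inl (Sum.inl (Sum.inr (Sum.inl i))))
  let vG : Fin m → V := fun i => Sum.inl (Sum.inl (Sum.inl (Sum.inr (Sum.inr i))))
  let vh : Fin m → Fin m → V := fun i j => Sum.inl (Sum.inl (Sum.inr (i, j)))
  let vx : Fin n → V := fun i => Sum.inl (Sum.inr i)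
  let vπ : Fin m → V := fun i => Sum.inr (Sum.inl i)
  let vy : Fin m → V := fun i => Sum.inr (Sum.inr i)
  let p : Fin m ⊕ (Fin m ⊕ Fin m) → MvPolynomial V ℝ := Sum.elim
    (fun j => MvPolynomial.rename (Fin.snoc vx (vf j)) (P j)) (Sum.elim
    (fun j => MvPolynomial.rename (Fin.snoc vτ (vG j)) (Q j))
    (fun j => MvPolynomial.X (vG j) - MvPolynomial.X (vπ j) -
      ∑ i, MvPolynomial.X (vh j i) * (MvPolynomial.X (vy i) - MvPolynomial.X (vf i))))
  have hxjet : ∀ (i : Fin n) N, HasJet N (fun x : Fin n → ℝ => x i) (MvPowerSeries.X i) := by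
    intro i N
    simpa using HasJet.eval_mvPolynomial_self N (MvPolynomial.X i)
  obtain ⟨e', h', π', he'N, he'jet, hπ'N, hπ'jet, hrel⟩ := exists_nested_nash_realization
    (N := N) (by omega) hfa hf0 (fun j => ⟨hfaj j, P j, hP0 j, hP j⟩)
    (Sum.elim τh (Sum.elim fh Gh)) (fun ij : Fin m × Fin m => h ij.1 ij.2) πh p (by
      rintro (j | j | j)
      · simp only [p, Sum.elim_inl, MvPolynomial.aeval_rename, Function.comp_def]
        have h1 : MvPolynomial.aeval (Fin.snoc MvPowerSeries.X (fh j)) (P j) = 0 := by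
          refine aeval_eq_zero_of_hasJet
            (φ := Fin.snoc (fun (i : Fin n) (x : Fin n → ℝ) => x i) fun x => f x j) ?_ ?_
          · intro i N
            refine Fin.lastCases ?_ (fun i => ?_) i
            · simpa using hfh j N
            · simpa using hxjet i N
          · filter_upwards [hP j] with x hx
            rw [hsnoc (fun F : (Fin n → ℝ) → ℝ => F x)]
            exact hx
        have h2 := congrArg (MvPowerSeries.map (algebraMap ℝ (MvPowerSeries (Fin m) ℝ))) h1
        rw [MvPowerSeries.map_algebraMap_aeval, map_zero, hsnoc] at h2
        rw [hsnoc, ← h2]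
        simp [vx, vf]
      · simp only [p, Sum.elim_inl, Sum.elim_inr, MvPolynomial.aeval_rename, Function.comp_def]
        have h1 : MvPolynomial.aeval (Fin.snoc τh (Gh j)) (Q j) = 0 := by
          refine aeval_eq_zero_of_hasJet
            (φ := Fin.snoc (fun (i : Fin n) (x : Fin n → ℝ) => τ x i) fun x => g (τ x) j) ?_ ?_
          · intro i N
            refine Fin.lastCases ?_ (fun i => ?_) i
            · simpa using hGh j N
            · simpa using hτh i N
          · filter_upwards [hτt.eventually (hQ j)] with x hx
            rw [hsnoc (fun F : (Fin n → ℝ) → ℝ => F x)]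
            exact hx
        have h2 := congrArg (MvPowerSeries.map (algebraMap ℝ (MvPowerSeries (Fin m) ℝ))) h1
        rw [MvPowerSeries.map_algebraMap_aeval, map_zero, hsnoc] at h2
        rw [hsnoc, ← h2]
        rfl
      · simp only [p, Sum.elim_inr, map_sub, map_sum, map_mul, MvPolynomial.aeval_X]
        rw [sub_eq_zero]
        exact hh j)
  let τ' : (Fin n → ℝ) → (Fin n → ℝ) := fun x i => e' (Sum.inl i) x
  let G' : Fin m → (Fin n → ℝ) → ℝ := fun j => e' (Sum.inr (Sum.inr j))
  let ψ : (Fin m → ℝ) → (Fin m → ℝ) := fun y j => π' j y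
  have hτ'a : AnalyticAt ℝ τ' 0 := AnalyticAt.pi fun i => (he'N _).1
  have hτ'0 : τ' 0 = 0 := by
    funext i
    have h1 := (he'jet (Sum.inl i)).apply_zero (by omega)
    have h2 := (hτh i N).apply_zero (by omega)
    exact h1.trans (h2.symm.trans (by rw [hτ0]))
  have hτ'D : HasFDerivAt τ' (Dτ : (Fin n → ℝ) →L[ℝ] (Fin n → ℝ)) 0 := by
    rw [hasFDerivAt_pi'] at hDτ ⊢
    exact fun i => (hτh i 2).hasFDerivAt ((he'jet (Sum.inl i)).mono hN2) (hDτ i)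
  have hψa : AnalyticAt ℝ ψ 0 := AnalyticAt.pi fun i => (hπ'N _).1
  have hψ0 : ψ 0 = 0 := by
    funext i
    have h1 := (hπ'jet i).apply_zero (by omega)
    have h2 := (hπh i N).apply_zero (by omega)
    exact h1.trans (h2.symm.trans (by rw [hπ0]))
  have hψD : HasFDerivAt ψ (Dπ : (Fin m → ℝ) →L[ℝ] (Fin m → ℝ)) 0 := by
    rw [hasFDerivAt_pi'] at hDπ ⊢
    exact fun i => (hπh i 2).hasFDerivAt ((hπ'jet i).mono hN2) (hDπ i)
  have hf' : ∀ j, ∀ᶠ x in 𝓝 0, e' (Sum.inr (Sum.inl j)) x = f x j := by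
    intro j
    refine hN₁ j _ (he'N _).1 ?_ ?_
    · filter_upwards [hrel] with x hx
      have := hx (Sum.inl j)
      simp only [p, Sum.elim_inl, MvPolynomial.eval_rename, Function.comp_def, hsnoc] at this
      exact this
    · exact ((he'jet (Sum.inr (Sum.inl j))).isBigO_sub (hfh j N)).trans
        (isBigO_norm_pow_of_le (hNN₁ j))
  have hG' : ∀ j, ∀ᶠ x in 𝓝 0, G' j x = g (τ' x) j := by
    intro j
    refine eventually_eq_comp_of_isBigO (hN₂ j) (he'N _).1 hτ'a hτ'0 hτ'D ?_ ?_
    · filter_upwards [hrel] with x hx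
      have := hx (Sum.inr (Sum.inl j))
      simp only [p, Sum.elim_inl, Sum.elim_inr, MvPolynomial.eval_rename, Function.comp_def,
        hsnoc] at this
      exact this
    · have h1 := (he'jet (Sum.inr (Sum.inr j))).isBigO_sub (hGh j N)
      have h2 : (fun x => τ x - τ' x) =O[𝓝 0] fun x => ‖x‖ ^ N :=
        Asymptotics.isBigO_pi.2 fun i => (hτh i N).isBigO_sub (he'jet (Sum.inl i))
      have h3 : (fun x => g (τ x) j - g (τ' x) j) =O[𝓝 0] fun x => τ x - τ' x := by
        have hτ't : Filter.Tendsto τ' (𝓝 0) (𝓝 0) := by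
          have := hτ'a.continuousAt.tendsto
          rwa [hτ'0] at this
        have h4 := (hgaj j).hasStrictFDerivAt.isBigO_sub
        exact h4.comp_tendsto (hτt.prodMk_nhds hτ't)
      exact ((h1.add (h3.trans h2)).congr_left fun x => by simp [G']).trans
        (isBigO_norm_pow_of_le (hNN₂ j))
  refine ⟨τ', ψ, ⟨⟨hτ'a, hτ'0, fun j => (he'N _).2⟩, Dτ, hτ'D⟩,
    ⟨⟨hψa, hψ0, fun j => (hπ'N j).2⟩, Dπ, hψD⟩, ?_⟩
  filter_upwards [hrel, Filter.eventually_all.2 hf', Filter.eventually_all.2 hG'] with x h1 h2 h3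
  funext j
  have h4 := h1 (Sum.inr (Sum.inr j))
  simp only [p, Sum.elim_inr, map_sub, map_sum, map_mul, MvPolynomial.eval_X] at h4
  have h5 : ∑ i, h' (j, i) x * (f x i - e' (Sum.inr (Sum.inl i)) x) = 0 :=
    Finset.sum_eq_zero fun i _ => by rw [h2 i, sub_self, mul_zero]
  have h6 : G' j x - π' j (f x) - ∑ i, h' (j, i) x * (f x i - e' (Sum.inr (Sum.inl i)) x) = 0 := h4
  rw [h5, sub_zero, sub_eq_zero] at h6
  rw [← h3 j, h6]
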